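/- Suppose |1−χ| = O(ε), the initial data satisfy φ₀ ∈ H³(Ω) with ∫_Ω φ₀ dx = 0, ψ₀, θ₀ ∈ H¹₀(Ω)∩H³(Ω), and the compatibility conditions hold. Then there exists a positive constant Re′ depending only on Pr, μ′/μ and γ, and positive constants ε′ and N′ depending only on Re, Pr, μ′/μ and γ, such that for any smooth solution (φ,ψ,θ) of the perturbation system on Ω×[0,T]: if Re < Re′, ε < ε′, and N̂ := N(T) < N′, then N̂ ≤ Ĉ N(0), where Ĉ is a positive constant depending only on Re, Pr, μ′/μ and γ (in particular independent of ε and T). -/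

import Mathlib

noncomputable section

open MeasureTheory Real Filter Topology

namespace Couette

/-- The periodic cell of the horizontally periodic layer `Ω = 𝕊¹ × (0,1)`. -/
def Ω : Set (ℝ × ℝ) := {x : ℝ × ℝ | x.1 ∈ Set.Ioo 0 (2 * π) ∧ x.2 ∈ Set.Ioo 0 1}

variable {F : Type*} [NormedAddCommGroup F] [NormedSpace ℝ F]

/-- Partial derivative in the horizontal direction `x₁`. -/
def d1 (f : ℝ × ℝ → F) (x : ℝ × ℝ) : F := fderiv ℝ f x (1, 0)

/-- Partial derivative in the vertical direction `x₂`. -/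
def d2 (f : ℝ × ℝ → F) (x : ℝ × ℝ) : F := fderiv ℝ f x (0, 1)

/-- Time derivative of a time-dependent field. -/
def dt (f : ℝ → ℝ × ℝ → F) (t : ℝ) (x : ℝ × ℝ) : F := deriv (fun s => f s x) t

/-- Divergence of a (two-dimensional) vector field. -/
def divv (v : ℝ × ℝ → ℝ × ℝ) (x : ℝ × ℝ) : ℝ :=
  d1 (fun y => (v y).1) x + d2 (fun y => (v y).2) x

/-- Gradient of a scalar field. -/
def grad (f : ℝ × ℝ → ℝ) (x : ℝ × ℝ) : ℝ × ℝ := (d1 f x, d2 f x)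

/-- Laplacian. -/
def lap (f : ℝ × ℝ → F) (x : ℝ × ℝ) : F := d1 (d1 f) x + d2 (d2 f) x

/-- Euclidean inner product on `ℝ²`. -/
def dot (a b : ℝ × ℝ) : ℝ := a.1 * b.1 + a.2 * b.2

/-- The contraction `𝔇(v) : 𝔇(w)` of deformation tensors, where
`𝔇(v) = (∇v + (∇v)ᵀ)/2`. -/
def defContract (v w : ℝ × ℝ → ℝ × ℝ) (x : ℝ × ℝ) : ℝ :=
  d1 (fun y => (v y).1) x * d1 (fun y => (w y).1) x
    + d2 (fun y => (v y).2) x * d2 (fun y => (w y).2) x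
    + 2 * ((d1 (fun y => (v y).2) x + d2 (fun y => (v y).1) x) / 2)
        * ((d1 (fun y => (w y).2) x + d2 (fun y => (w y).1) x) / 2)

/-- Squared `L²(Ω)` norm of the `j`-th spatial derivative. -/
def dSq (j : ℕ) (f : ℝ × ℝ → F) : ℝ := ∫ x in Ω, ‖iteratedFDeriv ℝ j f x‖ ^ 2

/-- Squared `L²(Ω)` norm. -/
def L2Sq (f : ℝ × ℝ → F) : ℝ := dSq 0 f

/-- Squared `Hᵏ(Ω)` norm. -/
def HSq (k : ℕ) (f : ℝ × ℝ → F) : ℝ := ∑ j ∈ Finset.range (k + 1), dSq j f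

/-- `L∞(Ω)` (sup) norm. -/
def LinfSup (f : ℝ × ℝ → F) : ℝ := ⨆ x ∈ Ω, ‖f x‖

/-- Membership in the Sobolev space `Hᵏ(Ω)`. -/
def MemH (k : ℕ) (f : ℝ × ℝ → F) : Prop :=
  ∀ j ≤ k, IntegrableOn (fun x => ‖iteratedFDeriv ℝ j f x‖ ^ 2) Ω

/-- Continuity in time, with values in `Hᵏ(Ω)`, on the time set `s`. -/
def ContInH (k : ℕ) (f : ℝ → ℝ × ℝ → F) (s : Set ℝ) : Prop :=
  (∀ t ∈ s, MemH k (f t)) ∧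
    ∀ t₀ ∈ s, Tendsto (fun t => HSq k (fun x => f t x - f t₀ x)) (nhdsWithin t₀ s) (nhds 0)

/-- Square integrability in time, with values in `Hᵏ(Ω)`, on the time set `s`. -/
def L2InH (k : ℕ) (f : ℝ → ℝ × ℝ → F) (s : Set ℝ) : Prop :=
  IntegrableOn (fun t => HSq k (f t)) s

/-- Temperature `𝒯̃` of the non-dimensional plane Couette flow
(here `C_p = γ/(γ-1)`, the gas constant being normalized to `R = 1`). -/
def tT (γ Pr ε χ : ℝ) (x : ℝ × ℝ) : ℝ :=
  χ + (1 - χ) * x.2 - ε ^ 2 * Pr / (2 * (γ / (γ - 1))) * (x.2 ^ 2 - x.2)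

/-- Density `ρ̃ = 𝒯̃⁻¹` of the plane Couette flow. -/
def tρ (γ Pr ε χ : ℝ) (x : ℝ × ℝ) : ℝ := (tT γ Pr ε χ x)⁻¹

/-- Velocity `ũ = (x₂, 0)` of the plane Couette flow. -/
def tu (x : ℝ × ℝ) : ℝ × ℝ := (x.2, 0)

/-- Total density `ρ = ρ̃ + φ`. -/
def pρ (γ Pr ε χ : ℝ) (φ : ℝ → ℝ × ℝ → ℝ) (t : ℝ) (x : ℝ × ℝ) : ℝ := tρ γ Pr ε χ x + φ t x

/-- Total temperature `𝒯 = 𝒯̃ + θ`. -/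
def pT (γ Pr ε χ : ℝ) (θ : ℝ → ℝ × ℝ → ℝ) (t : ℝ) (x : ℝ × ℝ) : ℝ := tT γ Pr ε χ x + θ t x

/-- Total velocity `u = ũ + ψ`. -/
def pu (ψ : ℝ → ℝ × ℝ → ℝ × ℝ) (t : ℝ) (x : ℝ × ℝ) : ℝ × ℝ := tu x + ψ t x

/-- A classical solution `(φ, ψ, θ) = (ρ - ρ̃, u - ũ, 𝒯 - 𝒯̃)` of the perturbation
system around the plane Couette flow on `Ω × [0,T]`, with non-slip and isothermal
boundary conditions and periodicity in `x₁`.  Here `μ = 1/Re`, `μ' = r·μ`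
(`r = μ'/μ = ν'/ν`), and `κ = C_p/(Re·Pr)` with `C_p = γ/(γ-1)`. -/
structure PerturbSol (γ Pr r Re ε χ T : ℝ) where
  φ : ℝ → ℝ × ℝ → ℝ
  ψ : ℝ → ℝ × ℝ → ℝ × ℝ
  θ : ℝ → ℝ × ℝ → ℝ
  mass_eq : ∀ t ∈ Set.Icc (0 : ℝ) T, ∀ x ∈ Ω,
    dt φ t x + dot (pu ψ t x) (grad (φ t) x) + pρ γ Pr ε χ φ t x * divv (ψ t) x
      + dot (ψ t x) (grad (tρ γ Pr ε χ) x) = 0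
  mom_eq1 : ∀ t ∈ Set.Icc (0 : ℝ) T, ∀ x ∈ Ω,
    pρ γ Pr ε χ φ t x * ((dt ψ t x).1 + dot (pu ψ t x) (grad (fun y => (ψ t y).1) x)
        + dot (ψ t x) (grad (fun y => (tu y).1) x))
      + (ε ^ 2)⁻¹ * d1 (fun y => pρ γ Pr ε χ φ t y * pT γ Pr ε χ θ t y) x
      - Re⁻¹ * lap (fun y => (ψ t y).1) x
      - (Re⁻¹ + r * Re⁻¹) * d1 (divv (ψ t)) x = 0
  mom_eq2 : ∀ t ∈ Set.Icc (0 : ℝ) T, ∀ x ∈ Ω,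
    pρ γ Pr ε χ φ t x * ((dt ψ t x).2 + dot (pu ψ t x) (grad (fun y => (ψ t y).2) x)
        + dot (ψ t x) (grad (fun y => (tu y).2) x))
      + (ε ^ 2)⁻¹ * d2 (fun y => pρ γ Pr ε χ φ t y * pT γ Pr ε χ θ t y) x
      - Re⁻¹ * lap (fun y => (ψ t y).2) x
      - (Re⁻¹ + r * Re⁻¹) * d2 (divv (ψ t)) x = 0
  energy_eq : ∀ t ∈ Set.Icc (0 : ℝ) T, ∀ x ∈ Ω,
    pρ γ Pr ε χ φ t x / (γ - 1) * (dt θ t x + dot (pu ψ t x) (grad (θ t) x)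
        + dot (ψ t x) (grad (tT γ Pr ε χ) x))
      + pρ γ Pr ε χ φ t x * pT γ Pr ε χ θ t x * divv (ψ t) x
      - γ / (γ - 1) / (Re * Pr) * lap (θ t) x
      = ε ^ 2 * (2 * Re⁻¹ * defContract (ψ t) (ψ t) x
          + 4 * Re⁻¹ * defContract tu (ψ t) x + r * Re⁻¹ * (divv (ψ t) x) ^ 2)
  bc_ψ : ∀ t ∈ Set.Icc (0 : ℝ) T, ∀ x : ℝ × ℝ, (x.2 = 0 ∨ x.2 = 1) → ψ t x = 0
  bc_θ : ∀ t ∈ Set.Icc (0 : ℝ) T, ∀ x : ℝ × ℝ, (x.2 = 0 ∨ x.2 = 1) → θ t x = 0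
  periodic_φ : ∀ t x, φ t (x.1 + 2 * π, x.2) = φ t x
  periodic_ψ : ∀ t x, ψ t (x.1 + 2 * π, x.2) = ψ t x
  periodic_θ : ∀ t x, θ t (x.1 + 2 * π, x.2) = θ t x

/-- Smoothness (in time and space) of a solution of the perturbation system. -/
def SmoothSol {γ Pr r Re ε χ T : ℝ} (S : PerturbSol γ Pr r Re ε χ T) : Prop :=
  ContDiff ℝ (⊤ : ℕ∞) (Function.uncurry S.φ) ∧ ContDiff ℝ (⊤ : ℕ∞) (Function.uncurry S.ψ) ∧
    ContDiff ℝ (⊤ : ℕ∞) (Function.uncurry S.θ)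

/-- Standing hypotheses on a solution of the perturbation system: initial regularity
`(φ₀, ψ₀, θ₀) ∈ H³`, zero average of the initial density perturbation, and the
compatibility conditions `∂tψ(0) = ∂tθ(0) = 0` on `∂Ω`. -/
def StdHyp {γ Pr r Re ε χ T : ℝ} (S : PerturbSol γ Pr r Re ε χ T) : Prop :=
  MemH 3 (S.φ 0) ∧ MemH 3 (S.ψ 0) ∧ MemH 3 (S.θ 0) ∧
    (∫ x in Ω, S.φ 0 x) = 0 ∧
    ∀ x : ℝ × ℝ, (x.2 = 0 ∨ x.2 = 1) → dt S.ψ 0 x = 0 ∧ dt S.θ 0 x = 0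

/-- The energy functional `A₀`. -/
def A0 (ε : ℝ) (φ : ℝ → ℝ × ℝ → ℝ) (ψ : ℝ → ℝ × ℝ → ℝ × ℝ) (θ : ℝ → ℝ × ℝ → ℝ)
    (t : ℝ) : ℝ :=
  (⨆ s ∈ Set.Icc (0 : ℝ) t,
      (L2Sq (ψ s) + (ε ^ 2)⁻¹ * L2Sq (φ s) + (ε ^ 2)⁻¹ * L2Sq (θ s)))
    + ∫ s in (0 : ℝ)..t, (HSq 1 (ψ s) + (ε ^ 2)⁻¹ * HSq 1 (θ s))

/-- The energy functional `A₁`. -/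
def A1 (ε : ℝ) (φ : ℝ → ℝ × ℝ → ℝ) (ψ : ℝ → ℝ × ℝ → ℝ × ℝ) (θ : ℝ → ℝ × ℝ → ℝ)
    (t : ℝ) : ℝ :=
  (⨆ s ∈ Set.Icc (0 : ℝ) t, (dSq 1 (ψ s) + (ε ^ 2)⁻¹ * dSq 1 (θ s)))
    + ∫ s in (0 : ℝ)..t, (L2Sq (dt ψ s) + (ε ^ 2)⁻¹ * L2Sq (dt θ s))

/-- The energy functional `A₂`. -/
def A2 (ε : ℝ) (φ : ℝ → ℝ × ℝ → ℝ) (ψ : ℝ → ℝ × ℝ → ℝ × ℝ) (θ : ℝ → ℝ × ℝ → ℝ)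
    (t : ℝ) : ℝ :=
  (ε ^ 2)⁻¹ * (⨆ s ∈ Set.Icc (0 : ℝ) t, dSq 1 (φ s))
    + (∫ s in (0 : ℝ)..t, ((ε ^ 4)⁻¹ * HSq 1 (φ s) + (ε ^ 2)⁻¹ * L2Sq (dt φ s)))
    + ∫ s in (0 : ℝ)..t, (HSq 2 (ψ s) + (ε ^ 2)⁻¹ * HSq 2 (θ s))

/-- The energy functional `A₃`. -/
def A3 (ε : ℝ) (φ : ℝ → ℝ × ℝ → ℝ) (ψ : ℝ → ℝ × ℝ → ℝ × ℝ) (θ : ℝ → ℝ × ℝ → ℝ)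
    (t : ℝ) : ℝ :=
  (⨆ s ∈ Set.Icc (0 : ℝ) t,
      ((ε ^ 2)⁻¹ * L2Sq (dt φ s) + L2Sq (dt ψ s) + (ε ^ 2)⁻¹ * L2Sq (dt θ s)))
    + ∫ s in (0 : ℝ)..t, (dSq 1 (dt ψ s) + (ε ^ 2)⁻¹ * dSq 1 (dt θ s))

/-- The energy functional `A₄`. -/
def A4 (ε : ℝ) (φ : ℝ → ℝ × ℝ → ℝ) (ψ : ℝ → ℝ × ℝ → ℝ × ℝ) (θ : ℝ → ℝ × ℝ → ℝ)
    (t : ℝ) : ℝ :=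
  (⨆ s ∈ Set.Icc (0 : ℝ) t,
      ((ε ^ 2)⁻¹ * dSq 2 (φ s) + dSq 2 (ψ s) + (ε ^ 2)⁻¹ * dSq 2 (θ s)))
    + ∫ s in (0 : ℝ)..t, ((ε ^ 4)⁻¹ * HSq 2 (φ s) + HSq 3 (ψ s) + (ε ^ 2)⁻¹ * HSq 3 (θ s))

/-- The energy functional `A₅`. -/
def A5 (ε : ℝ) (φ : ℝ → ℝ × ℝ → ℝ) (ψ : ℝ → ℝ × ℝ → ℝ × ℝ) (θ : ℝ → ℝ × ℝ → ℝ)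
    (t : ℝ) : ℝ :=
  (⨆ s ∈ Set.Icc (0 : ℝ) t,
      ((ε ^ 2)⁻¹ * dSq 3 (φ s) + (dSq 3 (ψ s) + dSq 1 (dt ψ s))
        + (ε ^ 2)⁻¹ * (dSq 3 (θ s) + dSq 1 (dt θ s))))
    + ∫ s in (0 : ℝ)..t, (L2Sq (dt (dt ψ) s) + (ε ^ 2)⁻¹ * L2Sq (dt (dt θ) s))

/-- The total weighted energy functional `N(t)`. -/
def Nfun (ε : ℝ) (φ : ℝ → ℝ × ℝ → ℝ) (ψ : ℝ → ℝ × ℝ → ℝ × ℝ) (θ : ℝ → ℝ × ℝ → ℝ)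
    (t : ℝ) : ℝ :=
  (ε ^ 2)⁻¹ * A0 ε φ ψ θ t + A1 ε φ ψ θ t + A2 ε φ ψ θ t
    + ε ^ 2 * A3 ε φ ψ θ t + ε ^ 2 * A4 ε φ ψ θ t + ε ^ 4 * A5 ε φ ψ θ t

/-- The relative entropy
`η = (ε²ρ/𝒯̃)|ψ|² + (ρ/(γ-1))(𝒯/𝒯̃ - ln(𝒯/𝒯̃) - 1) + ρ(τ/τ̃ - ln(τ/τ̃) - 1)`,
where `τ = 1/ρ`, `τ̃ = 1/ρ̃`. -/
def relEnt (γ Pr ε χ : ℝ) (φ θ : ℝ → ℝ × ℝ → ℝ) (ψ : ℝ → ℝ × ℝ → ℝ × ℝ)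
    (t : ℝ) (x : ℝ × ℝ) : ℝ :=
  ε ^ 2 * pρ γ Pr ε χ φ t x / tT γ Pr ε χ x * ‖ψ t x‖ ^ 2
    + pρ γ Pr ε χ φ t x / (γ - 1) *
        (pT γ Pr ε χ θ t x / tT γ Pr ε χ x
          - Real.log (pT γ Pr ε χ θ t x / tT γ Pr ε χ x) - 1)
    + pρ γ Pr ε χ φ t x *
        ((pρ γ Pr ε χ φ t x)⁻¹ / (tρ γ Pr ε χ x)⁻¹
          - Real.log ((pρ γ Pr ε χ φ t x)⁻¹ / (tρ γ Pr ε χ x)⁻¹) - 1)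

/-- A classical solution `(ρ, u, 𝒯)` of the non-dimensional full compressible
Navier–Stokes system on `Ω × (0,∞)`, with non-slip and isothermal boundary
conditions and periodicity in `x₁`. -/
structure FullSol (γ Pr r Re ε χ : ℝ) where
  rho : ℝ → ℝ × ℝ → ℝ
  vel : ℝ → ℝ × ℝ → ℝ × ℝ
  temp : ℝ → ℝ × ℝ → ℝ
  mass_eq : ∀ t ∈ Set.Ioi (0 : ℝ), ∀ x ∈ Ω,
    dt rho t x + divv (fun y => rho t y • vel t y) x = 0
  mom_eq1 : ∀ t ∈ Set.Ioi (0 : ℝ), ∀ x ∈ Ω,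
    rho t x * ((dt vel t x).1 + dot (vel t x) (grad (fun y => (vel t y).1) x))
      + (ε ^ 2)⁻¹ * d1 (fun y => rho t y * temp t y) x
      = Re⁻¹ * lap (fun y => (vel t y).1) x + (Re⁻¹ + r * Re⁻¹) * d1 (divv (vel t)) x
  mom_eq2 : ∀ t ∈ Set.Ioi (0 : ℝ), ∀ x ∈ Ω,
    rho t x * ((dt vel t x).2 + dot (vel t x) (grad (fun y => (vel t y).2) x))
      + (ε ^ 2)⁻¹ * d2 (fun y => rho t y * temp t y) x
      = Re⁻¹ * lap (fun y => (vel t y).2) x + (Re⁻¹ + r * Re⁻¹) * d2 (divv (vel t)) x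
  energy_eq : ∀ t ∈ Set.Ioi (0 : ℝ), ∀ x ∈ Ω,
    rho t x / (γ - 1) * (dt temp t x + dot (vel t x) (grad (temp t) x))
      + rho t x * temp t x * divv (vel t) x
      = γ / (γ - 1) / (Re * Pr) * lap (temp t) x
        + ε ^ 2 * (2 * Re⁻¹ * defContract (vel t) (vel t) x
            + r * Re⁻¹ * (divv (vel t) x) ^ 2)
  bc_top : ∀ t ∈ Set.Ioi (0 : ℝ), ∀ x : ℝ × ℝ, x.2 = 1 →
    vel t x = (1, 0) ∧ temp t x = 1
  bc_bot : ∀ t ∈ Set.Ioi (0 : ℝ), ∀ x : ℝ × ℝ, x.2 = 0 →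
    vel t x = 0 ∧ temp t x = χ
  periodic_rho : ∀ t x, rho t (x.1 + 2 * π, x.2) = rho t x
  periodic_vel : ∀ t x, vel t (x.1 + 2 * π, x.2) = vel t x
  periodic_temp : ∀ t x, temp t (x.1 + 2 * π, x.2) = temp t x

/-- `∂tφ(0)`, defined from the initial data by taking `t = 0` in the mass equation
of the perturbation system. -/
def dtφ0 (γ Pr ε χ : ℝ) (φ₀ : ℝ × ℝ → ℝ) (ψ₀ : ℝ × ℝ → ℝ × ℝ) (x : ℝ × ℝ) : ℝ :=
  -(dot (tu x + ψ₀ x) (grad φ₀ x) + (tρ γ Pr ε χ x + φ₀ x) * divv ψ₀ x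
      + dot (ψ₀ x) (grad (tρ γ Pr ε χ) x))

/-- `∂tψ(0)`, defined from the initial data by taking `t = 0` in the momentum
equation of the perturbation system. -/
def dtψ0 (γ Pr r Re ε χ : ℝ) (φ₀ θ₀ : ℝ × ℝ → ℝ) (ψ₀ : ℝ × ℝ → ℝ × ℝ)
    (x : ℝ × ℝ) : ℝ × ℝ :=
  ((tρ γ Pr ε χ x + φ₀ x)⁻¹ *
      (Re⁻¹ * lap (fun y => (ψ₀ y).1) x + (Re⁻¹ + r * Re⁻¹) * d1 (divv ψ₀) x
        - (ε ^ 2)⁻¹ * d1 (fun y => (tρ γ Pr ε χ y + φ₀ y) * (tT γ Pr ε χ y + θ₀ y)) x)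
      - dot (tu x + ψ₀ x) (grad (fun y => (ψ₀ y).1) x)
      - dot (ψ₀ x) (grad (fun y => (tu y).1) x),
   (tρ γ Pr ε χ x + φ₀ x)⁻¹ *
      (Re⁻¹ * lap (fun y => (ψ₀ y).2) x + (Re⁻¹ + r * Re⁻¹) * d2 (divv ψ₀) x
        - (ε ^ 2)⁻¹ * d2 (fun y => (tρ γ Pr ε χ y + φ₀ y) * (tT γ Pr ε χ y + θ₀ y)) x)
      - dot (tu x + ψ₀ x) (grad (fun y => (ψ₀ y).2) x)
      - dot (ψ₀ x) (grad (fun y => (tu y).2) x))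

/-- `∂tθ(0)`, defined from the initial data by taking `t = 0` in the temperature
equation of the perturbation system. -/
def dtθ0 (γ Pr r Re ε χ : ℝ) (φ₀ θ₀ : ℝ × ℝ → ℝ) (ψ₀ : ℝ × ℝ → ℝ × ℝ)
    (x : ℝ × ℝ) : ℝ :=
  (γ - 1) * (tρ γ Pr ε χ x + φ₀ x)⁻¹ *
      (γ / (γ - 1) / (Re * Pr) * lap θ₀ x
        - (tρ γ Pr ε χ x + φ₀ x) * (tT γ Pr ε χ x + θ₀ x) * divv ψ₀ x
        + ε ^ 2 * (2 * Re⁻¹ * defContract ψ₀ ψ₀ x + 4 * Re⁻¹ * defContract tu ψ₀ x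
            + r * Re⁻¹ * (divv ψ₀ x) ^ 2))
    - dot (tu x + ψ₀ x) (grad θ₀ x) - dot (ψ₀ x) (grad (tT γ Pr ε χ) x)

end Couette
end

noncomputable section
open MeasureTheory Real Filter Topology
set_option linter.unusedSectionVars false
namespace Couette
namespace Core

/-- Uniform domination of nonnegative quantities over the index set. -/
def Bo {J : Type} (f g : J → ℝ) : Prop := ∃ C : ℝ, 0 ≤ C ∧ ∀ j, f j ≤ C * g j

/-- Abstract functional framework: a ring of (families of) smooth functions with scaled derivations,
an integration functional, boundary ideal, and the functional inequalities. -/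
class CB (R : Type) (J : outParam Type) [CommRing R] [Algebra ℝ R] where
  D0 : Derivation ℝ R R
  D1 : Derivation ℝ R R
  D2 : Derivation ℝ R R
  c01 : ∀ f, D0 (D1 f) = D1 (D0 f)
  c02 : ∀ f, D0 (D2 f) = D2 (D0 f)
  c12 : ∀ f, D2 (D1 f) = D1 (D2 f)
  I : R →ₗ[ℝ] (J → ℝ)
  I_sq : ∀ f j, 0 ≤ I (f * f) j
  Z : Ideal R
  Z0 : ∀ f ∈ Z, D0 f ∈ Z
  Z1 : ∀ f ∈ Z, D1 f ∈ Z
  I1 : ∀ f, I (D1 f) = 0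
  I2 : ∀ f ∈ Z, I (D2 f) = 0
  ep : J → ℝ
  ep_pos : ∀ j, 0 < ep j
  ep_le : ∀ j, ep j ≤ 1
  eps : R
  I_eps : ∀ f, I (eps * f) = ep * I f
  e0 : D0 eps = 0
  e1 : D1 eps = 0
  e2 : D2 eps = 0
  pz : ∀ f ∈ Z, ∀ j, I ((eps * f) * (eps * f)) j ≤ I (D2 f * D2 f) j
  I_one : Bo (I (1 * 1)) 1

variable {R J : Type} [CommRing R] [Algebra ℝ R] [CB R J]


open CB

theorem D0m (f g : R) : D0 (f * g) = D0 f * g + f * D0 g := by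
  rw [Derivation.leibniz]; simp only [smul_eq_mul]; ring
theorem D1m (f g : R) : D1 (f * g) = D1 f * g + f * D1 g := by
  rw [Derivation.leibniz]; simp only [smul_eq_mul]; ring
theorem D2m (f g : R) : D2 (f * g) = D2 f * g + f * D2 g := by
  rw [Derivation.leibniz]; simp only [smul_eq_mul]; ring

/-- real constants inside the ring -/
def cst (a : ℝ) : R := algebraMap ℝ R a

theorem cst_mul (a : ℝ) (f : R) : cst a * f = a • f := by
  rw [cst, Algebra.smul_def]
theorem cst_mul_cst (a b : ℝ) : (cst a * cst b : R) = cst (a * b) := by simp [cst]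
theorem cst_one : (cst 1 : R) = 1 := by simp [cst]
theorem cst_add (a b : ℝ) : (cst (a + b) : R) = cst a + cst b := by simp [cst]
theorem cst_two : (cst 2 : R) = 2 := by rw [cst]; exact map_ofNat (algebraMap ℝ R) 2

theorem D0c (a : ℝ) : D0 (cst a : R) = 0 := by simp [cst]
theorem D1c (a : ℝ) : D1 (cst a : R) = 0 := by simp [cst]
theorem D2c (a : ℝ) : D2 (cst a : R) = 0 := by simp [cst]
theorem Ic (a : ℝ) (f : R) (j : J) : I (cst a * f) j = a * I f j := by
  rw [cst_mul]; simp

theorem Ia (f g : R) (j : J) : I (f + g) j = I f j + I g j := by simp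
theorem Is (f g : R) (j : J) : I (f - g) j = I f j - I g j := by simp
theorem In (f : R) (j : J) : I (-f) j = - I f j := by simp
theorem Ie (f : R) (j : J) : I (eps * f) j = ep R j * I f j := by rw [I_eps]; rfl
theorem II1 (f : R) (j : J) : I (D1 f) j = 0 := by rw [I1]; rfl
theorem II2 (f : R) (hf : f ∈ Z (R := R)) (j : J) : I (D2 f) j = 0 := by rw [I2 f hf]; rfl

def nm (f : R) (j : J) : ℝ := √(I (f * f) j)

theorem nm_nonneg (f : R) (j : J) : 0 ≤ nm f j := Real.sqrt_nonneg _
theorem nm_sq (f : R) (j : J) : nm f j ^ 2 = I (f * f) j := Real.sq_sqrt (I_sq f j)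

theorem cs (f g : R) (j : J) : |I (f * g) j| ≤ nm f j * nm g j := by
  have h : ∀ a : ℝ, 0 ≤ I (g * g) j * (a * a) + (2 * I (f * g) j) * a + I (f * f) j := by
    intro a
    have := I_sq (f + cst a * g) j
    have h2 : (f + cst a * g) * (f + cst a * g)
        = f * f + cst a * (f * g) + cst a * (f * g) + cst a * (cst a * (g * g)) := by ring
    rw [h2] at this
    simp only [Ia, Ic] at this
    linarith
  have hd := discrim_le_zero h
  unfold discrim at hd
  rw [nm, nm, ← Real.sqrt_mul (I_sq f j)]
  apply Real.abs_le_sqrt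
  nlinarith

theorem cs' (f g : R) (j : J) : I (f * g) j ≤ nm f j * nm g j := le_trans (le_abs_self _) (cs f g j)

theorem nm_add (f g : R) (j : J) : nm (f + g) j ≤ nm f j + nm g j := by
  have h0 := nm_nonneg f j
  have h1 := nm_nonneg g j
  rw [nm]
  apply Real.sqrt_le_iff.2 ⟨by linarith, ?_⟩
  have h2 : (f + g) * (f + g) = f * f + f * g + f * g + g * g := by ring
  rw [h2]
  simp only [Ia]
  have := cs' f g j
  have h3 := nm_sq f j
  have h4 := nm_sq g j
  nlinarith

theorem nm_cst (a : ℝ) (f : R) (j : J) : nm (cst a * f) j = |a| * nm f j := by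
  rw [nm, nm, show cst a * f * (cst a * f) = cst a * (cst a * (f * f)) by ring]
  simp only [Ic]
  rw [← mul_assoc, Real.sqrt_mul (mul_self_nonneg a), Real.sqrt_mul_self_eq_abs]

theorem nm_smul (a : ℝ) (f : R) (j : J) : nm (a • f) j = |a| * nm f j := by
  rw [← cst_mul, nm_cst]

theorem nm_zero (j : J) : nm (0 : R) j = 0 := by simp [nm]

theorem nm_eps (f : R) (j : J) : nm (eps * f) j = ep R j * nm f j := by
  rw [nm, nm, show eps * f * (eps * f) = eps * (eps * (f * f)) by ring]
  simp only [Ie]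
  rw [← mul_assoc, Real.sqrt_mul (mul_self_nonneg _), Real.sqrt_mul_self (ep_pos j).le]

def hs : ℕ → R → J → ℝ
  | 0, f => nm f
  | (k+1), f => nm f + hs k (D1 f) + hs k (D2 f)

theorem hs_nonneg (k : ℕ) (f : R) (j : J) : 0 ≤ hs k f j := by
  induction k generalizing f with
  | zero => exact nm_nonneg f j
  | succ k ih =>
    have := ih (D1 f); have := ih (D2 f); have := nm_nonneg f j
    simp only [hs, Pi.add_apply]; linarith

theorem hs_add (k : ℕ) (f g : R) (j : J) : hs k (f + g) j ≤ hs k f j + hs k g j := by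
  induction k generalizing f g with
  | zero => exact nm_add f g j
  | succ k ih =>
    simp only [hs, Pi.add_apply, map_add]
    have := ih (D1 f) (D1 g); have := ih (D2 f) (D2 g); have := nm_add f g j
    linarith

theorem hs_smul (k : ℕ) (a : ℝ) (f : R) (j : J) : hs k (a • f) j = |a| * hs k f j := by
  induction k generalizing f with
  | zero => exact nm_smul a f j
  | succ k ih =>
    simp only [hs, Pi.add_apply, Derivation.map_smul, ih, nm_smul]; ring

theorem hs_zero (k : ℕ) (j : J) : hs k (0 : R) j = 0 := by
  have := hs_smul k 0 (0 : R) j; simpa using this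

/-! ### Bo calculus -/
theorem Bo.refl (f : J → ℝ) : Bo f f := ⟨1, by norm_num, fun j => by simp⟩
theorem Bo.trans {f g h : J → ℝ} (a : Bo f g) (b : Bo g h) : Bo f h := by
  obtain ⟨C, hC, h1⟩ := a; obtain ⟨D, hD, h2⟩ := b
  refine ⟨C * D, by positivity, fun j => (h1 j).trans ?_⟩
  rw [mul_assoc]; exact mul_le_mul_of_nonneg_left (h2 j) hC
theorem Bo.of_le {f g : J → ℝ} (h : ∀ j, f j ≤ g j) : Bo f g := ⟨1, by norm_num, fun j => by simpa using h j⟩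
theorem Bo.add {f g h : J → ℝ} (a : Bo f h) (b : Bo g h) : Bo (f + g) h := by
  obtain ⟨C, hC, h1⟩ := a; obtain ⟨D, hD, h2⟩ := b
  exact ⟨C + D, by positivity, fun j => by have := h1 j; have := h2 j; simp only [Pi.add_apply]; linarith⟩
theorem Bo.mul {f g f' g' : J → ℝ} (a : Bo f f') (b : Bo g g') (hf : 0 ≤ f) (hg : 0 ≤ g) : Bo (f * g) (f' * g') := by
  obtain ⟨C, hC, h1⟩ := a; obtain ⟨D, hD, h2⟩ := b
  refine ⟨C * D, by positivity, fun j => ?_⟩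
  have := mul_le_mul (h1 j) (h2 j) (hg j) ((hf j).trans (h1 j))
  simp only [Pi.mul_apply]; linarith

/-- functions whose `H^k` norm is dominated by `b` -/
def Hb (k : ℕ) (b : J → ℝ) : Submodule ℝ R where
  carrier := {f | Bo (hs k f) b}
  add_mem' := by
    intro f g hf hg
    exact (Bo.of_le (g := hs k f + hs k g) (fun j => hs_add k f g j)).trans (hf.add hg)
  zero_mem' := ⟨0, le_refl _, fun j => by rw [hs_zero]; simp⟩
  smul_mem' := by
    intro a f hf
    obtain ⟨C, hC, h1⟩ := hf
    refine ⟨|a| * C, by positivity, fun j => ?_⟩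
    rw [hs_smul, mul_assoc]
    exact mul_le_mul_of_nonneg_left (h1 j) (abs_nonneg a)

theorem mem_Hb {k : ℕ} {b : J → ℝ} {f : R} : f ∈ Hb k b ↔ Bo (hs k f) b := Iff.rfl

theorem Hb_succ {k : ℕ} {b : J → ℝ} {f : R} :
    f ∈ Hb (k+1) b ↔ f ∈ Hb 0 b ∧ D1 f ∈ Hb k b ∧ D2 f ∈ Hb k b := by
  constructor
  · intro h
    refine ⟨Bo.trans (Bo.of_le fun j => ?_) h, Bo.trans (Bo.of_le fun j => ?_) h, Bo.trans (Bo.of_le fun j => ?_) h⟩ <;>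
    · simp only [hs, Pi.add_apply]
      have := hs_nonneg k (D1 f) j; have := hs_nonneg k (D2 f) j; have := nm_nonneg f j
      linarith
  · rintro ⟨a, b, c⟩
    exact (Bo.add (Bo.add a b) c)

theorem Hb_lower {k : ℕ} {b : J → ℝ} {f : R} (h : f ∈ Hb (k+1) b) : f ∈ Hb k b := by
  induction k generalizing f with
  | zero => exact (Hb_succ.1 h).1
  | succ k ih =>
    obtain ⟨h0, h1, h2⟩ := Hb_succ.1 h
    exact Hb_succ.2 ⟨h0, ih h1, ih h2⟩
theorem Hb_le {k l : ℕ} (hkl : k ≤ l) {b : J → ℝ} {f : R} (h : f ∈ Hb l b) : f ∈ Hb k b := by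
  induction hkl with
  | refl => exact h
  | step _ ih => exact ih (Hb_lower h)
theorem Hb_mono {k : ℕ} {b b' : J → ℝ} (hb : Bo b b') {f : R} (h : f ∈ Hb k b) : f ∈ Hb k b' := Bo.trans h hb
theorem Hb_D1 {k : ℕ} {b : J → ℝ} {f : R} (h : f ∈ Hb (k+1) b) : D1 f ∈ Hb k b := (Hb_succ.1 h).2.1
theorem Hb_D2 {k : ℕ} {b : J → ℝ} {f : R} (h : f ∈ Hb (k+1) b) : D2 f ∈ Hb k b := (Hb_succ.1 h).2.2
theorem Hb_self (k : ℕ) (f : R) : f ∈ Hb k (hs k f) := Bo.refl _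

theorem Hb_cst {k : ℕ} {b : J → ℝ} {f : R} (a : ℝ) (h : f ∈ Hb k b) : cst a * f ∈ Hb k b := by
  rw [cst_mul]; exact Submodule.smul_mem _ _ h

theorem hs_eps (k : ℕ) (f : R) (j : J) : hs k (eps * f) j = ep R j * hs k f j := by
  induction k generalizing f with
  | zero => exact nm_eps f j
  | succ k ih =>
    simp only [hs, Pi.add_apply, nm_eps, D1m, D2m, e1, e2, zero_mul, zero_add, ih]; ring

theorem Hb_eps {k : ℕ} {b : J → ℝ} {f : R} (h : f ∈ Hb k b) : eps * f ∈ Hb k (ep R * b) := by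
  obtain ⟨C, hC, h1⟩ := h
  refine ⟨C, hC, fun j => ?_⟩
  rw [hs_eps]
  have := mul_le_mul_of_nonneg_left (h1 j) (ep_pos (R := R) j).le
  simp only [Pi.mul_apply]; linarith

theorem Hb_eps' {k : ℕ} {b : J → ℝ} {f : R} (h : f ∈ Hb k b) : eps * f ∈ Hb k b := by
  refine Bo.trans (Bo.of_le fun j => ?_) h
  rw [hs_eps]
  have := hs_nonneg k f j
  have := ep_le (R := R) j
  nlinarith

/-! ### weights -/
def M0 (w : R) : Prop := ∃ C : ℝ, 0 ≤ C ∧ ∀ f : R, ∀ j, nm (w * f) j ≤ C * nm f j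

inductive Wk : ℕ → R → Prop
  | base {w : R} (h : M0 w) : Wk 0 w
  | step {k : ℕ} {w : R} (h : M0 w) (h1 : Wk k (D1 w)) (h2 : Wk k (D2 w)) : Wk (k+1) w

theorem Wk_0 {w : R} : Wk 0 w ↔ M0 w := ⟨fun h => by cases h; assumption, Wk.base⟩
theorem Wk_succ {k : ℕ} {w : R} : Wk (k+1) w ↔ M0 w ∧ Wk k (D1 w) ∧ Wk k (D2 w) :=
  ⟨fun h => by cases h; exact ⟨by assumption, by assumption, by assumption⟩, fun h => Wk.step h.1 h.2.1 h.2.2⟩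

theorem Wk_M0 {k : ℕ} {w : R} (h : Wk k w) : M0 w := by
  cases h <;> assumption

theorem Wk_lower {k : ℕ} {w : R} (h : Wk (k+1) w) : Wk k w := by
  induction k generalizing w with
  | zero => exact .base (Wk_M0 h)
  | succ k ih => rw [Wk_succ] at h; exact .step h.1 (ih h.2.1) (ih h.2.2)

theorem M0_add {w v : R} (h : M0 w) (h' : M0 v) : M0 (w + v) := by
  obtain ⟨C, hC, h1⟩ := h; obtain ⟨D, hD, h2⟩ := h'
  refine ⟨C + D, by positivity, fun f j => ?_⟩
  rw [add_mul]
  have := nm_add (w * f) (v * f) j; have := h1 f j; have := h2 f j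
  linarith

theorem M0_mul {w v : R} (h : M0 w) (h' : M0 v) : M0 (w * v) := by
  obtain ⟨C, hC, h1⟩ := h; obtain ⟨D, hD, h2⟩ := h'
  refine ⟨C * D, by positivity, fun f j => ?_⟩
  rw [mul_assoc]
  have := h1 (v * f) j
  have := mul_le_mul_of_nonneg_left (h2 f j) hC
  linarith

theorem Wk_add {k : ℕ} {w v : R} (h : Wk k w) (h' : Wk k v) : Wk k (w + v) := by
  induction k generalizing w v with
  | zero => exact .base (M0_add (Wk_M0 h) (Wk_M0 h'))
  | succ k ih =>
    rw [Wk_succ] at h h'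
    exact .step (M0_add h.1 h'.1) (by rw [map_add]; exact ih h.2.1 h'.2.1) (by rw [map_add]; exact ih h.2.2 h'.2.2)

theorem Wk_mul {k : ℕ} {w v : R} (h : Wk k w) (h' : Wk k v) : Wk k (w * v) := by
  induction k generalizing w v with
  | zero => exact .base (M0_mul (Wk_M0 h) (Wk_M0 h'))
  | succ k ih =>
    have a := Wk_succ.1 h
    have b := Wk_succ.1 h'
    refine .step (M0_mul a.1 b.1) ?_ ?_
    · rw [D1m]; exact Wk_add (ih a.2.1 (Wk_lower h')) (ih (Wk_lower h) b.2.1)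
    · rw [D2m]; exact Wk_add (ih a.2.2 (Wk_lower h')) (ih (Wk_lower h) b.2.2)

theorem Wk_zero (k : ℕ) : Wk k (0 : R) := by
  have base : M0 (0 : R) := ⟨0, le_refl _, fun f j => by rw [zero_mul, nm_zero]; simp⟩
  induction k with
  | zero => exact .base base
  | succ k ih => exact .step base (by simpa using ih) (by simpa using ih)

theorem Wk_const (k : ℕ) {w : R} (h : M0 w) (h1 : D1 w = 0) (h2 : D2 w = 0) : Wk k w := by
  cases k with
  | zero => exact .base h
  | succ k => exact .step h (by rw [h1]; exact Wk_zero k) (by rw [h2]; exact Wk_zero k)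

theorem Wk_cst (k : ℕ) (a : ℝ) : Wk k (cst a : R) :=
  Wk_const k ⟨|a|, abs_nonneg a, fun f j => (nm_cst a f j).le⟩ (D1c a) (D2c a)
theorem Wk_one (k : ℕ) : Wk k (1 : R) := by rw [← cst_one]; exact Wk_cst k 1
theorem Wk_eps (k : ℕ) : Wk k (eps : R) :=
  Wk_const k ⟨1, by norm_num, fun f j => by
    rw [nm_eps]; exact mul_le_mul_of_nonneg_right (ep_le j) (nm_nonneg f j)⟩ e1 e2
theorem Wk_neg {k : ℕ} {w : R} (h : Wk k w) : Wk k (-w) := by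
  have : -w = cst (-1) * w := by simp [cst]
  rw [this]; exact Wk_mul (Wk_cst k _) h
theorem Wk_sub {k : ℕ} {w v : R} (h : Wk k w) (h' : Wk k v) : Wk k (w - v) := by
  rw [sub_eq_add_neg]; exact Wk_add h (Wk_neg h')

theorem Hb_wt {k : ℕ} {b : J → ℝ} {w f : R} (hw : Wk k w) (h : f ∈ Hb k b) : w * f ∈ Hb k b := by
  have base : ∀ {w f : R}, M0 w → f ∈ Hb 0 b → w * f ∈ Hb 0 b := by
    rintro w f ⟨C, hC, h1⟩ hf
    exact Bo.trans ⟨C, hC, h1 f⟩ hf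
  induction k generalizing w f with
  | zero => exact base (Wk_M0 hw) h
  | succ k ih =>
    have a := Wk_succ.1 hw
    refine Hb_succ.2 ⟨base a.1 (Hb_succ.1 h).1, ?_, ?_⟩
    · rw [D1m]; exact add_mem (ih a.2.1 (Hb_lower h)) (ih (Wk_lower hw) (Hb_D1 h))
    · rw [D2m]; exact add_mem (ih a.2.2 (Hb_lower h)) (ih (Wk_lower hw) (Hb_D2 h))

/-! ### pairing -/
theorem pair {a b : J → ℝ} {f g : R} (hf : f ∈ Hb 0 a) (hg : g ∈ Hb 0 b) : Bo (|I (f * g)|) (a * b) :=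
  (Bo.of_le (g := nm f * nm g) (fun j => cs f g j)).trans
    (Bo.mul hf hg (fun j => nm_nonneg f j) (fun j => nm_nonneg g j))

end Core
end Couette
end

noncomputable section
open MeasureTheory Real Filter Topology
set_option linter.unusedSectionVars false
namespace Couette
namespace Core
open CB
variable {R J : Type} [CommRing R] [Algebra ℝ R] [CB R J]

def eF (ph p1 p2 th : R) : J → ℝ :=
  hs 3 ph + (hs 3 p1 + hs 3 p2 + hs 3 th) + (hs 1 (D0 p1) + hs 1 (D0 p2) + hs 1 (D0 th))
def yV (v : R) : J → ℝ := nm (eps * v) + (hs 3 (D1 v) + hs 3 (D2 v)) + hs 2 (D0 v) + nm (D0 (D0 v))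
def yF (ph p1 p2 th : R) : J → ℝ :=
  nm (eps * ph) + (hs 2 (D1 ph) + hs 2 (D2 ph)) + (yV p1 + yV p2 + yV th)

/-- A family of solutions of the scaled perturbation system. -/
class CF (R : Type) (J : outParam Type) [CommRing R] [Algebra ℝ R] [CB R J] where
  mu : ℝ
  nu : ℝ
  kap : ℝ
  cc : ℝ
  lam : ℝ
  KK : ℝ
  c0 : ℝ
  nu_pos : 0 < nu
  cc_pos : 0 < cc
  KK_nonneg : 0 ≤ KK
  c0_nonneg : 0 ≤ c0
  mu_big : 1 + (1 + cc) * (KK + 3 * c0) ≤ mu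
  kap_big : 1 + (1 + cc) * (KK + 3 * c0) ≤ kap
  sob0 : ∃ C, 0 ≤ C ∧ ∀ (f g : R) (j : J), ep R j * nm (f * g) j ≤ C * (nm f j * hs 2 g j)
  sob1 : ∃ C, 0 ≤ C ∧ ∀ (f g : R) (j : J), ep R j * nm (f * g) j ≤ C * (hs 1 f j * hs 1 g j)
  infsup : ∃ C, 0 ≤ C ∧ ∀ (Q h11 h12 h21 h22 : R) (j : J),
    (∀ w1 ∈ Z (R := R), ∀ w2 ∈ Z (R := R), I (D1 Q * (D1 w1 + D2 w2)) j
      = I (h11 * D1 w1 + h12 * D1 w2 + h21 * D2 w1 + h22 * D2 w2) j) →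
    nm (D1 Q) j ≤ C * (nm h11 j + nm h12 j + nm h21 j + nm h22 j + nm (D2 Q) j)
  X : R
  kk : R
  rt : R
  X0 : D0 X = 0
  X1 : D1 X = 0
  X2 : D2 X = eps
  k0 : D0 kk = 0
  k1 : D1 kk = 0
  k2 : D2 kk = 0
  Xb : ∀ (f : R) (j : J), nm (X * f) j ≤ nm f j
  kb : ∀ (f : R) (j : J), nm (kk * f) j ≤ KK * nm f j
  rb : ∀ (f : R) (j : J), nm (rt * f) j ≤ 2 * nm f j
  rt_eq : rt * (1 + eps * (kk * (X - 1) + cst c0 * (eps * (X - X * X)))) = 1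
  ph : R
  p1 : R
  p2 : R
  th : R
  p1Z : p1 ∈ Z (R := R)
  p2Z : p2 ∈ Z (R := R)
  thZ : th ∈ Z (R := R)
  pm : Bo (nm (eps * ph)) (nm (D1 ph) + nm (D2 ph))
  eqM : D0 ph + eps * X * D1 ph + eps * eps * (p1 * D1 ph + p2 * D2 ph)
    + (rt + eps * eps * ph) * (D1 p1 + D2 p2) + p2 * D2 rt = 0
  eqP1 : (rt + eps * eps * ph) * (D0 p1 + eps * X * D1 p1 + eps * eps * (p1 * D1 p1 + p2 * D2 p1)
      + eps * eps * p2)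
    + D1 ((1 + eps * (kk * (X - 1) + cst c0 * (eps * (X - X * X)))) * ph + rt * th + eps * eps * (ph * th))
    - cst mu * (D1 (D1 p1) + D2 (D2 p1)) - cst nu * D1 (D1 p1 + D2 p2) = 0
  eqP2 : (rt + eps * eps * ph) * (D0 p2 + eps * X * D1 p2 + eps * eps * (p1 * D1 p2 + p2 * D2 p2))
    + D2 ((1 + eps * (kk * (X - 1) + cst c0 * (eps * (X - X * X)))) * ph + rt * th + eps * eps * (ph * th))
    - cst mu * (D1 (D1 p2) + D2 (D2 p2)) - cst nu * D2 (D1 p1 + D2 p2) = 0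
  eqT : cst cc * (rt + eps * eps * ph) * (D0 th + eps * X * D1 th + eps * eps * (p1 * D1 th + p2 * D2 th)
      + p2 * D2 (1 + eps * (kk * (X - 1) + cst c0 * (eps * (X - X * X)))))
    + (rt + eps * eps * ph) * (1 + eps * (kk * (X - 1) + cst c0 * (eps * (X - X * X))) + eps * eps * th)
      * (D1 p1 + D2 p2)
    - cst kap * (D1 (D1 th) + D2 (D2 th))
    = eps * eps * (cst (2 * mu) * (D1 p1 * D1 p1 + D2 p2 * D2 p2) + cst mu * ((D1 p2 + D2 p1) * (D1 p2 + D2 p1))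
      + cst (2 * mu) * (D1 p2 + D2 p1) + cst lam * ((D1 p1 + D2 p2) * (D1 p1 + D2 p2)))
  s_le : ∀ j, ep R j + eF ph p1 p2 th j ≤ 1

open CF
variable [CF R J]

variable (R) in
def E : J → ℝ := eF (ph : R) p1 p2 th
variable (R) in
def Y : J → ℝ := yF (ph : R) p1 p2 th
variable (R) in
def S : J → ℝ := ep R + E R

theorem mu_pos : 0 < mu R := by
  have := mu_big (R := R); have := cc_pos (R := R); have := KK_nonneg (R := R); have := c0_nonneg (R := R)
  have : 0 ≤ (1 + cc R) * (KK R + 3 * c0 R) := by positivity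
  linarith
theorem kap_pos : 0 < kap R := by
  have := kap_big (R := R); have := cc_pos (R := R); have := KK_nonneg (R := R); have := c0_nonneg (R := R)
  have : 0 ≤ (1 + cc R) * (KK R + 3 * c0 R) := by positivity
  linarith

theorem E_nonneg (j : J) : 0 ≤ E R j := by
  simp only [E, eF, Pi.add_apply]
  have := fun (k : ℕ) (f : R) => hs_nonneg k f j
  linarith [this 3 ph, this 3 p1, this 3 p2, this 3 th, this 1 (D0 p1), this 1 (D0 p2), this 1 (D0 th)]
theorem S_nonneg (j : J) : 0 ≤ S R j := by
  simp only [S, Pi.add_apply]; linarith [E_nonneg (R := R) j, ep_pos (R := R) j]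
theorem S_le (j : J) : S R j ≤ 1 := s_le j
theorem yV_nonneg (v : R) (j : J) : 0 ≤ yV v j := by
  simp only [yV, Pi.add_apply]
  linarith [hs_nonneg 3 (D1 v) j, hs_nonneg 3 (D2 v) j, hs_nonneg 2 (D0 v) j, nm_nonneg (eps * v) j,
    nm_nonneg (D0 (D0 v)) j]
theorem Y_nonneg (j : J) : 0 ≤ Y R j := by
  simp only [Y, yF, Pi.add_apply]
  linarith [hs_nonneg 2 (D1 (ph : R)) j, hs_nonneg 2 (D2 (ph : R)) j, yV_nonneg (p1 : R) j, yV_nonneg (p2 : R) j,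
    yV_nonneg (th : R) j, nm_nonneg (eps * ph : R) j]

theorem Bo_ES : Bo (E R) (S R) := Bo.of_le fun j => by
  simp only [S, Pi.add_apply]; linarith [ep_pos (R := R) j]
theorem Bo_epS : Bo (ep R) (S R) := Bo.of_le fun j => by
  simp only [S, Pi.add_apply]; linarith [E_nonneg (R := R) j]
theorem Bo_S1 {b : J → ℝ} (hb : 0 ≤ b) : Bo (S R * b) b := Bo.of_le fun j => by
  simp only [Pi.mul_apply]
  have := S_le (R := R) j; have := hb j; simp only [Pi.zero_apply] at this; nlinarith

/-- the three parabolic components -/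
def V (v : R) : Prop := v = p1 ∨ v = p2 ∨ v = th

theorem V1 : V (p1 : R) := Or.inl rfl
theorem V2 : V (p2 : R) := Or.inr (Or.inl rfl)
theorem V3 : V (th : R) := Or.inr (Or.inr rfl)
theorem V_Z {v : R} (h : V v) : v ∈ Z (R := R) := by
  rcases h with rfl | rfl | rfl
  exacts [p1Z, p2Z, thZ]

theorem V_e {v : R} (h : V v) : v ∈ Hb 3 (E R) ∧ D0 v ∈ Hb 1 (E R) := by
  rcases h with rfl | rfl | rfl <;> refine ⟨Bo.of_le fun j => ?_, Bo.of_le fun j => ?_⟩ <;>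
  · simp only [E, eF, Pi.add_apply]
    have := fun (k : ℕ) (f : R) => hs_nonneg k f j
    linarith [this 3 ph, this 3 p1, this 3 p2, this 3 th, this 1 (D0 p1), this 1 (D0 p2), this 1 (D0 th)]
theorem ph_e : (ph : R) ∈ Hb 3 (E R) := Bo.of_le fun j => by
    simp only [E, eF, Pi.add_apply]
    have := fun (k : ℕ) (f : R) => hs_nonneg k f j
    linarith [this 3 ph, this 3 p1, this 3 p2, this 3 th, this 1 (D0 p1), this 1 (D0 p2), this 1 (D0 th)]

theorem yV_Y {v : R} (h : V v) : Bo (yV v) (Y R) := by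
  rcases h with rfl | rfl | rfl <;> refine Bo.of_le fun j => ?_ <;>
  · simp only [Y, yF, Pi.add_apply]
    linarith [hs_nonneg 2 (D1 (ph : R)) j, hs_nonneg 2 (D2 (ph : R)) j, yV_nonneg (p1 : R) j, yV_nonneg (p2 : R) j,
      yV_nonneg (th : R) j, nm_nonneg (eps * ph : R) j]
theorem V_y {v : R} (h : V v) : D1 v ∈ Hb 3 (Y R) ∧ D2 v ∈ Hb 3 (Y R) ∧ D0 v ∈ Hb 2 (Y R) ∧
    D0 (D0 v) ∈ Hb 0 (Y R) ∧ eps * v ∈ Hb 0 (Y R) := by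
  have H := yV_Y h
  refine ⟨?_, ?_, ?_, ?_, ?_⟩ <;> refine Bo.trans (Bo.of_le fun j => ?_) H <;>
  · simp only [yV, Pi.add_apply, hs]
    have := fun (k : ℕ) (f : R) => hs_nonneg k f j
    have h3 := nm_nonneg (eps * v) j
    have h4 := nm_nonneg (D0 (D0 v)) j
    have h5 := this 3 (D1 v)
    have h6 := this 3 (D2 v)
    have h7 := this 2 (D0 v)
    simp only [hs, Pi.add_apply] at h5 h6 h7
    linarith
theorem ph_y : D1 (ph : R) ∈ Hb 2 (Y R) ∧ D2 (ph : R) ∈ Hb 2 (Y R) ∧ (eps * ph : R) ∈ Hb 0 (Y R) := by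
  refine ⟨?_, ?_, ?_⟩ <;> refine Bo.of_le fun j => ?_ <;>
  · simp only [Y, yF, Pi.add_apply]
    have h1 := hs_nonneg 2 (D1 (ph : R)) j
    have h2 := hs_nonneg 2 (D2 (ph : R)) j
    have h3 := nm_nonneg (eps * ph : R) j
    simp only [hs, Pi.add_apply] at h1 h2 ⊢
    linarith [yV_nonneg (p1 : R) j, yV_nonneg (p2 : R) j,
      yV_nonneg (th : R) j]

theorem ephY : (eps * ph : R) ∈ Hb 3 (Y R) := Hb_succ.2 ⟨ph_y.2.2, by
  rw [D1m, e1, zero_mul, zero_add]; exact Hb_eps' ph_y.1, by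
  rw [D2m, e2, zero_mul, zero_add]; exact Hb_eps' ph_y.2.1⟩
theorem evY {v : R} (h : V v) : eps * v ∈ Hb 3 (Y R) := Hb_succ.2 ⟨(V_y h).2.2.2.2, by
  rw [D1m, e1, zero_mul, zero_add]; exact Hb_eps' (Hb_lower (V_y h).1), by
  rw [D2m, e2, zero_mul, zero_add]; exact Hb_eps' (Hb_lower (V_y h).2.1)⟩

/-! ### products -/
theorem prod0 {a b : J → ℝ} {f g : R} (hf : f ∈ Hb 0 a) (hg : g ∈ Hb 2 b) : eps * (f * g) ∈ Hb 0 (a * b) := by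
  obtain ⟨C, hC, h⟩ := sob0 (R := R) (J := J)
  refine Bo.trans ⟨C, hC, fun j => ?_⟩ (Bo.mul hf hg (fun j => nm_nonneg f j) (fun j => hs_nonneg 2 g j))
  have := h f g j
  simp only [hs, nm_eps] at this ⊢; exact this
theorem prod11 {a b : J → ℝ} {f g : R} (hf : f ∈ Hb 1 a) (hg : g ∈ Hb 1 b) : eps * (f * g) ∈ Hb 0 (a * b) := by
  obtain ⟨C, hC, h⟩ := sob1 (R := R) (J := J)
  refine Bo.trans ⟨C, hC, fun j => ?_⟩ (Bo.mul hf hg (fun j => hs_nonneg 1 f j) (fun j => hs_nonneg 1 g j))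
  have := h f g j
  simp only [hs, nm_eps] at this ⊢; exact this

theorem Deps1 (f g : R) : D1 (eps * (f * g)) = eps * (D1 f * g) + eps * (f * D1 g) := by
  rw [D1m, D1m, e1]; ring
theorem Deps2 (f g : R) : D2 (eps * (f * g)) = eps * (D2 f * g) + eps * (f * D2 g) := by
  rw [D2m, D2m, e2]; ring
theorem Deps0 (f g : R) : D0 (eps * (f * g)) = eps * (D0 f * g) + eps * (f * D0 g) := by
  rw [D0m, D0m, e0]; ring
theorem prod1 {a b : J → ℝ} {f g : R} (hf : f ∈ Hb 1 a) (hg : g ∈ Hb 2 b) : eps * (f * g) ∈ Hb 1 (a * b) := by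
  refine Hb_succ.2 ⟨prod0 (Hb_lower hf) hg, ?_, ?_⟩
  · rw [Deps1]; exact add_mem (prod0 (Hb_D1 hf) hg) (prod11 hf (Hb_D1 hg))
  · rw [Deps2]; exact add_mem (prod0 (Hb_D2 hf) hg) (prod11 hf (Hb_D2 hg))
theorem prod1' {a b : J → ℝ} {f g : R} (hf : f ∈ Hb 2 a) (hg : g ∈ Hb 1 b) : eps * (f * g) ∈ Hb 1 (a * b) := by
  rw [mul_comm f, mul_comm a]; exact prod1 hg hf
theorem prod2 {a b : J → ℝ} {f g : R} (hf : f ∈ Hb 2 a) (hg : g ∈ Hb 2 b) : eps * (f * g) ∈ Hb 2 (a * b) := by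
  refine Hb_succ.2 ⟨prod0 (Hb_le (by norm_num) hf) hg, ?_, ?_⟩
  · rw [Deps1]; exact add_mem (prod1 (Hb_D1 hf) hg) (prod1' hf (Hb_D1 hg))
  · rw [Deps2]; exact add_mem (prod1 (Hb_D2 hf) hg) (prod1' hf (Hb_D2 hg))
theorem prod3 {a b : J → ℝ} {f g : R} (hf : f ∈ Hb 3 a) (hg : g ∈ Hb 3 b) : eps * (f * g) ∈ Hb 3 (a * b) := by
  refine Hb_succ.2 ⟨prod0 (Hb_le (by norm_num) hf) (Hb_lower hg), ?_, ?_⟩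
  · rw [Deps1]; exact add_mem (prod2 (Hb_D1 hf) (Hb_lower hg)) (prod2 (Hb_lower hf) (Hb_D1 hg))
  · rw [Deps2]; exact add_mem (prod2 (Hb_D2 hf) (Hb_lower hg)) (prod2 (Hb_lower hf) (Hb_D2 hg))
theorem prodk {k : ℕ} (hk : k ≤ 3) {a b : J → ℝ} {f g : R} (hf : f ∈ Hb 3 a) (hg : g ∈ Hb k b) :
    eps * (f * g) ∈ Hb k (a * b) := by
  interval_cases k
  · rw [mul_comm f, mul_comm a]; exact prod0 hg (Hb_lower hf)
  · exact prod1' (Hb_lower hf) hg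
  · exact prod2 (Hb_lower hf) hg
  · exact prod3 hf hg

end Core
end Couette
end

noncomputable section
open MeasureTheory Real Filter Topology
set_option linter.unusedSectionVars false
namespace Couette
namespace Core
open CB CF
variable {R J : Type} [CommRing R] [Algebra ℝ R] [CB R J] [CF R J]

/-! ### background profile -/
variable (R) in
def tau : R := kk * (X - 1) + cst (c0 R) * (eps * (X - X * X))
variable (R) in
def ta : R := kk + cst (c0 R) * (eps * (1 - cst 2 * X))
variable (R) in
def AA : R := - (tau R * rt)

theorem rt1 : (rt : R) = 1 + eps * AA R := by
  have := rt_eq (R := R)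
  rw [AA, tau]; linear_combination this
theorem tau1 : D1 (tau R) = 0 := by
  simp only [tau, map_add, map_sub, D1m, k1, X1, D1c, e1, Derivation.map_one_eq_zero]; ring
theorem tau2 : D2 (tau R) = eps * ta R := by
  simp only [tau, ta, map_add, map_sub, D2m, k2, X2, D2c, e2, Derivation.map_one_eq_zero, cst_two]; ring
theorem tau0 : D0 (tau R) = 0 := by
  simp only [tau, map_add, map_sub, D0m, k0, X0, D0c, e0, Derivation.map_one_eq_zero]; ring
theorem rtt : (rt : R) * (1 + eps * tau R) = 1 := rt_eq
theorem r0 : D0 (rt : R) = 0 := by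
  have h := congrArg (fun z => D0 z) (rtt (R := R))
  simp only [D0m, map_add, e0, tau0, Derivation.map_one_eq_zero] at h
  linear_combination rt * h - D0 rt * rtt (R := R)
theorem r1 : D1 (rt : R) = 0 := by
  have h := congrArg (fun z => D1 z) (rtt (R := R))
  simp only [D1m, map_add, e1, tau1, Derivation.map_one_eq_zero] at h
  linear_combination rt * h - D1 rt * rtt (R := R)
theorem r2 : D2 (rt : R) = - (eps * eps * (rt * rt * ta R)) := by
  have h := congrArg (fun z => D2 z) (rtt (R := R))
  simp only [D2m, map_add, e2, tau2, Derivation.map_one_eq_zero] at h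
  linear_combination rt * h - D2 rt * rtt (R := R)
theorem A0' : D0 (AA R) = 0 := by simp only [AA, map_neg, D0m, tau0, r0]; ring
theorem A1' : D1 (AA R) = 0 := by simp only [AA, map_neg, D1m, tau1, r1]; ring
variable (R) in
def A' : R := - (ta R * rt) + tau R * (eps * (rt * rt * ta R))
theorem A2' : D2 (AA R) = eps * A' R := by simp only [AA, A', map_neg, D2m, tau2, r2]; ring

theorem M0_X : M0 (X : R) := ⟨1, by norm_num, fun f j => by simpa using Xb f j⟩
theorem Wk_X (k : ℕ) : Wk k (X : R) := by
  cases k with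
  | zero => exact .base M0_X
  | succ k => exact .step M0_X (by rw [X1]; exact Wk_zero k) (by rw [X2]; exact Wk_eps k)
theorem Wk_kk (k : ℕ) : Wk k (kk : R) := Wk_const k ⟨KK R, KK_nonneg, kb⟩ k1 k2
theorem Wk_2 (k : ℕ) : Wk k (2 : R) := by rw [← cst_two]; exact Wk_cst k 2
theorem Wk_tau (k : ℕ) : Wk k (tau R) :=
  Wk_add (Wk_mul (Wk_kk k) (Wk_sub (Wk_X k) (Wk_one k)))
    (Wk_mul (Wk_cst k _) (Wk_mul (Wk_eps k) (Wk_sub (Wk_X k) (Wk_mul (Wk_X k) (Wk_X k)))))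
theorem Wk_ta (k : ℕ) : Wk k (ta R) :=
  Wk_add (Wk_kk k)
    (Wk_mul (Wk_cst k _) (Wk_mul (Wk_eps k) (Wk_sub (Wk_one k) (Wk_mul (Wk_cst k 2) (Wk_X k)))))
theorem M0_rt : M0 (rt : R) := ⟨2, by norm_num, rb⟩
theorem Wk_rt (k : ℕ) : Wk k (rt : R) := by
  induction k with
  | zero => exact .base M0_rt
  | succ k ih =>
    refine .step M0_rt (by rw [r1]; exact Wk_zero k) ?_
    rw [r2]
    exact Wk_neg (Wk_mul (Wk_mul (Wk_eps k) (Wk_eps k)) (Wk_mul (Wk_mul ih ih) (Wk_ta k)))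
theorem Wk_AA (k : ℕ) : Wk k (AA R) := Wk_neg (Wk_mul (Wk_tau k) (Wk_rt k))
theorem Wk_A' (k : ℕ) : Wk k (A' R) :=
  Wk_add (Wk_neg (Wk_mul (Wk_ta k) (Wk_rt k)))
    (Wk_mul (Wk_tau k) (Wk_mul (Wk_eps k) (Wk_mul (Wk_mul (Wk_rt k) (Wk_rt k)) (Wk_ta k))))

/-! ### multipliers -/
def Mk (n : ℕ) (g : R) : Prop := ∀ k ≤ n, ∀ (b : J → ℝ) (f : R), f ∈ Hb k b → 0 ≤ b → eps * (g * f) ∈ Hb k (S R * b)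

theorem Bo_mulr {a a' b : J → ℝ} (ha : Bo a a') (hb : 0 ≤ b) : Bo (a * b) (a' * b) := by
  obtain ⟨C, hC, h1⟩ := ha
  refine ⟨C, hC, fun j => ?_⟩
  have := mul_le_mul_of_nonneg_right (h1 j) (hb j)
  simp only [Pi.mul_apply]; linarith

theorem Wk_le {k : ℕ} (hk : k ≤ 3) {w : R} (hw : Wk 3 w) : Wk k w := by
  interval_cases k
  · exact Wk_lower (Wk_lower (Wk_lower hw))
  · exact Wk_lower (Wk_lower hw)
  · exact Wk_lower hw
  · exact hw
theorem Mk_e {n : ℕ} (hn : n ≤ 3) {g : R} (hg : g ∈ Hb 3 (E R)) : Mk n g := by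
  intro k hk b f hf hb
  exact Hb_mono (Bo_mulr Bo_ES hb) (prodk (by omega) hg hf)
theorem Mk_e2 {g : R} (hg : g ∈ Hb 2 (E R)) : Mk 2 g := by
  intro k hk b f hf hb
  refine Hb_mono (Bo_mulr Bo_ES hb) ?_
  interval_cases k
  · rw [mul_comm g, mul_comm (E R)]; exact prod0 hf hg
  · exact prod1' hg hf
  · exact prod2 hg hf
theorem Mk_add {n : ℕ} {g h : R} (hg : Mk n g) (hh : Mk n h) : Mk n (g + h) := by
  intro k hk b f hf hb
  rw [show eps * ((g + h) * f) = eps * (g * f) + eps * (h * f) by ring]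
  exact add_mem (hg k hk b f hf hb) (hh k hk b f hf hb)
theorem Mk_eps {n : ℕ} {g : R} (hg : Mk n g) : Mk n (eps * g) := by
  intro k hk b f hf hb
  rw [show eps * (eps * g * f) = eps * (eps * (g * f)) by ring]
  exact Hb_eps' (hg k hk b f hf hb)
theorem Mk_wmul {n : ℕ} (hn : n ≤ 3) {w g : R} (hw : Wk 3 w) (hg : Mk n g) : Mk n (w * g) := by
  intro k hk b f hf hb
  rw [show eps * (w * g * f) = w * (eps * (g * f)) by ring]
  exact Hb_wt (Wk_le (by omega) hw) (hg k hk b f hf hb)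
theorem Mk_one {n : ℕ} : Mk n (1 : R) := by
  intro k hk b f hf hb
  rw [one_mul]
  exact Hb_mono (Bo_mulr Bo_epS hb) (Hb_eps hf)

/-! ### sources -/
variable (R) in
def dv : R := D1 p1 + D2 p2
variable (R) in
def u1 : R := X + eps * p1
variable (R) in
def u2 : R := eps * p2
variable (R) in
def mm : R := AA R + eps * ph
/-- transport operator -/
def tr (f : R) : R := eps * (u1 R * D1 f) + eps * (u2 R * D2 f)
variable (R) in
def f0 : R := - (eps * (mm R * dv R)) + eps * ((rt * rt * ta R) * (eps * p2))
def q0 (z : R) : R := z + eps * (mm R * z)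
variable (R) in
def f1 : R := - (eps * (mm R * D0 p1) + q0 (tr p1 + eps * (1 * (eps * p2)))
  + eps * (tau R * D1 ph) + eps * (AA R * D1 th) + eps * (eps * ph * D1 th) + eps * (eps * th * D1 ph))
variable (R) in
def f2 : R := - (eps * (mm R * D0 p2) + q0 (tr p2)
  + eps * (tau R * D2 ph) + eps * (AA R * D2 th) + eps * (eps * ph * D2 th) + eps * (eps * th * D2 ph)
  + eps * (ta R * (eps * ph)) + eps * (A' R * (eps * th)))
variable (R) in
def pq : R := ph + eps * (tau R * ph) + th + eps * (AA R * th) + eps * (ph * (eps * th))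
variable (R) in
def gg : R := - (cst (cc R) * (eps * (mm R * D0 th)) + cst (cc R) * q0 (tr th + eps * (ta R * (eps * p2)))
  + eps * (eps * pq R * dv R))
  + cst (2 * mu R) * (eps * (eps * D1 p1 * D1 p1)) + cst (2 * mu R) * (eps * (eps * D2 p2 * D2 p2))
  + cst (mu R) * (eps * (eps * D1 p2 * D1 p2)) + cst (2 * mu R) * (eps * (eps * D1 p2 * D2 p1))
  + cst (mu R) * (eps * (eps * D2 p1 * D2 p1))
  + cst (2 * mu R) * (eps * (eps * D1 p2)) + cst (2 * mu R) * (eps * (eps * D2 p1))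
  + cst (lam R) * (eps * (eps * dv R * dv R))

theorem eqM' : D0 (ph : R) + tr (ph : R) + dv R = f0 R := by
  have h := eqM (R := R)
  rw [r2, rt1] at h
  simp only [tr, u1, u2, f0, mm, dv, rt1]
  linear_combination h
theorem eqP1' : D0 (p1 : R) + D1 (ph + th) - cst (mu R) * (D1 (D1 p1) + D2 (D2 p1)) - cst (nu R) * D1 (dv R) = f1 R := by
  have h := eqP1 (R := R)
  rw [← tau] at h
  simp only [rt1, map_add, D1m, e1, tau1, Derivation.map_one_eq_zero, A1'] at h
  simp only [tr, u1, u2, f1, q0, mm, dv, map_add]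
  linear_combination h
theorem eqP2' : D0 (p2 : R) + D2 (ph + th) - cst (mu R) * (D1 (D1 p2) + D2 (D2 p2)) - cst (nu R) * D2 (dv R) = f2 R := by
  have h := eqP2 (R := R)
  rw [← tau] at h
  simp only [rt1, map_add, D2m, e2, tau2, Derivation.map_one_eq_zero, A2'] at h
  simp only [tr, u1, u2, f2, q0, mm, dv, map_add]
  linear_combination h
theorem eqT' : cst (cc R) * D0 (th : R) + dv R - cst (kap R) * (D1 (D1 th) + D2 (D2 th)) = gg R := by
  have h := eqT (R := R)
  have hr := rtt (R := R)
  rw [← tau] at h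
  simp only [map_add, D2m, e2, tau2, Derivation.map_one_eq_zero] at h
  have h2 : (2 : R) = cst 2 := cst_two.symm
  rw [show (2 : ℝ) * mu R = mu R + mu R by ring, cst_add] at h
  simp only [rt1] at h hr
  simp only [tr, u1, u2, gg, q0, mm, dv, pq]
  rw [show (2 : ℝ) * mu R = mu R + mu R by ring, cst_add]
  linear_combination h - (D1 p1 + D2 p2) * hr

/-- Generic source estimate for pairs of submodules. -/
structure Pr (Y' S' : Submodule ℝ R) (MM : R → Prop) : Prop where
  mul : ∀ g, MM g → ∀ f ∈ Y', eps * (g * f) ∈ S'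
  le : S' ≤ Y'
  add : ∀ g h, MM g → MM h → MM (g + h)
  ee : ∀ g, MM g → MM (eps * g)
  wt : ∀ w g, Wk 3 w → D0 w = 0 → MM g → MM (w * g)
  one : MM 1
  ph : MM ph
  v : ∀ v, V v → MM v

section
variable {Y' S' : Submodule ℝ R} {MM : R → Prop}
theorem Pr.w (P : Pr Y' S' MM) {w : R} (hw : Wk 3 w) (h0 : D0 w = 0) : MM w := by
  have := P.wt w 1 hw h0 P.one; rwa [mul_one] at this
theorem Pr.mm (P : Pr Y' S' MM) : MM (mm R) := P.add _ _ (P.w (Wk_AA 3) A0') (P.ee _ P.ph)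
theorem Pr.u1 (P : Pr Y' S' MM) : MM (u1 R) := P.add _ _ (P.w (Wk_X 3) X0) (P.ee _ (P.v _ V1))
theorem Pr.u2 (P : Pr Y' S' MM) : MM (u2 R) := P.ee _ (P.v _ V2)
theorem Pr.tr (P : Pr Y' S' MM) {f : R} (h1 : D1 f ∈ Y') (h2 : D2 f ∈ Y') : tr f ∈ S' :=
  add_mem (P.mul _ P.u1 _ h1) (P.mul _ P.u2 _ h2)
theorem ta0 : D0 (ta R) = 0 := by
  simp only [ta, map_add, map_sub, D0m, k0, X0, D0c, e0, Derivation.map_one_eq_zero]; ring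
theorem wr : Wk 3 (rt * rt * ta R) ∧ D0 (rt * rt * ta R) = 0 :=
  ⟨Wk_mul (Wk_mul (Wk_rt 3) (Wk_rt 3)) (Wk_ta 3), by simp only [D0m, r0, ta0]; ring⟩
theorem A'0 : D0 (A' R) = 0 := by simp only [A', map_add, map_neg, D0m, r0, ta0, tau0, e0]; ring
theorem Pr.f0 (P : Pr Y' S' MM) (h1 : dv R ∈ Y') (h2 : (eps * p2 : R) ∈ Y') : f0 R ∈ S' :=
  add_mem (neg_mem (P.mul _ P.mm _ h1)) (P.mul _ (P.w wr.1 wr.2) _ h2)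
theorem Pr.q0 (P : Pr Y' S' MM) {f : R} (h1 : f ∈ S') : q0 f ∈ S' :=
  add_mem h1 (P.mul _ P.mm _ (P.le h1))
theorem Pr.f1 (P : Pr Y' S' MM) (hp : D1 (CF.ph : R) ∈ Y') (hv1 : ∀ v : R, V v → D1 v ∈ Y')
    (hv2 : ∀ v : R, V v → D2 v ∈ Y') (ht : ∀ v : R, V v → D0 v ∈ Y') (he : ∀ v : R, V v → eps * v ∈ Y') :
    f1 R ∈ S' := by
  refine neg_mem (add_mem (add_mem (add_mem (add_mem (add_mem ?_ ?_) ?_) ?_) ?_) ?_)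
  · exact P.mul _ P.mm _ (ht _ V1)
  · exact P.q0 (add_mem (P.tr (hv1 _ V1) (hv2 _ V1)) (P.mul _ P.one _ (he _ V2)))
  · exact P.mul _ (P.w (Wk_tau 3) tau0) _ hp
  · exact P.mul _ (P.w (Wk_AA 3) A0') _ (hv1 _ V3)
  · exact P.mul _ (P.ee _ P.ph) _ (hv1 _ V3)
  · exact P.mul _ (P.ee _ (P.v _ V3)) _ hp
theorem Pr.f2 (P : Pr Y' S' MM) (hp : D2 (CF.ph : R) ∈ Y') (hv1 : ∀ v : R, V v → D1 v ∈ Y')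
    (hv2 : ∀ v : R, V v → D2 v ∈ Y') (ht : ∀ v : R, V v → D0 v ∈ Y') (he : ∀ v : R, V v → eps * v ∈ Y')
    (hpe : (eps * CF.ph : R) ∈ Y') : f2 R ∈ S' := by
  refine neg_mem (add_mem (add_mem (add_mem (add_mem (add_mem (add_mem (add_mem ?_ ?_) ?_) ?_) ?_) ?_) ?_) ?_)
  · exact P.mul _ P.mm _ (ht _ V2)
  · exact P.q0 (P.tr (hv1 _ V2) (hv2 _ V2))
  · exact P.mul _ (P.w (Wk_tau 3) tau0) _ hp
  · exact P.mul _ (P.w (Wk_AA 3) A0') _ (hv2 _ V3)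
  · exact P.mul _ (P.ee _ P.ph) _ (hv2 _ V3)
  · exact P.mul _ (P.ee _ (P.v _ V3)) _ hp
  · exact P.mul _ (P.w (Wk_ta 3) ta0) _ hpe
  · exact P.mul _ (P.w (Wk_A' 3) A'0) _ (he _ V3)
theorem Pr.gg (P : Pr Y' S' MM) (hv1 : ∀ v : R, V v → D1 v ∈ Y')
    (hv2 : ∀ v : R, V v → D2 v ∈ Y') (ht : ∀ v : R, V v → D0 v ∈ Y') (he : ∀ v : R, V v → eps * v ∈ Y')
    (m1 : ∀ v : R, V v → MM (D1 v)) (m2 : ∀ v : R, V v → MM (D2 v)) (mp : MM (eps * (CF.ph * (eps * CF.th)))) :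
    gg R ∈ S' := by
  have c : ∀ (a : ℝ) (f : R), f ∈ S' → cst a * f ∈ S' := fun a f h => by
    rw [cst_mul]; exact Submodule.smul_mem _ _ h
  have hdv : dv R ∈ Y' := add_mem (hv1 _ V1) (hv2 _ V2)
  have hpq : MM (pq R) := P.add _ _ (P.add _ _ (P.add _ _ (P.add _ _ P.ph (P.ee _ (P.wt _ _ (Wk_tau 3) tau0 P.ph)))
    (P.v _ V3)) (P.ee _ (P.wt _ _ (Wk_AA 3) A0' (P.v _ V3)))) mp
  have e1 : ∀ f, f ∈ Y' → eps * f ∈ S' := fun f h => by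
    have := P.mul _ P.one _ h
    rwa [one_mul] at this
  refine add_mem (add_mem (add_mem (add_mem (add_mem (add_mem (add_mem (add_mem (neg_mem
    (add_mem (add_mem ?_ ?_) ?_)) ?_) ?_) ?_) ?_) ?_) ?_) ?_) ?_
  · exact c _ _ (P.mul _ P.mm _ (ht _ V3))
  · exact c _ _ (P.q0 (add_mem (P.tr (hv1 _ V3) (hv2 _ V3)) (P.mul _ (P.w (Wk_ta 3) ta0) _ (he _ V2))))
  · exact P.mul _ (P.ee _ hpq) _ hdv
  · exact c _ _ (P.mul _ (P.ee _ (m1 _ V1)) _ (hv1 _ V1))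
  · exact c _ _ (P.mul _ (P.ee _ (m2 _ V2)) _ (hv2 _ V2))
  · exact c _ _ (P.mul _ (P.ee _ (m1 _ V2)) _ (hv1 _ V2))
  · exact c _ _ (P.mul _ (P.ee _ (m1 _ V2)) _ (hv2 _ V1))
  · exact c _ _ (P.mul _ (P.ee _ (m2 _ V1)) _ (hv2 _ V1))
  · exact c _ _ (e1 _ (P.le (e1 _ (hv1 _ V2))))
  · exact c _ _ (e1 _ (P.le (e1 _ (hv2 _ V1))))
  · exact c _ _ (P.mul _ (P.ee _ (P.add _ _ (m1 _ V1) (m2 _ V2))) _ hdv)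
end

theorem Enn : (0 : J → ℝ) ≤ E R := fun j => E_nonneg j
theorem Ynn : (0 : J → ℝ) ≤ Y R := fun j => Y_nonneg j
theorem Snn : (0 : J → ℝ) ≤ S R := fun j => S_nonneg j

theorem Pr_k {n k : ℕ} (hn : n ≤ 3) (hk : k ≤ n) {b : J → ℝ} (hb : 0 ≤ b) :
    Pr (R := R) (Hb k b) (Hb k (S R * b)) (Mk n) where
  mul g hg f hf := hg k hk b f hf hb
  le f hf := Hb_mono (Bo_S1 hb) hf
  add g h := Mk_add
  ee g := Mk_eps
  wt w g hw _ hg := Mk_wmul hn hw hg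
  one := Mk_one
  ph := Mk_e hn ph_e
  v v hv := Mk_e hn (V_e hv).1

theorem dv_y : dv R ∈ Hb 3 (Y R) := add_mem (V_y V1).1 (V_y V2).2.1
theorem dv_e : dv R ∈ Hb 2 (E R) := add_mem (Hb_D1 (V_e V1).1) (Hb_D2 (V_e V2).1)

theorem f0_y : f0 R ∈ Hb 3 (S R * Y R) := (Pr_k (n := 3) (k := 3) le_rfl le_rfl Ynn).f0 dv_y (evY V2)
theorem f0_e : f0 R ∈ Hb 2 (S R * E R) :=
  (Pr_k (n := 2) (k := 2) (by norm_num) le_rfl Enn).f0 dv_e (Hb_eps' (Hb_lower (V_e V2).1))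
theorem trph_y : tr (ph : R) ∈ Hb 2 (S R * Y R) := (Pr_k (n := 2) (k := 2) (by norm_num) le_rfl Ynn).tr ph_y.1 ph_y.2.1
theorem trph_e : tr (ph : R) ∈ Hb 2 (S R * E R) :=
  (Pr_k (n := 2) (k := 2) (by norm_num) le_rfl Enn).tr (Hb_D1 ph_e) (Hb_D2 ph_e)
theorem pht_eq : D0 (ph : R) = f0 R - tr (ph : R) - dv R := by linear_combination eqM' (R := R)
theorem pht_e : D0 (ph : R) ∈ Hb 2 (E R) := by
  rw [pht_eq]
  exact sub_mem (sub_mem (Hb_mono (Bo_S1 Enn) f0_e) (Hb_mono (Bo_S1 Enn) trph_e)) dv_e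
theorem pht_y : D0 (ph : R) ∈ Hb 2 (Y R) := by
  rw [pht_eq]
  exact sub_mem (sub_mem (Hb_mono (Bo_S1 Ynn) (Hb_lower f0_y)) (Hb_mono (Bo_S1 Ynn) trph_y)) (Hb_lower dv_y)

/-- sources at energy level -/
theorem Me1 (v : R) (h : V v) : Mk 2 (D1 v) := Mk_e2 (Hb_D1 (V_e h).1)
theorem Me2 (v : R) (h : V v) : Mk 2 (D2 v) := Mk_e2 (Hb_D2 (V_e h).1)
theorem phth_e : (eps * (ph * (eps * th)) : R) ∈ Hb 3 (E R) := by
  have h := (Mk_e (n := 3) le_rfl (ph_e (R := R))) 3 le_rfl _ _ (Hb_eps' (V_e (V3 (R := R))).1) Enn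
  exact Hb_mono (Bo_S1 Enn) h
theorem f1_e : f1 R ∈ Hb 1 (S R * E R) :=
  (Pr_k (n := 2) (k := 1) (by norm_num) (by norm_num) Enn).f1 (Hb_lower (Hb_D1 ph_e))
    (fun v h => Hb_lower (Hb_D1 (V_e h).1)) (fun v h => Hb_lower (Hb_D2 (V_e h).1)) (fun v h => (V_e h).2)
    (fun v h => Hb_eps' (Hb_le (by norm_num) (V_e h).1))
theorem f2_e : f2 R ∈ Hb 1 (S R * E R) :=
  (Pr_k (n := 2) (k := 1) (by norm_num) (by norm_num) Enn).f2 (Hb_lower (Hb_D2 ph_e))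
    (fun v h => Hb_lower (Hb_D1 (V_e h).1)) (fun v h => Hb_lower (Hb_D2 (V_e h).1)) (fun v h => (V_e h).2)
    (fun v h => Hb_eps' (Hb_le (by norm_num) (V_e h).1)) (Hb_eps' (Hb_le (by norm_num) ph_e))
theorem gg_e : gg R ∈ Hb 1 (S R * E R) :=
  (Pr_k (n := 2) (k := 1) (by norm_num) (by norm_num) Enn).gg
    (fun v h => Hb_lower (Hb_D1 (V_e h).1)) (fun v h => Hb_lower (Hb_D2 (V_e h).1)) (fun v h => (V_e h).2)
    (fun v h => Hb_eps' (Hb_le (by norm_num) (V_e h).1)) Me1 Me2 (Mk_e (by norm_num) phth_e)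

/-- submodules with time derivative -/
def Yd (b : J → ℝ) : Submodule ℝ R := Hb 2 b ⊓ (Hb 0 b).comap (D0 : Derivation ℝ R R).toLinearMap
theorem mem_Yd {b : J → ℝ} {f : R} : f ∈ Yd b ↔ f ∈ Hb 2 b ∧ D0 f ∈ Hb 0 b := Iff.rfl
def Mt (g : R) : Prop := Mk 2 g ∧ ∀ f ∈ Hb 2 (Y R), eps * (D0 g * f) ∈ Hb 0 (S R * Y R)
theorem Mt_of {g : R} (h : Mk 2 g) (h0 : D0 g ∈ Hb 0 (E R)) : Mt g :=
  ⟨h, fun _ hf => Hb_mono (Bo_mulr Bo_ES Ynn) (prod0 h0 hf)⟩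

theorem Pr_t : Pr (R := R) (Yd (Y R)) (Yd (S R * Y R)) Mt where
  mul g hg f hf := by
    refine mem_Yd.2 ⟨hg.1 2 le_rfl _ _ (mem_Yd.1 hf).1 Ynn, ?_⟩
    rw [Deps0]
    exact add_mem (hg.2 f (mem_Yd.1 hf).1) (hg.1 0 (by norm_num) _ _ (mem_Yd.1 hf).2 Ynn)
  le f hf := mem_Yd.2 ⟨Hb_mono (Bo_S1 Ynn) (mem_Yd.1 hf).1, Hb_mono (Bo_S1 Ynn) (mem_Yd.1 hf).2⟩
  add g h hg hh := ⟨Mk_add hg.1 hh.1, fun f hf => by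
    rw [map_add, show eps * ((D0 g + D0 h) * f) = eps * (D0 g * f) + eps * (D0 h * f) by ring]
    exact add_mem (hg.2 f hf) (hh.2 f hf)⟩
  ee g hg := ⟨Mk_eps hg.1, fun f hf => by
    rw [D0m, e0, show eps * ((0 * g + eps * D0 g) * f) = eps * (eps * (D0 g * f)) by ring]
    exact Hb_eps' (hg.2 f hf)⟩
  wt w g hw h0 hg := ⟨Mk_wmul (by norm_num) hw hg.1, fun f hf => by
    rw [D0m, h0, show eps * ((0 * g + w * D0 g) * f) = w * (eps * (D0 g * f)) by ring]
    exact Hb_wt (Wk_le (by norm_num) hw) (hg.2 f hf)⟩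
  one := ⟨Mk_one, fun f hf => by
    rw [Derivation.map_one_eq_zero, zero_mul, mul_zero]; exact zero_mem _⟩
  ph := Mt_of (Mk_e (by norm_num) ph_e) (Hb_le (by norm_num) pht_e)
  v v hv := Mt_of (Mk_e (by norm_num) (V_e hv).1) (Hb_lower (V_e hv).2)

theorem V1t (v : R) (h : V v) : D1 v ∈ Yd (Y R) :=
  mem_Yd.2 ⟨Hb_lower (V_y h).1, by rw [c01]; exact Hb_lower (Hb_D1 (V_y h).2.2.1)⟩
theorem V2t (v : R) (h : V v) : D2 v ∈ Yd (Y R) :=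
  mem_Yd.2 ⟨Hb_lower (V_y h).2.1, by rw [c02]; exact Hb_lower (Hb_D2 (V_y h).2.2.1)⟩
theorem V0t (v : R) (h : V v) : D0 v ∈ Yd (Y R) := mem_Yd.2 ⟨(V_y h).2.2.1, (V_y h).2.2.2.1⟩
theorem Vet (v : R) (h : V v) : eps * v ∈ Yd (Y R) := mem_Yd.2 ⟨Hb_lower (evY h), by
  rw [D0m, e0, zero_mul, zero_add]; exact Hb_eps' (Hb_le (by norm_num) (V_y h).2.2.1)⟩
theorem ph1t : D1 (ph : R) ∈ Yd (Y R) := mem_Yd.2 ⟨ph_y.1, by rw [c01]; exact Hb_lower (Hb_D1 pht_y)⟩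
theorem ph2t : D2 (ph : R) ∈ Yd (Y R) := mem_Yd.2 ⟨ph_y.2.1, by rw [c02]; exact Hb_lower (Hb_D2 pht_y)⟩
theorem phet : (eps * ph : R) ∈ Yd (Y R) := mem_Yd.2 ⟨Hb_lower ephY, by
  rw [D0m, e0, zero_mul, zero_add]; exact Hb_eps' (Hb_le (by norm_num) pht_y)⟩
theorem Mt1 (v : R) (h : V v) : Mt (D1 v) := Mt_of (Me1 v h) (by rw [c01]; exact Hb_D1 (V_e h).2)
theorem Mt2 (v : R) (h : V v) : Mt (D2 v) := Mt_of (Me2 v h) (by rw [c02]; exact Hb_D2 (V_e h).2)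
theorem f0_t : f0 R ∈ Yd (S R * Y R) := Pr_t.f0 (add_mem (V1t _ V1) (V2t _ V2)) (Vet _ V2)
theorem tr_t : tr (ph : R) ∈ Yd (S R * Y R) := Pr_t.tr ph1t ph2t
theorem f1_t : f1 R ∈ Yd (S R * Y R) := Pr_t.f1 ph1t V1t V2t V0t Vet
theorem f2_t : f2 R ∈ Yd (S R * Y R) := Pr_t.f2 ph2t V1t V2t V0t Vet phet
theorem gg_t : gg R ∈ Yd (S R * Y R) := by
  refine Pr_t.gg V1t V2t V0t Vet Mt1 Mt2 (Mt_of (Mk_e (by norm_num) phth_e) ?_)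
  rw [Deps0]
  have b : Bo (E R * E R) (E R) := (Bo_mulr Bo_ES Enn).trans (Bo_S1 Enn)
  refine add_mem (Hb_mono b (prod0 (Hb_le (by norm_num) pht_e) (Hb_eps' (Hb_lower (V_e V3).1)))) ?_
  rw [mul_comm (CF.ph : R), D0m, e0, zero_mul, zero_add]
  exact Hb_mono b (prod0 (Hb_eps' (Hb_lower (V_e V3).2)) (Hb_lower ph_e))

end Core
end Couette
end

noncomputable section
open MeasureTheory Real Filter Topology
set_option linter.unusedSectionVars false
set_option linter.unusedVariables false
namespace Couette
namespace Core
open CB CF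
variable {R J : Type} [CommRing R] [Algebra ℝ R] [CB R J] [CF R J]

/-! ### Lyapunov calculus -/
variable (R) in
def SE : J → ℝ := S R * (E R * E R)
variable (R) in
def SY : J → ℝ := S R * (Y R * Y R)
theorem SE_nn (j : J) : 0 ≤ SE R j := by
  have := S_nonneg (R := R) j; have := E_nonneg (R := R) j
  simp only [SE, Pi.mul_apply]; positivity
theorem SY_nn (j : J) : 0 ≤ SY R j := by
  have := S_nonneg (R := R) j; have := Y_nonneg (R := R) j
  simp only [SY, Pi.mul_apply]; positivity

variable (R) in
def Ly (g k : J → ℝ) : Prop := ∃ q : R, ∃ C : ℝ, 0 ≤ C ∧ ∀ j, g j ≤ I q j + C * SE R j ∧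
  |I q j| ≤ C * (E R j * E R j) ∧ I (D0 q) j + k j ≤ C * SY R j
variable (R) in
def GB (h : J → ℝ) : Prop := Ly R h 0
variable (R) in
def KB (h : J → ℝ) : Prop := Ly R 0 h

theorem Ly_add {g k g' k' : J → ℝ} (h : Ly R g k) (h' : Ly R g' k') : Ly R (g + g') (k + k') := by
  obtain ⟨q, C, hC, h⟩ := h
  obtain ⟨q', C', hC', h'⟩ := h'
  refine ⟨q + q', C + C', by positivity, fun j => ?_⟩
  obtain ⟨a1, a2, a3⟩ := h j
  obtain ⟨b1, b2, b3⟩ := h' j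
  simp only [map_add, Pi.add_apply]
  refine ⟨by linarith, ?_, by linarith⟩
  have := abs_add_le (I q j) (I q' j)
  linarith

theorem Ly_mono {g k g' k' : J → ℝ} (h : Ly R g k) (h1 : ∃ C, 0 ≤ C ∧ ∀ j, g' j ≤ C * g j ∧ k' j ≤ C * k j) : Ly R g' k' := by
  obtain ⟨q, C, hC, h⟩ := h
  obtain ⟨D, hD, hd⟩ := h1
  refine ⟨cst D * q, D * C, by positivity, fun j => ?_⟩
  obtain ⟨a1, a2, a3⟩ := h j
  obtain ⟨b1, b2⟩ := hd j
  have e : D0 (cst D * q) = cst D * D0 q := by rw [D0m, D0c]; ring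
  rw [e]
  simp only [Ic]
  refine ⟨?_, ?_, ?_⟩
  · nlinarith [mul_le_mul_of_nonneg_left a1 hD]
  · rw [abs_mul, abs_of_nonneg hD]; nlinarith [mul_le_mul_of_nonneg_left a2 hD]
  · nlinarith [mul_le_mul_of_nonneg_left a3 hD]

theorem KB_mono {h h' : J → ℝ} (hh : KB R h) (hb : Bo h' h) : KB R h' := by
  obtain ⟨C, hC, hb⟩ := hb
  exact Ly_mono hh ⟨C, hC, fun j => ⟨by simp, hb j⟩⟩
theorem GB_mono {h h' : J → ℝ} (hh : GB R h) (hb : Bo h' h) : GB R h' := by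
  obtain ⟨C, hC, hb⟩ := hb
  exact Ly_mono hh ⟨C, hC, fun j => ⟨hb j, by simp⟩⟩
theorem KB_add {h h' : J → ℝ} (hh : KB R h) (hb : KB R h') : KB R (h + h') := by
  have := Ly_add hh hb; rwa [add_zero] at this
theorem GB_add {h h' : J → ℝ} (hh : GB R h) (hb : GB R h') : GB R (h + h') := by
  have := Ly_add hh hb; rwa [add_zero] at this
theorem KB_SY : KB R (SY R) := ⟨0, 1, by norm_num, fun j => ⟨by simp [SE_nn], by
  have := E_nonneg (R := R) j
  simp; positivity, by simp⟩⟩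
theorem GB_SE : GB R (SE R) := ⟨0, 1, by norm_num, fun j => ⟨by simp, by
  have := E_nonneg (R := R) j
  simp; positivity, by simp [SY_nn]⟩⟩
theorem KB_smul {h : J → ℝ} (hh : KB R h) {C : ℝ} (hC : 0 ≤ C) : KB R (fun j => C * h j) :=
  KB_mono hh ⟨C, hC, fun j => le_rfl⟩
theorem GB_smul {h : J → ℝ} (hh : GB R h) {C : ℝ} (hC : 0 ≤ C) : GB R (fun j => C * h j) :=
  GB_mono hh ⟨C, hC, fun j => le_rfl⟩

theorem Ly_ext {g k h l : J → ℝ} (q : R) (hh : GB R h) (hl : KB R l) (hq : Bo |I q| (E R * E R))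
    (h1 : ∀ j, g j ≤ I q j + h j) (h2 : ∀ j, I (D0 q) j + k j ≤ l j) : Ly R g k := by
  obtain ⟨q1, C, hC, hh⟩ := hh
  obtain ⟨q2, D, hD, hl⟩ := hl
  obtain ⟨F, hF, hq⟩ := hq
  refine ⟨q + q1 + q2, C + D + F, by positivity, fun j => ?_⟩
  obtain ⟨a1, a2, a3⟩ := hh j
  obtain ⟨b1, b2, b3⟩ := hl j
  have c := hq j
  have d1 := h1 j
  have d2 := h2 j
  have e1 := SE_nn (R := R) j
  have e2 := SY_nn (R := R) j
  have e3 := E_nonneg (R := R) j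
  have f1 := mul_nonneg hF e1
  have f2 := mul_nonneg hF e2
  simp only [map_add, Pi.add_apply, Pi.mul_apply, Pi.zero_apply, Pi.abs_apply] at *
  refine ⟨by linarith, ?_, by linarith⟩
  have := abs_add_le (I q j + I q1 j) (I q2 j)
  have := abs_add_le (I q j) (I q1 j)
  linarith

theorem Ly_G {g k : J → ℝ} (h : Ly R g k) (hk : ∀ j, 0 ≤ k j) : GB R g :=
  Ly_mono h ⟨1, by norm_num, fun j => ⟨by simp, by simpa using hk j⟩⟩
theorem Ly_K {g k : J → ℝ} (h : Ly R g k) (hk : ∀ j, 0 ≤ g j) : KB R k :=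
  Ly_mono h ⟨1, by norm_num, fun j => ⟨by simpa using hk j, by simp⟩⟩

variable (R) in
def GS (h : J → ℝ) : Prop := (∀ j, 0 ≤ h j) ∧ GB R (h * h)
variable (R) in
def KS (h : J → ℝ) : Prop := (∀ j, 0 ≤ h j) ∧ KB R (h * h)

theorem sq_bo {h h' : J → ℝ} : Bo ((h + h') * (h + h')) (h * h + h' * h') :=
  ⟨2, by norm_num, fun j => by simp only [Pi.add_apply, Pi.mul_apply]; nlinarith [sq_nonneg (h j - h' j)]⟩
theorem KS_add {h h' : J → ℝ} (a : KS R h) (b : KS R h') : KS R (h + h') :=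
  ⟨fun j => add_nonneg (a.1 j) (b.1 j), KB_mono (KB_add a.2 b.2) sq_bo⟩
theorem GS_add {h h' : J → ℝ} (a : GS R h) (b : GS R h') : GS R (h + h') :=
  ⟨fun j => add_nonneg (a.1 j) (b.1 j), GB_mono (GB_add a.2 b.2) sq_bo⟩
theorem KS_mono {h h' : J → ℝ} (a : KS R h) (b : Bo h' h) (c : ∀ j, 0 ≤ h' j) : KS R h' :=
  ⟨c, KB_mono a.2 (Bo.mul b b c c)⟩
theorem GS_mono {h h' : J → ℝ} (a : GS R h) (b : Bo h' h) (c : ∀ j, 0 ≤ h' j) : GS R h' :=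
  ⟨c, GB_mono a.2 (Bo.mul b b c c)⟩

variable (R) in
def Kd : Submodule ℝ R where
  carrier := {f | KS R (nm f)}
  add_mem' := fun {f g} hf hg => KS_mono (KS_add hf hg) (Bo.of_le fun j => nm_add f g j) (nm_nonneg _)
  zero_mem' := KS_mono (h := 0) ⟨fun j => le_rfl, KB_mono KB_SY ⟨0, le_rfl, fun j => by simp⟩⟩
    ⟨0, le_rfl, fun j => by simp [nm_zero]⟩ (nm_nonneg _)
  smul_mem' := fun a f hf => KS_mono hf ⟨|a|, abs_nonneg a, fun j => (nm_smul a f j).le⟩ (nm_nonneg _)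
variable (R) in
def Gd : Submodule ℝ R where
  carrier := {f | GS R (nm f)}
  add_mem' := fun {f g} hf hg => GS_mono (GS_add hf hg) (Bo.of_le fun j => nm_add f g j) (nm_nonneg _)
  zero_mem' := GS_mono (h := 0) ⟨fun j => le_rfl, GB_mono GB_SE ⟨0, le_rfl, fun j => by simp⟩⟩
    ⟨0, le_rfl, fun j => by simp [nm_zero]⟩ (nm_nonneg _)
  smul_mem' := fun a f hf => GS_mono hf ⟨|a|, abs_nonneg a, fun j => (nm_smul a f j).le⟩ (nm_nonneg _)
theorem mem_Kd {f : R} : f ∈ Kd R ↔ KS R (nm f) := Iff.rfl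
theorem mem_Gd {f : R} : f ∈ Gd R ↔ GS R (nm f) := Iff.rfl

theorem Bo_SSY : Bo ((S R * Y R) * (S R * Y R)) (SY R) := Bo.of_le fun j => by
  have := S_nonneg (R := R) j; have := S_le (R := R) j; have := Y_nonneg (R := R) j
  simp only [SY, Pi.mul_apply]
  have : S R j * S R j ≤ S R j := by nlinarith
  nlinarith [mul_nonneg ‹0 ≤ Y R j› ‹0 ≤ Y R j›]
theorem Bo_SSE : Bo ((S R * E R) * (S R * E R)) (SE R) := Bo.of_le fun j => by
  have := S_nonneg (R := R) j; have := S_le (R := R) j; have := E_nonneg (R := R) j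
  simp only [SE, Pi.mul_apply]
  have : S R j * S R j ≤ S R j := by nlinarith
  nlinarith [mul_nonneg ‹0 ≤ E R j› ‹0 ≤ E R j›]
theorem KS_SY : KS R (S R * Y R) := ⟨fun j => mul_nonneg (S_nonneg j) (Y_nonneg j), KB_mono KB_SY Bo_SSY⟩
theorem GS_SE : GS R (S R * E R) := ⟨fun j => mul_nonneg (S_nonneg j) (E_nonneg j), GB_mono GB_SE Bo_SSE⟩
theorem Kd_SY {f : R} (h : f ∈ Hb 0 (S R * Y R)) : f ∈ Kd R := KS_mono KS_SY h (nm_nonneg _)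
theorem Gd_SE {f : R} (h : f ∈ Hb 0 (S R * E R)) : f ∈ Gd R := GS_mono GS_SE h (nm_nonneg _)

theorem KB_pair {f g : R} (hf : f ∈ Hb 0 (S R * Y R)) (hg : g ∈ Hb 0 (Y R)) : KB R |I (f * g)| :=
  KB_mono KB_SY (by
    have := pair hf hg
    rwa [mul_assoc] at this)
theorem KB_pair' {f g : R} (hf : f ∈ Hb 0 (S R * Y R)) (hg : g ∈ Hb 0 (Y R)) : KB R |I (g * f)| := by
  rw [mul_comm g]; exact KB_pair hf hg
theorem KB_abs_add {f g : R} (hf : KB R |I f|) (hg : KB R |I g|) : KB R |I (f + g)| :=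
  KB_mono (KB_add hf hg) (Bo.of_le fun j => by
    simp only [map_add, Pi.abs_apply, Pi.add_apply]; exact abs_add_le _ _)
theorem KB_abs_neg {f : R} (hf : KB R |I f|) : KB R |I (-f)| := by
  rwa [map_neg, abs_neg]
theorem KB_abs_sub {f g : R} (hf : KB R |I f|) (hg : KB R |I g|) : KB R |I (f - g)| := by
  rw [sub_eq_add_neg]; exact KB_abs_add hf (KB_abs_neg hg)
theorem KB_sq {f : R} (h : f ∈ Kd R) : KB R (I (f * f)) := by
  have := h.2
  refine KB_mono this (Bo.of_le fun j => ?_)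
  rw [Pi.mul_apply, ← nm_sq, sq]
theorem GB_sq {f : R} (h : f ∈ Gd R) : GB R (I (f * f)) := by
  have := h.2
  refine GB_mono this (Bo.of_le fun j => ?_)
  rw [Pi.mul_apply, ← nm_sq, sq]
theorem Kd_of {f : R} (h : KB R (I (f * f))) : f ∈ Kd R := ⟨nm_nonneg f, KB_mono h (Bo.of_le fun j => by
  rw [Pi.mul_apply, ← sq, nm_sq])⟩
theorem Gd_of {f : R} (h : GB R (I (f * f))) : f ∈ Gd R := ⟨nm_nonneg f, GB_mono h (Bo.of_le fun j => by
  rw [Pi.mul_apply, ← sq, nm_sq])⟩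
theorem KB_zero : KB R 0 := KB_mono KB_SY ⟨0, le_rfl, fun j => by simp⟩
theorem GB_zero : GB R 0 := GB_mono GB_SE ⟨0, le_rfl, fun j => by simp⟩

/-- I of a product bounded at energy level -/
theorem EE_pair {f g : R} (hf : f ∈ Hb 0 (E R)) (hg : g ∈ Hb 0 (E R)) : Bo |I (f * g)| (E R * E R) := pair hf hg
theorem Bo_abs_add {f g : R} {b : J → ℝ} (hf : Bo |I f| b) (hg : Bo |I g| b) : Bo |I (f + g)| b :=
  (Bo.of_le (g := |I f| + |I g|) fun j => by
    simp only [map_add, Pi.abs_apply, Pi.add_apply]; exact abs_add_le _ _).trans (hf.add hg)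
theorem Bo_abs_sub {f g : R} {b : J → ℝ} (hf : Bo |I f| b) (hg : Bo |I g| b) : Bo |I (f - g)| b := by
  rw [sub_eq_add_neg]; refine Bo_abs_add hf ?_
  rwa [map_neg, abs_neg]
theorem Bo_abs_cst {f : R} {b : J → ℝ} (a : ℝ) (hf : Bo |I f| b) : Bo |I (cst a * f)| b := by
  refine Bo.trans ⟨|a|, abs_nonneg a, fun j => ?_⟩ hf
  simp only [Pi.abs_apply, Ic, abs_mul]; exact le_rfl

/-! ### linearised system -/
def dd (b1 b2 : R) : R := D1 b1 + D2 b2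
structure Sys (a b1 b2 c F0 F1 F2 G : R) : Prop where
  m : D0 a + dd b1 b2 = F0
  p1 : D0 b1 + D1 (a + c) - cst (mu R) * (D1 (D1 b1) + D2 (D2 b1)) - cst (nu R) * D1 (dd b1 b2) = F1
  p2 : D0 b2 + D2 (a + c) - cst (mu R) * (D1 (D1 b2) + D2 (D2 b2)) - cst (nu R) * D2 (dd b1 b2) = F2
  t : cst (cc R) * D0 c + dd b1 b2 - cst (kap R) * (D1 (D1 c) + D2 (D2 c)) = G
  z1 : b1 ∈ Z (R := R)
  z2 : b2 ∈ Z (R := R)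
  zc : c ∈ Z (R := R)

theorem Sys.D1 {a b1 b2 c F0 F1 F2 G : R} (s : Sys a b1 b2 c F0 F1 F2 G) :
    Sys (D1 a) (D1 b1) (D1 b2) (D1 c) (D1 F0) (D1 F1) (D1 F2) (D1 G) where
  m := by rw [← s.m]; simp only [dd, map_add, c01, c12]
  p1 := by rw [← s.p1]; simp only [dd, map_add, map_sub, D1m, D1c, c01, c12]; ring
  p2 := by rw [← s.p2]; simp only [dd, map_add, map_sub, D1m, D1c, c01, c12]; ring
  t := by rw [← s.t]; simp only [dd, map_add, map_sub, D1m, D1c, c01, c12]; ring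
  z1 := Z1 _ s.z1
  z2 := Z1 _ s.z2
  zc := Z1 _ s.zc
theorem Sys.D0 {a b1 b2 c F0 F1 F2 G : R} (s : Sys a b1 b2 c F0 F1 F2 G) :
    Sys (D0 a) (D0 b1) (D0 b2) (D0 c) (D0 F0) (D0 F1) (D0 F2) (D0 G) where
  m := by rw [← s.m]; simp only [dd, map_add, c01, c02]
  p1 := by rw [← s.p1]; simp only [dd, map_add, map_sub, D0m, D0c, c01, c02]; ring
  p2 := by rw [← s.p2]; simp only [dd, map_add, map_sub, D0m, D0c, c01, c02]; ring
  t := by rw [← s.t]; simp only [dd, map_add, map_sub, D0m, D0c, c01, c02]; ring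
  z1 := Z0 _ s.z1
  z2 := Z0 _ s.z2
  zc := Z0 _ s.zc
theorem base : Sys (ph : R) p1 p2 th (f0 R - tr (ph : R)) (f1 R) (f2 R) (gg R) where
  m := by rw [← eqM']; simp only [dd, dv]; ring
  p1 := eqP1'
  p2 := eqP2'
  t := eqT'
  z1 := p1Z
  z2 := p2Z
  zc := thZ

theorem Zm {f : R} (h : f ∈ Z (R := R)) (g : R) : f * g ∈ Z (R := R) := Ideal.mul_mem_right _ _ h
theorem Zm' {f : R} (h : f ∈ Z (R := R)) (g : R) : g * f ∈ Z (R := R) := Ideal.mul_mem_left _ _ h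
theorem Isq (f : R) (j : J) : 0 ≤ I (f * f) j := I_sq f j

theorem Sys.e0 {a b1 b2 c F0 F1 F2 G : R} (s : Sys a b1 b2 c F0 F1 F2 G)
    (ka : KB R |I (a * F0)|) (k1 : KB R |I (b1 * F1)|) (k2 : KB R |I (b2 * F2)|) (kc : KB R |I (c * G)|)
    (ea : a ∈ Hb 0 (E R)) (e1 : b1 ∈ Hb 0 (E R)) (e2 : b2 ∈ Hb 0 (E R)) (ec : c ∈ Hb 0 (E R)) :
    (a ∈ Gd R ∧ b1 ∈ Gd R ∧ b2 ∈ Gd R ∧ c ∈ Gd R) ∧ (CB.D1 b1 ∈ Kd R ∧ CB.D2 b1 ∈ Kd R ∧ CB.D1 b2 ∈ Kd R ∧ CB.D2 b2 ∈ Kd R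
      ∧ CB.D1 c ∈ Kd R ∧ CB.D2 c ∈ Kd R) := by
  have key : ∀ j, I (CB.D0 (a * a + b1 * b1 + b2 * b2 + cst (cc R) * (c * c))) j =
      2 * (I (a * F0) j + I (b1 * F1) j + I (b2 * F2) j + I (c * G) j)
      - 2 * (mu R * (I (CB.D1 b1 * CB.D1 b1) j + I (CB.D2 b1 * CB.D2 b1) j + I (CB.D1 b2 * CB.D1 b2) j + I (CB.D2 b2 * CB.D2 b2) j)
        + nu R * I (dd b1 b2 * dd b1 b2) j + kap R * (I (CB.D1 c * CB.D1 c) j + I (CB.D2 c * CB.D2 c) j)) := by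
    intro j
    have id : CB.D0 (a * a + b1 * b1 + b2 * b2 + cst (cc R) * (c * c)) =
      cst 2 * (a * F0 + b1 * F1 + b2 * F2 + c * G)
      - cst 2 * (cst (mu R) * (CB.D1 b1 * CB.D1 b1 + CB.D2 b1 * CB.D2 b1 + CB.D1 b2 * CB.D1 b2 + CB.D2 b2 * CB.D2 b2)
        + cst (nu R) * (dd b1 b2 * dd b1 b2) + cst (kap R) * (CB.D1 c * CB.D1 c + CB.D2 c * CB.D2 c))
      + cst 2 * CB.D1 (b1 * (cst (mu R) * CB.D1 b1 + cst (nu R) * dd b1 b2 - (a + c)) + cst (mu R) * (b2 * CB.D1 b2)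
          + cst (kap R) * (c * CB.D1 c))
      + cst 2 * CB.D2 (b2 * (cst (mu R) * CB.D2 b2 + cst (nu R) * dd b1 b2 - (a + c)) + cst (mu R) * (b1 * CB.D2 b1)
          + cst (kap R) * (c * CB.D2 c)) := by
      have m := s.m; have q1 := s.p1; have q2 := s.p2; have qt := s.t
      simp only [map_add, map_sub, D0m, D1m, D2m, D0c, D1c, D2c, cst_two, dd] at *
      linear_combination 2 * a * m + 2 * b1 * q1 + 2 * b2 * q2 + 2 * c * qt
    rw [id]
    simp only [Ia, Is, Ic, II1]
    rw [II2]
    · ring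
    · exact add_mem (add_mem (Zm s.z2 _) (Zm' (Zm s.z1 _) _)) (Zm' (Zm s.zc _) _)
  have hL : Ly R (I (a * a) + I (b1 * b1) + I (b2 * b2) + fun j => cc R * I (c * c) j)
    (fun j => 2 * (mu R * (I (CB.D1 b1 * CB.D1 b1) j + I (CB.D2 b1 * CB.D2 b1) j + I (CB.D1 b2 * CB.D1 b2) j + I (CB.D2 b2 * CB.D2 b2) j)
        + kap R * (I (CB.D1 c * CB.D1 c) j + I (CB.D2 c * CB.D2 c) j))) := by
    refine Ly_ext (a * a + b1 * b1 + b2 * b2 + cst (cc R) * (c * c)) GB_zero (KB_smul (KB_add (KB_add (KB_add ka k1) k2) kc) (C := 2) (by norm_num)) ?_ ?_ ?_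
    · exact Bo_abs_add (Bo_abs_add (Bo_abs_add (EE_pair ea ea) (EE_pair e1 e1)) (EE_pair e2 e2)) (Bo_abs_cst _ (EE_pair ec ec))
    · intro j; simp only [Pi.add_apply, Pi.zero_apply, Ia, Ic]; linarith
    · intro j
      rw [key]
      have := mul_nonneg (nu_pos (R := R)).le (Isq (dd b1 b2) j)
      simp only [Pi.add_apply, Pi.abs_apply]
      linarith [le_abs_self (I (a * F0) j), le_abs_self (I (b1 * F1) j), le_abs_self (I (b2 * F2) j), le_abs_self (I (c * G) j)]
  have hm := mu_pos (R := R); have hk := kap_pos (R := R); have hc := cc_pos (R := R)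
  have gg := Ly_G hL (fun j => by
    have := fun f : R => Isq f j
    have h1 := this (CB.D1 b1); have h2 := this (CB.D2 b1); have h3 := this (CB.D1 b2); have h4 := this (CB.D2 b2)
    have h5 := this (CB.D1 c); have h6 := this (CB.D2 c)
    positivity)
  have kk := Ly_K hL (fun j => by
    have := fun f : R => Isq f j
    have h1 := this a; have h2 := this b1; have h3 := this b2; have h4 := this c
    simp only [Pi.add_apply]
    positivity)
  refine ⟨⟨?_, ?_, ?_, ?_⟩, ?_, ?_, ?_, ?_, ?_, ?_⟩
  any_goals
    refine Gd_of (GB_mono gg ⟨1 + (cc R)⁻¹, by positivity, fun j => ?_⟩)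
    have := fun f : R => Isq f j
    have h1 := this a; have h2 := this b1; have h3 := this b2; have h4 := mul_nonneg hc.le (this c)
    simp only [Pi.add_apply]
    have h5 : 0 ≤ (cc R)⁻¹ := by positivity
    have h6 : (cc R)⁻¹ * (cc R * I (c * c) j) = I (c * c) j := by field_simp
    nlinarith [mul_nonneg h5 h1, mul_nonneg h5 h2, mul_nonneg h5 h3, mul_nonneg h5 h4]
  all_goals
    refine Kd_of (KB_mono kk ⟨(mu R)⁻¹ + (kap R)⁻¹, by positivity, fun j => ?_⟩)
    have := fun f : R => Isq f j
    have h1 := this (CB.D1 b1); have h2 := this (CB.D2 b1); have h3 := this (CB.D1 b2); have h4 := this (CB.D2 b2)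
    have h5 := this (CB.D1 c); have h6 := this (CB.D2 c)
    have h7 : ((mu R)⁻¹ + (kap R)⁻¹) * mu R = 1 + (kap R)⁻¹ * mu R := by field_simp
    have h8 : ((mu R)⁻¹ + (kap R)⁻¹) * kap R = 1 + (mu R)⁻¹ * kap R := by field_simp; ring
    have h9 : 0 ≤ (kap R)⁻¹ * mu R := by positivity
    have h10 : 0 ≤ (mu R)⁻¹ * kap R := by positivity
    rw [mul_left_comm, mul_add, ← mul_assoc, ← mul_assoc, h7, h8]
    nlinarith [mul_nonneg h9 h1, mul_nonneg h9 h2, mul_nonneg h9 h3, mul_nonneg h9 h4, mul_nonneg h10 h5, mul_nonneg h10 h6]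

theorem yng (a b : R) (t : ℝ) (ht : 0 < t) (j : J) : I (a * b) j ≤ t * I (a * a) j + t⁻¹ * I (b * b) j := by
  have h := cs' a b j
  have h1 := nm_sq a j; have h2 := nm_sq b j
  rw [← h1, ← h2]
  refine h.trans ?_
  have e : nm a j * nm b j = (√t * nm a j) * ((√t)⁻¹ * nm b j) := by
    have : √t ≠ 0 := (Real.sqrt_pos.2 ht).ne'
    field_simp
  have e1 : t * nm a j ^ 2 = (√t * nm a j) ^ 2 := by rw [mul_pow, Real.sq_sqrt ht.le]
  have e2 : t⁻¹ * nm b j ^ 2 = ((√t)⁻¹ * nm b j) ^ 2 := by rw [mul_pow, inv_pow, Real.sq_sqrt ht.le]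
  rw [e, e1, e2]
  nlinarith [sq_nonneg (√t * nm a j - (√t)⁻¹ * nm b j), sq_nonneg (√t * nm a j), sq_nonneg ((√t)⁻¹ * nm b j)]

end Core
end Couette
end

noncomputable section
open MeasureTheory Real Filter Topology
set_option linter.unusedSectionVars false
set_option linter.unusedVariables false
namespace Couette
namespace Core
open CB CF
variable {R J : Type} [CommRing R] [Algebra ℝ R] [CB R J] [CF R J]

theorem Sys.e1 {a b1 b2 c F0 F1 F2 G : R} (s : Sys a b1 b2 c F0 F1 F2 G)
    (h0 : F0 ∈ Kd R) (h1 : F1 ∈ Kd R) (h2 : F2 ∈ Kd R) (hG : G ∈ Kd R)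
    (k1 : CB.D1 b1 ∈ Kd R) (k2 : CB.D2 b2 ∈ Kd R)
    (ga : a ∈ Gd R) (gc : c ∈ Gd R)
    (ea : a ∈ Hb 0 (E R)) (e1 : b1 ∈ Hb 1 (E R)) (e2 : b2 ∈ Hb 1 (E R)) (ec : c ∈ Hb 1 (E R)) :
    (CB.D1 b1 ∈ Gd R ∧ CB.D2 b1 ∈ Gd R ∧ CB.D1 b2 ∈ Gd R ∧ CB.D2 b2 ∈ Gd R
      ∧ CB.D1 c ∈ Gd R ∧ CB.D2 c ∈ Gd R) ∧ (CB.D0 b1 ∈ Kd R ∧ CB.D0 b2 ∈ Kd R ∧ CB.D0 c ∈ Kd R) := by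
  have hm := mu_pos (R := R); have hk := kap_pos (R := R); have hc := cc_pos (R := R); have hn := nu_pos (R := R)
  set q : R := cst (mu R) * (CB.D1 b1 * CB.D1 b1 + CB.D2 b1 * CB.D2 b1 + CB.D1 b2 * CB.D1 b2 + CB.D2 b2 * CB.D2 b2)
        + cst (nu R) * (dd b1 b2 * dd b1 b2) + cst (kap R) * (CB.D1 c * CB.D1 c + CB.D2 c * CB.D2 c)
        - cst 2 * (dd b1 b2 * (a + c)) with hq
  have key : ∀ j, I (CB.D0 q) j = - 2 * (I (CB.D0 b1 * CB.D0 b1) j + I (CB.D0 b2 * CB.D0 b2) j + cc R * I (CB.D0 c * CB.D0 c) j)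
      + 2 * I (CB.D0 b1 * F1) j + 2 * I (CB.D0 b2 * F2) j + 2 * I (CB.D0 c * G) j + 2 * I ((-F0) * dd b1 b2) j
      + 2 * I (dd b1 b2 * dd b1 b2) j + 4 * I (CB.D0 c * (- dd b1 b2)) j := by
    intro j
    have id : CB.D0 q = cst (-2) * (CB.D0 b1 * CB.D0 b1 + CB.D0 b2 * CB.D0 b2 + cst (cc R) * (CB.D0 c * CB.D0 c))
      + cst 2 * (CB.D0 b1 * F1) + cst 2 * (CB.D0 b2 * F2) + cst 2 * (CB.D0 c * G) + cst 2 * ((-F0) * dd b1 b2)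
      + cst 2 * (dd b1 b2 * dd b1 b2) + cst 4 * (CB.D0 c * (- dd b1 b2))
      + cst 2 * CB.D1 (CB.D0 b1 * (cst (mu R) * CB.D1 b1 + cst (nu R) * dd b1 b2 - (a + c)) + cst (mu R) * (CB.D0 b2 * CB.D1 b2)
          + cst (kap R) * (CB.D0 c * CB.D1 c))
      + cst 2 * CB.D2 (CB.D0 b2 * (cst (mu R) * CB.D2 b2 + cst (nu R) * dd b1 b2 - (a + c)) + cst (mu R) * (CB.D0 b1 * CB.D2 b1)
          + cst (kap R) * (CB.D0 c * CB.D2 c)) := by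
      have m := s.m; have q1 := s.p1; have q2 := s.p2; have qt := s.t
      have t2 : (cst (-2) : R) = -2 := by rw [cst, map_neg, map_ofNat]
      have dt2 : CB.D0 (2 : R) = 0 := by rw [← cst_two]; exact D0c 2
      have t4 : (cst 4 : R) = 4 := by rw [cst]; exact map_ofNat (algebraMap ℝ R) 4
      rw [hq]
      simp only [map_add, map_sub, D0m, D1m, D2m, D0c, D1c, D2c, cst_two, dd, t2, t4, dt2, c01, c02, c12] at m q1 q2 qt ⊢
      linear_combination (-2) * (CB.D1 b1 + CB.D2 b2) * m + 2 * CB.D0 b1 * q1 + 2 * CB.D0 b2 * q2 + 2 * CB.D0 c * qt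
    rw [id]
    simp only [Ia, Ic, II1]
    rw [II2]
    · ring
    · exact add_mem (add_mem (Zm (Z0 _ s.z2) _) (Zm' (Zm (Z0 _ s.z1) _) _)) (Zm' (Zm (Z0 _ s.zc) _) _)
  have kd : dd b1 b2 ∈ Kd R := add_mem k1 k2
  have ed : dd b1 b2 ∈ Hb 0 (E R) := add_mem (Hb_D1 e1) (Hb_D2 e2)
  have sqE : ∀ f : R, f ∈ Hb 0 (E R) → Bo |I (f * f)| (E R * E R) := fun f hf => EE_pair hf hf
  have hL : Ly R (fun j => mu R * (I (CB.D1 b1 * CB.D1 b1) j + I (CB.D2 b1 * CB.D2 b1) j + I (CB.D1 b2 * CB.D1 b2) j + I (CB.D2 b2 * CB.D2 b2) j)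
        + kap R * (I (CB.D1 c * CB.D1 c) j + I (CB.D2 c * CB.D2 c) j))
      (I (CB.D0 b1 * CB.D0 b1) + I (CB.D0 b2 * CB.D0 b2) + fun j => cc R * I (CB.D0 c * CB.D0 c) j) := by
    refine Ly_ext q (GB_smul (GB_sq (add_mem ga gc)) (C := 4 * (nu R)⁻¹) (by positivity))
      (KB_add (KB_add (KB_smul (KB_add (KB_sq h1) (KB_sq h2)) (C := 4) (by norm_num))
       (KB_smul (KB_sq hG) (C := 8 * (cc R)⁻¹) (by positivity)))
       (KB_add (KB_smul (KB_sq h0) (C := 2) (by norm_num)) (KB_smul (KB_sq kd) (C := 4 + 32 * (cc R)⁻¹) (by positivity)))) ?_ ?_ ?_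
    · refine Bo_abs_sub (Bo_abs_add (Bo_abs_add (Bo_abs_cst _ ?_) (Bo_abs_cst _ (sqE _ ed))) (Bo_abs_cst _ ?_))
        (Bo_abs_cst _ (EE_pair ed (add_mem ea (Hb_lower ec))))
      · exact Bo_abs_add (Bo_abs_add (Bo_abs_add (sqE _ (Hb_D1 e1)) (sqE _ (Hb_D2 e1))) (sqE _ (Hb_D1 e2))) (sqE _ (Hb_D2 e2))
      · exact Bo_abs_add (sqE _ (Hb_D1 ec)) (sqE _ (Hb_D2 ec))
    · intro j
      have y := yng (dd b1 b2) (a + c) (nu R / 2) (by positivity) j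
      have e : (nu R / 2)⁻¹ = 2 * (nu R)⁻¹ := by field_simp
      rw [e] at y
      simp only [hq, Ia, Is, Ic] at *
      linarith
    · intro j
      rw [key]
      have y1 := yng (CB.D0 b1) F1 (1/2) (by positivity) j
      have y2 := yng (CB.D0 b2) F2 (1/2) (by positivity) j
      have y3 := yng (CB.D0 c) G (cc R / 4) (by positivity) j
      have y4 := yng (-F0) (dd b1 b2) 1 (by positivity) j
      have y5 := yng (CB.D0 c) (-dd b1 b2) (cc R / 8) (by positivity) j
      have t1 : (cc R / 4)⁻¹ = 4 * (cc R)⁻¹ := by field_simp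
      have t2 : (cc R / 8)⁻¹ = 8 * (cc R)⁻¹ := by field_simp
      rw [t1] at y3
      rw [t2] at y5
      simp only [neg_mul_neg, inv_one] at y4 y5
      simp only [Pi.add_apply]
      norm_num at y1 y2
      linarith
  have gg := Ly_G hL (fun j => by
    have := fun f : R => Isq f j
    have h1 := this (CB.D0 b1); have h2 := this (CB.D0 b2); have h5 := this (CB.D0 c)
    simp only [Pi.add_apply]; positivity)
  have kk := Ly_K hL (fun j => by
    have := fun f : R => Isq f j
    have h1 := this (CB.D1 b1); have h2 := this (CB.D2 b1); have h3 := this (CB.D1 b2); have h4 := this (CB.D2 b2)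
    have h5 := this (CB.D1 c); have h6 := this (CB.D2 c)
    positivity)
  refine ⟨⟨?_, ?_, ?_, ?_, ?_, ?_⟩, ?_, ?_, ?_⟩
  any_goals
    refine Gd_of (GB_mono gg ⟨(mu R)⁻¹ + (kap R)⁻¹, by positivity, fun j => ?_⟩)
    have := fun f : R => Isq f j
    have h1 := this (CB.D1 b1); have h2 := this (CB.D2 b1); have h3 := this (CB.D1 b2); have h4 := this (CB.D2 b2)
    have h5 := this (CB.D1 c); have h6 := this (CB.D2 c)
    have h7 : ((mu R)⁻¹ + (kap R)⁻¹) * mu R = 1 + (kap R)⁻¹ * mu R := by field_simp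
    have h8 : ((mu R)⁻¹ + (kap R)⁻¹) * kap R = 1 + (mu R)⁻¹ * kap R := by field_simp; ring
    have h9 : 0 ≤ (kap R)⁻¹ * mu R := by positivity
    have h10 : 0 ≤ (mu R)⁻¹ * kap R := by positivity
    rw [mul_add, ← mul_assoc, ← mul_assoc, h7, h8]
    nlinarith [mul_nonneg h9 h1, mul_nonneg h9 h2, mul_nonneg h9 h3, mul_nonneg h9 h4, mul_nonneg h10 h5, mul_nonneg h10 h6]
  all_goals
    refine Kd_of (KB_mono kk ⟨1 + (cc R)⁻¹, by positivity, fun j => ?_⟩)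
    have := fun f : R => Isq f j
    have h2 := this (CB.D0 b1); have h3 := this (CB.D0 b2); have h4 := mul_nonneg hc.le (this (CB.D0 c))
    simp only [Pi.add_apply]
    have h5 : 0 ≤ (cc R)⁻¹ := by positivity
    have h6 : (cc R)⁻¹ * (cc R * I (CB.D0 c * CB.D0 c) j) = I (CB.D0 c * CB.D0 c) j := by field_simp
    nlinarith [mul_nonneg h5 h2, mul_nonneg h5 h3, mul_nonneg h5 h4]

/-! ### transport -/
def cm1 (g : R) : R := eps * (D1 (u1 R) * D1 g) + eps * (D1 (u2 R) * D2 g)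
def cm2 (g : R) : R := eps * (D2 (u1 R) * D1 g) + eps * (D2 (u2 R) * D2 g)
theorem D1tr (g : R) : D1 (tr g) = tr (D1 g) + cm1 g := by
  simp only [tr, cm1, map_add, Deps1, c12]; ring
theorem D2tr (g : R) : D2 (tr g) = tr (D2 g) + cm2 g := by
  simp only [tr, cm2, map_add, Deps2, c12]; ring
theorem Mk11 : Mk 2 (D1 (u1 R)) := by
  rw [u1, map_add, X1, D1m, e1, zero_mul, zero_add, zero_add]; exact Mk_eps (Me1 _ V1)
theorem Mk12 : Mk 2 (D1 (u2 R)) := by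
  rw [u2, D1m, e1, zero_mul, zero_add]; exact Mk_eps (Me1 _ V2)
theorem Mk21 : Mk 2 (D2 (u1 R)) := by
  rw [u1, map_add, X2, D2m, e2, zero_mul, zero_add]
  refine Mk_add ?_ (Mk_eps (Me2 _ V1))
  have := Mk_eps (n := 2) (g := (1 : R)) Mk_one
  rwa [mul_one] at this
theorem Mk22 : Mk 2 (D2 (u2 R)) := by
  rw [u2, D2m, e2, zero_mul, zero_add]; exact Mk_eps (Me2 _ V2)
theorem cm1_y {k : ℕ} (hk : k ≤ 2) {g : R} (h1 : D1 g ∈ Hb k (Y R)) (h2 : D2 g ∈ Hb k (Y R)) : cm1 g ∈ Hb k (S R * Y R) :=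
  add_mem (Mk11 k hk _ _ h1 Ynn) (Mk12 k hk _ _ h2 Ynn)
theorem cm2_y {k : ℕ} (hk : k ≤ 2) {g : R} (h1 : D1 g ∈ Hb k (Y R)) (h2 : D2 g ∈ Hb k (Y R)) : cm2 g ∈ Hb k (S R * Y R) :=
  add_mem (Mk21 k hk _ _ h1 Ynn) (Mk22 k hk _ _ h2 Ynn)

theorem tr_self {g : R} (hg : g ∈ Hb 0 (Y R)) : KB R |I (g * tr g)| := by
  have h1 : eps * ((D1 (u1 R) + D2 (u2 R)) * g) ∈ Hb 0 (S R * Y R) :=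
    (Mk_add Mk11 Mk22) 0 (by norm_num) _ _ hg Ynn
  refine KB_mono (KB_pair h1 hg) (Bo.of_le fun j => ?_)
  have id : cst 2 * (g * tr g) = D1 (eps * (u1 R * (g * g))) + D2 (eps * (u2 R * (g * g)))
      - eps * ((D1 (u1 R) + D2 (u2 R)) * g) * g := by
    simp only [tr, CB.e1, CB.e2, cst_two, D1m, D2m]; ring
  have e : 2 * I (g * tr g) j = - I (eps * ((D1 (u1 R) + D2 (u2 R)) * g) * g) j := by
    rw [← Ic, id, Is, Ia, II1, II2]
    · ring
    · exact Zm' (Zm (Zm' p2Z _) _) _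
  simp only [Pi.abs_apply]
  have h2 : |I (g * tr g) j| ≤ |2 * I (g * tr g) j| := by
    rw [abs_mul]; have := abs_nonneg (I (g * tr g) j); norm_num; linarith
  rw [e, abs_neg] at h2
  exact h2

/-- transport pairing for derivative words -/
theorem tr_word (P Q O : Derivation ℝ R R) (hP : P = D1 ∨ P = D2) (hQ : Q = D1 ∨ Q = D2) (hO : O = D1 ∨ O = D2) :
    KB R |I (P (Q (O (ph : R))) * P (Q (O (tr (ph : R)))))| := by
  have lo : ∀ (A : Derivation ℝ R R), (A = D1 ∨ A = D2) → ∀ (k : ℕ) (b : J → ℝ) (g : R), g ∈ Hb (k+1) b → A g ∈ Hb k b := by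
    rintro A (rfl | rfl) k b g hg
    exacts [Hb_D1 hg, Hb_D2 hg]
  have cmm : ∀ (A : Derivation ℝ R R), (A = D1 ∨ A = D2) → ∀ g : R, ∃ r : R, A (tr g) = tr (A g) + r ∧
      ∀ k ≤ 2, D1 g ∈ Hb k (Y R) → D2 g ∈ Hb k (Y R) → r ∈ Hb k (S R * Y R) := by
    rintro A (rfl | rfl) g
    · exact ⟨cm1 g, D1tr g, fun k hk h1 h2 => cm1_y hk h1 h2⟩
    · exact ⟨cm2 g, D2tr g, fun k hk h1 h2 => cm2_y hk h1 h2⟩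
  obtain ⟨r1, e1, b1⟩ := cmm O hO ph
  obtain ⟨r2, e2, b2⟩ := cmm Q hQ (O ph)
  obtain ⟨r3, e3, b3⟩ := cmm P hP (Q (O ph))
  have a1 : (O ph : R) ∈ Hb 2 (Y R) := by rcases hO with rfl | rfl; exacts [ph_y.1, ph_y.2.1]
  have a2 : (Q (O ph) : R) ∈ Hb 1 (Y R) := lo Q hQ 1 _ _ a1
  have a3 : (P (Q (O ph)) : R) ∈ Hb 0 (Y R) := lo P hP 0 _ _ a2
  have c1 := b1 2 le_rfl ph_y.1 ph_y.2.1
  have c2 := b2 1 (by norm_num) (Hb_D1 a1) (Hb_D2 a1)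
  have c3 := b3 0 (by norm_num) (Hb_D1 a2) (Hb_D2 a2)
  have e : P (Q (O (tr (ph : R)))) = tr (P (Q (O ph))) + (r3 + P r2 + P (Q r1)) := by
    rw [e1, map_add, e2, map_add, map_add, e3]; ring
  rw [e, mul_add]
  refine KB_abs_add (tr_self a3) (KB_pair' ?_ a3)
  exact add_mem (add_mem c3 (lo P hP 0 _ _ c2)) (lo P hP 0 _ _ (lo Q hQ 1 _ _ c1))

/-! ### words -/
structure Wd (W : R →ₗ[ℝ] R) : Prop where
  w0 : ∀ f, D0 (W f) = W (D0 f)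
  w1 : ∀ f, D1 (W f) = W (D1 f)
  w2 : ∀ f, D2 (W f) = W (D2 f)
variable (R) in
def L1 : R →ₗ[ℝ] R := (D1 : Derivation ℝ R R).toLinearMap
variable (R) in
def L2 : R →ₗ[ℝ] R := (D2 : Derivation ℝ R R).toLinearMap
variable (R) in
def L0 : R →ₗ[ℝ] R := (D0 : Derivation ℝ R R).toLinearMap
theorem L1a (f : R) : L1 R f = D1 f := rfl
theorem L2a (f : R) : L2 R f = D2 f := rfl
theorem L0a (f : R) : L0 R f = D0 f := rfl
theorem Wd_id : Wd (LinearMap.id : R →ₗ[ℝ] R) := ⟨fun f => rfl, fun f => rfl, fun f => rfl⟩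
theorem Wd_1 : Wd (L1 R) := ⟨fun f => c01 f, fun f => rfl, fun f => c12 f⟩
theorem Wd_2 : Wd (L2 R) := ⟨fun f => c02 f, fun f => (c12 f).symm, fun f => rfl⟩
theorem Wd_0 : Wd (L0 R) := ⟨fun f => rfl, fun f => (c01 f).symm, fun f => (c02 f).symm⟩
theorem Wd_comp {W W' : R →ₗ[ℝ] R} (h : Wd W) (h' : Wd W') : Wd (W.comp W') :=
  ⟨fun f => by simp [h.w0, h'.w0], fun f => by simp [h.w1, h'.w1], fun f => by simp [h.w2, h'.w2]⟩
theorem Wc (W : R →ₗ[ℝ] R) (a : ℝ) (f : R) : W (cst a * f) = cst a * W f := by rw [cst_mul, cst_mul, map_smul]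

theorem cst_mem (P : Submodule ℝ R) (a : ℝ) {f : R} (h : f ∈ P) : cst a * f ∈ P := by
  rw [cst_mul]; exact P.smul_mem a h
theorem of_cst (P : Submodule ℝ R) {a : ℝ} (ha : a ≠ 0) {f : R} (h : cst a * f ∈ P) : f ∈ P := by
  have := P.smul_mem a⁻¹ h
  rwa [cst_mul, smul_smul, inv_mul_cancel₀ ha, one_smul] at this

/-- static elliptic relations -/
theorem st1 (P : Submodule ℝ R) (W : R →ₗ[ℝ] R) (hf : W (f1 R) ∈ P) (ht : W (D0 p1) ∈ P)
    (h1 : W (D1 ph) ∈ P) (h2 : W (D1 th) ∈ P) (h3 : W (D1 (D1 p1)) ∈ P) (h4 : W (D1 (D2 p2)) ∈ P) :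
    W (D2 (D2 p1)) ∈ P := by
  refine of_cst P (mu_pos (R := R)).ne' ?_
  have e := eqP1' (R := R)
  have : cst (mu R) * W (D2 (D2 p1)) = W (D0 p1) + W (D1 ph) + W (D1 th) - cst (mu R) * W (D1 (D1 p1))
      - cst (nu R) * (W (D1 (D1 p1)) + W (D1 (D2 p2))) - W (f1 R) := by
    rw [← e]; simp only [dv, map_add, map_sub, Wc]; ring
  rw [this]
  exact sub_mem (sub_mem (sub_mem (add_mem (add_mem ht h1) h2) (cst_mem P _ h3)) (cst_mem P _ (add_mem h3 h4))) hf
theorem st2 (P : Submodule ℝ R) (W : R →ₗ[ℝ] R) (hf : W (f2 R) ∈ P) (ht : W (D0 p2) ∈ P)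
    (h1 : W (D2 ph) ∈ P) (h2 : W (D2 th) ∈ P) (h3 : W (D1 (D1 p2)) ∈ P) (h4 : W (D1 (D2 p1)) ∈ P) :
    W (D2 (D2 p2)) ∈ P := by
  have hp : mu R + nu R ≠ 0 := (add_pos (mu_pos (R := R)) nu_pos).ne'
  refine of_cst P hp ?_
  have e := eqP2' (R := R)
  have : cst (mu R + nu R) * W (D2 (D2 p2)) = W (D0 p2) + W (D2 ph) + W (D2 th) - cst (mu R) * W (D1 (D1 p2))
      - cst (nu R) * W (D1 (D2 p1)) - W (f2 R) := by
    rw [← e]; simp only [dv, map_add, map_sub, Wc, c12, cst_add]; ring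
  rw [this]
  exact sub_mem (sub_mem (sub_mem (add_mem (add_mem ht h1) h2) (cst_mem P _ h3)) (cst_mem P _ h4)) hf
theorem st3 (P : Submodule ℝ R) (W : R →ₗ[ℝ] R) (hf : W (gg R) ∈ P) (ht : W (D0 th) ∈ P)
    (h1 : W (D1 p1) ∈ P) (h2 : W (D2 p2) ∈ P) (h3 : W (D1 (D1 th)) ∈ P) :
    W (D2 (D2 th)) ∈ P := by
  refine of_cst P (kap_pos (R := R)).ne' ?_
  have e := eqT' (R := R)
  have : cst (kap R) * W (D2 (D2 th)) = cst (cc R) * W (D0 th) + (W (D1 p1) + W (D2 p2)) - cst (kap R) * W (D1 (D1 th))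
      - W (gg R) := by
    rw [← e]; simp only [dv, map_add, map_sub, Wc]; ring
  rw [this]
  exact sub_mem (sub_mem (add_mem (cst_mem P _ ht) (add_mem h1 h2)) (cst_mem P _ h3)) hf

/-- damping of normal derivatives of the density -/
theorem damp (W : R →ₗ[ℝ] R) (w : Wd W) (hE : W (D2 ph) ∈ Hb 0 (E R)) (hY : W (D2 ph) ∈ Hb 0 (Y R))
    (hf0 : W (D2 (f0 R)) ∈ Hb 0 (S R * Y R)) (hf2 : W (f2 R) ∈ Hb 0 (S R * Y R))
    (ht : KB R |I (W (D2 ph) * W (D2 (tr (ph : R))))|)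
    (h1 : W (D0 p2) ∈ Kd R) (h2 : W (D2 th) ∈ Kd R) (h3 : W (D1 (D1 p2)) ∈ Kd R) (h4 : W (D1 (D2 p1)) ∈ Kd R) :
    W (D2 ph) ∈ Kd R ∧ W (D2 ph) ∈ Gd R := by
  have hp : 0 < mu R + nu R := add_pos (mu_pos (R := R)) nu_pos
  set χ : R := W (D2 ph) with hχ
  set r : R := W (D0 p2) + W (D2 th) - W (f2 R) - cst (mu R) * (W (D1 (D1 p2)) - W (D1 (D2 p1))) with hr
  have rK : r ∈ Kd R := sub_mem (sub_mem (add_mem h1 h2) (Kd_SY hf2)) (cst_mem _ _ (sub_mem h3 h4))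
  have id : cst (mu R + nu R) * D0 χ + χ + r = cst (mu R + nu R) * W (D2 (f0 R)) - cst (mu R + nu R) * W (D2 (tr (ph : R))) := by
    have m := congrArg (fun f => W (D2 f)) (eqM' (R := R))
    have e := congrArg W (eqP2' (R := R))
    simp only [dv, map_add, map_sub, Wc, c12] at m e
    have h0 : D0 χ = W (D2 (D0 ph)) := by rw [hχ, w.w0, c02]
    rw [h0, hr]
    simp only [hχ, cst_add]
    linear_combination (cst (mu R) + cst (nu R)) * m + e
  have hL : Ly R (I (χ * χ)) (fun j => (mu R + nu R)⁻¹ * I (χ * χ) j) := by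
    refine Ly_ext (χ * χ) GB_zero (KB_add (KB_add (KB_smul (KB_pair hf0 hY) (C := 2) (by norm_num)) (KB_smul ht (C := 2) (by norm_num)))
      (KB_smul (KB_sq rK) (C := 4 * (mu R + nu R)⁻¹) (by positivity))) (EE_pair hE hE) (fun j => by simp) fun j => ?_
    have e : (mu R + nu R) * I (D0 (χ * χ)) j = 2 * (mu R + nu R) * I (W (D2 (f0 R)) * χ) j
       - 2 * (mu R + nu R) * I (χ * W (D2 (tr (ph : R)))) j - 2 * I (χ * χ) j + 2 * I (χ * (-r)) j := by
      have : cst (mu R + nu R) * D0 (χ * χ) = cst (2 * (mu R + nu R)) * (W (D2 (f0 R)) * χ)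
         - cst (2 * (mu R + nu R)) * (χ * W (D2 (tr (ph : R)))) - cst 2 * (χ * χ) + cst 2 * (χ * (-r)) := by
        rw [D0m, ← cst_mul_cst, cst_two]
        linear_combination 2 * χ * id
      have := congrArg (fun f => I f j) this
      simpa only [Ia, Is, Ic] using this
    have y := yng χ (-r) (1/2) (by norm_num) j
    simp only [neg_mul_neg] at y
    norm_num at y
    have e2 : I (D0 (χ * χ)) j = 2 * I (W (D2 (f0 R)) * χ) j - 2 * I (χ * W (D2 (tr (ph : R)))) j
      - 2 * (mu R + nu R)⁻¹ * I (χ * χ) j + 2 * (mu R + nu R)⁻¹ * I (χ * (-r)) j := by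
      field_simp
      field_simp at e
      linarith
    have hi : 0 ≤ (mu R + nu R)⁻¹ := by positivity
    have y' := mul_le_mul_of_nonneg_left y hi
    simp only [Pi.add_apply, Pi.abs_apply]
    have m1 : I (χ * (-r)) j = - I (χ * r) j := by rw [mul_neg, In]
    rw [e2, m1]
    nlinarith [le_abs_self (I (W (D2 (f0 R)) * χ) j), neg_abs_le (I (χ * W (D2 (tr (ph : R)))) j)]
  refine ⟨Kd_of (KB_mono (Ly_K hL (fun j => Isq χ j)) ⟨mu R + nu R, hp.le, fun j => ?_⟩),
    Gd_of (Ly_G hL (fun j => mul_nonneg (by positivity) (Isq χ j)))⟩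
  field_simp; exact le_rfl

/-- horizontal derivatives of the density through the inf-sup estimate -/
theorem isp (W : R →ₗ[ℝ] R) (w : Wd W) (hf1 : W (f1 R) ∈ Kd R) (hf2 : W (f2 R) ∈ Kd R)
    (t1 : W (D0 p1) ∈ Kd R) (t2 : W (D0 p2) ∈ Kd R) (a1 : W (D1 (D1 p1)) ∈ Kd R) (a2 : W (D1 (D1 p2)) ∈ Kd R)
    (b1 : W (D1 (D2 p1)) ∈ Kd R) (b2 : W (D1 (D2 p2)) ∈ Kd R) (hn : W (D2 ph) ∈ Kd R)
    (hθ1 : W (D1 th) ∈ Kd R) (hθ2 : W (D2 th) ∈ Kd R) : W (D1 ph) ∈ Kd R := by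
  obtain ⟨C, hC, h⟩ := infsup (R := R) (J := J)
  have hdv : W (D1 (dv R)) ∈ Kd R := by rw [dv, map_add, map_add]; exact add_mem a1 b2
  set h11 : R := W (f1 R) - W (D0 p1) + cst (mu R) * W (D1 (D1 p1)) + cst (nu R) * W (D1 (dv R)) with e11
  set h12 : R := W (f2 R) - W (D0 p2) + cst (mu R) * W (D1 (D1 p2)) with e12
  set h21 : R := cst (mu R) * W (D1 (D2 p1)) with e21
  set h22 : R := cst (mu R) * W (D1 (D2 p2)) + cst (nu R) * W (D1 (dv R)) with e22
  set Q : R := W (ph + th) with eQ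
  have k11 : h11 ∈ Kd R := add_mem (add_mem (sub_mem hf1 t1) (cst_mem _ _ a1)) (cst_mem _ _ hdv)
  have k12 : h12 ∈ Kd R := add_mem (sub_mem hf2 t2) (cst_mem _ _ a2)
  have k21 : h21 ∈ Kd R := cst_mem _ _ b1
  have k22 : h22 ∈ Kd R := add_mem (cst_mem _ _ b2) (cst_mem _ _ hdv)
  have kQ : D2 Q ∈ Kd R := by rw [eQ, w.w2, map_add, map_add]; exact add_mem hn hθ2
  have main : D1 Q ∈ Kd R := by
    refine KS_mono (KS_add (KS_add (KS_add (KS_add k11 k12) k21) k22) kQ) ⟨C, hC, fun j => ?_⟩ (nm_nonneg _)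
    refine h Q h11 h12 h21 h22 j fun w1 z1 w2 z2 => ?_
    have id : D1 Q * (D1 w1 + D2 w2) = h11 * D1 w1 + h12 * D1 w2 + h21 * D2 w1 + h22 * D2 w2
        + D1 (D1 Q * w1 - h11 * w1 - h12 * w2) + D2 (D1 Q * w2 - h21 * w1 - h22 * w2) := by
      have q1 := congrArg (fun f => W (D1 f)) (eqP1' (R := R))
      have q2 := congrArg (fun f => W (D1 f)) (eqP2' (R := R))
      simp only [eQ, e11, e12, e21, e22, map_add, map_sub, D1m, D2m, D1c, D2c, w.w1, w.w2, Wc, c12, zero_mul, map_zero, zero_add, dv] at q1 q2 ⊢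
      linear_combination (-w1) * q1 - w2 * q2
    rw [id]
    simp only [Ia, II1]
    rw [II2]
    · ring
    · exact sub_mem (sub_mem (Zm' z2 _) (Zm' z1 _)) (Zm' z2 _)
  have e : W (D1 ph) = D1 Q - W (D1 th) := by rw [eQ, w.w1]; simp only [map_add]; ring
  rw [e]; exact sub_mem main hθ1

end Core
end Couette
end

noncomputable section
open MeasureTheory Real Filter Topology
set_option linter.unusedSectionVars false
set_option linter.unusedVariables false
namespace Couette
namespace Core
open CB CF
variable {R J : Type} [CommRing R] [Algebra ℝ R] [CB R J] [CF R J]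


/-! ### zeroth order estimate -/
variable (R) in
def KI : Submodule ℝ R where
  carrier := {f | KB R |I f|}
  add_mem' := fun hf hg => KB_abs_add hf hg
  zero_mem' := by
    show KB R |I (0 : R)|
    rw [map_zero, abs_zero]; exact KB_zero
  smul_mem' := fun a f hf => by
    refine KB_mono hf ⟨|a|, abs_nonneg a, fun j => ?_⟩
    simp only [Pi.abs_apply, map_smul, Pi.smul_apply, smul_eq_mul, abs_mul]; exact le_rfl

theorem epsS {f : R} (h : f ∈ Hb 0 (Y R)) : eps * f ∈ Hb 0 (S R * Y R) :=
  Hb_mono (Bo_mulr Bo_epS Ynn) (Hb_eps h)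
theorem SYY {k : ℕ} {f : R} (h : f ∈ Hb k (S R * Y R)) : f ∈ Hb k (Y R) := Hb_mono (Bo_S1 Ynn) h
theorem KI_e {f g : R} (hf : f ∈ Hb 0 (Y R)) (hg : g ∈ Hb 0 (Y R)) : eps * (f * g) ∈ KI R := by
  rw [← mul_assoc]; exact KB_pair (epsS hf) hg
theorem KI_s {f g : R} (hf : f ∈ Hb 0 (S R * Y R)) (hg : g ∈ Hb 0 (Y R)) : f * g ∈ KI R := KB_pair hf hg

variable (R) in
def tT' : R := 1 + eps * tau R
theorem tT0 : D0 (tT' R) = 0 := by simp only [tT', map_add, D0m, tau0, e0, Derivation.map_one_eq_zero]; ring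
theorem tT1 : D1 (tT' R) = 0 := by simp only [tT', map_add, D1m, tau1, e1, Derivation.map_one_eq_zero]; ring
theorem tT2 : D2 (tT' R) = eps * (eps * ta R) := by simp only [tT', map_add, D2m, tau2, e2, Derivation.map_one_eq_zero]; ring
theorem Wk_tT (k : ℕ) : Wk k (tT' R) := Wk_add (Wk_one k) (Wk_mul (Wk_eps k) (Wk_tau k))
theorem rT : (rt : R) * tT' R = 1 := rtt

variable (R) in
def n0 : R := - (eps * (p1 * D1 ph) + eps * (p2 * D2 ph) + eps * (ph * dv R))
def gn (v z : R) : R := D0 v + eps * (X * D1 v) + eps * (eps * (p1 * D1 v) + eps * (p2 * D2 v)) + z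
def nv (v z g : R) : R := -(rt * (eps * (p1 * D1 v) + eps * (p2 * D2 v)) + eps * (ph * gn v z) + g)
variable (R) in
def n3 : R := cst (cc R) * nv th (eps * (ta R * (eps * p2))) 0 - (eps * (ph * (tT' R * dv R)) + eps * (th * (rt * dv R)) + eps * (th * (eps * (eps * (ph * dv R)))))
  + eps * (cst (2 * mu R) * (D1 p1 * D1 p1 + D2 p2 * D2 p2) + cst (mu R) * ((D1 p2 + D2 p1) * (D1 p2 + D2 p1))
      + cst (lam R) * (dv R * dv R)) + eps * (cst (2 * mu R) * (D1 p2 + D2 p1))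

theorem lm : D0 (ph : R) + eps * X * D1 ph + rt * dv R - p2 * (eps * (eps * (rt * rt * ta R))) = eps * n0 R := by
  have h := eqM (R := R)
  rw [r2] at h
  simp only [n0, dv]
  linear_combination h
theorem lp1 : rt * (D0 (p1 : R) + eps * X * D1 p1 + eps * eps * p2) + D1 (tT' R * ph + rt * th)
   - cst (mu R) * (D1 (D1 p1) + D2 (D2 p1)) - cst (nu R) * D1 (dv R) = eps * nv p1 (eps * (eps * p2)) (eps * (D1 ph * th) + eps * (ph * D1 th)) := by
  have h := eqP1 (R := R)
  simp only [map_add, Deps1, mul_assoc, n0, dv, nv, gn, tT', tau] at h ⊢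
  rw [e1, D1m ph th] at h
  linear_combination h
theorem lp2 : rt * (D0 (p2 : R) + eps * X * D1 p2) + D2 (tT' R * ph + rt * th)
   - cst (mu R) * (D1 (D1 p2) + D2 (D2 p2)) - cst (nu R) * D2 (dv R) = eps * nv p2 0 (eps * (D2 ph * th) + eps * (ph * D2 th)) := by
  have h := eqP2 (R := R)
  simp only [map_add, Deps2, mul_assoc, n0, dv, nv, gn, tT', tau] at h ⊢
  rw [e2, D2m ph th] at h
  linear_combination h
theorem lt : cst (cc R) * (rt * (D0 (th : R) + eps * X * D1 th + p2 * (eps * (eps * ta R)))) + dv R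
   - cst (kap R) * (D1 (D1 th) + D2 (D2 th)) = eps * n3 R := by
  have h := eqT (R := R)
  have h2 : (1 + eps * (kk * (X - 1) + cst (c0 R) * (eps * (X - X * X)))) = tT' R := rfl
  rw [h2, tT2] at h
  simp only [n3, nv, gn, dv]
  linear_combination h - (D1 p1 + D2 p2) * rT (R := R)

theorem mE {f g : R} (hf : f ∈ Hb 3 (E R)) (hg : g ∈ Hb 0 (Y R)) : eps * (f * g) ∈ Hb 0 (S R * Y R) :=
  (Mk_e (n := 0) (by norm_num) hf) 0 le_rfl _ _ hg Ynn
theorem V0y {v : R} (h : V v) : D1 v ∈ Hb 0 (Y R) ∧ D2 v ∈ Hb 0 (Y R) ∧ D0 v ∈ Hb 0 (Y R) ∧ eps * v ∈ Hb 0 (Y R) :=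
  ⟨Hb_le (by norm_num) (V_y h).1, Hb_le (by norm_num) (V_y h).2.1, Hb_le (by norm_num) (V_y h).2.2.1, (V_y h).2.2.2.2⟩
theorem ph0y : D1 (ph : R) ∈ Hb 0 (Y R) ∧ D2 (ph : R) ∈ Hb 0 (Y R) ∧ (eps * ph : R) ∈ Hb 0 (Y R) :=
  ⟨Hb_le (by norm_num) ph_y.1, Hb_le (by norm_num) ph_y.2.1, ph_y.2.2⟩
theorem dv0y : dv R ∈ Hb 0 (Y R) := Hb_le (by norm_num) dv_y

theorem n0_b : n0 R ∈ Hb 0 (S R * Y R) :=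
  neg_mem (add_mem (add_mem (mE (V_e V1).1 ph0y.1) (mE (V_e V2).1 ph0y.2.1)) (mE ph_e dv0y))
theorem gn_b {v z : R} (hv : V v) (hz : z ∈ Hb 0 (Y R)) : gn v z ∈ Hb 0 (Y R) :=
  add_mem (add_mem (add_mem (V0y hv).2.2.1 (Hb_eps' (Hb_wt (Wk_X 0) (V0y hv).1)))
    (Hb_eps' (SYY (add_mem (mE (V_e V1).1 (V0y hv).1) (mE (V_e V2).1 (V0y hv).2.1))))) hz
theorem nv_b {v z g : R} (hv : V v) (hz : z ∈ Hb 0 (Y R)) (hg : g ∈ Hb 0 (S R * Y R)) : nv v z g ∈ Hb 0 (S R * Y R) :=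
  neg_mem (add_mem (add_mem (Hb_wt (Wk_rt 0) (add_mem (mE (V_e V1).1 (V0y hv).1) (mE (V_e V2).1 (V0y hv).2.1)))
    (mE ph_e (gn_b hv hz))) hg)
theorem n1_b : nv (p1 : R) (eps * (eps * p2)) (eps * (D1 ph * th) + eps * (ph * D1 th)) ∈ Hb 0 (S R * Y R) :=
  nv_b V1 (Hb_eps' (V0y V2).2.2.2) (add_mem (by rw [mul_comm (D1 ph)]; exact mE (V_e V3).1 ph0y.1) (mE ph_e (V0y V3).1))
theorem n2_b : nv (p2 : R) 0 (eps * (D2 ph * th) + eps * (ph * D2 th)) ∈ Hb 0 (S R * Y R) :=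
  nv_b V2 (zero_mem _) (add_mem (by rw [mul_comm (D2 ph)]; exact mE (V_e V3).1 ph0y.2.1) (mE ph_e (V0y V3).2.1))
theorem m22 {f g : R} (hf : f ∈ Hb 2 (E R)) (hg : g ∈ Hb 0 (Y R)) : eps * (f * g) ∈ Hb 0 (S R * Y R) :=
  (Mk_e2 hf) 0 (by norm_num) _ _ hg Ynn
theorem n3_b : n3 R ∈ Hb 0 (S R * Y R) := by
  have a1 := Hb_D1 (V_e (V1 (R := R))).1
  have a2 := Hb_D2 (V_e (V2 (R := R))).1
  have a3 : D1 p2 + D2 p1 ∈ Hb 2 (E R) := add_mem (Hb_D1 (V_e (V2 (R := R))).1) (Hb_D2 (V_e (V1 (R := R))).1)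
  have b3 : D1 p2 + D2 p1 ∈ Hb 0 (Y R) := add_mem (V0y V2).1 (V0y V1).2.1
  refine add_mem (add_mem (sub_mem ?_ ?_) ?_) ?_
  · exact Hb_cst _ (nv_b V3 (Hb_eps' (Hb_wt (Wk_ta 0) (V0y V2).2.2.2)) (zero_mem _))
  · exact add_mem (add_mem (mE ph_e (Hb_wt (Wk_tT 0) dv0y)) (mE (V_e V3).1 (Hb_wt (Wk_rt 0) dv0y)))
      (mE (V_e V3).1 (Hb_eps' (SYY (mE ph_e dv0y))))
  · have e : eps * (cst (2 * mu R) * (D1 p1 * D1 p1 + D2 p2 * D2 p2) + cst (mu R) * ((D1 p2 + D2 p1) * (D1 p2 + D2 p1))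
      + cst (lam R) * (dv R * dv R)) = cst (2 * mu R) * (eps * (D1 p1 * D1 p1) + eps * (D2 p2 * D2 p2)) + cst (mu R) * (eps * ((D1 p2 + D2 p1) * (D1 p2 + D2 p1)))
      + cst (lam R) * (eps * (dv R * dv R)) := by ring
    rw [e]
    exact add_mem (add_mem (Hb_cst _ (add_mem (m22 a1 (V0y V1).1) (m22 a2 (V0y V2).2.1))) (Hb_cst _ (m22 a3 b3))) (Hb_cst _ (m22 dv_e dv0y))
  · exact epsS (Hb_cst _ b3)

variable (R) in
def qq : R := tT' R * (ph * ph) + rt * rt * (p1 * p1 + p2 * p2) + cst (cc R) * (rt * rt * rt * (th * th))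
variable (R) in
def dis : R := cst (mu R) * (D1 p1 * D1 p1 + D2 p1 * D2 p1 + D1 p2 * D1 p2 + D2 p2 * D2 p2) + cst (nu R) * (dv R * dv R)
variable (R) in
def ert : R := - (eps * (AA R * dis R)) - cst (kap R) * (eps * (AA R * (1 + rt) * (D1 th * D1 th + D2 th * D2 th)))
  - eps * (AA R * (1 + rt) * ((eps * p1) * (eps * p2)))
  - cst (1 + cc R) * (eps * (AA R * (1 + rt + rt * rt) * (ta R * ((eps * p2) * (eps * th)))))
  + (tT' R * (n0 R * (eps * ph)) + rt * (nv p1 (eps * (eps * p2)) (eps * (D1 ph * th) + eps * (ph * D1 th)) * (eps * p1)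
    + nv p2 0 (eps * (D2 ph * th) + eps * (ph * D2 th)) * (eps * p2)) + rt * rt * (n3 R * (eps * th)))
  + rt * rt * ta R * (cst (mu R) * (eps * ((eps * p1) * D2 p1) + eps * ((eps * p2) * D2 p2)) + cst (nu R) * (eps * ((eps * p2) * dv R)))
  + cst (2 * kap R) * (rt * rt * rt * ta R * (eps * ((eps * th) * D2 th)))
variable (R) in
def Fl1 : R := - cst (1/2) * (eps * X * qq R) - rt * (p1 * (tT' R * ph + rt * th)) + cst (mu R) * (rt * (p1 * D1 p1 + p2 * D1 p2))
  + cst (nu R) * (rt * (p1 * dv R)) + cst (kap R) * (rt * rt * (th * D1 th))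
variable (R) in
def Fl2 : R := - rt * ((tT' R * ph + rt * th) * p2) + cst (mu R) * (rt * (D2 p1 * p1 + D2 p2 * p2))
  + cst (nu R) * (rt * (dv R * p2)) + cst (kap R) * (rt * rt * (D2 th * th))

theorem id0 : D0 (qq R) = cst 2 * (D1 (Fl1 R) + D2 (Fl2 R) - dis R - cst (kap R) * (D1 th * D1 th + D2 th * D2 th)
   - (eps * p1) * (eps * p2) - cst (1 + cc R) * ((ta R * (eps * p2)) * (eps * th)) + ert R) := by
  have m := lm (R := R)
  have q1 := lp1 (R := R)
  have q2 := lp2 (R := R)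
  have qt := lt (R := R)
  have hh : (2 : R) * cst (1/2) = 1 := by
    have := cst_mul_cst (R := R) 2 (1/2); rw [cst_two] at this; rw [this]; norm_num [cst]
  have h2k : (cst (2 * kap R) : R) = 2 * cst (kap R) := by rw [← cst_mul_cst, cst_two]
  have hA : eps * AA R = rt - 1 := by rw [rt1]; ring
  have h1c : (cst (1 + cc R) : R) = 1 + cst (cc R) := by rw [cst_add, cst_one]
  have q1' : D1 (qq R) = 2 * (tT' R * (ph * D1 ph) + rt * rt * (p1 * D1 p1 + p2 * D1 p2) + cst (cc R) * (rt * rt * rt * (th * D1 th))) := by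
    simp only [qq, map_add, D1m, D1c, tT1, r1]; ring
  have f1 : D1 (Fl1 R) = - cst (1/2) * (eps * X * D1 (qq R)) - rt * (D1 p1 * (tT' R * ph + rt * th) + p1 * D1 (tT' R * ph + rt * th)) + cst (mu R) * (rt * (D1 p1 * D1 p1 + D1 p2 * D1 p2 + p1 * D1 (D1 p1) + p2 * D1 (D1 p2)))
     + cst (nu R) * (rt * (D1 p1 * dv R + p1 * D1 (dv R))) + cst (kap R) * (rt * rt * (D1 th * D1 th + th * D1 (D1 th))) := by
    simp only [Fl1, map_add, map_sub, map_neg, D1m, D1c, X1, e1, r1]; ring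
  have f2 : D2 (Fl2 R) = - rt * (D2 p2 * (tT' R * ph + rt * th) + p2 * D2 (tT' R * ph + rt * th)) + cst (mu R) * (rt * (D2 p1 * D2 p1 + D2 p2 * D2 p2 + p1 * D2 (D2 p1) + p2 * D2 (D2 p2)))
     + cst (nu R) * (rt * (D2 p2 * dv R + p2 * D2 (dv R))) + cst (kap R) * (rt * rt * (D2 th * D2 th + th * D2 (D2 th)))
     + D2 rt * (- (tT' R * ph + rt * th) * p2 + cst (mu R) * (p1 * D2 p1 + p2 * D2 p2) + cst (nu R) * (p2 * dv R) + 2 * rt * cst (kap R) * (th * D2 th)) := by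
    simp only [Fl2, map_add, map_sub, map_neg, D2m, D2c]; ring
  have q0' : D0 (qq R) = 2 * (tT' R * (ph * D0 ph) + rt * rt * (p1 * D0 p1 + p2 * D0 p2) + cst (cc R) * (rt * rt * rt * (th * D0 th))) := by
    simp only [qq, map_add, D0m, D0c, tT0, r0]; ring
  rw [q0', f1, f2, q1', r2, cst_two]
  generalize D1 (tT' R * ph + rt * th) = P1 at *
  generalize D2 (tT' R * ph + rt * th) = P2 at *
  generalize D1 (dv R) = V1 at *
  generalize D2 (dv R) = V2 at *
  rw [ert, h1c, h2k]
  generalize nv (p1 : R) (eps * (eps * p2)) (eps * (D1 ph * th) + eps * (ph * D1 th)) = N1 at *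
  generalize nv (p2 : R) 0 (eps * (D2 ph * th) + eps * (ph * D2 th)) = N2 at *
  simp only [dis, dv] at m qt ⊢
  linear_combination 2 * tT' R * ph * m + 2 * rt * p1 * q1 + 2 * rt * p2 * q2 + 2 * rt * rt * th * qt
   + (eps * X * (2 * (tT' R * (ph * D1 ph) + rt * rt * (p1 * D1 p1 + p2 * D1 p2) + cst (cc R) * (rt * rt * rt * (th * D1 th))))) * hh
   + 2 * ((cst (mu R) * (D1 p1 * D1 p1 + D2 p1 * D2 p1 + D1 p2 * D1 p2 + D2 p2 * D2 p2) + cst (nu R) * ((D1 p1 + D2 p2) * (D1 p1 + D2 p2))) + cst (kap R) * (1 + rt) * (D1 th * D1 th + D2 th * D2 th) + (1 + rt) * (eps * p1) * (eps * p2)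
     + (1 + cst (cc R)) * (1 + rt + rt * rt) * ta R * (eps * p2) * (eps * th)) * hA

theorem Fl2Z : Fl2 R ∈ Z (R := R) :=
  add_mem (add_mem (add_mem (Zm' (Zm' p2Z _) _) (Zm' (Zm' (add_mem (Zm' p1Z _) (Zm' p2Z _)) _) _)) (Zm' (Zm' (Zm' p2Z _) _) _))
    (Zm' (Zm' (Zm' thZ _) _) _)

theorem KI_w {w f g : R} (hw : Wk 0 w) (hf : f ∈ Hb 0 (Y R)) (hg : g ∈ Hb 0 (Y R)) : eps * (w * (f * g)) ∈ KI R := by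
  rw [← mul_assoc w]; exact KI_e (Hb_wt hw hf) hg
theorem KI_ws {w f g : R} (hw : Wk 0 w) (hf : f ∈ Hb 0 (S R * Y R)) (hg : g ∈ Hb 0 (Y R)) : w * (f * g) ∈ KI R := by
  rw [← mul_assoc w]; exact KI_s (Hb_wt hw hf) hg

theorem ert_KI : ert R ∈ KI R := by
  have d11 := (V0y (V1 (R := R))).1; have d21 := (V0y (V1 (R := R))).2.1; have ee1 := (V0y (V1 (R := R))).2.2.2
  have d12 := (V0y (V2 (R := R))).1; have d22 := (V0y (V2 (R := R))).2.1; have ee2 := (V0y (V2 (R := R))).2.2.2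
  have d13 := (V0y (V3 (R := R))).1; have d23 := (V0y (V3 (R := R))).2.1; have ee3 := (V0y (V3 (R := R))).2.2.2
  have wA := Wk_AA (R := R) 0; have wr := Wk_rt (R := R) 0; have wt := Wk_ta (R := R) 0; have w1 := Wk_one (R := R) 0
  have wA1 := Wk_mul wA (Wk_add w1 wr)
  have wA2 := Wk_mul wA (Wk_add (Wk_add w1 wr) (Wk_mul wr wr))
  have dvb := dv0y (R := R)
  have id : ert R = - (cst (mu R) * (eps * (AA R * (D1 p1 * D1 p1)) + eps * (AA R * (D2 p1 * D2 p1)) + eps * (AA R * (D1 p2 * D1 p2)) + eps * (AA R * (D2 p2 * D2 p2))) + cst (nu R) * (eps * (AA R * (dv R * dv R))))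
  - cst (kap R) * (eps * (AA R * (1 + rt) * (D1 th * D1 th)) + eps * (AA R * (1 + rt) * (D2 th * D2 th)))
  - eps * (AA R * (1 + rt) * ((eps * p1) * (eps * p2)))
  - cst (1 + cc R) * (eps * (AA R * (1 + rt + rt * rt) * ((ta R * (eps * p2)) * (eps * th))))
  + (tT' R * (n0 R * (eps * ph)) + (rt * (nv p1 (eps * (eps * p2)) (eps * (D1 ph * th) + eps * (ph * D1 th)) * (eps * p1))
    + rt * (nv p2 0 (eps * (D2 ph * th) + eps * (ph * D2 th)) * (eps * p2))) + rt * rt * (n3 R * (eps * th)))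
  + (cst (mu R) * (eps * (rt * rt * ta R * ((eps * p1) * D2 p1)) + eps * (rt * rt * ta R * ((eps * p2) * D2 p2))) + cst (nu R) * (eps * (rt * rt * ta R * ((eps * p2) * dv R))))
  + cst (2 * kap R) * (eps * (rt * rt * rt * ta R * ((eps * th) * D2 th))) := by
    simp only [ert, dis]; ring
  rw [id]
  have wrr := Wk_mul (Wk_mul wr wr) wt
  refine add_mem (add_mem (add_mem (sub_mem (sub_mem (sub_mem (neg_mem ?_) ?_) ?_) ?_) ?_) ?_) ?_
  · exact add_mem (cst_mem _ _ (add_mem (add_mem (add_mem (KI_w wA d11 d11) (KI_w wA d21 d21)) (KI_w wA d12 d12)) (KI_w wA d22 d22))) (cst_mem _ _ (KI_w wA dvb dvb))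
  · exact cst_mem _ _ (add_mem (KI_w wA1 d13 d13) (KI_w wA1 d23 d23))
  · exact KI_w wA1 ee1 ee2
  · exact cst_mem _ _ (KI_w wA2 (Hb_wt wt ee2) ee3)
  · exact add_mem (add_mem (KI_ws (Wk_tT 0) n0_b ph0y.2.2) (add_mem (KI_ws wr n1_b ee1) (KI_ws wr n2_b ee2))) (KI_ws (Wk_mul wr wr) n3_b ee3)
  · exact add_mem (cst_mem _ _ (add_mem (KI_w wrr ee1 d21) (KI_w wrr ee2 d22))) (cst_mem _ _ (KI_w wrr ee2 dvb))
  · exact cst_mem _ _ (KI_w (Wk_mul (Wk_mul (Wk_mul wr wr) wr) wt) ee3 d23)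

theorem ta_b (f : R) (j : J) : nm (ta R * f) j ≤ (KK R + 3 * c0 R) * nm f j := by
  have e : ta R * f = kk * f + (cst (c0 R) * (eps * f) + cst (-(2 * c0 R)) * (eps * (X * f))) := by
    have : (cst (-(2 * c0 R)) : R) = - (2 * cst (c0 R)) := by
      have h := cst_mul_cst (R := R) 2 (c0 R)
      rw [cst_two] at h
      rw [h]; simp [cst]
    rw [this, ta, cst_two]; ring
  have c := c0_nonneg (R := R)
  rw [e]
  refine (nm_add _ _ j).trans ?_
  have h1 := nm_add (cst (c0 R) * (eps * f)) (cst (-(2 * c0 R)) * (eps * (X * f))) j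
  rw [nm_cst, nm_cst, nm_eps, nm_eps, abs_neg, abs_of_nonneg c, abs_of_nonneg (by positivity)] at h1
  have h2 := kb f j
  have h3 := Xb f j
  have h4 := ep_le (R := R) j
  have h5 := ep_pos (R := R) j
  have h6 := nm_nonneg f j
  have h7 := nm_nonneg (X * f) j
  have h8 : ep R j * nm f j ≤ nm f j := by nlinarith
  have h9 : ep R j * nm (X * f) j ≤ nm f j := by nlinarith
  have := mul_le_mul_of_nonneg_left h8 c
  have := mul_le_mul_of_nonneg_left h9 c
  linarith

set_option maxHeartbeats 1600000 in
theorem e00 : ((ph : R) ∈ Gd R ∧ (p1 : R) ∈ Gd R ∧ (p2 : R) ∈ Gd R ∧ (th : R) ∈ Gd R) ∧ (D1 (p1 : R) ∈ Kd R ∧ D2 (p1 : R) ∈ Kd R ∧ D1 (p2 : R) ∈ Kd R ∧ D2 (p2 : R) ∈ Kd R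
      ∧ D1 (th : R) ∈ Kd R ∧ D2 (th : R) ∈ Kd R) := by
  have hc := cc_pos (R := R); have hm := mu_pos (R := R); have hk := kap_pos (R := R)
  set w : R := tau R * (ph * ph) + AA R * (1 + rt) * (p1 * p1 + p2 * p2) + cst (cc R) * (AA R * (1 + rt + rt * rt) * (th * th)) with hw
  have eA : eps * AA R = rt - 1 := by rw [rt1]; ring
  have hq : qq R = (ph * ph + p1 * p1 + p2 * p2 + cst (cc R) * (th * th)) + eps * w := by
    rw [hw, qq, tT']
    linear_combination (-((1 + rt) * (p1 * p1 + p2 * p2)) - cst (cc R) * ((1 + rt + rt * rt) * (th * th))) * eA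
  have ve : ∀ v : R, V v → v ∈ Hb 0 (E R) := fun v h => Hb_le (by norm_num) (V_e h).1
  have pe : (ph : R) ∈ Hb 0 (E R) := Hb_le (by norm_num) ph_e
  have wA := Wk_AA (R := R) 0; have wr := Wk_rt (R := R) 0; have wt := Wk_tau (R := R) 0; have w1 := Wk_one (R := R) 0
  have wA1 := Wk_mul wA (Wk_add w1 wr)
  have wA2 := Wk_mul wA (Wk_add (Wk_add w1 wr) (Wk_mul wr wr))
  have sq : ∀ (u v : R), Wk 0 u → v ∈ Hb 0 (E R) → Bo |I (u * (v * v))| (E R * E R) := fun u v hu hv => by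
    rw [← mul_assoc]; exact EE_pair (Hb_wt hu hv) hv
  have bw : Bo |I w| (E R * E R) := by
    rw [hw, mul_add]
    exact Bo_abs_add (Bo_abs_add (sq _ _ wt pe) (Bo_abs_add (sq _ _ wA1 (ve _ V1)) (sq _ _ wA1 (ve _ V2)))) (Bo_abs_cst _ (sq _ _ wA2 (ve _ V3)))
  have b0 : Bo |I (ph * ph + p1 * p1 + p2 * p2 + cst (cc R) * (th * th) : R)| (E R * E R) :=
    Bo_abs_add (Bo_abs_add (Bo_abs_add (EE_pair pe pe) (EE_pair (ve _ V1) (ve _ V1))) (EE_pair (ve _ V2) (ve _ V2))) (Bo_abs_cst _ (EE_pair (ve _ V3) (ve _ V3)))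
  have bew : Bo |I (eps * w)| (SE R) := by
    obtain ⟨C, hC, h⟩ := bw
    refine ⟨C, hC, fun j => ?_⟩
    have h1 := h j
    have h2 := ep_pos (R := R) j
    have h3 := E_nonneg (R := R) j
    simp only [SE, S, Pi.mul_apply, Pi.add_apply, Pi.abs_apply, Ie, abs_mul, abs_of_pos h2] at h1 ⊢
    have := mul_le_mul_of_nonneg_left h1 h2.le
    have : 0 ≤ C * (E R j * (E R j * E R j)) := by positivity
    nlinarith
  have bE : Bo (SE R) (E R * E R) := Bo_S1 (fun j => mul_nonneg (E_nonneg j) (E_nonneg j))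
  have hL : Ly R (I (ph * ph : R) + I (p1 * p1 : R) + I (p2 * p2 : R) + fun j => cc R * I (th * th : R) j)
    (fun j => (mu R * (I (D1 (p1 : R) * D1 p1) j + I (D2 (p1 : R) * D2 p1) j + I (D1 (p2 : R) * D1 p2) j + I (D2 (p2 : R) * D2 p2) j)
        + kap R * (I (D1 (th : R) * D1 th) j + I (D2 (th : R) * D2 th) j))) := by
    refine Ly_ext (qq R) (GB_mono GB_SE bew) (KB_smul (show KB R |I (ert R)| from ert_KI) (C := 2) (by norm_num)) ?_ ?_ ?_
    · rw [hq]; exact Bo_abs_add b0 (bew.trans bE)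
    · intro j
      rw [hq]
      simp only [Pi.add_apply, Pi.abs_apply, Ia, Ic]
      linarith [neg_abs_le (I (eps * w) j)]
    · intro j
      rw [id0]
      simp only [Ic, Ia, Is, II1, II2 _ Fl2Z, dis]
      have hK : 0 ≤ KK R + 3 * c0 R := by have := KK_nonneg (R := R); have := c0_nonneg (R := R); positivity
      have x1 := pz (p1 : R) p1Z j
      have x2 := pz (p2 : R) p2Z j
      have x3 := pz (th : R) thZ j
      have y1 := cs (eps * p1 : R) (eps * p2) j
      have y2 := cs (ta R * (eps * p2 : R)) (eps * th) j
      have y3 := ta_b (eps * p2 : R) j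
      rw [← nm_sq, ← nm_sq] at x1 x2 x3
      have n1 := nm_nonneg (eps * p1 : R) j
      have n2 := nm_nonneg (eps * p2 : R) j
      have n3 := nm_nonneg (eps * th : R) j
      have z2 : |I (ta R * (eps * p2 : R) * (eps * th)) j| ≤ (KK R + 3 * c0 R) * (nm (eps * p2 : R) j * nm (eps * th : R) j) :=
        y2.trans ((mul_le_mul_of_nonneg_right y3 n3).trans (le_of_eq (by ring)))
      have w1 : -I ((eps * p1 : R) * (eps * p2)) j ≤ (nm (D2 (p1 : R)) j ^ 2 + nm (D2 (p2 : R)) j ^ 2) / 2 := by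
        have := neg_abs_le (I ((eps * p1 : R) * (eps * p2)) j)
        nlinarith [sq_nonneg (nm (eps * p1 : R) j - nm (eps * p2 : R) j)]
      have w2 : -I (ta R * (eps * p2 : R) * (eps * th)) j ≤ (KK R + 3 * c0 R) * ((nm (D2 (p2 : R)) j ^ 2 + nm (D2 (th : R)) j ^ 2) / 2) := by
        have := neg_abs_le (I (ta R * (eps * p2 : R) * (eps * th)) j)
        have h : nm (eps * p2 : R) j * nm (eps * th : R) j ≤ (nm (D2 (p2 : R)) j ^ 2 + nm (D2 (th : R)) j ^ 2) / 2 := by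
          nlinarith [sq_nonneg (nm (eps * p2 : R) j - nm (eps * th : R) j)]
        have := mul_le_mul_of_nonneg_left h hK
        linarith
      have w3 := mul_le_mul_of_nonneg_left w2 (show 0 ≤ 1 + cc R by linarith)
      have mb := mu_big (R := R)
      have kb := kap_big (R := R)
      simp only [← nm_sq, Pi.abs_apply] at w1 w3 ⊢
      set a := nm (D2 (p1 : R)) j ^ 2 with ha
      set b := nm (D2 (p2 : R)) j ^ 2 with hb
      set c := nm (D2 (th : R)) j ^ 2 with hc'
      have a0 : 0 ≤ a := sq_nonneg _
      have b0 : 0 ≤ b := sq_nonneg _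
      have c0' : 0 ≤ c := sq_nonneg _
      set K := (1 + cc R) * (KK R + 3 * c0 R) with hKK
      have K0 : 0 ≤ K := by positivity
      have v1 := mul_le_mul_of_nonneg_right mb a0
      have v2 := mul_le_mul_of_nonneg_right mb b0
      have v3 := mul_le_mul_of_nonneg_right kb c0'
      have u1 := mul_nonneg (nu_pos (R := R)).le (sq_nonneg (nm (dv R) j))
      have u2 := mul_nonneg hm.le (sq_nonneg (nm (D1 (p1 : R)) j))
      have u3 := mul_nonneg hm.le (sq_nonneg (nm (D1 (p2 : R)) j))
      have u4 := mul_nonneg hk.le (sq_nonneg (nm (D1 (th : R)) j))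
      have w3' : (1 + cc R) * -I (ta R * (eps * p2 : R) * (eps * th)) j ≤ K * ((b + c) / 2) := by
        rw [hKK]; exact w3.trans (le_of_eq (by ring))
      have := le_abs_self (I (ert R) j)
      have := mul_nonneg K0 a0
      nlinarith
  have gg := Ly_G hL (fun j => by
    have := fun f : R => Isq f j
    have h1 := this (D1 p1); have h2 := this (D2 p1); have h3 := this (D1 p2); have h4 := this (D2 p2)
    have h5 := this (D1 th); have h6 := this (D2 th)
    positivity)
  have kk := Ly_K hL (fun j => by
    have := fun f : R => Isq f j
    have h1 := this ph; have h2 := this p1; have h3 := this p2; have h4 := this th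
    simp only [Pi.add_apply]
    positivity)
  refine ⟨⟨?_, ?_, ?_, ?_⟩, ?_, ?_, ?_, ?_, ?_, ?_⟩
  any_goals
    refine Gd_of (GB_mono gg ⟨1 + (cc R)⁻¹, by positivity, fun j => ?_⟩)
    have := fun f : R => Isq f j
    have h1 := this ph; have h2 := this p1; have h3 := this p2; have h4 := mul_nonneg hc.le (this th)
    simp only [Pi.add_apply]
    have h5 : 0 ≤ (cc R)⁻¹ := by positivity
    have h6 : (cc R)⁻¹ * (cc R * I (th * th : R) j) = I (th * th : R) j := by field_simp
    nlinarith [mul_nonneg h5 h1, mul_nonneg h5 h2, mul_nonneg h5 h3, mul_nonneg h5 h4]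
  all_goals
    refine Kd_of (KB_mono kk ⟨(mu R)⁻¹ + (kap R)⁻¹, by positivity, fun j => ?_⟩)
    have := fun f : R => Isq f j
    have h1 := this (D1 p1); have h2 := this (D2 p1); have h3 := this (D1 p2); have h4 := this (D2 p2)
    have h5 := this (D1 th); have h6 := this (D2 th)
    have h7 : ((mu R)⁻¹ + (kap R)⁻¹) * mu R = 1 + (kap R)⁻¹ * mu R := by field_simp
    have h8 : ((mu R)⁻¹ + (kap R)⁻¹) * kap R = 1 + (mu R)⁻¹ * kap R := by field_simp; ring
    have h9 : 0 ≤ (kap R)⁻¹ * mu R := by positivity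
    have h10 : 0 ≤ (mu R)⁻¹ * kap R := by positivity
    rw [mul_add, ← mul_assoc, ← mul_assoc, h7, h8]
    nlinarith [mul_nonneg h9 h1, mul_nonneg h9 h2, mul_nonneg h9 h3, mul_nonneg h9 h4, mul_nonneg h10 h5, mul_nonneg h10 h6]

end Core
end Couette
end

noncomputable section
open MeasureTheory Real Filter Topology
set_option linter.unusedSectionVars false
set_option linter.unusedVariables false
namespace Couette
namespace Core
open CB CF
variable {R J : Type} [CommRing R] [Algebra ℝ R] [CB R J] [CF R J]

/-! ### words -/
def w (a b c : ℕ) : R →ₗ[ℝ] R := (L1 R ^ a * L2 R ^ b * L0 R ^ c : Module.End ℝ R)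

theorem cm01 : Commute (L0 R : Module.End ℝ R) (L1 R) := LinearMap.ext fun f => c01 f
theorem cm02 : Commute (L0 R : Module.End ℝ R) (L2 R) := LinearMap.ext fun f => c02 f
theorem cm21 : Commute (L2 R : Module.End ℝ R) (L1 R) := LinearMap.ext fun f => c12 f

theorem w1 (a b c : ℕ) (f : R) : D1 (w a b c f) = w (a+1) b c f := by
  have : (L1 R : Module.End ℝ R) * w a b c = w (a+1) b c := by
    simp only [w, pow_succ']; noncomm_ring
  exact LinearMap.congr_fun this f
theorem w2 (a b c : ℕ) (f : R) : D2 (w a b c f) = w a (b+1) c f := by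
  have : (L2 R : Module.End ℝ R) * w a b c = w a (b+1) c := by
    have h := (cm21 (R := R)).pow_right a
    simp only [w, pow_succ' (L2 R : Module.End ℝ R) b, ← mul_assoc]
    rw [h.eq]
  exact LinearMap.congr_fun this f
theorem w0 (a b c : ℕ) (f : R) : D0 (w a b c f) = w a b (c+1) f := by
  have : (L0 R : Module.End ℝ R) * w a b c = w a b (c+1) := by
    have h := (cm01 (R := R)).pow_right a
    have h' := (cm02 (R := R)).pow_right b
    simp only [w, pow_succ' (L0 R : Module.End ℝ R) c, ← mul_assoc]
    rw [h.eq, mul_assoc (L1 R ^ a : Module.End ℝ R), h'.eq]; simp only [mul_assoc]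
  exact LinearMap.congr_fun this f
theorem w1' (a b c : ℕ) (f : R) : w a b c (D1 f) = w (a+1) b c f := by
  have : w a b c * (L1 R : Module.End ℝ R) = w (a+1) b c := by
    have h1 := (cm01 (R := R)).pow_left c
    have h2 := (cm21 (R := R)).pow_left b
    simp only [w, pow_succ (L1 R : Module.End ℝ R) a]
    rw [mul_assoc, h1.eq, ← mul_assoc, mul_assoc (L1 R ^ a : Module.End ℝ R), h2.eq]; simp only [mul_assoc]
  exact LinearMap.congr_fun this f
theorem w2' (a b c : ℕ) (f : R) : w a b c (D2 f) = w a (b+1) c f := by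
  have : w a b c * (L2 R : Module.End ℝ R) = w a (b+1) c := by
    have h1 := (cm02 (R := R)).pow_left c
    simp only [w, pow_succ (L2 R : Module.End ℝ R) b]
    rw [mul_assoc, h1.eq]; simp only [mul_assoc]
  exact LinearMap.congr_fun this f
theorem w0' (a b c : ℕ) (f : R) : w a b c (D0 f) = w a b (c+1) f := by
  have : w a b c * (L0 R : Module.End ℝ R) = w a b (c+1) := by
    simp only [w, pow_succ (L0 R : Module.End ℝ R) c, mul_assoc]
  exact LinearMap.congr_fun this f
theorem w000 (f : R) : w 0 0 0 f = f := by simp [w]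
theorem w100 (f : R) : w 1 0 0 f = D1 f := by rw [← w1, w000]
theorem w010 (f : R) : w 0 1 0 f = D2 f := by rw [← w2, w000]
theorem w001 (f : R) : w 0 0 1 f = D0 f := by rw [← w0, w000]
theorem Wd_w (a b c : ℕ) : Wd (w (R := R) a b c) :=
  ⟨fun f => by rw [w0, w0'], fun f => by rw [w1, w1'], fun f => by rw [w2, w2']⟩

theorem Hb_w {k : ℕ} {b : J → ℝ} {f : R} (h : f ∈ Hb k b) {a c : ℕ} (hk : a + c ≤ k) : w a c 0 f ∈ Hb 0 b := by
  induction k generalizing f a c with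
  | zero =>
    obtain rfl : a = 0 := by omega
    obtain rfl : c = 0 := by omega
    rwa [w000]
  | succ k ih =>
    rcases a with _ | a
    · rcases c with _ | c
      · rw [w000]; exact (Hb_succ.1 h).1
      · rw [← w2']; exact ih (Hb_D2 h) (by omega)
    · rw [← w1']; exact ih (Hb_D1 h) (by omega)
theorem Hb_w1 {k : ℕ} {b : J → ℝ} {f : R} (h : D0 f ∈ Hb k b) {a c : ℕ} (hk : a + c ≤ k) : w a c 1 f ∈ Hb 0 b := by
  rw [← w0']; exact Hb_w h hk

theorem Sys_w (a c : ℕ) : Sys (w a 0 c (ph : R)) (w a 0 c p1) (w a 0 c p2) (w a 0 c th)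
    (w a 0 c (f0 R - tr (ph : R))) (w a 0 c (f1 R)) (w a 0 c (f2 R)) (w a 0 c (gg R)) := by
  induction a with
  | succ a ih => simp only [← w1]; exact ih.D1
  | zero =>
    induction c with
    | zero => simp only [w000]; exact base
    | succ c ih => simp only [← w0]; exact ih.D0

/-- all parabolic components have their word in `P` -/
def VP (P : Submodule ℝ R) (a b c : ℕ) : Prop := ∀ v : R, V v → w a b c v ∈ P
def PP (P : Submodule ℝ R) (a b c : ℕ) : Prop := w a b c (ph : R) ∈ P
def FP (P : Submodule ℝ R) (a b c : ℕ) : Prop := w a b c (f1 R) ∈ P ∧ w a b c (f2 R) ∈ P ∧ w a b c (gg R) ∈ P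
theorem VPm {P : Submodule ℝ R} {a b c : ℕ} (h1 : w a b c (p1 : R) ∈ P) (h2 : w a b c (p2 : R) ∈ P) (h3 : w a b c (th : R) ∈ P) :
    VP P a b c := by
  rintro v (rfl | rfl | rfl) <;> assumption

theorem st (P : Submodule ℝ R) (a b c : ℕ) (hf : FP P a b c) (ht : VP P a b (c+1)) (q1 : PP P (a+1) b c) (q2 : PP P a (b+1) c)
    (h1 : VP P (a+1) b c) (h2 : VP P a (b+1) c) (h11 : VP P (a+2) b c) (h12 : VP P (a+1) (b+1) c) : VP P a (b+2) c := by
  have r : ∀ f : R, w a b c (D2 (D2 f)) = w a (b+2) c f := fun f => by rw [w2', w2']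
  have r0 : ∀ f : R, w a b c (D0 f) = w a b (c+1) f := fun f => w0' _ _ _ _
  have r1 : ∀ f : R, w a b c (D1 f) = w (a+1) b c f := fun f => w1' _ _ _ _
  have r2 : ∀ f : R, w a b c (D2 f) = w a (b+1) c f := fun f => w2' _ _ _ _
  have r11 : ∀ f : R, w a b c (D1 (D1 f)) = w (a+2) b c f := fun f => by rw [w1', w1']
  have r12 : ∀ f : R, w a b c (D1 (D2 f)) = w (a+1) (b+1) c f := fun f => by rw [w1', w2']
  refine VPm ?_ ?_ ?_
  · have := st1 P (w a b c) hf.1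
    rw [r, r0, r1, r1, r11, r12] at this
    exact this (ht _ V1) q1 (h1 _ V3) (h11 _ V1) (h12 _ V2)
  · have := st2 P (w a b c) hf.2.1
    rw [r, r0, r2, r2, r11, r12] at this
    exact this (ht _ V2) q2 (h2 _ V3) (h11 _ V2) (h12 _ V1)
  · have := st3 P (w a b c) hf.2.2
    rw [r, r0, r1, r2, r11] at this
    exact this (ht _ V3) (h1 _ V1) (h2 _ V2) (h11 _ V3)

theorem ke0 (a c : ℕ) (ka : KB R |I (w a 0 c (ph : R) * w a 0 c (f0 R - tr (ph : R)))|)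
    (kv : ∀ v f : R, V v → f ∈ Yd (S R * Y R) → KB R |I (w a 0 c v * w a 0 c f)|) (ea : PP (Hb 0 (E R) : Submodule ℝ R) a 0 c) (ev : VP (Hb 0 (E R) : Submodule ℝ R) a 0 c) :
    PP (Gd R) a 0 c ∧ VP (Gd R) a 0 c ∧ VP (Kd R) (a+1) 0 c ∧ VP (Kd R) a 1 c := by
  obtain ⟨⟨g0, g1, g2, g3⟩, k1, k2, k3, k4, k5, k6⟩ := (Sys_w (R := R) a c).e0 ka (kv _ _ V1 f1_t) (kv _ _ V2 f2_t) (kv _ _ V3 gg_t) ea (ev _ V1) (ev _ V2) (ev _ V3)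
  rw [w1] at k1 k3 k5
  rw [w2] at k2 k4 k6
  exact ⟨g0, VPm g1 g2 g3, VPm k1 k3 k5, VPm k2 k4 k6⟩

theorem ke1 (a c : ℕ) (h0 : w a 0 c (f0 R - tr (ph : R)) ∈ Kd R) (hf : FP (Kd R) a 0 c)
    (k1 : VP (Kd R) (a+1) 0 c) (k2 : VP (Kd R) a 1 c) (gp : PP (Gd R) a 0 c) (gv : VP (Gd R) a 0 c)
    (ea : PP (Hb 0 (E R) : Submodule ℝ R) a 0 c) (ev : VP (Hb 1 (E R) : Submodule ℝ R) a 0 c) : VP (Gd R) (a+1) 0 c ∧ VP (Gd R) a 1 c ∧ VP (Kd R) a 0 (c+1) := by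
  have := (Sys_w (R := R) a c).e1 h0 hf.1 hf.2.1 hf.2.2 (by rw [w1]; exact k1 _ V1) (by rw [w2]; exact k2 _ V2) gp (gv _ V3) ea
    (ev _ V1) (ev _ V2) (ev _ V3)
  obtain ⟨⟨g1, g2, g3, g4, g5, g6⟩, t1, t2, t3⟩ := this
  rw [w1] at g1 g3 g5
  rw [w2] at g2 g4 g6
  rw [w0] at t1 t2 t3
  exact ⟨VPm g1 g3 g5, VPm g2 g4 g6, VPm t1 t2 t3⟩

theorem kdamp (a b : ℕ) (hab : a + b ≤ 2) (h1 : VP (Kd R) a b 1) (h2 : VP (Kd R) a (b+1) 0) (h3 : VP (Kd R) (a+2) b 0)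
    (h4 : VP (Kd R) (a+1) (b+1) 0) : PP (Kd R) a (b+1) 0 ∧ PP (Gd R) a (b+1) 0 := by
  have r0 : ∀ f : R, w a b 0 (D0 f) = w a b 1 f := fun f => w0' _ _ _ _
  have r2 : ∀ f : R, w a b 0 (D2 f) = w a (b+1) 0 f := fun f => w2' _ _ _ _
  have r11 : ∀ f : R, w a b 0 (D1 (D1 f)) = w (a+2) b 0 f := fun f => by rw [w1', w1']
  have r12 : ∀ f : R, w a b 0 (D1 (D2 f)) = w (a+1) (b+1) 0 f := fun f => by rw [w1', w2']
  have yy : w a (b+1) 0 (ph : R) ∈ Hb 0 (Y R) := by rw [← r2]; exact Hb_w ph_y.2.1 hab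
  have tw : KB R |I (w a (b+1) 0 (ph : R) * w a (b+1) 0 (tr (ph : R)))| := by
    by_cases h : a + b ≤ 1
    · exact KB_pair' (Hb_w trph_y (by omega)) yy
    · have e : (a = 0 ∧ b = 2) ∨ (a = 1 ∧ b = 1) ∨ (a = 2 ∧ b = 0) := by omega
      rcases e with ⟨rfl, rfl⟩ | ⟨rfl, rfl⟩ | ⟨rfl, rfl⟩
      · simp only [Nat.reduceAdd, ← w1, ← w2, w000, zero_add]
        exact tr_word D2 D2 D2 (Or.inr rfl) (Or.inr rfl) (Or.inr rfl)
      · have : ∀ f : R, w 1 2 0 f = D1 (D2 (D2 f)) := fun f => by rw [← w1, ← w2, ← w2, w000]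
        simp only [Nat.reduceAdd, this]
        exact tr_word D1 D2 D2 (Or.inl rfl) (Or.inr rfl) (Or.inr rfl)
      · have : ∀ f : R, w 2 1 0 f = D1 (D1 (D2 f)) := fun f => by rw [← w1, ← w1, ← w2, w000]
        simp only [Nat.reduceAdd, zero_add, this]
        exact tr_word D1 D1 D2 (Or.inl rfl) (Or.inl rfl) (Or.inr rfl)
  have := damp (R := R) (w a b 0) (Wd_w a b 0)
  rw [r0, r11, r12] at this
  simp only [r2] at this
  exact this (by rw [← r2]; exact Hb_w (Hb_D2 ph_e) hab) yy (Hb_w f0_y (by omega)) (Hb_w (mem_Yd.1 f2_t).1 hab) tw (h1 _ V2) (h2 _ V3) (h3 _ V2) (h4 _ V1)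

theorem kisp (a b : ℕ) (hf : FP (Kd R) a b 0) (h1 : VP (Kd R) a b 1) (h11 : VP (Kd R) (a+2) b 0) (h12 : VP (Kd R) (a+1) (b+1) 0)
    (hn : PP (Kd R) a (b+1) 0) (t1 : VP (Kd R) (a+1) b 0) (t2 : VP (Kd R) a (b+1) 0) : PP (Kd R) (a+1) b 0 := by
  have r0 : ∀ f : R, w a b 0 (D0 f) = w a b 1 f := fun f => w0' _ _ _ _
  have r1 : ∀ f : R, w a b 0 (D1 f) = w (a+1) b 0 f := fun f => w1' _ _ _ _
  have r2 : ∀ f : R, w a b 0 (D2 f) = w a (b+1) 0 f := fun f => w2' _ _ _ _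
  have r11 : ∀ f : R, w a b 0 (D1 (D1 f)) = w (a+2) b 0 f := fun f => by rw [w1', w1']
  have r12 : ∀ f : R, w a b 0 (D1 (D2 f)) = w (a+1) (b+1) 0 f := fun f => by rw [w1', w2']
  have := isp (R := R) (w a b 0) (Wd_w a b 0) hf.1 hf.2.1
  simp only [r0, r11, r12] at this
  simp only [r1, r2] at this
  exact this (h1 _ V1) (h1 _ V2) (h11 _ V1) (h11 _ V2) (h12 _ V1) (h12 _ V2) hn (t1 _ V3) (t2 _ V3)

/-- integration by parts in a pairing -/
theorem ibp1 (f g : R) : |I (D1 f * g)| = |I (f * D1 g)| := by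
  have : I (D1 f * g) = - I (f * D1 g) := by
    have h := I1 (f * g)
    rw [D1m, map_add] at h
    exact eq_neg_of_add_eq_zero_left h
  rw [this, abs_neg]

set_option maxHeartbeats 1000000 in
theorem EY : GS R (E R) ∧ KS R (Y R) := by
  -- forcing terms
  have FY : ∀ a b, a + b ≤ 2 → FP (Hb 0 (S R * Y R) : Submodule ℝ R) a b 0 := fun a b h =>
    ⟨Hb_w (mem_Yd.1 f1_t).1 h, Hb_w (mem_Yd.1 f2_t).1 h, Hb_w (mem_Yd.1 gg_t).1 h⟩
  have FK : ∀ a b, a + b ≤ 2 → FP (Kd R) a b 0 := fun a b h =>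
    ⟨Kd_SY (FY a b h).1, Kd_SY (FY a b h).2.1, Kd_SY (FY a b h).2.2⟩
  have FG : ∀ a b, a + b ≤ 1 → FP (Gd R) a b 0 := fun a b h =>
    ⟨Gd_SE (Hb_w f1_e h), Gd_SE (Hb_w f2_e h), Gd_SE (Hb_w gg_e h)⟩
  have F1 : FP (Kd R) 0 0 1 := by
    refine ⟨?_, ?_, ?_⟩ <;> rw [w001]
    exacts [Kd_SY (mem_Yd.1 f1_t).2, Kd_SY (mem_Yd.1 f2_t).2, Kd_SY (mem_Yd.1 gg_t).2]
  have f0t : f0 R - tr (ph : R) ∈ Yd (S R * Y R) := sub_mem f0_t tr_t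
  have F0 : ∀ a b, a + b ≤ 2 → w a b 0 (f0 R - tr (ph : R)) ∈ Hb 0 (S R * Y R) := fun a b h => Hb_w (mem_Yd.1 f0t).1 h
  have phE : ∀ a b, a + b ≤ 3 → PP (Hb 0 (E R) : Submodule ℝ R) a b 0 := fun a b h => Hb_w ph_e h
  have vE : ∀ a b, a + b ≤ 3 → VP (Hb 0 (E R) : Submodule ℝ R) a b 0 := fun a b h v hv => Hb_w (V_e hv).1 h
  have vY1 : ∀ a b, a + b ≤ 3 → VP (Hb 0 (Y R) : Submodule ℝ R) (a+1) b 0 := fun a b h v hv => by rw [← w1']; exact Hb_w (V_y hv).1 h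
  have vY2 : ∀ a b, a + b ≤ 3 → VP (Hb 0 (Y R) : Submodule ℝ R) a (b+1) 0 := fun a b h v hv => by rw [← w2']; exact Hb_w (V_y hv).2.1 h
  have vYt : ∀ a b, a + b ≤ 2 → VP (Hb 0 (Y R) : Submodule ℝ R) a b 1 := fun a b h v hv => Hb_w1 (V_y hv).2.2.1 h
  have phY : ∀ a b, a + b ≤ 2 → PP (Hb 0 (Y R) : Submodule ℝ R) (a+1) b 0 := fun a b h => by rw [PP, ← w1']; exact Hb_w ph_y.1 h
  -- (a)
  obtain ⟨⟨a1, a2, a3, a4⟩, b1, b2, b3, b4, b5, b6⟩ := e00 (R := R)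
  have gp00 : PP (Gd R) 0 0 0 := by rw [PP, w000]; exact a1
  have gv00 : VP (Gd R) 0 0 0 := VPm (by rwa [w000]) (by rwa [w000]) (by rwa [w000])
  have k10 : VP (Kd R) 1 0 0 := VPm (by rwa [w100]) (by rwa [w100]) (by rwa [w100])
  have k01 : VP (Kd R) 0 1 0 := VPm (by rwa [w010]) (by rwa [w010]) (by rwa [w010])
  -- (b)
  obtain ⟨gv10, gv01, kt00⟩ := ke1 (R := R) 0 0 (Kd_SY (F0 0 0 (by norm_num))) (FK 0 0 (by norm_num)) k10 k01 gp00 gv00 (phE 0 0 (by norm_num))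
    (fun v h => by rw [w000]; exact Hb_le (by norm_num) (V_e h).1)
  -- (c)
  obtain ⟨gp10, _, k20, k11⟩ := ke0 (R := R) 1 0 (KB_pair' (F0 1 0 (by norm_num)) (phY 0 0 (by norm_num)))
    (fun v f hv hf => KB_pair' (Hb_w (mem_Yd.1 hf).1 (by norm_num)) (vY1 0 0 (by norm_num) v hv)) (phE 1 0 (by norm_num)) (vE 1 0 (by norm_num))
  -- (d)
  obtain ⟨gv20, gv11, kt10⟩ := ke1 (R := R) 1 0 (Kd_SY (F0 1 0 (by norm_num))) (FK 1 0 (by norm_num)) k20 k11 gp10 gv10 (phE 1 0 (by norm_num))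
    (fun v h => by rw [w100]; exact Hb_lower (Hb_D1 (V_e h).1))
  -- (e)
  obtain ⟨gp20, _, k30, k21⟩ := ke0 (R := R) 2 0 (KB_pair' (F0 2 0 (by norm_num)) (phY 1 0 (by norm_num)))
    (fun v f hv hf => KB_pair' (Hb_w (mem_Yd.1 hf).1 (by norm_num)) (vY1 1 0 (by norm_num) v hv)) (phE 2 0 (by norm_num)) (vE 2 0 (by norm_num))
  -- (f)
  obtain ⟨gv30, gv21, kt20⟩ := ke1 (R := R) 2 0 (Kd_SY (F0 2 0 (by norm_num))) (FK 2 0 (by norm_num)) k30 k21 gp20 gv20 (phE 2 0 (by norm_num))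
    (fun v h => by rw [← w1', w100]; exact (Hb_D1 (Hb_D1 (V_e h).1)))
  -- (g)
  obtain ⟨gp30, _, k40, k31⟩ := ke0 (R := R) 3 0 (by
      rw [map_sub, mul_sub]
      refine KB_abs_sub (KB_pair' (Hb_w f0_y (by norm_num)) (phY 2 0 (by norm_num))) ?_
      have : ∀ f : R, w 3 0 0 f = D1 (D1 (D1 f)) := fun f => by rw [← w1, ← w1, w100]
      rw [this, this]
      exact tr_word D1 D1 D1 (Or.inl rfl) (Or.inl rfl) (Or.inl rfl))
    (fun v f hv hf => by
      rw [← w1 2 0 0 f, ← ibp1, w1]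
      exact KB_pair' (Hb_w (mem_Yd.1 hf).1 (by norm_num)) (vY1 3 0 (by norm_num) v hv)) (phE 3 0 (by norm_num)) (vE 3 0 (by norm_num))
  -- (h)
  obtain ⟨_, gvt00, kt10', kt01⟩ := ke0 (R := R) 0 1 (by
      rw [w001, w001]; exact KB_pair' (mem_Yd.1 f0t).2 (Hb_le (by norm_num) pht_y))
    (fun v f hv hf => by rw [w001 f]; exact KB_pair' (mem_Yd.1 hf).2 (vYt 0 0 (by norm_num) v hv))
    (by rw [PP, w001]; exact Hb_le (by norm_num) pht_e) (fun v hv => by rw [w001]; exact Hb_lower (V_e hv).2)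
  -- (i)
  obtain ⟨gvt10, gvt01, ktt⟩ := ke1 (R := R) 0 1 (by rw [w001]; exact Kd_SY (mem_Yd.1 f0t).2) F1 kt10' kt01
     (by assumption) gvt00 (by rw [PP, w001]; exact Hb_le (by norm_num) pht_e) (fun v hv => by rw [w001]; exact (V_e hv).2)
  -- (j)
  obtain ⟨_, _, kt20', kt11⟩ := ke0 (R := R) 1 1 (by
      rw [← w1 0 0 1 (f0 R - _), ← ibp1, w1, w001]
      exact KB_pair' (mem_Yd.1 f0t).2 (Hb_w1 pht_y (by norm_num)))
    (fun v f hv hf => by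
      rw [← w1 0 0 1 f, ← ibp1, w1, w001]
      exact KB_pair' (mem_Yd.1 hf).2 (vYt 2 0 (by norm_num) v hv))
    (Hb_w1 pht_e (by norm_num)) (fun v hv => Hb_w1 (V_e hv).2 (by norm_num))
  -- density and remaining normal derivatives
  have d01 := kdamp (R := R) 0 0 (by norm_num) kt00 k01 k20 k11
  have q10 := kisp (R := R) 0 0 (FK 0 0 (by norm_num)) kt00 k20 k11 d01.1 k10 k01
  have k02 := st (R := R) _ 0 0 0 (FK 0 0 (by norm_num)) kt00 q10 d01.1 k10 k01 k20 k11
  have ptK : ∀ a b, a + b ≤ 2 → VP (Kd R) (a+1) b 0 → VP (Kd R) a (b+1) 0 → PP (Kd R) a b 1 := fun a b h h1 h2 => by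
    rw [PP, ← w0', pht_eq, map_sub, dv, map_add, w1', w2']
    exact sub_mem (Kd_SY (F0 a b h)) (add_mem (h1 _ V1) (h2 _ V2))
  have k02t := st (R := R) _ 0 0 1 F1 ktt (ptK 1 0 (by norm_num) k20 k11) (ptK 0 1 (by norm_num) k11 k02) kt10 kt01 kt20 kt11
  have d11 := kdamp (R := R) 1 0 (by norm_num) kt10 k11 k30 k21
  have q20 := kisp (R := R) 1 0 (FK 1 0 (by norm_num)) kt10 k30 k21 d11.1 k20 k11
  have k12 := st (R := R) _ 1 0 0 (FK 1 0 (by norm_num)) kt10 q20 d11.1 k20 k11 k30 k21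
  have d02 := kdamp (R := R) 0 1 (by norm_num) kt01 k02 k21 k12
  have k03 := st (R := R) _ 0 1 0 (FK 0 1 (by norm_num)) kt01 d11.1 d02.1 k11 k02 k21 k12
  have d21 := kdamp (R := R) 2 0 (by norm_num) kt20 k21 k40 k31
  have q30 := kisp (R := R) 2 0 (FK 2 0 (by norm_num)) kt20 k40 k31 d21.1 k30 k21
  have k22 := st (R := R) _ 2 0 0 (FK 2 0 (by norm_num)) kt20 q30 d21.1 k30 k21 k40 k31
  have d12 := kdamp (R := R) 1 1 (by norm_num) kt11 k12 k31 k22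
  have k13 := st (R := R) _ 1 1 0 (FK 1 1 (by norm_num)) kt11 d21.1 d12.1 k21 k12 k31 k22
  have d03 := kdamp (R := R) 0 2 (by norm_num) k02t k03 k22 k13
  have k04 := st (R := R) _ 0 2 0 (FK 0 2 (by norm_num)) k02t d12.1 d03.1 k12 k03 k22 k13
  -- energy level
  have gv02 := st (R := R) _ 0 0 0 (FG 0 0 (by norm_num)) gvt00 gp10 d01.2 gv10 gv01 gv20 gv11
  have gv12 := st (R := R) _ 1 0 0 (FG 1 0 (by norm_num)) gvt10 gp20 d11.2 gv20 gv11 gv30 gv21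
  have gv03 := st (R := R) _ 0 1 0 (FG 0 1 (by norm_num)) gvt01 d11.2 d02.2 gv11 gv02 gv21 gv12
  -- collect
  have hsw : ∀ (k : ℕ) (a b c : ℕ) (f : R), hs (k+1) (w a b c f) = nm (w a b c f) + hs k (w (a+1) b c f) + hs k (w a (b+1) c f) :=
    fun k a b c f => by rw [hs, w1, w2]
  have hsw0 : ∀ (a b c : ℕ) (f : R), hs 0 (w a b c f) = nm (w a b c f) := fun a b c f => rfl
  have cG : ∀ v : R, V v → GS R (hs 3 v) ∧ GS R (hs 1 (D0 v)) := fun v hv => by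
    rw [← w001 v]
    nth_rw 1 [← w000 v]
    simp only [hsw, hsw0]
    have h00 := gv00 v hv; have h10 := gv10 v hv; have h01 := gv01 v hv; have h20 := gv20 v hv; have h11 := gv11 v hv
    have h02 := gv02 v hv; have h30 := gv30 v hv; have h21 := gv21 v hv; have h12 := gv12 v hv; have h03 := gv03 v hv
    have t00 := gvt00 v hv; have t10 := gvt10 v hv; have t01 := gvt01 v hv
    constructor <;> repeat' first | assumption | apply GS_add
  have cGp : GS R (hs 3 (ph : R)) := by
    rw [← w000 (ph : R)]
    simp only [hsw, hsw0]
    have e1 := d01.2; have e2 := d11.2; have e3 := d02.2; have e4 := d21.2; have e5 := d12.2; have e6 := d03.2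
    repeat' first | assumption | apply GS_add
  have cK : ∀ v : R, V v → KS R (yV v) := fun v hv => by
    have h10 := k10 v hv; have h01 := k01 v hv; have h20 := k20 v hv; have h11 := k11 v hv
    have h02 := k02 v hv; have h30 := k30 v hv; have h21 := k21 v hv; have h12 := k12 v hv; have h03 := k03 v hv
    have h40 := k40 v hv; have h31 := k31 v hv; have h22 := k22 v hv; have h13 := k13 v hv; have h04 := k04 v hv
    have t00 := kt00 v hv; have t10 := kt10 v hv; have t01 := kt01 v hv
    have t20 := kt20 v hv; have t11 := kt11 v hv; have t02 := k02t v hv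
    have tt := ktt v hv
    have z : KS R (nm (eps * v)) := by
      refine KS_mono (h := nm (w 0 1 0 v)) h01 (Bo.of_le fun j => ?_) (nm_nonneg _)
      rw [w010]
      exact Real.sqrt_le_sqrt (pz v (V_Z hv) j)
    rw [yV, ← w100 v, ← w010 v, ← w001 v, w0]
    simp only [hsw, hsw0]
    repeat' first | assumption | apply KS_add
  have cKp : KS R (hs 2 (D1 (ph : R))) ∧ KS R (hs 2 (D2 (ph : R))) := by
    rw [← w100 (ph : R), ← w010 (ph : R)]
    simp only [hsw, hsw0]
    have e1 := d01.1; have e2 := d11.1; have e3 := d02.1; have e4 := d21.1; have e5 := d12.1; have e6 := d03.1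
    constructor <;> repeat' first | assumption | apply KS_add
  have cKe : KS R (nm (eps * ph : R)) := by
    refine KS_mono (KS_add (h := nm (w 1 0 0 (ph : R))) (h' := nm (w 0 1 0 (ph : R))) q10 d01.1) ?_ (nm_nonneg _)
    rw [w100, w010]; exact pm
  refine ⟨?_, ?_⟩
  · rw [E, eF]
    exact GS_add (GS_add cGp (GS_add (GS_add (cG _ V1).1 (cG _ V2).1) (cG _ V3).1)) (GS_add (GS_add (cG _ V1).2 (cG _ V2).2) (cG _ V3).2)
  · rw [Y, yF]
    exact KS_add (KS_add cKe (KS_add cKp.1 cKp.2)) (KS_add (KS_add (cK _ V1) (cK _ V2)) (cK _ V3))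

/-- the closed Lyapunov inequality -/
theorem lyap : ∃ q : R, ∃ C : ℝ, 0 ≤ C ∧ ∀ j, E R j * E R j ≤ I q j + C * (S R j * (E R j * E R j)) ∧
    |I q j| ≤ C * (E R j * E R j) ∧ I (D0 q) j + Y R j * Y R j ≤ C * (S R j * (Y R j * Y R j)) := by
  have h := Ly_add (EY (R := R)).1.2 (EY (R := R)).2.2
  rw [zero_add, add_zero] at h
  exact h

end Core
end Couette
end

noncomputable section
open MeasureTheory Real Filter Topology
set_option linter.unusedSectionVars false
set_option linter.unusedVariables false
namespace Couette
namespace Con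
open Couette.Core
set_option linter.ambiguousOpen false
set_option linter.deprecated false

/-- Space-time. -/
abbrev V3 : Type := ℝ × (ℝ × ℝ)

def w0 : V3 := (1, (0, 0))
def w1 : V3 := (0, (1, 0))
def w2 : V3 := (0, (0, 1))

/-- directional derivative -/
def pd (v : V3) (f : V3 → ℝ) : V3 → ℝ := fun p => fderiv ℝ f p v

def Per (f : V3 → ℝ) : Prop := ∀ t x y, f (t, (x + 2 * π, y)) = f (t, (x, y))

/-- smooth functions, periodic in the horizontal variable -/
def SP : Subalgebra ℝ (V3 → ℝ) where
  carrier := {f | ContDiff ℝ (⊤ : ℕ∞) f ∧ Per f}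
  mul_mem' := by
    rintro f g ⟨hf, hf'⟩ ⟨hg, hg'⟩
    exact ⟨hf.mul hg, fun t x y => by simp only [Pi.mul_apply, hf' t x y, hg' t x y]⟩
  add_mem' := by
    rintro f g ⟨hf, hf'⟩ ⟨hg, hg'⟩
    exact ⟨hf.add hg, fun t x y => by simp only [Pi.add_apply, hf' t x y, hg' t x y]⟩
  algebraMap_mem' := fun r => ⟨contDiff_const, fun t x y => rfl⟩

theorem pd_cd {f : V3 → ℝ} (hf : ContDiff ℝ (⊤ : ℕ∞) f) (v : V3) : ContDiff ℝ (⊤ : ℕ∞) (pd v f) :=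
  (hf.fderiv_right (m := (⊤ : ℕ∞)) (by exact_mod_cast le_top)).clm_apply contDiff_const

theorem SP_diff {f : V3 → ℝ} (hf : ContDiff ℝ (⊤ : ℕ∞) f) : Differentiable ℝ f :=
  hf.differentiable (by simp)

theorem pd_per {f : V3 → ℝ} (hf : Per f) (v : V3) : Per (pd v f) := by
  intro t x y
  have h : (fun p : V3 => f (p + (0, (2 * π, 0)))) = f := by
    funext p; obtain ⟨t, x, y⟩ := p
    simpa using hf t x y
  have h2 := fderiv_comp_add_right (𝕜 := ℝ) (f := f) (x := ((t, (x, y)) : V3)) (0, (2 * π, 0))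
  rw [h] at h2
  simp only [pd, h2]
  simp

theorem pd_mem {f : V3 → ℝ} (hf : f ∈ SP) (v : V3) : pd v f ∈ SP := ⟨pd_cd hf.1 v, pd_per hf.2 v⟩

theorem pd_comm {f : V3 → ℝ} (hf : ContDiff ℝ (⊤ : ℕ∞) f) (v w : V3) : pd v (pd w f) = pd w (pd v f) := by
  funext p
  have hd : DifferentiableAt ℝ (fderiv ℝ f) p :=
    ((hf.fderiv_right (m := (⊤ : ℕ∞)) (by exact_mod_cast le_top)).differentiable (by simp)) p
  have h2 : (2 : WithTop ℕ∞) ≤ ((⊤ : ℕ∞) : WithTop ℕ∞) := by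
    have : ((2 : ℕ∞) : WithTop ℕ∞) ≤ ((⊤ : ℕ∞) : WithTop ℕ∞) := WithTop.coe_le_coe.2 le_top
    exact this
  have hs : IsSymmSndFDerivAt ℝ f p := (hf.contDiffAt).isSymmSndFDerivAt (by simpa using h2)
  have h := fun a b : V3 => fderiv_clm_apply (𝕜 := ℝ) (c := fderiv ℝ f) (u := fun _ => a) (x := p) hd
    (differentiableAt_const a)
  have h1 : fderiv ℝ (fun q => fderiv ℝ f q w) p v = fderiv ℝ (fderiv ℝ f) p v w := by
    rw [h w w]; simp
  have h2 : fderiv ℝ (fun q => fderiv ℝ f q v) p w = fderiv ℝ (fderiv ℝ f) p w v := by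
    rw [h v v]; simp
  show fderiv ℝ (fun q => fderiv ℝ f q w) p v = fderiv ℝ (fun q => fderiv ℝ f q v) p w
  rw [h1, h2]; exact hs v w

/-- index data of a family -/
structure Fam where
  ι : Type
  e : ι → ℝ
  T : ι → ℝ
  e_pos : ∀ i, 0 < e i
  e_le : ∀ i, e i ≤ 1
  T_pos : ∀ i, 0 < T i

variable (F : Fam)

abbrev AA : Type := F.ι → SP

def dA (c : F.ι → ℝ) (v : V3) : Derivation ℝ (AA F) (AA F) :=
  Derivation.mk'
    { toFun := fun f i => c i • ⟨pd v (f i).1, pd_mem (f i).2 v⟩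
      map_add' := by
        intro f g; funext i; apply Subtype.ext; funext p
        have := fderiv_add (SP_diff (f i).2.1 p) (SP_diff (g i).2.1 p)
        simp only [Pi.add_apply, AddMemClass.coe_add, SetLike.val_smul, Pi.smul_apply, pd, this, smul_eq_mul,
          ContinuousLinearMap.add_apply]
        ring
      map_smul' := by
        intro r f; funext i; apply Subtype.ext; funext p
        have := fderiv_const_smul (𝕜 := ℝ) (SP_diff (f i).2.1 p) r
        simp only [Pi.smul_apply, SetLike.val_smul, pd, smul_eq_mul, RingHom.id_apply, this,
          ContinuousLinearMap.smul_apply]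
        ring }
    (by
      intro f g; funext i; apply Subtype.ext; funext p
      have := fderiv_mul (SP_diff (f i).2.1 p) (SP_diff (g i).2.1 p)
      simp only [LinearMap.coe_mk, AddHom.coe_mk, Pi.mul_apply, MulMemClass.coe_mul, SetLike.val_smul,
        Pi.smul_apply, Pi.add_apply, AddMemClass.coe_add, pd, smul_eq_mul, this,
        ContinuousLinearMap.add_apply, ContinuousLinearMap.smul_apply]
      ring)

theorem dA_apply (c : F.ι → ℝ) (v : V3) (f : AA F) (i : F.ι) (p : V3) :
    (dA F c v f i).1 p = c i * pd v (f i).1 p := rfl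

/-- closed space-time domain -/
def Dom : Set (F.ι × V3) := {q | q.2.1 ∈ Set.Icc 0 (F.T q.1) ∧ q.2.2.2 ∈ Set.Icc (0 : ℝ) 1}

/-- restriction -/
def res : AA F →ₐ[ℝ] (Dom F → ℝ) where
  toFun := fun f q => (f q.1.1).1 q.1.2
  map_one' := rfl
  map_mul' := fun _ _ => rfl
  map_zero' := rfl
  map_add' := fun _ _ => rfl
  commutes' := fun _ => rfl

def RR : Type := (res F).range
instance : CommRing (RR F) := inferInstanceAs (CommRing (res F).range)
instance : Algebra ℝ (RR F) := inferInstanceAs (Algebra ℝ (res F).range)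

def π' : AA F →ₐ[ℝ] RR F := (res F).rangeRestrict
theorem π'_surj : Function.Surjective (π' F) := (res F).rangeRestrict_surjective

variable {F}
theorem π'_eq {f g : AA F} : π' F f = π' F g ↔
    ∀ i t x y, t ∈ Set.Icc 0 (F.T i) → y ∈ Set.Icc (0 : ℝ) 1 → (f i).1 (t, (x, y)) = (g i).1 (t, (x, y)) := by
  constructor
  · intro h i t x y ht hy
    have h1 := congrArg (fun z : RR F => (z : (res F).range).1 ⟨(i, (t, (x, y))), ht, hy⟩) h
    exact h1
  · intro h
    apply Subtype.ext; funext q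
    obtain ⟨⟨i, t, x, y⟩, ht, hy⟩ := q
    exact h i t x y ht hy

theorem pd_zero {f : V3 → ℝ} (hf : ContDiff ℝ (⊤ : ℕ∞) f) {T : ℝ} (hT : 0 < T)
    (h : ∀ t x y, t ∈ Set.Icc 0 T → y ∈ Set.Icc (0 : ℝ) 1 → f (t, (x, y)) = 0) (v : V3) :
    ∀ t x y, t ∈ Set.Icc 0 T → y ∈ Set.Icc (0 : ℝ) 1 → pd v f (t, (x, y)) = 0 := by
  intro t x y ht hy
  have hc : Continuous (pd v f) := (pd_cd hf v).continuous
  let U : Set V3 := Set.Ioo 0 T ×ˢ (Set.univ ×ˢ Set.Ioo 0 1)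
  have hU : IsOpen U := isOpen_Ioo.prod (isOpen_univ.prod isOpen_Ioo)
  have hz : ∀ p ∈ U, pd v f p = 0 := by
    intro p hp
    have : f =ᶠ[𝓝 p] fun _ => 0 := by
      filter_upwards [hU.mem_nhds hp] with q hq
      exact h q.1 q.2.1 q.2.2 ⟨hq.1.1.le, hq.1.2.le⟩ ⟨hq.2.2.1.le, hq.2.2.2.le⟩
    simp [pd, this.fderiv_eq]
  have hcl : closure U ⊆ {p | pd v f p = 0} :=
    closure_minimal hz (isClosed_eq hc continuous_const)
  apply hcl
  simp only [U, closure_prod_eq, closure_Ioo hT.ne, closure_Ioo (zero_ne_one), closure_univ]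
  exact ⟨ht, trivial, hy⟩

theorem dA_ker (c : F.ι → ℝ) (v : V3) (f : AA F) (h : π' F f = 0) : π' F (dA F c v f) = 0 := by
  rw [← map_zero (π' F), π'_eq] at h ⊢
  intro i t x y ht hy
  rw [dA_apply]
  rw [pd_zero (f i).2.1 (F.T_pos i) (fun t x y ht hy => h i t x y ht hy) v t x y ht hy]
  simp

/-- descend a derivation along a surjective algebra map -/
def descD (D : Derivation ℝ (AA F) (AA F)) (hD : ∀ f, π' F f = 0 → π' F (D f) = 0) :
    Derivation ℝ (RR F) (RR F) :=
  have key : ∀ f g, π' F f = π' F g → π' F (D f) = π' F (D g) := by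
    intro f g h
    have := hD (f - g) (by rw [map_sub, h, sub_self])
    rwa [map_sub, map_sub, sub_eq_zero] at this
  have hs : ∀ z, π' F (Function.surjInv (π'_surj F) z) = z := Function.surjInv_eq (π'_surj F)
  Derivation.mk'
    { toFun := fun z => π' F (D (Function.surjInv (π'_surj F) z))
      map_add' := by
        intro z w
        rw [← map_add, ← map_add]
        apply key
        rw [hs, map_add, hs, hs]
      map_smul' := by
        intro r z
        rw [RingHom.id_apply, ← map_smul, ← Derivation.map_smul]
        apply key
        rw [hs, map_smul, hs] }
    (by
      intro z w
      show π' F (D (Function.surjInv (π'_surj F) (z * w))) = z • π' F (D (Function.surjInv (π'_surj F) w))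
        + w • π' F (D (Function.surjInv (π'_surj F) z))
      have e : z • π' F (D (Function.surjInv (π'_surj F) w)) + w • π' F (D (Function.surjInv (π'_surj F) z))
        = π' F (D (Function.surjInv (π'_surj F) z * Function.surjInv (π'_surj F) w)) := by
        rw [Derivation.leibniz, smul_eq_mul, smul_eq_mul, smul_eq_mul, smul_eq_mul, map_add, map_mul, map_mul, hs, hs]
      rw [e]
      apply key
      rw [hs, map_mul, hs, hs])

theorem descD_π (D : Derivation ℝ (AA F) (AA F)) (hD) (f : AA F) :
    descD D hD (π' F f) = π' F (D f) := by
  show π' F (D (Function.surjInv (π'_surj F) (π' F f))) = _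
  have := hD (Function.surjInv (π'_surj F) (π' F f) - f)
    (by rw [map_sub, Function.surjInv_eq (π'_surj F), sub_self])
  rwa [map_sub, map_sub, sub_eq_zero] at this

variable (F) in
def JJ : Type := {q : F.ι × ℝ // q.2 ∈ Set.Icc 0 (F.T q.1)}

theorem Ω_meas : MeasurableSet Ω :=
  (measurableSet_Ioo.preimage measurable_fst).inter (measurableSet_Ioo.preimage measurable_snd)

theorem Ω_sub : Ω ⊆ Set.Icc 0 (2 * π) ×ˢ Set.Icc 0 1 := fun x hx =>
  ⟨⟨hx.1.1.le, hx.1.2.le⟩, ⟨hx.2.1.le, hx.2.2.le⟩⟩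

theorem Ω_int {f : ℝ × ℝ → ℝ} (hf : Continuous f) : IntegrableOn f Ω :=
  (hf.continuousOn.integrableOn_compact (isCompact_Icc.prod isCompact_Icc)).mono_set Ω_sub

theorem slice_cont {f : V3 → ℝ} (hf : ContDiff ℝ (⊤ : ℕ∞) f) (t : ℝ) : Continuous (fun x : ℝ × ℝ => f (t, x)) :=
  hf.continuous.comp (by fun_prop)

/-- integration on the big algebra -/
def IA : AA F →ₗ[ℝ] (JJ F → ℝ) where
  toFun := fun f j => ∫ x in Ω, (f j.1.1).1 (j.1.2, x)
  map_add' := by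
    intro f g; funext j
    exact integral_add (Ω_int (slice_cont (f j.1.1).2.1 _)) (Ω_int (slice_cont (g j.1.1).2.1 _))
  map_smul' := by
    intro r f; funext j
    exact integral_const_mul r _

theorem IA_congr {f g : AA F} (h : π' F f = π' F g) : IA f = IA g := by
  funext j
  apply setIntegral_congr_fun Ω_meas
  intro x hx
  exact (π'_eq.1 h) j.1.1 j.1.2 x.1 x.2 j.2 ⟨hx.2.1.le, hx.2.2.le⟩

variable (F) in
def IR : RR F →ₗ[ℝ] (JJ F → ℝ) where
  toFun := fun z => IA (Function.surjInv (π'_surj F) z)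
  map_add' := by
    intro z w
    rw [← map_add]; apply IA_congr
    simp only [map_add, Function.surjInv_eq (π'_surj F)]
  map_smul' := by
    intro r z
    rw [RingHom.id_apply, ← map_smul]; apply IA_congr
    simp only [map_smul, Function.surjInv_eq (π'_surj F)]

theorem IR_π (f : AA F) (j : JJ F) : IR F (π' F f) j = ∫ x in Ω, (f j.1.1).1 (j.1.2, x) := by
  show IA (Function.surjInv (π'_surj F) (π' F f)) j = IA f j
  rw [IA_congr]; rw [Function.surjInv_eq (π'_surj F)]

variable (F) in
def ZA : Ideal (RR F) where
  carrier := {z | ∃ f : AA F, π' F f = z ∧ ∀ i t x y, t ∈ Set.Icc 0 (F.T i) → (y = 0 ∨ y = 1) →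
    (f i).1 (t, (x, y)) = 0}
  zero_mem' := ⟨0, map_zero _, fun _ _ _ _ _ _ => rfl⟩
  add_mem' := by
    rintro _ _ ⟨f, rfl, hf⟩ ⟨g, rfl, hg⟩
    refine ⟨f + g, map_add _ _ _, fun i t x y ht hy => ?_⟩
    show (f i).1 _ + (g i).1 _ = 0
    rw [hf i t x y ht hy, hg i t x y ht hy, add_zero]
  smul_mem' := by
    rintro c _ ⟨g, rfl, hg⟩
    obtain ⟨f, rfl⟩ := π'_surj F c
    refine ⟨f * g, map_mul _ _ _, fun i t x y ht hy => ?_⟩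
    show (f i).1 _ * (g i).1 _ = 0
    rw [hg i t x y ht hy, mul_zero]

theorem pd_line {f : V3 → ℝ} (hf : ContDiff ℝ (⊤ : ℕ∞) f) (p v : V3) :
    HasDerivAt (fun s : ℝ => f (p + s • v)) (pd v f p) 0 := by
  have h : HasDerivAt (fun s : ℝ => p + s • v) v 0 := by
    simpa using ((hasDerivAt_id (0 : ℝ)).smul_const v).const_add p
  have h1 : HasFDerivAt f (fderiv ℝ f p) (p + (0 : ℝ) • v) := by
    simpa using (SP_diff hf p).hasFDerivAt
  exact h1.comp_hasDerivAt (0 : ℝ) h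

theorem pd_t {f : V3 → ℝ} (hf : ContDiff ℝ (⊤ : ℕ∞) f) (t x y : ℝ) :
    HasDerivAt (fun s : ℝ => f (s, (x, y))) (pd w0 f (t, (x, y))) t := by
  have h : HasDerivAt (fun s : ℝ => ((s, (x, y)) : V3)) w0 t :=
    (hasDerivAt_id t).prodMk (hasDerivAt_const t (x, y))
  exact ((SP_diff hf (t, (x, y))).hasFDerivAt).comp_hasDerivAt t h
theorem pd_x {f : V3 → ℝ} (hf : ContDiff ℝ (⊤ : ℕ∞) f) (t x y : ℝ) :
    HasDerivAt (fun s : ℝ => f (t, (s, y))) (pd w1 f (t, (x, y))) x := by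
  have h : HasDerivAt (fun s : ℝ => ((t, (s, y)) : V3)) w1 x :=
    (hasDerivAt_const x t).prodMk ((hasDerivAt_id x).prodMk (hasDerivAt_const x y))
  exact ((SP_diff hf (t, (x, y))).hasFDerivAt).comp_hasDerivAt x h
theorem pd_y {f : V3 → ℝ} (hf : ContDiff ℝ (⊤ : ℕ∞) f) (t x y : ℝ) :
    HasDerivAt (fun s : ℝ => f (t, (x, s))) (pd w2 f (t, (x, y))) y := by
  have h : HasDerivAt (fun s : ℝ => ((t, (x, s)) : V3)) w2 y :=
    (hasDerivAt_const y t).prodMk ((hasDerivAt_const y x).prodMk (hasDerivAt_id y))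
  exact ((SP_diff hf (t, (x, y))).hasFDerivAt).comp_hasDerivAt y h

theorem deriv_zero_Icc {u : ℝ → ℝ} {T t u' : ℝ} (hT : 0 < T) (h : ∀ s ∈ Set.Icc 0 T, u s = 0)
    (ht : t ∈ Set.Icc 0 T) (hu : HasDerivAt u u' t) : u' = 0 := by
  have hw := hu.hasDerivWithinAt (s := Set.Icc 0 T)
  have h0 : HasDerivWithinAt u 0 (Set.Icc 0 T) t :=
    (hasDerivWithinAt_const t (Set.Icc 0 T) (0 : ℝ)).congr h (h t ht)
  exact (uniqueDiffOn_Icc hT t ht).eq_deriv _ hw h0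

/-- Integral over the cell as an iterated integral. -/
theorem Ω_eq : Ω = Set.Ioo 0 (2 * π) ×ˢ Set.Ioo 0 1 := rfl
theorem int_Ω {f : ℝ × ℝ → ℝ} (hf : Continuous f) :
    ∫ x in Ω, f x = ∫ x in (0 : ℝ)..(2 * π), ∫ y in (0 : ℝ)..1, f (x, y) := by
  have h := Ω_int hf
  rw [Ω_eq] at h ⊢
  rw [Measure.volume_eq_prod, setIntegral_prod f (by rwa [Measure.volume_eq_prod] at h),
    intervalIntegral.integral_of_le (by positivity), integral_Ioc_eq_integral_Ioo]
  congr 1; funext x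
  rw [intervalIntegral.integral_of_le zero_le_one, integral_Ioc_eq_integral_Ioo]
theorem int_Ω' {f : ℝ × ℝ → ℝ} (hf : Continuous f) :
    ∫ x in Ω, f x = ∫ y in (0 : ℝ)..1, ∫ x in (0 : ℝ)..(2 * π), f (x, y) := by
  rw [int_Ω hf]
  apply intervalIntegral_intervalIntegral_swap (F := fun x y => f (x, y))
  exact (hf.continuousOn.integrableOn_compact (isCompact_uIcc.prod isCompact_uIcc)).mono_set
    (Set.prod_mono Set.uIoc_subset_uIcc Set.uIoc_subset_uIcc)

theorem int_x0 {f : V3 → ℝ} (hf : f ∈ SP) (t : ℝ) : ∫ x in Ω, pd w1 f (t, x) = 0 := by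
  rw [int_Ω' (slice_cont (pd_cd hf.1 w1) t)]
  have : ∀ y, ∫ x in (0 : ℝ)..(2 * π), pd w1 f (t, (x, y)) = 0 := by
    intro y
    rw [intervalIntegral.integral_eq_sub_of_hasDerivAt (fun x _ => pd_x hf.1 t x y)]
    · have := hf.2 t 0 y
      rw [zero_add] at this; rw [this, sub_self]
    · exact (((slice_cont (pd_cd hf.1 w1) t)).comp (by fun_prop : Continuous fun x : ℝ => (x, y))).intervalIntegrable _ _
  simp [this]
theorem int_y0 {f : V3 → ℝ} (hf : f ∈ SP) (t : ℝ) (h : ∀ x, f (t, (x, 0)) = 0) (h' : ∀ x, f (t, (x, 1)) = 0) :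
    ∫ x in Ω, pd w2 f (t, x) = 0 := by
  rw [int_Ω (slice_cont (pd_cd hf.1 w2) t)]
  have : ∀ x, ∫ y in (0 : ℝ)..1, pd w2 f (t, (x, y)) = 0 := by
    intro x
    rw [intervalIntegral.integral_eq_sub_of_hasDerivAt (fun y _ => pd_y hf.1 t x y)]
    · rw [h, h', sub_self]
    · exact (((slice_cont (pd_cd hf.1 w2) t)).comp (by fun_prop : Continuous fun y : ℝ => (x, y))).intervalIntegrable _ _
  simp [this]

/-- 1D Poincare: pointwise bound. -/
theorem poin1 {u u' : ℝ → ℝ} (hu : ∀ y, HasDerivAt u (u' y) y) (hc : Continuous u') (h0 : u 0 = 0) :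
    ∫ y in (0 : ℝ)..1, u y * u y ≤ ∫ y in (0 : ℝ)..1, u' y * u' y := by
  have hcu : Continuous u := continuous_iff_continuousAt.2 fun y => (hu y).continuousAt
  have hb : ∀ y ∈ Set.Icc (0 : ℝ) 1, u y * u y ≤ ∫ y in (0 : ℝ)..1, u' y * u' y := by
    intro y hy
    have h1 : ∫ s in (0 : ℝ)..y, u' s = u y := by
      rw [intervalIntegral.integral_eq_sub_of_hasDerivAt (fun s _ => hu s) (hc.intervalIntegrable _ _), h0, sub_zero]
    have h2 : 0 ≤ ∫ s in (0 : ℝ)..y, (u' s - u y) * (u' s - u y) :=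
      intervalIntegral.integral_nonneg hy.1 fun s _ => mul_self_nonneg _
    have h3 : ∫ s in (0 : ℝ)..y, (u' s - u y) * (u' s - u y)
        = (∫ s in (0 : ℝ)..y, u' s * u' s) - 2 * u y * (∫ s in (0 : ℝ)..y, u' s) + y * (u y * u y) := by
      have : ∀ s, (u' s - u y) * (u' s - u y) = u' s * u' s - 2 * u y * u' s + u y * u y := fun s => by ring
      simp only [this]
      rw [intervalIntegral.integral_add, intervalIntegral.integral_sub, intervalIntegral.integral_const_mul]
      · simp; ring
      all_goals exact Continuous.intervalIntegrable (by fun_prop) _ _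
    have h4 : ∫ s in (0 : ℝ)..y, u' s * u' s ≤ ∫ y in (0 : ℝ)..1, u' y * u' y := by
      apply intervalIntegral.integral_mono_interval le_rfl hy.1 hy.2
      · exact Filter.Eventually.of_forall fun s => mul_self_nonneg _
      · exact Continuous.intervalIntegrable (by fun_prop) _ _
    rw [h3, h1] at h2
    have h5 : 0 ≤ (1 - y) * (u y * u y) := mul_nonneg (by linarith [hy.2]) (mul_self_nonneg _)
    nlinarith
  have := intervalIntegral.integral_mono_on (μ := volume) (zero_le_one' ℝ)
    (f := fun y => u y * u y) (g := fun _ => ∫ y in (0 : ℝ)..1, u' y * u' y)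
    (Continuous.intervalIntegrable (by fun_prop) _ _) (by simp) hb
  simpa using this

theorem poin2 {f : V3 → ℝ} (hf : f ∈ SP) (t : ℝ) (h : ∀ x, f (t, (x, 0)) = 0) :
    ∫ x in Ω, f (t, x) * f (t, x) ≤ ∫ x in Ω, pd w2 f (t, x) * pd w2 f (t, x) := by
  have hc := slice_cont hf.1 t
  have hc2 := slice_cont (pd_cd hf.1 w2) t
  have hcc : Continuous fun x : ℝ × ℝ => f (t, x) * f (t, x) := hc.mul hc
  have hcc2 : Continuous fun x : ℝ × ℝ => pd w2 f (t, x) * pd w2 f (t, x) := hc2.mul hc2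
  rw [int_Ω hcc, int_Ω hcc2]
  apply intervalIntegral.integral_mono_on (by positivity)
  · exact (intervalIntegral.continuous_parametric_intervalIntegral_of_continuous' (by exact hcc) _ _).intervalIntegrable _ _
  · exact (intervalIntegral.continuous_parametric_intervalIntegral_of_continuous' (by exact hcc2) _ _).intervalIntegrable _ _
  · intro x hx
    exact poin1 (fun y => pd_y hf.1 t x y) (hc2.comp (by fun_prop : Continuous fun y : ℝ => (x, y))) (h x)

variable (F) in
def cA (c : F.ι → ℝ) : AA F := fun i => algebraMap ℝ SP (c i)
theorem cA_apply (c : F.ι → ℝ) (i : F.ι) (p : V3) : (cA F c i).1 p = c i := rfl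

theorem dA_cA (c : F.ι → ℝ) (v : V3) (d : F.ι → ℝ) : dA F c v (cA F d) = 0 := by
  funext i; apply Subtype.ext; funext p
  rw [dA_apply]
  have : pd v (cA F d i).1 p = 0 := by
    have : (cA F d i).1 = fun _ => d i := rfl
    simp [pd, this]
  rw [this, mul_zero]; rfl

theorem dA_comm (c d : F.ι → ℝ) (v w : V3) (f : AA F) : dA F c v (dA F d w f) = dA F d w (dA F c v f) := by
  funext i; apply Subtype.ext; funext p
  have hh : ∀ (c d : ℝ) (v w : V3), pd v (fun q => d * pd w (f i).1 q) p = d * pd v (pd w (f i).1) p := by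
    intro c d v w
    have := fderiv_const_mul (𝕜 := ℝ) (SP_diff (pd_cd (f i).2.1 w) p) d
    simp only [pd] at this ⊢
    rw [this]; rfl
  have h1 : (dA F d w f i).1 = fun q => d i * pd w (f i).1 q := rfl
  have h2 : (dA F c v f i).1 = fun q => c i * pd v (f i).1 q := rfl
  rw [dA_apply, dA_apply, h1, h2, hh (c i), hh (c i), pd_comm (f i).2.1 v w]; ring

theorem vol_Ω : ∫ x in Ω, (1 : ℝ) = 2 * π := by
  rw [int_Ω continuous_const]; simp

instance instCB : CB (RR F) (JJ F) where
  D0 := descD (dA F (fun i => F.e i ^ 2) w0) (dA_ker _ _)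
  D1 := descD (dA F (fun i => F.e i) w1) (dA_ker _ _)
  D2 := descD (dA F (fun i => F.e i) w2) (dA_ker _ _)
  c01 := by intro f; obtain ⟨f, rfl⟩ := π'_surj F f; simp only [descD_π]; rw [dA_comm]
  c02 := by intro f; obtain ⟨f, rfl⟩ := π'_surj F f; simp only [descD_π]; rw [dA_comm]
  c12 := by intro f; obtain ⟨f, rfl⟩ := π'_surj F f; simp only [descD_π]; rw [dA_comm]
  I := IR F
  I_sq := by
    intro f j; obtain ⟨f, rfl⟩ := π'_surj F f
    rw [← map_mul, IR_π]
    exact integral_nonneg fun x => mul_self_nonneg ((f j.1.1).1 (j.1.2, x))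
  Z := ZA F
  Z0 := by
    rintro _ ⟨f, rfl, hf⟩
    rw [descD_π]
    refine ⟨_, rfl, fun i t x y ht hy => ?_⟩
    rw [dA_apply, deriv_zero_Icc (F.T_pos i) (fun s hs => hf i s x y hs hy) ht (pd_t (f i).2.1 t x y), mul_zero]
  Z1 := by
    rintro _ ⟨f, rfl, hf⟩
    rw [descD_π]
    refine ⟨_, rfl, fun i t x y ht hy => ?_⟩
    have h := pd_x (f i).2.1 t x y
    have h0 : (fun s : ℝ => (f i).1 (t, (s, y))) = fun _ => 0 := by funext s; exact hf i t s y ht hy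
    rw [h0] at h
    rw [dA_apply, h.unique (hasDerivAt_const x 0), mul_zero]
  I1 := by
    intro f; obtain ⟨f, rfl⟩ := π'_surj F f
    funext j
    rw [descD_π, IR_π]
    simp only [dA_apply]
    rw [integral_const_mul, int_x0 (f j.1.1).2]; simp
  I2 := by
    rintro _ ⟨f, rfl, hf⟩
    funext j
    rw [descD_π, IR_π]
    simp only [dA_apply]
    rw [integral_const_mul, int_y0 (f j.1.1).2 _ (fun x => hf _ _ _ _ j.2 (Or.inl rfl))
      (fun x => hf _ _ _ _ j.2 (Or.inr rfl))]; simp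
  ep := fun j => F.e j.1.1
  ep_pos := fun j => F.e_pos _
  ep_le := fun j => F.e_le _
  eps := π' F (cA F F.e)
  I_eps := by
    intro f; obtain ⟨f, rfl⟩ := π'_surj F f
    funext j
    rw [← map_mul, Pi.mul_apply, IR_π, IR_π]
    exact integral_const_mul _ _
  e0 := by rw [descD_π, dA_cA, map_zero]
  e1 := by rw [descD_π, dA_cA, map_zero]
  e2 := by rw [descD_π, dA_cA, map_zero]
  pz := by
    rintro _ ⟨f, rfl, hf⟩ j
    rw [descD_π, ← map_mul, ← map_mul, ← map_mul, IR_π, IR_π]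
    have h := poin2 (f j.1.1).2 j.1.2 (fun x => hf _ _ _ _ j.2 (Or.inl rfl))
    have h1 : ∀ x, ((cA F F.e * f * (cA F F.e * f)) j.1.1).1 (j.1.2, x)
      = F.e j.1.1 ^ 2 * ((f j.1.1).1 (j.1.2, x) * (f j.1.1).1 (j.1.2, x)) := by
      intro x
      show F.e j.1.1 * (f j.1.1).1 (j.1.2, x) * (F.e j.1.1 * (f j.1.1).1 (j.1.2, x)) = _
      ring
    have h2 : ∀ x, ((dA F (fun i => F.e i) w2 f * dA F (fun i => F.e i) w2 f) j.1.1).1 (j.1.2, x)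
      = F.e j.1.1 ^ 2 * (pd w2 (f j.1.1).1 (j.1.2, x) * pd w2 (f j.1.1).1 (j.1.2, x)) := by
      intro x
      show F.e j.1.1 * pd w2 (f j.1.1).1 (j.1.2, x) * (F.e j.1.1 * pd w2 (f j.1.1).1 (j.1.2, x)) = _
      ring
    simp only [h1, h2]
    rw [integral_const_mul, integral_const_mul]
    exact mul_le_mul_of_nonneg_left h (by positivity)
  I_one := by
    refine ⟨2 * π, by positivity, fun j => ?_⟩
    rw [mul_one, ← map_one (π' F), IR_π]
    have : ∫ x in Ω, ((1 : AA F) j.1.1).1 (j.1.2, x) = 2 * π := vol_Ω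
    rw [this]; simp

open CB
theorem D0_π (f : AA F) : D0 (π' F f) = π' F (dA F (fun i => F.e i ^ 2) w0 f) := descD_π _ _ _
theorem D1_π (f : AA F) : D1 (π' F f) = π' F (dA F (fun i => F.e i) w1 f) := descD_π _ _ _
theorem D2_π (f : AA F) : D2 (π' F f) = π' F (dA F (fun i => F.e i) w2 f) := descD_π _ _ _
theorem I_π (f : AA F) (j : JJ F) : I (π' F f) j = ∫ x in Ω, (f j.1.1).1 (j.1.2, x) := IR_π _ _
theorem Z_π (f : AA F) (h : ∀ i t x y, t ∈ Set.Icc 0 (F.T i) → (y = 0 ∨ y = 1) →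
    (f i).1 (t, (x, y)) = 0) : π' F f ∈ Z (R := RR F) := ⟨f, rfl, h⟩
theorem ep_π (j : JJ F) : ep (RR F) j = F.e j.1.1 := rfl
theorem eps_π : (eps : RR F) = π' F (cA F F.e) := rfl

end Con
end Couette
end

noncomputable section
open MeasureTheory Real Filter Topology
set_option linter.unusedSectionVars false
set_option linter.unusedVariables false
set_option linter.ambiguousOpen false
set_option linter.deprecated false
namespace Couette
namespace Con
open Couette.Core CB
variable {F : Fam}

theorem osc {w w' g : ℝ → ℝ} (hw : ∀ y, HasDerivAt w (w' y) y) (hc : Continuous w') (hg : Continuous g)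
    (h : ∀ y, |w' y| ≤ g y) {L s y : ℝ} (hs : s ∈ Set.Icc 0 L) (hy : y ∈ Set.Icc 0 L) :
    w y - w s ≤ ∫ r in (0 : ℝ)..L, g r := by
  have hi := intervalIntegral.integral_eq_sub_of_hasDerivAt (a := s) (b := y) (fun r _ => hw r)
    (hc.intervalIntegrable _ _)
  have hL : 0 ≤ L := hs.1.trans hs.2
  have hg0 : ∀ r, 0 ≤ g r := fun r => (abs_nonneg _).trans (h r)
  rw [← hi]
  calc _ ≤ |∫ r in s..y, w' r| := le_abs_self _
    _ ≤ |∫ r in s..y, g r| := by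
      have := intervalIntegral.norm_integral_le_abs_of_norm_le (μ := volume) (a := s) (b := y) (f := w') (g := g)
        (Eventually.of_forall h) (hg.intervalIntegrable _ _)
      exact this
    _ ≤ |∫ r in (0 : ℝ)..L, g r| := by
      apply intervalIntegral.abs_integral_mono_interval
      · rw [Set.uIoc_of_le hL]
        intro r hr
        rw [Set.mem_uIoc] at hr
        rcases hr with hr | hr
        · exact ⟨lt_of_le_of_lt hs.1 hr.1, hr.2.trans hy.2⟩
        · exact ⟨lt_of_le_of_lt hy.1 hr.1, hr.2.trans hs.2⟩
      · exact Eventually.of_forall hg0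
      · exact hg.intervalIntegrable _ _
    _ = _ := abs_of_nonneg (intervalIntegral.integral_nonneg hL fun r _ => hg0 r)

theorem sup1 {u u' : ℝ → ℝ} (hu : ∀ y, HasDerivAt u (u' y) y) (hc : Continuous u') {L : ℝ} (hL : 1 ≤ L)
    {e : ℝ} (he : 0 < e) (he1 : e ≤ 1) {y : ℝ} (hy : y ∈ Set.Icc 0 L) :
    e * (u y * u y) ≤ ∫ s in (0 : ℝ)..L, (2 * (u s * u s) + (e * u' s) * (e * u' s)) := by
  have hcu : Continuous u := continuous_iff_continuousAt.2 fun y => (hu y).continuousAt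
  have hL0 : 0 ≤ L := by linarith
  have hB : ∀ s ∈ Set.Icc 0 L, e * (u y * u y) ≤ u s * u s +
      ∫ s in (0 : ℝ)..L, ((u s * u s) + (e * u' s) * (e * u' s)) := by
    intro s hs
    have hd : ∀ r, HasDerivAt (fun r => e * (u r * u r)) (e * (u' r * u r + u r * u' r)) r :=
      fun r => ((hu r).mul (hu r)).const_mul e
    have h1 := osc (g := fun s => (u s * u s) + (e * u' s) * (e * u' s)) hd (by fun_prop) (by fun_prop)
      (fun r => by
        rw [abs_le]; constructor
        · nlinarith [mul_self_nonneg (u r + e * u' r)]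
        · nlinarith [mul_self_nonneg (u r - e * u' r)]) hs hy
    have h2 : e * (u s * u s) ≤ 1 * (u s * u s) := mul_le_mul_of_nonneg_right he1 (mul_self_nonneg _)
    linarith
  set B := ∫ s in (0 : ℝ)..L, ((u s * u s) + (e * u' s) * (e * u' s)) with hBd
  have h3 := intervalIntegral.integral_mono_on (μ := volume) hL0
    (f := fun _ => e * (u y * u y)) (g := fun s => u s * u s + B) (by simp)
    (Continuous.intervalIntegrable (by fun_prop) _ _) hB
  have h4 : ∫ s in (0 : ℝ)..L, (u s * u s + B) = (∫ s in (0 : ℝ)..L, u s * u s) + L * B := by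
    rw [intervalIntegral.integral_add (Continuous.intervalIntegrable (by fun_prop) _ _) (by simp)]
    simp
  have h5 : ∫ s in (0 : ℝ)..L, (2 * (u s * u s) + (e * u' s) * (e * u' s))
      = (∫ s in (0 : ℝ)..L, u s * u s) + B := by
    rw [hBd, ← intervalIntegral.integral_add (Continuous.intervalIntegrable (by fun_prop) _ _)
      (Continuous.intervalIntegrable (by fun_prop) _ _)]
    congr 1; funext s; ring
  rw [h4, intervalIntegral.integral_const, smul_eq_mul, sub_zero] at h3
  rw [h5]
  have h6 : 0 ≤ ∫ s in (0 : ℝ)..L, u s * u s :=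
    intervalIntegral.integral_nonneg hL0 fun s _ => mul_self_nonneg _
  have h7 : L * (e * (u y * u y)) ≤ L * ((∫ s in (0 : ℝ)..L, u s * u s) + B) := by nlinarith
  exact le_of_mul_le_mul_left h7 (by linarith)

theorem two_pi_one : (1 : ℝ) ≤ 2 * π := by linarith [Real.two_le_pi]

theorem supY {f : V3 → ℝ} (hf : ContDiff ℝ (⊤ : ℕ∞) f) {e : ℝ} (he : 0 < e) (he1 : e ≤ 1) (t x : ℝ) {y : ℝ}
    (hy : y ∈ Set.Icc (0 : ℝ) 1) : e * (f (t, (x, y)) * f (t, (x, y))) ≤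
    ∫ s in (0 : ℝ)..1, (2 * (f (t, (x, s)) * f (t, (x, s)))
      + (e * pd w2 f (t, (x, s))) * (e * pd w2 f (t, (x, s)))) :=
  sup1 (fun y => pd_y hf t x y) ((slice_cont (pd_cd hf w2) t).comp (by fun_prop : Continuous fun y : ℝ => (x, y)))
    le_rfl he he1 hy
theorem supX {f : V3 → ℝ} (hf : ContDiff ℝ (⊤ : ℕ∞) f) {e : ℝ} (he : 0 < e) (he1 : e ≤ 1) (t y : ℝ) {x : ℝ}
    (hx : x ∈ Set.Icc (0 : ℝ) (2 * π)) : e * (f (t, (x, y)) * f (t, (x, y))) ≤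
    ∫ s in (0 : ℝ)..(2 * π), (2 * (f (t, (s, y)) * f (t, (s, y)))
      + (e * pd w1 f (t, (s, y))) * (e * pd w1 f (t, (s, y)))) :=
  sup1 (fun x => pd_x hf t x y) ((slice_cont (pd_cd hf w1) t).comp (by fun_prop : Continuous fun x : ℝ => (x, y)))
    two_pi_one he he1 hx

theorem par_x {h : ℝ × ℝ → ℝ} (hh : Continuous h) : Continuous fun x => ∫ y in (0 : ℝ)..1, h (x, y) :=
  intervalIntegral.continuous_parametric_intervalIntegral_of_continuous' (by exact hh) _ _
theorem par_y {h : ℝ × ℝ → ℝ} (hh : Continuous h) : Continuous fun y => ∫ x in (0 : ℝ)..(2 * π), h (x, y) :=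
  intervalIntegral.continuous_parametric_intervalIntegral_of_continuous'
    (f := fun y x => h (x, y)) (by exact hh.comp continuous_swap) _ _

/-- squared L2 norm on a slice -/
def q2 (f : V3 → ℝ) (t : ℝ) : ℝ := ∫ x in Ω, f (t, x) * f (t, x)
theorem q2_nonneg (f : V3 → ℝ) (t : ℝ) : 0 ≤ q2 f t := integral_nonneg fun x => mul_self_nonneg _

theorem sob1_slice {f g : V3 → ℝ} (hf : ContDiff ℝ (⊤ : ℕ∞) f) (hg : ContDiff ℝ (⊤ : ℕ∞) g)
    {e : ℝ} (he : 0 < e) (he1 : e ≤ 1) (t : ℝ) :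
    e ^ 2 * q2 (fun p => f p * g p) t ≤
      (2 * q2 f t + q2 (fun p => e * pd w2 f p) t) * (2 * q2 g t + q2 (fun p => e * pd w1 g p) t) := by
  have cf := slice_cont hf t
  have cg := slice_cont hg t
  have cf2 := slice_cont (pd_cd hf w2) t
  have cg1 := slice_cont (pd_cd hg w1) t
  have c1 : Continuous fun x : ℝ × ℝ => 2 * (f (t, x) * f (t, x)) + (e * pd w2 f (t, x)) * (e * pd w2 f (t, x)) := by
    fun_prop
  have c2 : Continuous fun x : ℝ × ℝ => 2 * (g (t, x) * g (t, x)) + (e * pd w1 g (t, x)) * (e * pd w1 g (t, x)) := by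
    fun_prop
  have e1 : 2 * q2 f t + q2 (fun p => e * pd w2 f p) t =
      ∫ x in Ω, (2 * (f (t, x) * f (t, x)) + (e * pd w2 f (t, x)) * (e * pd w2 f (t, x))) := by
    rw [integral_add (Ω_int (by fun_prop)) (Ω_int (by fun_prop)), integral_const_mul]; rfl
  have e2 : 2 * q2 g t + q2 (fun p => e * pd w1 g p) t =
      ∫ x in Ω, (2 * (g (t, x) * g (t, x)) + (e * pd w1 g (t, x)) * (e * pd w1 g (t, x))) := by
    rw [integral_add (Ω_int (by fun_prop)) (Ω_int (by fun_prop)), integral_const_mul]; rfl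
  rw [e1, e2, int_Ω c1, int_Ω' c2, q2, ← integral_const_mul]
  have cm := par_x c1
  have cn := par_y c2
  set m := fun x => ∫ y in (0 : ℝ)..1, (2 * (f (t, (x, y)) * f (t, (x, y)))
    + (e * pd w2 f (t, (x, y))) * (e * pd w2 f (t, (x, y)))) with hm
  set n := fun y => ∫ x in (0 : ℝ)..(2 * π), (2 * (g (t, (x, y)) * g (t, (x, y)))
    + (e * pd w1 g (t, (x, y))) * (e * pd w1 g (t, (x, y)))) with hn
  have e3 : (∫ x in (0 : ℝ)..(2 * π), m x) * (∫ y in (0 : ℝ)..1, n y) = ∫ x in Ω, m x.1 * n x.2 := by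
    rw [int_Ω (by fun_prop)]
    simp only [intervalIntegral.integral_const_mul, intervalIntegral.integral_mul_const]
  have e4 : (∫ x in (0 : ℝ)..(2 * π), m x) * (∫ y in (0 : ℝ)..1, n y) =
      (∫ x in (0 : ℝ)..(2 * π), ∫ y in (0 : ℝ)..1, (2 * (f (t, (x, y)) * f (t, (x, y)))
    + (e * pd w2 f (t, (x, y))) * (e * pd w2 f (t, (x, y))))) * (∫ y in (0 : ℝ)..1, n y) := rfl
  rw [← e4, e3]
  apply setIntegral_mono_on (Ω_int (by fun_prop)) (Ω_int (by fun_prop)) Ω_meas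
  intro x hx
  have h1 := supY hf he he1 t x.1 (y := x.2) ⟨hx.2.1.le, hx.2.2.le⟩
  have h2 := supX hg he he1 t x.2 (x := x.1) ⟨hx.1.1.le, hx.1.2.le⟩
  calc _ = (e * (f (t, (x.1, x.2)) * f (t, (x.1, x.2)))) * (e * (g (t, (x.1, x.2)) * g (t, (x.1, x.2)))) := by ring
    _ ≤ _ := by
      apply mul_le_mul h1 h2 (mul_nonneg he.le (mul_self_nonneg _))
      exact (mul_nonneg he.le (mul_self_nonneg _)).trans h1

theorem sob0_slice {f g : V3 → ℝ} (hf : ContDiff ℝ (⊤ : ℕ∞) f) (hg : ContDiff ℝ (⊤ : ℕ∞) g)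
    {e : ℝ} (he : 0 < e) (he1 : e ≤ 1) (t : ℝ) :
    e ^ 2 * q2 (fun p => f p * g p) t ≤
      q2 f t * (4 * q2 g t + 2 * q2 (fun p => e * pd w1 g p) t + 2 * q2 (fun p => e * pd w2 g p) t
        + q2 (fun p => e * (e * pd w1 (pd w2 g) p)) t) := by
  have cf := slice_cont hf t
  have cg := slice_cont hg t
  have cg2 := slice_cont (pd_cd hg w2) t
  have cg1 := slice_cont (pd_cd hg w1) t
  have cg12 := slice_cont (pd_cd (pd_cd hg w2) w1) t
  set K := 4 * q2 g t + 2 * q2 (fun p => e * pd w1 g p) t + 2 * q2 (fun p => e * pd w2 g p) t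
        + q2 (fun p => e * (e * pd w1 (pd w2 g) p)) t with hK
  have hsup : ∀ x ∈ Ω, e ^ 2 * (g (t, x) * g (t, x)) ≤ K := by
    intro x hx
    have h1 := supY hg he he1 t x.1 (y := x.2) ⟨hx.2.1.le, hx.2.2.le⟩
    have h2 : ∀ y, e * (2 * (g (t, (x.1, y)) * g (t, (x.1, y)))
        + (e * pd w2 g (t, (x.1, y))) * (e * pd w2 g (t, (x.1, y)))) ≤
        ∫ r in (0 : ℝ)..(2 * π), (2 * (2 * (g (t, (r, y)) * g (t, (r, y))) + (e * pd w1 g (t, (r, y))) * (e * pd w1 g (t, (r, y))))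
          + (2 * ((e * pd w2 g (t, (r, y))) * (e * pd w2 g (t, (r, y))))
          + (e * (e * pd w1 (pd w2 g) (t, (r, y)))) * (e * (e * pd w1 (pd w2 g) (t, (r, y)))))) := by
      intro y
      have a1 := supX hg he he1 t y (x := x.1) ⟨hx.1.1.le, hx.1.2.le⟩
      have a2 := supX (pd_cd hg w2) he he1 t y (x := x.1) ⟨hx.1.1.le, hx.1.2.le⟩
      have cy : Continuous fun r : ℝ => (r, y) := by fun_prop
      have b1 := cg.comp cy
      have b2 := cg1.comp cy
      have b3 := cg2.comp cy
      have b4 := cg12.comp cy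
      simp only [Function.comp_def] at b1 b2 b3 b4
      rw [intervalIntegral.integral_add (Continuous.intervalIntegrable (by fun_prop) _ _)
        (Continuous.intervalIntegrable (by fun_prop) _ _), intervalIntegral.integral_const_mul]
      have a3 : ∫ r in (0 : ℝ)..(2 * π), (2 * ((e * pd w2 g (t, (r, y))) * (e * pd w2 g (t, (r, y))))
          + (e * (e * pd w1 (pd w2 g) (t, (r, y)))) * (e * (e * pd w1 (pd w2 g) (t, (r, y)))))
          = e ^ 2 * ∫ s in (0 : ℝ)..(2 * π), (2 * (pd w2 g (t, (s, y)) * pd w2 g (t, (s, y)))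
      + (e * pd w1 (pd w2 g) (t, (s, y))) * (e * pd w1 (pd w2 g) (t, (s, y)))) := by
        rw [← intervalIntegral.integral_const_mul]; congr 1; funext r; ring
      rw [a3]
      have a4 := mul_le_mul_of_nonneg_left a2 (by positivity : 0 ≤ e ^ 2)
      nlinarith
    have c1 : Continuous fun x : ℝ × ℝ => (2 * (2 * (g (t, x) * g (t, x)) + (e * pd w1 g (t, x)) * (e * pd w1 g (t, x)))
          + (2 * ((e * pd w2 g (t, x)) * (e * pd w2 g (t, x)))
          + (e * (e * pd w1 (pd w2 g) (t, x))) * (e * (e * pd w1 (pd w2 g) (t, x))))) := by fun_prop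
    have h3 : K = ∫ y in (0 : ℝ)..1, ∫ r in (0 : ℝ)..(2 * π), (2 * (2 * (g (t, (r, y)) * g (t, (r, y))) + (e * pd w1 g (t, (r, y))) * (e * pd w1 g (t, (r, y))))
          + (2 * ((e * pd w2 g (t, (r, y))) * (e * pd w2 g (t, (r, y))))
          + (e * (e * pd w1 (pd w2 g) (t, (r, y)))) * (e * (e * pd w1 (pd w2 g) (t, (r, y)))))) := by
      rw [← int_Ω' c1, integral_add (Ω_int (by fun_prop)) (Ω_int (by fun_prop)), integral_const_mul,
        integral_add (Ω_int (by fun_prop)) (Ω_int (by fun_prop)), integral_const_mul,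
        integral_add (Ω_int (by fun_prop)) (Ω_int (by fun_prop)), integral_const_mul, hK]
      simp only [q2]; ring
    rw [h3]
    have cy : Continuous fun y : ℝ => (x.1, y) := by fun_prop
    have b1 := cg.comp cy
    have b3 := cg2.comp cy
    simp only [Function.comp_def] at b1 b3
    have h4 := intervalIntegral.integral_mono_on (μ := volume) (zero_le_one' ℝ)
      (Continuous.intervalIntegrable (by fun_prop) _ _) ((par_y c1).intervalIntegrable _ _) (fun y _ => h2 y)
    rw [intervalIntegral.integral_const_mul] at h4
    refine le_trans ?_ h4
    have := mul_le_mul_of_nonneg_left h1 he.le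
    calc _ = e * (e * (g (t, (x.1, x.2)) * g (t, (x.1, x.2)))) := by ring
      _ ≤ _ := this
  rw [mul_comm (q2 f t), q2, q2, ← integral_const_mul, ← integral_const_mul]
  apply setIntegral_mono_on (Ω_int (by fun_prop)) (Ω_int (by fun_prop)) Ω_meas
  intro x hx
  have := mul_le_mul_of_nonneg_right (hsup x hx) (mul_self_nonneg (f (t, x)))
  nlinarith

theorem nm_π (f : AA F) (j : JJ F) : nm (π' F f) j ^ 2 = q2 (f j.1.1).1 j.1.2 := by
  rw [nm_sq, ← map_mul, I_π]; rfl

theorem dA_fun (c : F.ι → ℝ) (v : V3) (f : AA F) (i : F.ι) : (dA F c v f i).1 = fun p => c i * pd v (f i).1 p := rfl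
theorem mul_fun (f g : AA F) (i : F.ι) : ((f * g) i).1 = fun p => (f i).1 p * (g i).1 p := rfl

theorem le_of_sq_le {a b : ℝ} (hb : 0 ≤ b) (h : a ^ 2 ≤ b ^ 2) : a ≤ b := abs_le_of_sq_le_sq' h hb |>.2

theorem pd_smul {g : V3 → ℝ} (hg : ContDiff ℝ (⊤ : ℕ∞) g) (c : ℝ) (v : V3) :
    pd v (fun p => c * g p) = fun p => c * pd v g p := by
  funext p
  have := fderiv_const_mul (𝕜 := ℝ) (SP_diff hg p) c
  simp only [pd] at this ⊢
  rw [this]; rfl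

theorem sob1R (f g : RR F) (j : JJ F) : ep (RR F) j * nm (f * g) j ≤ 2 * (hs 1 f j * hs 1 g j) := by
  obtain ⟨f, rfl⟩ := π'_surj F f
  obtain ⟨g, rfl⟩ := π'_surj F g
  have h := sob1_slice (f j.1.1).2.1 (g j.1.1).2.1 (F.e_pos j.1.1) (F.e_le j.1.1) j.1.2
  have h1 := nm_π (f * g) j
  have h2 := nm_π f j
  have h3 := nm_π g j
  have h4 := nm_π (dA F (fun i => F.e i) w2 f) j
  have h5 := nm_π (dA F (fun i => F.e i) w1 g) j
  simp only [dA_fun] at h4 h5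
  rw [mul_fun] at h1
  rw [← h1, ← h2, ← h3, ← h4, ← h5] at h
  simp only [hs, Pi.add_apply, D1_π, D2_π, ← map_mul, ep_π]
  have n1 := nm_nonneg (π' F f) j
  have n2 := nm_nonneg (π' F g) j
  have n3 := nm_nonneg (π' F (dA F (fun i => F.e i) w2 f)) j
  have n4 := nm_nonneg (π' F (dA F (fun i => F.e i) w1 g)) j
  have n5 := nm_nonneg (π' F (dA F (fun i => F.e i) w2 g)) j
  have n6 := nm_nonneg (π' F (dA F (fun i => F.e i) w1 f)) j
  apply le_of_sq_le (by positivity)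
  calc _ = F.e j.1.1 ^ 2 * nm (π' F (f * g)) j ^ 2 := by ring
    _ ≤ _ := h
    _ ≤ (2 * (nm (π' F f) j + nm (π' F (dA F (fun i => F.e i) w1 f)) j + nm (π' F (dA F (fun i => F.e i) w2 f)) j) ^ 2)
      * (2 * (nm (π' F g) j + nm (π' F (dA F (fun i => F.e i) w1 g)) j + nm (π' F (dA F (fun i => F.e i) w2 g)) j) ^ 2) := by
      apply mul_le_mul _ _ (by positivity) (by positivity)
      · nlinarith [mul_nonneg n1 n3, mul_nonneg n1 n6, mul_nonneg n6 n3, mul_nonneg n6 n6]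
      · nlinarith [mul_nonneg n2 n4, mul_nonneg n2 n5, mul_nonneg n5 n4, mul_nonneg n5 n5]
    _ = _ := by ring

theorem sob0R (f g : RR F) (j : JJ F) : ep (RR F) j * nm (f * g) j ≤ 2 * (nm f j * hs 2 g j) := by
  obtain ⟨f, rfl⟩ := π'_surj F f
  obtain ⟨g, rfl⟩ := π'_surj F g
  have h := sob0_slice (f j.1.1).2.1 (g j.1.1).2.1 (F.e_pos j.1.1) (F.e_le j.1.1) j.1.2
  have h1 := nm_π (f * g) j
  have h2 := nm_π f j
  have h3 := nm_π g j
  have h4 := nm_π (dA F (fun i => F.e i) w1 g) j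
  have h5 := nm_π (dA F (fun i => F.e i) w2 g) j
  have h6 := nm_π (dA F (fun i => F.e i) w1 (dA F (fun i => F.e i) w2 g)) j
  simp only [dA_fun] at h4 h5 h6
  rw [pd_smul (pd_cd (g j.1.1).2.1 w2)] at h6
  rw [mul_fun] at h1
  rw [← h1, ← h2, ← h3, ← h4, ← h5, ← h6] at h
  have hp : 0 ≤ 2 * (nm (π' F f) j * hs 2 (π' F g) j) := by
    have := hs_nonneg 2 (π' F g) j
    have := nm_nonneg (π' F f) j
    positivity
  simp only [hs, Pi.add_apply, D1_π, D2_π, ← map_mul, ep_π] at hp ⊢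
  have n0 := fun z : RR F => nm_nonneg z j
  apply le_of_sq_le hp
  calc _ = F.e j.1.1 ^ 2 * nm (π' F (f * g)) j ^ 2 := by ring
    _ ≤ _ := h
    _ ≤ nm (π' F f) j ^ 2 * (4 * (nm (π' F g) j + nm (π' F (dA F (fun i => F.e i) w1 g)) j + nm (π' F (dA F (fun i => F.e i) w2 g)) j
        + nm (π' F (dA F (fun i => F.e i) w1 (dA F (fun i => F.e i) w2 g))) j) ^ 2) := by
      apply mul_le_mul_of_nonneg_left _ (by positivity)
      have n1 := n0 (π' F g)
      have n2 := n0 (π' F (dA F (fun i => F.e i) w1 g))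
      have n3 := n0 (π' F (dA F (fun i => F.e i) w2 g))
      have n4 := n0 (π' F (dA F (fun i => F.e i) w1 (dA F (fun i => F.e i) w2 g)))
      nlinarith [mul_nonneg n1 n2, mul_nonneg n1 n3, mul_nonneg n1 n4, mul_nonneg n2 n3, mul_nonneg n2 n4, mul_nonneg n3 n4]
    _ = (2 * (nm (π' F f) j * (nm (π' F g) j + nm (π' F (dA F (fun i => F.e i) w1 g)) j + nm (π' F (dA F (fun i => F.e i) w2 g)) j
        + nm (π' F (dA F (fun i => F.e i) w1 (dA F (fun i => F.e i) w2 g))) j))) ^ 2 := by ring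
    _ ≤ _ := by
      have n1 := n0 (π' F g)
      have n2 := n0 (π' F (dA F (fun i => F.e i) w1 g))
      have n3 := n0 (π' F (dA F (fun i => F.e i) w2 g))
      have n4 := n0 (π' F (dA F (fun i => F.e i) w1 (dA F (fun i => F.e i) w2 g)))
      have n5 := n0 (π' F f)
      apply pow_le_pow_left₀ (by positivity)
      apply mul_le_mul_of_nonneg_left _ (by norm_num)
      apply mul_le_mul_of_nonneg_left _ n5
      have a1 := n0 (π' F (dA F (fun i => F.e i) w1 (dA F (fun i => F.e i) w1 g)))
      have a2 := n0 (π' F (dA F (fun i => F.e i) w2 (dA F (fun i => F.e i) w1 g)))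
      have a3 := n0 (π' F (dA F (fun i => F.e i) w2 (dA F (fun i => F.e i) w2 g)))
      linarith

end Con
end Couette
end

noncomputable section
open MeasureTheory Real Filter Topology
set_option linter.unusedSectionVars false
set_option linter.unusedVariables false
set_option linter.ambiguousOpen false
set_option linter.deprecated false
namespace Couette
namespace Con
open Couette.Core CB
variable {F : Fam}

/-- differentiation under the integral sign -/
theorem par_deriv {α : Type*} [TopologicalSpace α] [MeasurableSpace α] [BorelSpace α] [SecondCountableTopology α]
    {μ : Measure α} {A K : Set α} (hK : IsCompact K) (hA : MeasurableSet A) (hAK : A ⊆ K) (hμ : μ A ≠ ⊤)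
    {f f' : ℝ → α → ℝ} (hf : Continuous (Function.uncurry f)) (hf' : Continuous (Function.uncurry f'))
    (h : ∀ t a, HasDerivAt (fun t => f t a) (f' t a) t) (t : ℝ) :
    HasDerivAt (fun t => ∫ a in A, f t a ∂μ) (∫ a in A, f' t a ∂μ) t := by
  obtain ⟨M, hM⟩ := ((isCompact_Icc (a := t - 1) (b := t + 1)).prod hK).exists_bound_of_continuousOn hf'.continuousOn
  obtain ⟨M', hM'⟩ := hK.exists_bound_of_continuousOn
    ((hf.comp (Continuous.prodMk_right t)).continuousOn)
  have hfin : IsFiniteMeasure (μ.restrict A) := ⟨by simpa using lt_top_iff_ne_top.2 hμ⟩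
  have hcs : ∀ s, AEStronglyMeasurable (f s) (μ.restrict A) := fun s =>
    (hf.comp (Continuous.prodMk_right s)).aestronglyMeasurable
  have hcs' : ∀ s, AEStronglyMeasurable (f' s) (μ.restrict A) := fun s =>
    (hf'.comp (Continuous.prodMk_right s)).aestronglyMeasurable
  refine (hasDerivAt_integral_of_dominated_loc_of_deriv_le (s := Set.Icc (t - 1) (t + 1)) (bound := fun _ => M)
    (Icc_mem_nhds (by linarith) (by linarith)) (Eventually.of_forall hcs) ?_ (hcs' t) ?_ (integrable_const M)
    (Eventually.of_forall fun a s _ => h s a)).2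
  · refine Integrable.of_bound (hcs t) M' ?_
    exact (ae_restrict_iff' hA).2 (Eventually.of_forall fun a ha => hM' a (hAK ha))
  · exact (ae_restrict_iff' hA).2 (Eventually.of_forall fun a ha s hs => hM (s, a) ⟨hs, hAK ha⟩)

/-- horizontal Fourier coefficient -/
def Fo (c : ℝ → ℝ) (f : ℝ × ℝ → ℝ) (y : ℝ) : ℝ := ∫ x in (0 : ℝ)..(2 * π), f (x, y) * c x

theorem Fo_cont {c : ℝ → ℝ} (hc : Continuous c) {f : ℝ × ℝ → ℝ} (hf : Continuous f) : Continuous (Fo c f) :=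
  par_y (h := fun q => f q * c q.1) (by fun_prop)

theorem two_pi_nn : (0 : ℝ) ≤ 2 * π := by linarith [two_pi_one]

theorem Fo_deriv {c : ℝ → ℝ} (hc : Continuous c) {f : V3 → ℝ} (hf : ContDiff ℝ (⊤ : ℕ∞) f) (t y : ℝ) :
    HasDerivAt (Fo c (fun q => f (t, q))) (Fo c (fun q => pd w2 f (t, q)) y) y := by
  have hfc := hf.continuous
  have hfc' := (pd_cd hf w2).continuous
  have := par_deriv (μ := (volume : Measure ℝ)) (A := Set.Ioc 0 (2 * π)) (K := Set.Icc 0 (2 * π)) isCompact_Icc measurableSet_Ioc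
    Set.Ioc_subset_Icc_self (by rw [Real.volume_Ioc]; exact ENNReal.ofReal_ne_top) (f := fun y x => f (t, (x, y)) * c x)
    (f' := fun y x => pd w2 f (t, (x, y)) * c x) (by simp only [Function.uncurry_def]; fun_prop) (by simp only [Function.uncurry_def]; fun_prop)
    (fun y x => (pd_y hf t x y).mul_const _) y
  have e : Fo c (fun q => f (t, q)) = fun y => ∫ x in Set.Ioc 0 (2 * π), f (t, (x, y)) * c x := by
    funext y; exact intervalIntegral.integral_of_le two_pi_nn
  have e' : Fo c (fun q => pd w2 f (t, q)) y = ∫ x in Set.Ioc 0 (2 * π), pd w2 f (t, (x, y)) * c x :=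
    intervalIntegral.integral_of_le two_pi_nn
  rw [e, e']; exact this

theorem Fo_smooth {c : ℝ → ℝ} (hc : Continuous c) {f : V3 → ℝ} (hf : ContDiff ℝ (⊤ : ℕ∞) f) (t : ℝ) :
    ContDiff ℝ (⊤ : ℕ∞) (Fo c (fun q => f (t, q))) := by
  rw [contDiff_infty]
  intro n
  induction n generalizing f with
  | zero => exact contDiff_zero.2 (Fo_cont hc (slice_cont hf t))
  | succ n ih =>
    push_cast
    rw [contDiff_succ_iff_deriv]
    refine ⟨fun y => (Fo_deriv hc hf t y).differentiableAt, by simp, ?_⟩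
    have : deriv (Fo c (fun q => f (t, q))) = Fo c (fun q => pd w2 f (t, q)) :=
      funext fun y => (Fo_deriv hc hf t y).deriv
    rw [this]; exact ih (pd_cd hf w2)

/-- integration by parts in the periodic variable -/
theorem Fo_ibp {c s : ℝ → ℝ} {k : ℝ} (hc : Continuous c) (hs : ∀ x, HasDerivAt s (-(k * c x)) x) (hp : s (2 * π) = s 0)
    {f : V3 → ℝ} (hf : f ∈ SP) (t y : ℝ) :
    Fo s (fun q => pd w1 f (t, q)) y = k * Fo c (fun q => f (t, q)) y := by
  have hsc : Continuous s := continuous_iff_continuousAt.2 fun x => (hs x).continuousAt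
  have h1 := (pd_cd hf.1 w1).continuous
  have h2 := hf.1.continuous
  have := intervalIntegral.integral_mul_deriv_eq_deriv_mul (a := 0) (b := 2 * π) (u := fun x => f (t, (x, y))) (v := s)
    (u' := fun x => pd w1 f (t, (x, y))) (v' := fun x => -(k * c x)) (fun x _ => pd_x hf.1 t x y) (fun x _ => hs x)
    (Continuous.intervalIntegrable (by fun_prop) _ _) (Continuous.intervalIntegrable (by fun_prop) _ _)
  have hper : f (t, (2 * π, y)) = f (t, (0, y)) := by simpa using hf.2 t 0 y
  simp only [Fo]
  rw [hper, hp, sub_self, zero_sub] at this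
  have e : ∫ x in (0 : ℝ)..2 * π, f (t, (x, y)) * -(k * c x) = -(k * ∫ x in (0 : ℝ)..2 * π, f (t, (x, y)) * c x) := by
    rw [← intervalIntegral.integral_const_mul, ← intervalIntegral.integral_neg]
    exact intervalIntegral.integral_congr fun x _ => by ring
  rw [e] at this
  linarith

def bb (k y : ℝ) : ℝ := 1 - Real.exp (-(k * (y * (1 - y))))
def bb' (k y : ℝ) : ℝ := k * (1 - 2 * y) * Real.exp (-(k * (y * (1 - y))))

theorem bb_deriv (k y : ℝ) : HasDerivAt (bb k) (bb' k y) y := by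
  have h1 : HasDerivAt (fun y : ℝ => -(k * (y * (1 - y)))) (-(k * (1 * (1 - y) + y * (0 - 1)))) y :=
    (((hasDerivAt_id' y).mul ((hasDerivAt_const y (1 : ℝ)).sub (hasDerivAt_id' y))).const_mul k).neg
  have := (hasDerivAt_const y (1 : ℝ)).sub h1.exp
  refine this.congr_deriv ?_
  simp only [bb']; ring

theorem bb_smooth (k : ℝ) : ContDiff ℝ (⊤ : ℕ∞) (bb k) := by
  unfold bb
  fun_prop

theorem yng1 {m A B : ℝ} (h : m ^ 2 ≤ 1) : -(2 * (m * A * B)) ≤ A ^ 2 / 6 + 6 * B ^ 2 := by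
  nlinarith [sq_nonneg (A / 6 + m * B), mul_nonneg (sub_nonneg.2 h) (sq_nonneg B)]
theorem yng2 {m A B : ℝ} (h : m ^ 2 ≤ 1) : 7 * (m * A * B) ≤ A ^ 2 / 6 + 74 * B ^ 2 := by
  nlinarith [sq_nonneg (A / 6 - 7 / 2 * (m * B)), mul_nonneg (sub_nonneg.2 h) (sq_nonneg B), sq_nonneg B]
theorem yng3 {m A B : ℝ} (h : m ^ 2 ≤ 1) : 7 * (m * A * B) ≤ 4 * A ^ 2 + 4 * B ^ 2 := by
  nlinarith [sq_nonneg (m * A - B), mul_nonneg (sub_nonneg.2 h) (sq_nonneg A), sq_nonneg B, sq_nonneg A]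

set_option maxHeartbeats 1000000 in
/-- the one dimensional inequality -/
theorem mode1 {k : ℝ} (hk : 1 ≤ k) {a a' X Y : ℝ → ℝ} (ha : ∀ y, HasDerivAt a (a' y) y) (ha' : Continuous a')
    (hX : Continuous X) (hY : Continuous Y)
    (H : ∫ y in (0 : ℝ)..1, k ^ 2 * (bb k y * a y ^ 2) =
      ∫ y in (0 : ℝ)..1, (k * (bb k y * a y) * X y + (bb' k y * a y + bb k y * a' y) * Y y)) :
    ∫ y in (0 : ℝ)..1, (k * a y) ^ 2 ≤ ∫ y in (0 : ℝ)..1, 200 * (a' y ^ 2 + X y ^ 2 + Y y ^ 2) := by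
  have hac : Continuous a := continuous_iff_continuousAt.2 fun x => (ha x).continuousAt
  have hb : Continuous (bb k) := (bb_smooth k).continuous
  have hb' : Continuous (bb' k) := by unfold bb'; fun_prop
  have hq : ∀ y, HasDerivAt (fun y => k * (1 - 2 * y) * bb k y * a y ^ 2)
      ((k * (0 - 2 * 1) * bb k y + k * (1 - 2 * y) * bb' k y) * a y ^ 2 + k * (1 - 2 * y) * bb k y * (2 * a y * a' y)) y := by
    intro y
    have h1 : HasDerivAt (fun y : ℝ => k * (1 - 2 * y)) (k * (0 - 2 * 1)) y :=
      ((hasDerivAt_const y (1 : ℝ)).sub ((hasDerivAt_id' y).const_mul 2)).const_mul k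
    have h2 := (h1.mul (bb_deriv k y)).mul ((ha y).pow 2)
    refine h2.congr_deriv ?_
    simp
  have I0 := intervalIntegral.integral_eq_sub_of_hasDerivAt (a := 0) (b := 1) (fun y _ => hq y)
    (Continuous.intervalIntegrable (by fun_prop) _ _)
  have b0 : bb k 0 = 0 := by simp [bb]
  have b1 : bb k 1 = 0 := by simp [bb]
  rw [b0, b1] at I0
  norm_num at I0
  have key : ∫ y in (0 : ℝ)..1, (k * a y) ^ 2 ≤ ∫ y in (0 : ℝ)..1,
     (((-(k * 2 * bb k y) + k * (1 - 2 * y) * bb' k y) * a y ^ 2 + k * (1 - 2 * y) * bb k y * (2 * a y * a' y))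
      + (7 * (k ^ 2 * (bb k y * a y ^ 2)) - 7 * (k * (bb k y * a y) * X y + (bb' k y * a y + bb k y * a' y) * Y y)))
      + ((k * a y) ^ 2 / 2 + 100 * (a' y ^ 2 + X y ^ 2 + Y y ^ 2)) := by
    refine intervalIntegral.integral_mono_on (by norm_num) (Continuous.intervalIntegrable (by fun_prop) _ _)
      (Continuous.intervalIntegrable (by fun_prop) _ _) ?_
    intro y hy
    set e := Real.exp (-(k * (y * (1 - y)))) with he
    have hu : 0 ≤ y * (1 - y) := mul_nonneg hy.1 (by linarith [hy.2])
    have he0 : 0 < e := Real.exp_pos _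
    have he1 : e ≤ 1 := Real.exp_le_one_iff.2 (by nlinarith)
    have heu : e * (1 + y * (1 - y)) ≤ 1 := by
      have h1 := Real.add_one_le_exp (k * (y * (1 - y)))
      have h2 : e * Real.exp (k * (y * (1 - y))) = 1 := by rw [he, ← Real.exp_add]; simp
      have h3 : 1 + y * (1 - y) ≤ Real.exp (k * (y * (1 - y))) := by nlinarith
      calc e * (1 + y * (1 - y)) ≤ e * Real.exp (k * (y * (1 - y))) := by gcongr
        _ = 1 := h2
    have eb : bb k y = 1 - e := rfl
    have eb' : bb' k y = k * (1 - 2 * y) * e := rfl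
    have hy2 : |1 - 2 * y| ≤ 1 := abs_le.2 ⟨by linarith [hy.2], by linarith [hy.1]⟩
    have hbb : |bb k y| ≤ 1 := by rw [eb, abs_le]; constructor <;> linarith
    have hbb' : |bb' k y| ≤ k := by
      rw [eb', abs_mul, abs_mul, abs_of_pos he0, abs_of_nonneg (by linarith : 0 ≤ k)]
      calc k * |1 - 2 * y| * e ≤ k * 1 * 1 := by gcongr
        _ = k := by ring
    -- the coercive part
    have c1 : k ^ 2 ≤ -(k * 2 * bb k y) + k * (1 - 2 * y) * bb' k y + 7 * k ^ 2 * bb k y := by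
      rw [eb, eb']
      have : 0 ≤ k * (k - 1) * (1 - e) := by
        apply mul_nonneg (mul_nonneg _ _) <;> linarith
      nlinarith [mul_nonneg (sq_nonneg k) (sub_nonneg.2 heu)]
    have c2 : k ^ 2 * a y ^ 2 ≤ (-(k * 2 * bb k y) + k * (1 - 2 * y) * bb' k y + 7 * k ^ 2 * bb k y) * a y ^ 2 :=
      mul_le_mul_of_nonneg_right c1 (sq_nonneg _)
    -- cross terms
    have d1 : -(k * (1 - 2 * y) * bb k y * (2 * a y * a' y)) ≤ (k * a y) ^ 2 / 6 + 6 * a' y ^ 2 := by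
      have m : ((1 - 2 * y) * bb k y) ^ 2 ≤ 1 := by
        rw [← sq_abs, abs_mul]
        have : |1 - 2 * y| * |bb k y| ≤ 1 * 1 := by gcongr
        nlinarith [mul_nonneg (abs_nonneg (1 - 2 * y)) (abs_nonneg (bb k y))]
      have := yng1 (A := k * a y) (B := a' y) m
      linarith [this]
    have m1 : bb k y ^ 2 ≤ 1 := by rw [← sq_abs]; nlinarith [abs_nonneg (bb k y)]
    have d2 : 7 * (k * (bb k y * a y) * X y) ≤ (k * a y) ^ 2 / 6 + 74 * X y ^ 2 := by
      have := yng2 (A := k * a y) (B := X y) m1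
      linarith [this]
    have d3 : 7 * (bb' k y * a y * Y y) ≤ (k * a y) ^ 2 / 6 + 74 * Y y ^ 2 := by
      have m : ((1 - 2 * y) * e) ^ 2 ≤ 1 := by
        rw [← sq_abs, abs_mul, abs_of_pos he0]
        have : |1 - 2 * y| * e ≤ 1 * 1 := by gcongr
        nlinarith [mul_nonneg (abs_nonneg (1 - 2 * y)) he0.le]
      rw [eb']
      have := yng2 (A := k * a y) (B := Y y) m
      linarith [this]
    have d4 : 7 * (bb k y * a' y * Y y) ≤ 4 * a' y ^ 2 + 4 * Y y ^ 2 := by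
      have := yng3 (A := a' y) (B := Y y) m1
      linarith [this]
    have n1 := sq_nonneg (a' y)
    have n2 := sq_nonneg (X y)
    have n3 := sq_nonneg (Y y)
    linarith [c2, d1, d2, d3, d4, n1, n2, n3]
  rw [intervalIntegral.integral_add (Continuous.intervalIntegrable (by fun_prop) _ _) (Continuous.intervalIntegrable (by fun_prop) _ _),
    intervalIntegral.integral_add (Continuous.intervalIntegrable (by fun_prop) _ _) (Continuous.intervalIntegrable (by fun_prop) _ _),
    intervalIntegral.integral_sub (Continuous.intervalIntegrable (by fun_prop) _ _) (Continuous.intervalIntegrable (by fun_prop) _ _),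
    intervalIntegral.integral_add (f := fun y => (k * a y) ^ 2 / 2) (Continuous.intervalIntegrable (by fun_prop) _ _) (Continuous.intervalIntegrable (by fun_prop) _ _),
    I0, intervalIntegral.integral_const_mul, intervalIntegral.integral_const_mul, intervalIntegral.integral_const_mul,
    intervalIntegral.integral_div, intervalIntegral.integral_const_mul] at key
  rw [intervalIntegral.integral_const_mul] at H
  rw [intervalIntegral.integral_const_mul]
  linarith
end Con
end Couette
end

noncomputable section
open MeasureTheory Real Filter Topology
set_option linter.unusedSectionVars false
set_option linter.unusedVariables false
set_option linter.ambiguousOpen false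
set_option linter.deprecated false
namespace Couette
namespace Con
open Couette.Core CB
variable {F : Fam}

/-- the mode estimate in two dimensions -/
theorem mode2 {k : ℝ} (hk : 1 ≤ k) {c s : ℝ → ℝ} (hcs : ContDiff ℝ (⊤ : ℕ∞) c) (hc : ∀ x, HasDerivAt c (k * s x) x)
    (hs : ∀ x, HasDerivAt s (-(k * c x)) x) (pc : ∀ x, c (x + 2 * π) = c x) (ps : s (2 * π) = s 0)
    {f : V3 → ℝ} (hf : f ∈ SP) (t : ℝ) {h1 h2 : ℝ × ℝ → ℝ} (hh1 : Continuous h1) (hh2 : Continuous h2)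
    (H : ∀ w : V3 → ℝ, w ∈ SP → (∀ t x, w (t, (x, 0)) = 0) → (∀ t x, w (t, (x, 1)) = 0) →
      ∫ q in Ω, pd w1 f (t, q) * pd w1 w (t, q) = ∫ q in Ω, (h1 q * pd w1 w (t, q) + h2 q * pd w2 w (t, q))) :
    ∫ y in (0 : ℝ)..1, (Fo s (fun q => pd w1 f (t, q)) y) ^ 2 ≤ 
      ∫ y in (0 : ℝ)..1, 200 * ((Fo c (fun q => pd w2 f (t, q)) y) ^ 2 + (Fo s h1 y) ^ 2 + (Fo c h2 y) ^ 2) := by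
  have hsc : Continuous s := continuous_iff_continuousAt.2 fun x => (hs x).continuousAt
  have hcc : Continuous c := hcs.continuous
  have cfx := slice_cont (pd_cd hf.1 w1) t
  have cfy := slice_cont (pd_cd hf.1 w2) t
  set a := Fo c (fun q => f (t, q)) with ha
  set a' := Fo c (fun q => pd w2 f (t, q)) with ha'
  have hda : ∀ y, HasDerivAt a (a' y) y := fun y => Fo_deriv hcc hf.1 t y
  have hsa : ContDiff ℝ (⊤ : ℕ∞) a := Fo_smooth hcc hf.1 t
  have hcb : Continuous (bb k) := (bb_smooth k).continuous
  have hcb' : Continuous (bb' k) := by unfold bb'; fun_prop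
  have hca' : Continuous a' := Fo_cont hcc cfy
  have e1 : ∀ y, Fo s (fun q => pd w1 f (t, q)) y = k * a y := fun y => Fo_ibp hcc hs ps hf t y
  set w : V3 → ℝ := fun p => (bb k p.2.2 * a p.2.2) * c p.2.1 with hw
  have hws : ContDiff ℝ (⊤ : ℕ∞) w := by
    have := bb_smooth k
    exact (((this.comp (contDiff_snd.comp contDiff_snd)).mul (hsa.comp (contDiff_snd.comp contDiff_snd))).mul
      (hcs.comp (contDiff_fst.comp contDiff_snd)))
  have hwx : ∀ x y, pd w1 w (t, (x, y)) = k * (bb k y * a y) * s x := fun x y =>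
    ((pd_x hws t x y).unique ((hc x).const_mul (bb k y * a y))).trans (by ring)
  have hwy : ∀ x y, pd w2 w (t, (x, y)) = (bb' k y * a y + bb k y * a' y) * c x := fun x y =>
    (pd_y hws t x y).unique (((bb_deriv k y).mul (hda y)).mul_const (c x))
  have H1 := H w ⟨hws, fun t x y => by simp only [hw, pc]⟩ (fun t x => by simp [hw, bb]) (fun t x => by simp [hw, bb])
  have cwx := slice_cont (pd_cd hws w1) t
  have cwy := slice_cont (pd_cd hws w2) t
  rw [int_Ω' (by fun_prop), int_Ω' (by fun_prop)] at H1
  have H2 : ∫ y in (0 : ℝ)..1, k ^ 2 * (bb k y * a y ^ 2) =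
      ∫ y in (0 : ℝ)..1, (k * (bb k y * a y) * Fo s h1 y + (bb' k y * a y + bb k y * a' y) * Fo c h2 y) := by
    calc _ = _ := ?_
      _ = _ := H1
      _ = _ := ?_
    · refine intervalIntegral.integral_congr fun y _ => ?_
      simp only [hwx]
      have : k ^ 2 * (bb k y * a y ^ 2) = k * (bb k y * a y) * Fo s (fun q => pd w1 f (t, q)) y := by rw [e1]; ring
      rw [this, Fo, ← intervalIntegral.integral_const_mul]
      exact intervalIntegral.integral_congr fun x _ => by ring
    · refine intervalIntegral.integral_congr fun y _ => ?_
      simp only [hwx, hwy]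
      rw [Fo, Fo, ← intervalIntegral.integral_const_mul, ← intervalIntegral.integral_const_mul,
        ← intervalIntegral.integral_add (Continuous.intervalIntegrable (by fun_prop) _ _) (Continuous.intervalIntegrable (by fun_prop) _ _)]
      exact intervalIntegral.integral_congr fun x _ => by ring
  have := mode1 hk hda hca' (Fo_cont hsc hh1) (Fo_cont hcc hh2) H2
  calc _ = ∫ y in (0 : ℝ)..1, (k * a y) ^ 2 := intervalIntegral.integral_congr fun y _ => by simp only [e1]
    _ ≤ _ := this

/-- power in the n-th mode -/
def Pn (n : ℤ) (f : ℝ × ℝ → ℝ) (y : ℝ) : ℝ :=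
  (Fo (fun x => Real.cos (n * x)) f y) ^ 2 + (Fo (fun x => Real.sin (n * x)) f y) ^ 2

theorem Pn_nonneg (n : ℤ) (f : ℝ × ℝ → ℝ) (y : ℝ) : 0 ≤ Pn n f y := by unfold Pn; positivity

theorem Pn_cont (n : ℤ) {f : ℝ × ℝ → ℝ} (hf : Continuous f) : Continuous (Pn n f) := by
  have h1 := Fo_cont (c := fun x => Real.cos (n * x)) (by fun_prop) hf
  have h2 := Fo_cont (c := fun x => Real.sin (n * x)) (by fun_prop) hf
  unfold Pn; fun_prop

theorem Pn_hasSum {f : ℝ × ℝ → ℝ} (hf : Continuous f) (y : ℝ) :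
    HasSum (fun n => Pn n f y) (2 * π * ∫ x in (0 : ℝ)..(2 * π), f (x, y) * f (x, y)) := by
  have hpi : (0 : ℝ) < 2 * π := by linarith [two_pi_one]
  have hc : Continuous (fun x => ((f (x, y) : ℝ) : ℂ)) := by fun_prop
  have hL : MemLp (fun x => ((f (x, y) : ℝ) : ℂ)) 2 (volume.restrict (Set.Ioc 0 (2 * π))) := by
    obtain ⟨M, hM⟩ := (isCompact_Icc (a := (0 : ℝ)) (b := 2 * π)).exists_bound_of_continuousOn hc.continuousOn
    exact MemLp.of_bound hc.aestronglyMeasurable M ((ae_restrict_iff' measurableSet_Ioc).2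
      (Eventually.of_forall fun x hx => hM x (Set.Ioc_subset_Icc_self hx)))
  have h := (hasSum_sq_fourierCoeffOn hpi hL).mul_left ((2 * π) ^ 2)
  have e2 : (2 * π) ^ 2 * ((2 * π - 0)⁻¹ • ∫ x in (0 : ℝ)..(2 * π), ‖((f (x, y) : ℝ) : ℂ)‖ ^ 2) =
      2 * π * ∫ x in (0 : ℝ)..(2 * π), f (x, y) * f (x, y) := by
    have : ∫ x in (0 : ℝ)..(2 * π), ‖((f (x, y) : ℝ) : ℂ)‖ ^ 2 = ∫ x in (0 : ℝ)..(2 * π), f (x, y) * f (x, y) :=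
      intervalIntegral.integral_congr fun x _ => by simp [sq]
    rw [this, sub_zero, smul_eq_mul]
    field_simp
  rw [e2] at h
  refine Eq.mp (congrArg (fun g => HasSum g _) (funext fun n => Eq.symm ?_)) h
  have hco : fourierCoeffOn hpi (fun x => ((f (x, y) : ℝ) : ℂ)) n =
      (((2 * π)⁻¹ : ℝ) : ℂ) * (((Fo (fun x => Real.cos (n * x)) f y : ℝ) : ℂ) - Complex.I * ((Fo (fun x => Real.sin (n * x)) f y : ℝ) : ℂ)) := by
    rw [fourierCoeffOn_eq_integral, Fo, Fo, ← intervalIntegral.integral_ofReal, ← intervalIntegral.integral_ofReal,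
      ← intervalIntegral.integral_const_mul, ← intervalIntegral.integral_sub
        (Continuous.intervalIntegrable (by fun_prop) _ _) (Continuous.intervalIntegrable (by fun_prop) _ _), Complex.real_smul]
    congr 1
    · simp
    · refine intervalIntegral.integral_congr fun x _ => ?_
      simp only [fourier_coe_apply, smul_eq_mul]
      have : (2 * π * Complex.I * ((-n : ℤ) : ℂ) * x / ((2 * π - 0 : ℝ) : ℂ) : ℂ) = ((-(n * x) : ℝ) : ℂ) * Complex.I := by
        have : (π : ℂ) ≠ 0 := by exact_mod_cast Real.pi_ne_zero
        push_cast
        rw [sub_zero]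
        field_simp
      rw [this, Complex.exp_mul_I, ← Complex.ofReal_cos, ← Complex.ofReal_sin, Real.cos_neg, Real.sin_neg]
      push_cast
      ring
  rw [hco, norm_mul, Pn, mul_pow ‖_‖ ‖_‖]
  have e3 : ∀ A B : ℝ, ‖((A : ℂ) - Complex.I * B)‖ ^ 2 = A ^ 2 + B ^ 2 := fun A B => by
    rw [← Complex.normSq_eq_norm_sq, Complex.normSq_apply]; simp; ring
  rw [e3, Complex.norm_real, Real.norm_of_nonneg (by positivity)]
  field_simp

theorem Pn_int_hasSum {f : ℝ × ℝ → ℝ} (hf : Continuous f) :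
    HasSum (fun n => ∫ y in (0 : ℝ)..1, Pn n f y) (2 * π * ∫ x in Ω, f x * f x) := by
  have hc2 : Continuous fun y => 2 * π * ∫ x in (0 : ℝ)..(2 * π), f (x, y) * f (x, y) :=
    continuous_const.mul (par_y (h := fun q => f q * f q) (by fun_prop))
  have hI : ∀ n : ℤ, Integrable (Pn n f) (volume.restrict (Set.Ioc 0 1)) := fun n =>
    ((Pn_cont n hf).intervalIntegrable 0 1).1
  have hnn : ∀ n : ℤ, 0 ≤ ∫ y in Set.Ioc (0 : ℝ) 1, ‖Pn n f y‖ := fun n => integral_nonneg fun _ => norm_nonneg _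
  have hsum : Summable fun n : ℤ => ∫ y in Set.Ioc (0 : ℝ) 1, ‖Pn n f y‖ := by
    refine summable_of_sum_le hnn (c := ∫ y in Set.Ioc (0 : ℝ) 1, 2 * π * ∫ x in (0 : ℝ)..(2 * π), f (x, y) * f (x, y)) fun u => ?_
    rw [← integral_finset_sum _ fun n _ => (hI n).norm]
    refine integral_mono (integrable_finset_sum _ fun n _ => (hI n).norm) (hc2.intervalIntegrable 0 1).1 fun y => ?_
    have h1 : ∀ n : ℤ, ‖Pn n f y‖ = Pn n f y := fun n => Real.norm_of_nonneg (Pn_nonneg n f y)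
    simp only [h1]
    exact sum_le_hasSum u (fun n _ => Pn_nonneg n f y) (Pn_hasSum hf y)
  have := hasSum_integral_of_summable_integral_norm hI hsum
  have e1 : ∫ y in Set.Ioc (0 : ℝ) 1, ∑' n, Pn n f y = 2 * π * ∫ x in Ω, f x * f x := by
    rw [int_Ω' (by fun_prop), ← intervalIntegral.integral_const_mul, intervalIntegral.integral_of_le (by norm_num : (0 : ℝ) ≤ 1)]
    exact integral_congr_ae (Eventually.of_forall fun y => (Pn_hasSum hf y).tsum_eq)
  rw [e1] at this
  refine Eq.mp (congrArg (fun g => HasSum g _) (funext fun n => Eq.symm ?_)) this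
  exact intervalIntegral.integral_of_le (by norm_num)

theorem Fo_neg (c : ℝ → ℝ) (f : ℝ × ℝ → ℝ) (y : ℝ) : Fo (fun x => -c x) f y = -Fo c f y := by
  rw [Fo, Fo, ← intervalIntegral.integral_neg]
  exact intervalIntegral.integral_congr fun x _ => by ring

theorem Pn_neg (n : ℤ) (f : ℝ × ℝ → ℝ) (y : ℝ) : Pn (-n) f y = Pn n f y := by
  have h1 : (fun x : ℝ => Real.cos (((-n : ℤ) : ℝ) * x)) = fun x => Real.cos (n * x) := by
    funext x; push_cast; rw [neg_mul, Real.cos_neg]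
  have h2 : (fun x : ℝ => Real.sin (((-n : ℤ) : ℝ) * x)) = fun x => -Real.sin (n * x) := by
    funext x; push_cast; rw [neg_mul, Real.sin_neg]
  rw [Pn, Pn, h1, h2, Fo_neg, neg_sq]

theorem infsup_slice {f : V3 → ℝ} (hf : f ∈ SP) (t : ℝ) {h1 h2 : ℝ × ℝ → ℝ} (hh1 : Continuous h1) (hh2 : Continuous h2)
    (H : ∀ w : V3 → ℝ, w ∈ SP → (∀ t x, w (t, (x, 0)) = 0) → (∀ t x, w (t, (x, 1)) = 0) →
      ∫ q in Ω, pd w1 f (t, q) * pd w1 w (t, q) = ∫ q in Ω, (h1 q * pd w1 w (t, q) + h2 q * pd w2 w (t, q))) :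
    ∫ q in Ω, pd w1 f (t, q) * pd w1 f (t, q) ≤ 200 * (∫ q in Ω, pd w2 f (t, q) * pd w2 f (t, q)) 
      + 200 * (∫ q in Ω, h1 q * h1 q) + 200 * (∫ q in Ω, h2 q * h2 q) := by
  have cfx := slice_cont (pd_cd hf.1 w1) t
  have cfy := slice_cont (pd_cd hf.1 w2) t
  set A := fun n : ℤ => ∫ y in (0 : ℝ)..1, Pn n (fun q => pd w1 f (t, q)) y with hA
  set B := fun n : ℤ => 200 * (∫ y in (0 : ℝ)..1, Pn n (fun q => pd w2 f (t, q)) y) + 200 * (∫ y in (0 : ℝ)..1, Pn n h1 y)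
    + 200 * (∫ y in (0 : ℝ)..1, Pn n h2 y) with hB
  have hpos : ∀ n : ℤ, 0 < n → A n ≤ B n := by
    intro n hn
    have hk : (1 : ℝ) ≤ n := by exact_mod_cast hn
    have d0 : ∀ x : ℝ, HasDerivAt (fun x : ℝ => (n : ℝ) * x) n x := fun x => by
      simpa using (hasDerivAt_id' x).const_mul (n : ℝ)
    have dcos : ∀ x : ℝ, HasDerivAt (fun x => Real.cos (n * x)) (-(n * Real.sin (n * x))) x := fun x =>
      ((d0 x).cos).congr_deriv (by ring)
    have dsin : ∀ x : ℝ, HasDerivAt (fun x => Real.sin (n * x)) (n * Real.cos (n * x)) x := fun x =>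
      ((d0 x).sin).congr_deriv (by ring)
    have pcos : ∀ x : ℝ, Real.cos (n * (x + 2 * π)) = Real.cos (n * x) := fun x => by
      rw [mul_add]; exact Real.cos_add_int_mul_two_pi _ _
    have psin : ∀ x : ℝ, Real.sin (n * (x + 2 * π)) = Real.sin (n * x) := fun x => by
      rw [mul_add]; exact Real.sin_add_int_mul_two_pi _ _
    have m1 := mode2 hk (c := fun x => Real.sin (n * x)) (s := fun x => Real.cos (n * x)) (by fun_prop) dsin dcos psin
      (by simpa using pcos 0) hf t hh1 hh2 H
    have m2 := mode2 hk (c := fun x => Real.cos (n * x)) (s := fun x => -Real.sin (n * x)) (by fun_prop) 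
      (fun x => (dcos x).congr_deriv (by ring)) (fun x => (dsin x).neg) pcos
      (by simp [by simpa using psin 0]) hf t hh1 hh2 H
    simp only [Fo_neg, neg_sq] at m2
    have c1 : ∀ g : ℝ × ℝ → ℝ, Continuous g → Continuous (Fo (fun x => Real.cos (n * x)) g) := fun g hg =>
      Fo_cont (by fun_prop) hg
    have c2 : ∀ g : ℝ × ℝ → ℝ, Continuous g → Continuous (Fo (fun x => Real.sin (n * x)) g) := fun g hg =>
      Fo_cont (by fun_prop) hg
    have := c1 _ cfx; have := c1 _ cfy; have := c1 _ hh1; have := c1 _ hh2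
    have := c2 _ cfx; have := c2 _ cfy; have := c2 _ hh1; have := c2 _ hh2
    simp only [hA, hB, Pn, ← intervalIntegral.integral_const_mul]
    rw [← intervalIntegral.integral_add (Continuous.intervalIntegrable (by fun_prop) _ _) (Continuous.intervalIntegrable (by fun_prop) _ _),
      ← intervalIntegral.integral_add (Continuous.intervalIntegrable (by fun_prop) _ _) (Continuous.intervalIntegrable (by fun_prop) _ _),
      intervalIntegral.integral_add (Continuous.intervalIntegrable (by fun_prop) _ _) (Continuous.intervalIntegrable (by fun_prop) _ _)]
    refine (add_le_add m1 m2).trans (le_of_eq ?_)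
    rw [← intervalIntegral.integral_add (Continuous.intervalIntegrable (by fun_prop) _ _) (Continuous.intervalIntegrable (by fun_prop) _ _)]
    exact intervalIntegral.integral_congr fun y _ => by ring
  have hle : ∀ n, A n ≤ B n := by
    intro n
    rcases lt_trichotomy n 0 with h | h | h
    · have := hpos (-n) (by omega)
      simpa only [hA, hB, Pn_neg] using this
    · subst h
      have z1 : ∀ y, Fo (fun _ => 1) (fun q => pd w1 f (t, q)) y = 0 := fun y => by
        have := Fo_ibp (c := fun _ => 1) (s := fun _ => 1) (k := 0) continuous_const (fun x => by simpa using hasDerivAt_const x (1 : ℝ)) rfl hf t y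
        simpa using this
      have z2 : ∀ y, Fo (fun _ => 0) (fun q => pd w1 f (t, q)) y = 0 := fun y => by simp [Fo]
      have : A 0 = 0 := by simp [hA, Pn, z1, z2]
      rw [this]
      have nn : ∀ g, 0 ≤ ∫ y in (0 : ℝ)..1, Pn 0 g y := fun g =>
        intervalIntegral.integral_nonneg (by norm_num) fun y _ => Pn_nonneg 0 g y
      have := nn (fun q => pd w2 f (t, q)); have := nn h1; have := nn h2
      simp only [hB]; linarith
    · exact hpos n h
  have hs := hasSum_le hle (Pn_int_hasSum cfx) ((((Pn_int_hasSum cfy).mul_left 200).add ((Pn_int_hasSum hh1).mul_left 200)).add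
    ((Pn_int_hasSum hh2).mul_left 200))
  have hpi : (0 : ℝ) < 2 * π := by linarith [two_pi_one]
  refine le_of_mul_le_mul_left ?_ hpi
  refine hs.trans (le_of_eq ?_)
  ring

theorem infsupR : ∃ C : ℝ, 0 ≤ C ∧ ∀ (Q h11 h12 h21 h22 : RR F) (j : JJ F),
    (∀ w1 ∈ (Z : Ideal (RR F)), ∀ w2 ∈ (Z : Ideal (RR F)), I (D1 Q * (D1 w1 + D2 w2)) j =
      I (h11 * D1 w1 + h12 * D1 w2 + h21 * D2 w1 + h22 * D2 w2) j) →
    nm (D1 Q) j ≤ C * (nm h11 j + nm h12 j + nm h21 j + nm h22 j + nm (D2 Q) j) := by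
  refine ⟨15, by norm_num, fun Q h11 h12 h21 h22 j H => ?_⟩
  obtain ⟨Q, rfl⟩ := π'_surj F Q
  obtain ⟨h11, rfl⟩ := π'_surj F h11
  obtain ⟨h21, rfl⟩ := π'_surj F h21
  have hQ := (Q j.1.1).2
  have hh1 := slice_cont (h11 j.1.1).2.1 j.1.2
  have hh2 := slice_cont (h21 j.1.1).2.1 j.1.2
  have he := F.e_pos j.1.1
  have key := infsup_slice (f := fun p => F.e j.1.1 * (Q j.1.1).1 p)
    (SP.smul_mem hQ (F.e j.1.1)) j.1.2 hh1 hh2 (by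
      intro w hw w0' w1'
      have := H (π' F (fun _ => ⟨w, hw⟩)) (Z_π _ (by
        intro i t x y _ hy
        rcases hy with rfl | rfl
        · exact w0' t x
        · exact w1' t x)) 0 (Ideal.zero_mem _)
      simp only [map_zero, add_zero, mul_zero] at this
      rw [D1_π, D1_π, D2_π, ← map_mul (π' F), ← map_mul (π' F), ← map_mul (π' F), ← map_add (π' F), I_π, I_π] at this
      have e1 : ∀ p, pd Con.w1 (fun p => F.e j.1.1 * (Q j.1.1).1 p) p = F.e j.1.1 * pd Con.w1 (Q j.1.1).1 p := fun p =>
        congrFun (pd_smul hQ.1 _ _) p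
      refine mul_left_cancel₀ he.ne' ?_
      rw [← integral_const_mul, ← integral_const_mul]
      refine Eq.trans ?_ (this.trans ?_)
      · refine integral_congr_ae (Eventually.of_forall fun q => ?_)
        simp only [mul_fun, dA_fun, e1]; ring
      · refine integral_congr_ae (Eventually.of_forall fun q => ?_)
        change (h11 j.1.1).1 (j.1.2, q) * (F.e j.1.1 * pd Con.w1 w (j.1.2, q)) + (h21 j.1.1).1 (j.1.2, q) * (F.e j.1.1 * pd Con.w2 w (j.1.2, q)) = _
        ring)
  have e1 : ∀ v p, pd v (fun p => F.e j.1.1 * (Q j.1.1).1 p) p = F.e j.1.1 * pd v (Q j.1.1).1 p := fun v p =>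
    congrFun (pd_smul hQ.1 _ _) p
  simp only [e1] at key
  have n1 : nm (D1 (π' F Q)) j ^ 2 ≤ 200 * nm (D2 (π' F Q)) j ^ 2 + 200 * nm (π' F h11) j ^ 2 + 200 * nm (π' F h21) j ^ 2 := by
    rw [D1_π, D2_π, nm_π, nm_π, nm_π, nm_π]
    exact key
  have p1 := nm_nonneg (D2 (π' F Q)) j
  have p2 := nm_nonneg (π' F h11) j
  have p3 := nm_nonneg (π' F h21) j
  have p4 := nm_nonneg h12 j
  have p5 := nm_nonneg h22 j
  refine (le_of_sq_le (b := 15 * (nm (π' F h11) j + nm (π' F h21) j + nm (D2 (π' F Q)) j)) (by positivity) ?_).trans (by linarith)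
  nlinarith [mul_nonneg p1 p2, mul_nonneg p1 p3, mul_nonneg p2 p3, sq_nonneg (nm (π' F h11) j), sq_nonneg (nm (π' F h21) j), sq_nonneg (nm (D2 (π' F Q)) j)]
end Con
end Couette
end

noncomputable section
open MeasureTheory Real Filter Topology
set_option linter.unusedSectionVars false
set_option linter.unusedVariables false
set_option linter.ambiguousOpen false
set_option linter.deprecated false
namespace Couette
namespace Con
open Couette.Core CB
variable {F : Fam}

theorem ile {n : ℕ} : ((n : ℕ) : WithTop ℕ∞) ≤ ((⊤ : ℕ∞) : WithTop ℕ∞) := by exact_mod_cast le_top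

theorem clm_le {G H : Type*} [NormedAddCommGroup G] [NormedSpace ℝ G] [NormedAddCommGroup H] [NormedSpace ℝ H]
    (L : G →L[ℝ] H) (hL : ‖L‖ ≤ 1) {f : ℝ × ℝ → G} (hf : ContDiff ℝ (⊤ : ℕ∞) f) (j : ℕ) (x : ℝ × ℝ) :
    ‖iteratedFDeriv ℝ j (fun y => L (f y)) x‖ ≤ ‖iteratedFDeriv ℝ j f x‖ := by
  refine (L.norm_iteratedFDeriv_comp_left hf.contDiffAt ile).trans ?_
  exact mul_le_of_le_one_left (norm_nonneg _) hL

theorem apply_le (v : ℝ × ℝ) (hv : ‖v‖ ≤ 1) : ‖ContinuousLinearMap.apply ℝ ℝ v‖ ≤ 1 :=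
  ContinuousLinearMap.opNorm_le_bound _ zero_le_one fun L => by
    simp only [ContinuousLinearMap.apply_apply]
    exact (L.le_opNorm v).trans (by nlinarith [norm_nonneg L])

theorem fd_cd {f : ℝ × ℝ → ℝ} (hf : ContDiff ℝ (⊤ : ℕ∞) f) : ContDiff ℝ (⊤ : ℕ∞) (fderiv ℝ f) :=
  hf.fderiv_right (m := (⊤ : ℕ∞)) (by exact_mod_cast le_top)
theorem d1_cd {f : ℝ × ℝ → ℝ} (hf : ContDiff ℝ (⊤ : ℕ∞) f) : ContDiff ℝ (⊤ : ℕ∞) (d1 f) :=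
  (fd_cd hf).clm_apply contDiff_const
theorem d2_cd {f : ℝ × ℝ → ℝ} (hf : ContDiff ℝ (⊤ : ℕ∞) f) : ContDiff ℝ (⊤ : ℕ∞) (d2 f) :=
  (fd_cd hf).clm_apply contDiff_const

theorem nI_d1 {f : ℝ × ℝ → ℝ} (hf : ContDiff ℝ (⊤ : ℕ∞) f) (j : ℕ) (x : ℝ × ℝ) :
    ‖iteratedFDeriv ℝ j (d1 f) x‖ ≤ ‖iteratedFDeriv ℝ (j + 1) f x‖ := by
  rw [← norm_iteratedFDeriv_fderiv]
  exact clm_le (ContinuousLinearMap.apply ℝ ℝ (((1 : ℝ), (0 : ℝ)))) (apply_le _ (by simp [Prod.norm_def])) (fd_cd hf) j x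
theorem nI_d2 {f : ℝ × ℝ → ℝ} (hf : ContDiff ℝ (⊤ : ℕ∞) f) (j : ℕ) (x : ℝ × ℝ) :
    ‖iteratedFDeriv ℝ j (d2 f) x‖ ≤ ‖iteratedFDeriv ℝ (j + 1) f x‖ := by
  rw [← norm_iteratedFDeriv_fderiv]
  exact clm_le (ContinuousLinearMap.apply ℝ ℝ (((0 : ℝ), (1 : ℝ)))) (apply_le _ (by simp [Prod.norm_def])) (fd_cd hf) j x

theorem smr_le (M : ℝ × ℝ →L[ℝ] ℝ) (hM : ‖M‖ ≤ 1) : ‖(ContinuousLinearMap.id ℝ ℝ).smulRight M‖ ≤ 1 :=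
  ContinuousLinearMap.opNorm_le_bound _ zero_le_one fun c => by
    simp only [ContinuousLinearMap.smulRight_apply, ContinuousLinearMap.id_apply, norm_smul]
    nlinarith [norm_nonneg c]

theorem nI_succ {f : ℝ × ℝ → ℝ} (hf : ContDiff ℝ (⊤ : ℕ∞) f) (j : ℕ) (x : ℝ × ℝ) :
    ‖iteratedFDeriv ℝ (j + 1) f x‖ ≤ ‖iteratedFDeriv ℝ j (d1 f) x‖ + ‖iteratedFDeriv ℝ j (d2 f) x‖ := by
  rw [← norm_iteratedFDeriv_fderiv]
  set L1 := (ContinuousLinearMap.id ℝ ℝ).smulRight (ContinuousLinearMap.fst ℝ ℝ ℝ)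
  set L2 := (ContinuousLinearMap.id ℝ ℝ).smulRight (ContinuousLinearMap.snd ℝ ℝ ℝ)
  have e : fderiv ℝ f = (fun y => L1 (d1 f y)) + fun y => L2 (d2 f y) := by
    funext y
    ext
    · simp [L1, L2, d1]
    · simp [L1, L2, d2]
  have a1 : ContDiffAt ℝ j (fun y => L1 (d1 f y)) x := (L1.contDiff.comp (d1_cd hf)).contDiffAt.of_le ile
  have a2 : ContDiffAt ℝ j (fun y => L2 (d2 f y)) x := (L2.contDiff.comp (d2_cd hf)).contDiffAt.of_le ile
  rw [e, iteratedFDeriv_add_apply a1 a2]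
  refine (norm_add_le _ _).trans (add_le_add ?_ ?_)
  · exact clm_le L1 (smr_le _ (ContinuousLinearMap.norm_fst_le ..)) (d1_cd hf) j x
  · exact clm_le L2 (smr_le _ (ContinuousLinearMap.norm_snd_le ..)) (d2_cd hf) j x

theorem dSq_int {G : Type*} [NormedAddCommGroup G] [NormedSpace ℝ G] {f : ℝ × ℝ → G} (hf : ContDiff ℝ (⊤ : ℕ∞) f) (j : ℕ) :
    IntegrableOn (fun x => ‖iteratedFDeriv ℝ j f x‖ ^ 2) Ω :=
  Ω_int ((hf.continuous_iteratedFDeriv ile).norm.pow 2)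

theorem dSq_nonneg {G : Type*} [NormedAddCommGroup G] [NormedSpace ℝ G] (f : ℝ × ℝ → G) (j : ℕ) : 0 ≤ dSq j f :=
  integral_nonneg fun x => by positivity

theorem dSq_mono {G H : Type*} [NormedAddCommGroup G] [NormedSpace ℝ G] [NormedAddCommGroup H] [NormedSpace ℝ H]
    {f : ℝ × ℝ → G} (hf : ContDiff ℝ (⊤ : ℕ∞) f) {g : ℝ × ℝ → H} (hg : ContDiff ℝ (⊤ : ℕ∞) g) {j k : ℕ}
    (h : ∀ x, ‖iteratedFDeriv ℝ j f x‖ ≤ ‖iteratedFDeriv ℝ k g x‖) : dSq j f ≤ dSq k g :=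
  integral_mono (dSq_int hf j) (dSq_int hg k) fun x => pow_le_pow_left₀ (norm_nonneg _) (h x) 2

theorem dSq_mono2 {G H K : Type*} [NormedAddCommGroup G] [NormedSpace ℝ G] [NormedAddCommGroup H] [NormedSpace ℝ H]
    [NormedAddCommGroup K] [NormedSpace ℝ K]
    {f : ℝ × ℝ → G} (hf : ContDiff ℝ (⊤ : ℕ∞) f) {g : ℝ × ℝ → H} (hg : ContDiff ℝ (⊤ : ℕ∞) g)
    {h : ℝ × ℝ → K} (hh : ContDiff ℝ (⊤ : ℕ∞) h) {j k l : ℕ}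
    (H : ∀ x, ‖iteratedFDeriv ℝ j f x‖ ≤ ‖iteratedFDeriv ℝ k g x‖ + ‖iteratedFDeriv ℝ l h x‖) :
    dSq j f ≤ 2 * (dSq k g + dSq l h) := by
  unfold dSq
  rw [← integral_add (dSq_int hg k) (dSq_int hh l), ← integral_const_mul]
  refine integral_mono (dSq_int hf j) (((dSq_int hg k).add (dSq_int hh l)).const_mul 2) fun x => ?_
  have := pow_le_pow_left₀ (norm_nonneg _) (H x) 2
  simp only
  nlinarith [sq_nonneg (‖iteratedFDeriv ℝ k g x‖ - ‖iteratedFDeriv ℝ l h x‖)]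

/-- time slices -/
def sl (V : V3 → ℝ) (t : ℝ) : ℝ × ℝ → ℝ := fun x => V (t, x)

theorem sl_cd {V : V3 → ℝ} (hV : ContDiff ℝ (⊤ : ℕ∞) V) (t : ℝ) : ContDiff ℝ (⊤ : ℕ∞) (sl V t) :=
  hV.comp (contDiff_const.prodMk contDiff_id)

theorem sl_fd {V : V3 → ℝ} (hV : ContDiff ℝ (⊤ : ℕ∞) V) (t : ℝ) (x v : ℝ × ℝ) :
    fderiv ℝ (sl V t) x v = fderiv ℝ V (t, x) (0, v) := by
  have h1 : HasFDerivAt (fun x : ℝ × ℝ => ((t, x) : V3)) (ContinuousLinearMap.inr ℝ ℝ (ℝ × ℝ)) x :=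
    hasFDerivAt_prodMk_right t x
  have h2 := ((SP_diff hV) (t, x)).hasFDerivAt.comp x h1
  have : fderiv ℝ (sl V t) x = _ := h2.fderiv
  rw [this]; simp

theorem d1_sl {V : V3 → ℝ} (hV : ContDiff ℝ (⊤ : ℕ∞) V) (t : ℝ) : d1 (sl V t) = sl (pd w1 V) t :=
  funext fun x => sl_fd hV t x _
theorem d2_sl {V : V3 → ℝ} (hV : ContDiff ℝ (⊤ : ℕ∞) V) (t : ℝ) : d2 (sl V t) = sl (pd w2 V) t :=
  funext fun x => sl_fd hV t x _
theorem dt_sl {V : V3 → ℝ} (hV : ContDiff ℝ (⊤ : ℕ∞) V) (t : ℝ) : dt (sl V) t = sl (pd w0 V) t :=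
  funext fun x => (pd_t hV t x.1 x.2).deriv

theorem dSq_sl0 (V : V3 → ℝ) (t : ℝ) : dSq 0 (sl V t) = q2 V t := by
  unfold dSq q2
  refine integral_congr_ae (Eventually.of_forall fun x => ?_)
  simp only [norm_iteratedFDeriv_zero, sl, Real.norm_eq_abs, sq, abs_mul_abs_self]

theorem dSq_sl_succ {V : V3 → ℝ} (hV : ContDiff ℝ (⊤ : ℕ∞) V) (t : ℝ) (j : ℕ) :
    dSq (j + 1) (sl V t) ≤ 2 * (dSq j (sl (pd w1 V) t) + dSq j (sl (pd w2 V) t)) := by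
  rw [← d1_sl hV, ← d2_sl hV]
  exact dSq_mono2 (sl_cd hV t) (d1_cd (sl_cd hV t)) (d2_cd (sl_cd hV t)) fun x => nI_succ (sl_cd hV t) j x
theorem dSq_sl_1 {V : V3 → ℝ} (hV : ContDiff ℝ (⊤ : ℕ∞) V) (t : ℝ) (j : ℕ) :
    dSq j (sl (pd w1 V) t) ≤ dSq (j + 1) (sl V t) := by
  rw [← d1_sl hV]
  exact dSq_mono (d1_cd (sl_cd hV t)) (sl_cd hV t) fun x => nI_d1 (sl_cd hV t) j x
theorem dSq_sl_2 {V : V3 → ℝ} (hV : ContDiff ℝ (⊤ : ℕ∞) V) (t : ℝ) (j : ℕ) :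
    dSq j (sl (pd w2 V) t) ≤ dSq (j + 1) (sl V t) := by
  rw [← d2_sl hV]
  exact dSq_mono (d2_cd (sl_cd hV t)) (sl_cd hV t) fun x => nI_d2 (sl_cd hV t) j x

theorem dSq_smul {V : V3 → ℝ} (hV : ContDiff ℝ (⊤ : ℕ∞) V) (c t : ℝ) (j : ℕ) :
    dSq j (sl (fun p => c * V p) t) = c ^ 2 * dSq j (sl V t) := by
  unfold dSq
  rw [← integral_const_mul]
  refine integral_congr_ae (Eventually.of_forall fun x => ?_)
  have : iteratedFDeriv ℝ j (sl (fun p => c * V p) t) x = c • iteratedFDeriv ℝ j (sl V t) x := by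
    have h : ContDiffAt ℝ j (sl V t) x := (sl_cd hV t).contDiffAt.of_le ile
    exact iteratedFDeriv_const_smul_apply' (a := c) h
  simp only [this, norm_smul, mul_pow, Real.norm_eq_abs, sq_abs]

/-- constants -/
def hsC : ℕ → ℝ
  | 0 => 1
  | k + 1 => 3 + 6 * hsC k

theorem hsC_pos (k : ℕ) : 1 ≤ hsC k := by
  induction k with
  | zero => simp [hsC]
  | succ k ih => rw [hsC]; linarith

theorem nm_dSq (v : AA F) (j : JJ F) : nm (π' F v) j ^ 2 = dSq 0 (sl (v j.1.1).1 j.1.2) := by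
  rw [nm_π, dSq_sl0]

theorem hs_le_dSq (k : ℕ) (v : AA F) (j : JJ F) :
    hs k (π' F v) j ^ 2 ≤ hsC k * ∑ l ∈ Finset.range (k + 1), F.e j.1.1 ^ (2 * l) * dSq l (sl (v j.1.1).1 j.1.2) := by
  induction k generalizing v with
  | zero => simp only [hs, hsC]; rw [nm_dSq]; simp
  | succ k ih =>
    have h1 := ih (dA F (fun i => F.e i) w1 v)
    have h2 := ih (dA F (fun i => F.e i) w2 v)
    have hs1 : hs (k + 1) (π' F v) j = nm (π' F v) j + hs k (D1 (π' F v)) j + hs k (D2 (π' F v)) j := rfl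
    rw [hs1, D1_π, D2_π]
    have sm := (v j.1.1).2.1
    have n0 : 0 ≤ ∑ l ∈ Finset.range (k + 1), F.e j.1.1 ^ (2 * (l + 1)) * dSq (l + 1) (sl (v j.1.1).1 j.1.2) :=
      Finset.sum_nonneg fun l _ => mul_nonneg (pow_nonneg (F.e_pos _).le _) (dSq_nonneg _ _)
    have b1 : ∑ l ∈ Finset.range (k + 1), F.e j.1.1 ^ (2 * l) * dSq l (sl (dA F (fun i => F.e i) w1 v j.1.1).1 j.1.2)
        ≤ ∑ l ∈ Finset.range (k + 1), F.e j.1.1 ^ (2 * (l + 1)) * dSq (l + 1) (sl (v j.1.1).1 j.1.2) := by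
      refine Finset.sum_le_sum fun l _ => ?_
      rw [dA_fun, dSq_smul (pd_cd sm _)]
      have := dSq_sl_1 sm j.1.2 l
      have e := (F.e_pos j.1.1).le
      calc _ = F.e j.1.1 ^ (2 * (l + 1)) * dSq l (sl (pd w1 (v j.1.1).1) j.1.2) := by ring
        _ ≤ _ := by gcongr
    have b2 : ∑ l ∈ Finset.range (k + 1), F.e j.1.1 ^ (2 * l) * dSq l (sl (dA F (fun i => F.e i) w2 v j.1.1).1 j.1.2)
        ≤ ∑ l ∈ Finset.range (k + 1), F.e j.1.1 ^ (2 * (l + 1)) * dSq (l + 1) (sl (v j.1.1).1 j.1.2) := by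
      refine Finset.sum_le_sum fun l _ => ?_
      rw [dA_fun, dSq_smul (pd_cd sm _)]
      have := dSq_sl_2 sm j.1.2 l
      have e := (F.e_pos j.1.1).le
      calc _ = F.e j.1.1 ^ (2 * (l + 1)) * dSq l (sl (pd w2 (v j.1.1).1) j.1.2) := by ring
        _ ≤ _ := by gcongr
    rw [Finset.sum_range_succ']
    have z := nm_dSq v j
    have zn := dSq_nonneg (sl (v j.1.1).1 j.1.2) 0
    have hC := hsC_pos k
    have hC2 : hsC (k + 1) = 3 + 6 * hsC k := rfl
    set B := ∑ l ∈ Finset.range (k + 1), F.e j.1.1 ^ (2 * (l + 1)) * dSq (l + 1) (sl (v j.1.1).1 j.1.2)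
    have g1 := h1.trans (mul_le_mul_of_nonneg_left b1 (by linarith))
    have g2 := h2.trans (mul_le_mul_of_nonneg_left b2 (by linarith))
    rw [hC2]
    simp only [mul_zero, pow_zero, one_mul]
    rw [← z] at zn ⊢
    have q := sq_nonneg (nm (π' F v) j)
    nlinarith [sq_nonneg (nm (π' F v) j - hs k (π' F (dA F (fun i => F.e i) w1 v)) j), sq_nonneg (nm (π' F v) j - hs k (π' F (dA F (fun i => F.e i) w2 v)) j),
      sq_nonneg (hs k (π' F (dA F (fun i => F.e i) w2 v)) j - hs k (π' F (dA F (fun i => F.e i) w1 v)) j), mul_nonneg (by linarith : 0 ≤ hsC k) q]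

theorem dSq_le_hs (l : ℕ) (v : AA F) (j : JJ F) :
    F.e j.1.1 ^ (2 * l) * dSq l (sl (v j.1.1).1 j.1.2) ≤ 2 ^ l * hs l (π' F v) j ^ 2 := by
  induction l generalizing v with
  | zero => simp only [hs]; rw [nm_dSq]; simp
  | succ l ih =>
    have h1 := ih (dA F (fun i => F.e i) w1 v)
    have h2 := ih (dA F (fun i => F.e i) w2 v)
    have sm := (v j.1.1).2.1
    have hs1 : hs (l + 1) (π' F v) j = nm (π' F v) j + hs l (D1 (π' F v)) j + hs l (D2 (π' F v)) j := rfl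
    rw [hs1, D1_π, D2_π]
    rw [dA_fun, dSq_smul (pd_cd sm _)] at h1 h2
    have e := (F.e_pos j.1.1).le
    have h3 := mul_le_mul_of_nonneg_left (dSq_sl_succ sm j.1.2 l) (pow_nonneg e (2 * (l + 1)))
    refine h3.trans ?_
    have a0 := nm_nonneg (π' F v) j
    have a1 := hs_nonneg l (π' F (dA F (fun i => F.e i) w1 v)) j
    have a2 := hs_nonneg l (π' F (dA F (fun i => F.e i) w2 v)) j
    calc _ = 2 * (F.e j.1.1 ^ (2 * l) * (F.e j.1.1 ^ 2 * dSq l (sl (pd w1 (v j.1.1).1) j.1.2)) + 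
            F.e j.1.1 ^ (2 * l) * (F.e j.1.1 ^ 2 * dSq l (sl (pd w2 (v j.1.1).1) j.1.2))) := by ring
      _ ≤ 2 * (2 ^ l * hs l (π' F (dA F (fun i => F.e i) w1 v)) j ^ 2 + 2 ^ l * hs l (π' F (dA F (fun i => F.e i) w2 v)) j ^ 2) := by
        gcongr
      _ = 2 ^ (l + 1) * (hs l (π' F (dA F (fun i => F.e i) w1 v)) j ^ 2 + hs l (π' F (dA F (fun i => F.e i) w2 v)) j ^ 2) := by ring
      _ ≤ _ := by
        gcongr
        nlinarith [mul_nonneg a0 a1, mul_nonneg a0 a2, mul_nonneg a1 a2]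

/-- derivative of space integrals -/
theorem int_t {V : V3 → ℝ} (hV : ContDiff ℝ (⊤ : ℕ∞) V) (t : ℝ) :
    HasDerivAt (fun t => ∫ x in Ω, V (t, x)) (∫ x in Ω, pd w0 V (t, x)) t := by
  refine par_deriv (μ := (volume : Measure (ℝ × ℝ))) (A := Ω) (K := Set.Icc 0 (2 * π) ×ˢ Set.Icc 0 1)
    (isCompact_Icc.prod isCompact_Icc) Ω_meas Ω_sub ?_ (f := fun t x => V (t, x)) (f' := fun t x => pd w0 V (t, x))
    hV.continuous (pd_cd hV w0).continuous (fun t a => pd_t hV t a.1 a.2) t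
  exact ((measure_mono Ω_sub).trans_lt (isCompact_Icc.prod isCompact_Icc).measure_lt_top).ne

theorem dSq_bdd {V : V3 → ℝ} (hV : ContDiff ℝ (⊤ : ℕ∞) V) (j : ℕ) (T : ℝ) :
    ∃ B, ∀ s ∈ Set.Icc 0 T, dSq j (sl V s) ≤ B := by
  induction j generalizing V with
  | zero =>
    have hc : Continuous fun t => ∫ x in Ω, (fun p => V p * V p) (t, x) :=
      continuous_iff_continuousAt.2 fun t => (int_t (V := fun p => V p * V p) (hV.mul hV) t).continuousAt
    obtain ⟨B, hB⟩ := (isCompact_Icc (a := 0) (b := T)).exists_bound_of_continuousOn hc.continuousOn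
    refine ⟨B, fun s hs => ?_⟩
    rw [dSq_sl0]
    exact (le_abs_self _).trans (hB s hs)
  | succ j ih =>
    obtain ⟨B1, h1⟩ := ih (pd_cd hV w1)
    obtain ⟨B2, h2⟩ := ih (pd_cd hV w2)
    exact ⟨2 * (B1 + B2), fun s hs => (dSq_sl_succ hV s j).trans (by linarith [h1 s hs, h2 s hs])⟩
end Con
end Couette
end

noncomputable section
open MeasureTheory Real Filter Topology
set_option linter.unusedSectionVars false
set_option linter.unusedVariables false
set_option linter.ambiguousOpen false
set_option linter.deprecated false
namespace Couette
namespace Con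
open Couette.Core CB
variable {F : Fam}

theorem osc_sq {w w' : ℝ → ℝ} (hw : ∀ y, HasDerivAt w (w' y) y) (hc : Continuous w') {L s y : ℝ} (hL : 0 < L)
    (hs : s ∈ Set.Icc 0 L) (hy : y ∈ Set.Icc 0 L) :
    (w y - w s) ^ 2 ≤ L * ∫ r in (0 : ℝ)..L, w' r * w' r := by
  set d := w y - w s with hd
  have h := osc (w := fun r => d * w r) (w' := fun r => d * w' r) (g := fun r => d ^ 2 / (2 * L) + L / 2 * (w' r * w' r))
    (fun r => (hw r).const_mul d) (by fun_prop) (by fun_prop) (fun r => by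
      have e1 : d ^ 2 / (2 * L) + L / 2 * (w' r * w' r) - d * w' r = (d - L * w' r) ^ 2 / (2 * L) := by field_simp; ring
      have e2 : d ^ 2 / (2 * L) + L / 2 * (w' r * w' r) + d * w' r = (d + L * w' r) ^ 2 / (2 * L) := by field_simp; ring
      have p1 : 0 ≤ (d - L * w' r) ^ 2 / (2 * L) := by positivity
      have p2 : 0 ≤ (d + L * w' r) ^ 2 / (2 * L) := by positivity
      rw [abs_le]; constructor <;> linarith) hs hy
  rw [intervalIntegral.integral_add (by simp) (Continuous.intervalIntegrable (by fun_prop) _ _),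
    intervalIntegral.integral_const_mul] at h
  simp only [intervalIntegral.integral_const, sub_zero, smul_eq_mul] at h
  have e3 : L * (d ^ 2 / (2 * L)) = d ^ 2 / 2 := by field_simp
  rw [e3] at h
  have : d * w y - d * w s = d ^ 2 := by rw [hd]; ring
  linarith

theorem poin0 {f : V3 → ℝ} (hf : ContDiff ℝ (⊤ : ℕ∞) f) (t : ℝ) (h : ∫ x in Ω, f (t, x) = 0) :
    q2 f t ≤ 8 * π ^ 2 * q2 (pd w1 f) t + 2 * q2 (pd w2 f) t := by
  have hc := slice_cont hf t
  have hc1 := slice_cont (pd_cd hf w1) t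
  have hc2 := slice_cont (pd_cd hf w2) t
  have hq1 : Continuous fun x : ℝ × ℝ => pd w1 f (t, x) * pd w1 f (t, x) := hc1.mul hc1
  have hq2 : Continuous fun x : ℝ × ℝ => pd w2 f (t, x) * pd w2 f (t, x) := hc2.mul hc2
  set G1 := fun y => ∫ x in (0 : ℝ)..(2 * π), pd w1 f (t, (x, y)) * pd w1 f (t, (x, y)) with hG1
  set G2 := fun x => ∫ y in (0 : ℝ)..1, pd w2 f (t, (x, y)) * pd w2 f (t, (x, y)) with hG2
  have cG1 : Continuous G1 := par_y hq1
  have cG2 : Continuous G2 := par_x hq2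
  have i1 : ∫ x in Ω, G1 x.2 = 2 * π * q2 (pd w1 f) t := by
    rw [int_Ω (f := fun x => G1 x.2) (by fun_prop)]
    simp only [intervalIntegral.integral_const, sub_zero, smul_eq_mul]
    unfold q2; rw [int_Ω' hq1]
  have i2 : ∫ x in Ω, G2 x.1 = q2 (pd w2 f) t := by
    rw [int_Ω (f := fun x => G2 x.1) (by fun_prop)]
    simp only [intervalIntegral.integral_const, sub_zero, smul_eq_mul, one_mul]
    unfold q2; rw [int_Ω hq2]
  have vol : ∀ c : ℝ, ∫ x in Ω, c = 2 * π * c := fun c => by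
    have : ∫ x in Ω, c = ∫ x in Ω, (1 : ℝ) * c := by simp
    rw [this, integral_mul_const, vol_Ω]
  have key : ∀ p ∈ Ω, 2 * π * (f (t, p) * f (t, p)) ≤ 8 * π ^ 2 * G1 p.2 + 2 * q2 (pd w2 f) t := by
    intro p hp
    have hm : ∫ q in Ω, (f (t, p) - f (t, q)) ^ 2 ≤ ∫ q in Ω, (4 * π * G1 p.2 + 2 * G2 q.1) := by
      refine setIntegral_mono_on (Ω_int (by fun_prop)) (Ω_int (by fun_prop)) Ω_meas fun q hq => ?_
      have a1 := osc_sq (w := fun x => f (t, (x, p.2))) (fun x => pd_x hf t x p.2)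
        (hc1.comp (by fun_prop : Continuous fun x : ℝ => (x, p.2))) (L := 2 * π) (by positivity)
        (s := q.1) (y := p.1) ⟨hq.1.1.le, hq.1.2.le⟩ ⟨hp.1.1.le, hp.1.2.le⟩
      have a2 := osc_sq (w := fun y => f (t, (q.1, y))) (fun y => pd_y hf t q.1 y)
        (hc2.comp (by fun_prop : Continuous fun y : ℝ => (q.1, y))) (L := 1) (by positivity)
        (s := q.2) (y := p.2) ⟨hq.2.1.le, hq.2.2.le⟩ ⟨hp.2.1.le, hp.2.2.le⟩
      change (f (t, p) - f (t, (q.1, p.2))) ^ 2 ≤ 2 * π * G1 p.2 at a1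
      change (f (t, (q.1, p.2)) - f (t, q)) ^ 2 ≤ 1 * G2 q.1 at a2
      nlinarith [sq_nonneg ((f (t, p) - f (t, (q.1, p.2))) - (f (t, (q.1, p.2)) - f (t, q)))]
    rw [integral_add (by exact Ω_int continuous_const) (by exact Ω_int (by fun_prop)), vol, integral_const_mul, i2] at hm
    have he : ∫ q in Ω, (f (t, p) - f (t, q)) ^ 2 = 2 * π * (f (t, p) * f (t, p)) + q2 f t := by
      have e1 : ∀ q, (f (t, p) - f (t, q)) ^ 2 = (f (t, p) * f (t, p) - 2 * f (t, p) * f (t, q)) + f (t, q) * f (t, q) :=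
        fun q => by ring
      simp only [e1]
      rw [integral_add (by exact Ω_int (by fun_prop)) (by exact Ω_int (by fun_prop)),
        integral_sub (by exact Ω_int continuous_const) (by exact Ω_int (by fun_prop)), vol, integral_const_mul, h]
      unfold q2; ring
    rw [he] at hm
    have := q2_nonneg f t
    nlinarith
  have hm := setIntegral_mono_on (Ω_int (by fun_prop)) (Ω_int (by fun_prop)) Ω_meas key
  rw [integral_add (by exact Ω_int (by fun_prop)) (by exact Ω_int continuous_const), vol, integral_const_mul,
    integral_const_mul, i1] at hm
  have hp : 0 < 2 * π := by positivity
  refine le_of_mul_le_mul_left ?_ hp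
  unfold q2 at hm ⊢
  nlinarith

/-- Extension of an identity from the open cell to the closed strip. -/
theorem ext0 {f : V3 → ℝ} (hf : f ∈ SP) (t : ℝ) (h : ∀ x ∈ Ω, f (t, x) = 0) (x y : ℝ) (hy : y ∈ Set.Icc (0 : ℝ) 1) :
    f (t, (x, y)) = 0 := by
  have hc := slice_cont hf.1 t
  have hcl : closure Ω ⊆ {x | f (t, x) = 0} := closure_minimal h (isClosed_eq hc continuous_const)
  have hΩ : closure Ω = Set.Icc 0 (2 * π) ×ˢ Set.Icc 0 1 := by
    rw [Ω_eq, closure_prod_eq, closure_Ioo (by positivity), closure_Ioo zero_ne_one]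
  have hper : Function.Periodic (fun x => f (t, (x, y))) (2 * π) := fun x => hf.2 t x y
  obtain ⟨z, hz, e⟩ := hper.exists_mem_Ico₀ (by positivity : 0 < 2 * π) x
  have e' : f (t, (x, y)) = f (t, (z, y)) := e
  rw [e']
  exact hcl (by rw [hΩ]; exact ⟨⟨hz.1, hz.2.le⟩, hy⟩)

/-- A smooth function equal to `1/s` for `s ≥ 1/2`. -/
def hinv (s : ℝ) : ℝ := Real.smoothTransition (4 * s - 1) / s

theorem hinv_eq {s : ℝ} (hs : 1 / 2 ≤ s) : hinv s = s⁻¹ := by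
  rw [hinv, Real.smoothTransition.one_of_one_le (by linarith), one_div]

theorem hinv_cd : ContDiff ℝ (⊤ : ℕ∞) hinv := by
  rw [contDiff_iff_contDiffAt]
  intro s
  by_cases hs : s < 1 / 4
  · have : hinv =ᶠ[𝓝 s] fun _ => 0 := by
      filter_upwards [gt_mem_nhds hs] with r hr
      rw [hinv, Real.smoothTransition.zero_of_nonpos (by linarith), zero_div]
    exact contDiffAt_const.congr_of_eventuallyEq this
  · have h1 : ContDiff ℝ (⊤ : ℕ∞) fun s : ℝ => Real.smoothTransition (4 * s - 1) :=
      Real.smoothTransition.contDiff.comp ((contDiff_const.mul contDiff_id).sub contDiff_const)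
    exact h1.contDiffAt.div contDiffAt_id (by simp; intro h; rw [h] at hs; norm_num at hs)

/-- vector fields versus components -/
theorem vec_le {f : ℝ × ℝ → ℝ × ℝ} (hf : ContDiff ℝ (⊤ : ℕ∞) f) (j : ℕ) :
    dSq j (fun y => (f y).1) ≤ dSq j f ∧ dSq j (fun y => (f y).2) ≤ dSq j f ∧
    dSq j f ≤ 2 * (dSq j (fun y => (f y).1) + dSq j (fun y => (f y).2)) := by
  have h1 : ContDiff ℝ (⊤ : ℕ∞) (fun y => (f y).1) := contDiff_fst.comp hf
  have h2 : ContDiff ℝ (⊤ : ℕ∞) (fun y => (f y).2) := contDiff_snd.comp hf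
  refine ⟨dSq_mono h1 hf fun x => clm_le (ContinuousLinearMap.fst ℝ ℝ ℝ) (ContinuousLinearMap.norm_fst_le ..) hf j x,
    dSq_mono h2 hf fun x => clm_le (ContinuousLinearMap.snd ℝ ℝ ℝ) (ContinuousLinearMap.norm_snd_le ..) hf j x,
    dSq_mono2 hf h1 h2 fun x => ?_⟩
  set L1 := ContinuousLinearMap.inl ℝ ℝ ℝ
  set L2 := ContinuousLinearMap.inr ℝ ℝ ℝ
  have e : f = (fun y => L1 (f y).1) + fun y => L2 (f y).2 := by
    funext y; ext <;> simp [L1, L2]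
  have a1 : ContDiffAt ℝ j (fun y => L1 (f y).1) x := (L1.contDiff.comp h1).contDiffAt.of_le ile
  have a2 : ContDiffAt ℝ j (fun y => L2 (f y).2) x := (L2.contDiff.comp h2).contDiffAt.of_le ile
  conv_lhs => rw [e, iteratedFDeriv_add_apply a1 a2]
  have n1 : ‖L1‖ ≤ 1 := ContinuousLinearMap.opNorm_le_bound _ zero_le_one fun x => by simp [L1, Prod.norm_def]
  have n2 : ‖L2‖ ≤ 1 := ContinuousLinearMap.opNorm_le_bound _ zero_le_one fun x => by simp [L2, Prod.norm_def]
  exact (norm_add_le _ _).trans (add_le_add (clm_le L1 n1 h1 j x) (clm_le L2 n2 h2 j x))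

/-- vector slices -/
theorem dt_vec {ψ : ℝ → ℝ × ℝ → ℝ × ℝ} (h : ContDiff ℝ (⊤ : ℕ∞) (Function.uncurry ψ)) (t : ℝ) :
    dt ψ t = fun x => (sl (pd w0 fun p => (ψ p.1 p.2).1) t x, sl (pd w0 fun p => (ψ p.1 p.2).2) t x) := by
  funext x
  have h1 : ContDiff ℝ (⊤ : ℕ∞) (fun p : V3 => (ψ p.1 p.2).1) := contDiff_fst.comp h
  have h2 : ContDiff ℝ (⊤ : ℕ∞) (fun p : V3 => (ψ p.1 p.2).2) := contDiff_snd.comp h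
  exact ((pd_t h1 t x.1 x.2).prodMk (pd_t h2 t x.1 x.2)).deriv
end Con
end Couette
end

noncomputable section
open MeasureTheory Real Filter Topology
set_option linter.unusedSectionVars false
set_option linter.unusedVariables false
set_option linter.ambiguousOpen false
set_option linter.deprecated false
namespace Couette
namespace Con
open Couette.Core CB
variable {F : Fam}

/-- the sup-part integrands -/
def Msup (ε : ℝ) (φ : ℝ → ℝ × ℝ → ℝ) (ψ : ℝ → ℝ × ℝ → ℝ × ℝ) (θ : ℝ → ℝ × ℝ → ℝ) (s : ℝ) : ℝ :=
  (ε ^ 2)⁻¹ * (L2Sq (ψ s) + (ε ^ 2)⁻¹ * L2Sq (φ s) + (ε ^ 2)⁻¹ * L2Sq (θ s))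
    + (dSq 1 (ψ s) + (ε ^ 2)⁻¹ * dSq 1 (θ s))
    + (ε ^ 2)⁻¹ * dSq 1 (φ s)
    + ε ^ 2 * ((ε ^ 2)⁻¹ * L2Sq (dt φ s) + L2Sq (dt ψ s) + (ε ^ 2)⁻¹ * L2Sq (dt θ s))
    + ε ^ 2 * ((ε ^ 2)⁻¹ * dSq 2 (φ s) + dSq 2 (ψ s) + (ε ^ 2)⁻¹ * dSq 2 (θ s))
    + ε ^ 4 * ((ε ^ 2)⁻¹ * dSq 3 (φ s) + (dSq 3 (ψ s) + dSq 1 (dt ψ s))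
        + (ε ^ 2)⁻¹ * (dSq 3 (θ s) + dSq 1 (dt θ s)))

structure Ix (γ Pr r Re Kχ : ℝ) where
  ε : ℝ
  χ : ℝ
  T : ℝ
  S : PerturbSol γ Pr r Re ε χ T
  hε : 0 < ε
  hε2 : ε ≤ 1 / 2
  hχ : |1 - χ| ≤ Kχ * ε
  hχ2 : |1 - χ| ≤ 1 / 2
  hT : 0 < T
  sm : SmoothSol S
  std : StdHyp S
  small : ∀ s ∈ Set.Icc 0 T, Msup ε S.φ S.ψ S.θ s ≤ 1 / 67620

structure Par where
  γ : ℝ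
  Pr : ℝ
  r : ℝ
  Re : ℝ
  Kχ : ℝ
  hγ : 1 < γ
  hPr : 0 < Pr
  hr : 0 < 1 + r
  hK : 0 < Kχ
  hRe : 0 < Re

abbrev Par.I (P : Par) : Type := Ix P.γ P.Pr P.r P.Re P.Kχ

@[reducible] def fam (P : Par) : Fam where
  ι := P.I
  e := fun i => i.ε
  T := fun i => i.T
  e_pos := fun i => i.hε
  e_le := fun i => i.hε2.trans (by norm_num)
  T_pos := fun i => i.hT

variable {P : Par}

def U0 (i : P.I) : SP := ⟨fun p => i.S.φ p.1 p.2, i.sm.1, fun t x y => i.S.periodic_φ t (x, y)⟩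
def U1 (i : P.I) : SP := ⟨fun p => (i.S.ψ p.1 p.2).1, contDiff_fst.comp i.sm.2.1,
  fun t x y => congrArg Prod.fst (i.S.periodic_ψ t (x, y))⟩
def U2 (i : P.I) : SP := ⟨fun p => (i.S.ψ p.1 p.2).2, contDiff_snd.comp i.sm.2.1,
  fun t x y => congrArg Prod.snd (i.S.periodic_ψ t (x, y))⟩
def U3 (i : P.I) : SP := ⟨fun p => i.S.θ p.1 p.2, i.sm.2.2, fun t x y => i.S.periodic_θ t (x, y)⟩

theorem tT_cd (γ Pr ε χ : ℝ) : ContDiff ℝ (⊤ : ℕ∞) fun p : V3 => tT γ Pr ε χ p.2 := by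
  unfold tT; fun_prop

def TT (i : P.I) : SP := ⟨fun p => tT P.γ P.Pr i.ε i.χ p.2, tT_cd _ _ _ _, fun _ _ _ => rfl⟩
def RT (i : P.I) : SP := ⟨fun p => hinv (tT P.γ P.Pr i.ε i.χ p.2), hinv_cd.comp (tT_cd _ _ _ _), fun _ _ _ => rfl⟩
def XX (i : P.I) : SP := ⟨fun p => p.2.2, by fun_prop, fun _ _ _ => rfl⟩

theorem tT_ge (i : P.I) {x : ℝ × ℝ} (hx : x.2 ∈ Set.Icc (0 : ℝ) 1) : 1 / 2 ≤ tT P.γ P.Pr i.ε i.χ x := by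
  have h := abs_le.1 i.hχ2
  have hg := P.hγ
  have hp := P.hPr
  have hc : 0 ≤ i.ε ^ 2 * P.Pr / (2 * (P.γ / (P.γ - 1))) := by
    have : 0 < P.γ - 1 := by linarith
    have : 0 < P.γ := by linarith
    positivity
  unfold tT
  have : 0 ≤ i.ε ^ 2 * P.Pr / (2 * (P.γ / (P.γ - 1))) * (x.2 - x.2 ^ 2) :=
    mul_nonneg hc (by nlinarith [hx.1, hx.2])
  nlinarith [hx.1, hx.2]

theorem tρ_eq (i : P.I) {x : ℝ × ℝ} (hx : x.2 ∈ Set.Icc (0 : ℝ) 1) (t : ℝ) :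
    tρ P.γ P.Pr i.ε i.χ x = (RT i).1 (t, x) := (hinv_eq (tT_ge i hx)).symm

theorem Ω_open : IsOpen Ω := isOpen_Ioo.prod isOpen_Ioo

theorem tρ_ev (i : P.I) {x : ℝ × ℝ} (hx : x ∈ Ω) (t : ℝ) :
    tρ P.γ P.Pr i.ε i.χ =ᶠ[𝓝 x] sl (RT i).1 t := by
  filter_upwards [Ω_open.mem_nhds hx] with y hy
  exact tρ_eq i ⟨hy.2.1.le, hy.2.2.le⟩ t

theorem pd1_indep {f : V3 → ℝ} (hf : ContDiff ℝ (⊤ : ℕ∞) f) (h : ∀ t x x' y, f (t, (x, y)) = f (t, (x', y))) (p : V3) :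
    pd w1 f p = 0 := by
  have h1 := pd_x hf p.1 p.2.1 p.2.2
  have h2 : HasDerivAt (fun s : ℝ => f (p.1, (s, p.2.2))) 0 p.2.1 := by
    have : (fun s : ℝ => f (p.1, (s, p.2.2))) = fun _ => f (p.1, (0, p.2.2)) := funext fun s => h _ _ _ _
    rw [this]; exact hasDerivAt_const _ _
  exact h1.unique h2

theorem pd_add {f g : V3 → ℝ} (hf : ContDiff ℝ (⊤ : ℕ∞) f) (hg : ContDiff ℝ (⊤ : ℕ∞) g) (v : V3) :
    pd v (fun p => f p + g p) = fun p => pd v f p + pd v g p := by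
  funext p
  have := fderiv_add (SP_diff hf p) (SP_diff hg p)
  show fderiv ℝ (f + g) p v = _
  rw [this]; rfl

/-- pressure perturbation -/
def PQ (i : P.I) : SP := TT i * U0 i + RT i * U3 i + U0 i * U3 i

theorem press (i : P.I) {x : ℝ × ℝ} (hx : x ∈ Ω) (t : ℝ) (v : ℝ × ℝ) :
    fderiv ℝ (fun y => pρ P.γ P.Pr i.ε i.χ i.S.φ t y * pT P.γ P.Pr i.ε i.χ i.S.θ t y) x v
      = pd (0, v) (PQ i).1 (t, x) := by
  have : (fun y => pρ P.γ P.Pr i.ε i.χ i.S.φ t y * pT P.γ P.Pr i.ε i.χ i.S.θ t y) =ᶠ[𝓝 x]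
      fun y => sl (PQ i).1 t y + 1 := by
    filter_upwards [Ω_open.mem_nhds hx] with y hy
    have h1 := tρ_eq i (x := y) ⟨hy.2.1.le, hy.2.2.le⟩ t
    have h2 := tT_ge i (x := y) ⟨hy.2.1.le, hy.2.2.le⟩
    have h3 : (RT i).1 (t, y) * tT P.γ P.Pr i.ε i.χ y = 1 := by
      rw [← h1, tρ]; exact inv_mul_cancel₀ (by linarith)
    show (tρ P.γ P.Pr i.ε i.χ y + (U0 i).1 (t, y)) * (tT P.γ P.Pr i.ε i.χ y + (U3 i).1 (t, y))
      = tT P.γ P.Pr i.ε i.χ y * (U0 i).1 (t, y) + (RT i).1 (t, y) * (U3 i).1 (t, y) + (U0 i).1 (t, y) * (U3 i).1 (t, y) + 1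
    rw [h1]; linear_combination h3
  rw [this.fderiv_eq, fderiv_add_const, sl_fd (PQ i).2.1]
  rfl

theorem divv_sl (i : P.I) (t : ℝ) : divv (i.S.ψ t) = sl (fun p => pd w1 (U1 i).1 p + pd w2 (U2 i).1 p) t := by
  funext x
  show d1 (sl (U1 i).1 t) x + d2 (sl (U2 i).1 t) x = _
  rw [d1_sl (U1 i).2.1, d2_sl (U2 i).2.1]; rfl

theorem tu1 (x : ℝ × ℝ) : d1 (fun y => (tu y).1) x = 0 := by
  show fderiv ℝ Prod.snd x (1, 0) = 0
  rw [fderiv_snd]; rfl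
theorem tu2 (x : ℝ × ℝ) : d2 (fun y => (tu y).1) x = 1 := by
  show fderiv ℝ Prod.snd x (0, 1) = 1
  rw [fderiv_snd]; rfl
theorem tu3 (x : ℝ × ℝ) : d1 (fun y => (tu y).2) x = 0 := by simp [d1, tu]
theorem tu4 (x : ℝ × ℝ) : d2 (fun y => (tu y).2) x = 0 := by simp [d2, tu]

theorem massC (i : P.I) {t : ℝ} (ht : t ∈ Set.Icc 0 i.T) {x : ℝ × ℝ} (hx : x ∈ Ω) :
    pd w0 (U0 i).1 (t, x) + ((x.2 + (U1 i).1 (t, x)) * pd w1 (U0 i).1 (t, x) + (U2 i).1 (t, x) * pd w2 (U0 i).1 (t, x))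
      + ((RT i).1 (t, x) + (U0 i).1 (t, x)) * (pd w1 (U1 i).1 (t, x) + pd w2 (U2 i).1 (t, x))
      + (U2 i).1 (t, x) * pd w2 (RT i).1 (t, x) = 0 := by
  have h := i.S.mass_eq t ht x hx
  have e0 : dt i.S.φ t x = pd w0 (U0 i).1 (t, x) := congrFun (dt_sl (U0 i).2.1 t) x
  have e1 : d1 (i.S.φ t) x = pd w1 (U0 i).1 (t, x) := congrFun (d1_sl (U0 i).2.1 t) x
  have e2 : d2 (i.S.φ t) x = pd w2 (U0 i).1 (t, x) := congrFun (d2_sl (U0 i).2.1 t) x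
  have r1 : d1 (tρ P.γ P.Pr i.ε i.χ) x = 0 := by
    rw [d1, (tρ_ev i hx t).fderiv_eq, ← d1, d1_sl (RT i).2.1]
    exact pd1_indep (RT i).2.1 (fun _ _ _ _ => rfl) _
  have r2 : d2 (tρ P.γ P.Pr i.ε i.χ) x = pd w2 (RT i).1 (t, x) := by
    rw [d2, (tρ_ev i hx t).fderiv_eq, ← d2, d2_sl (RT i).2.1]; rfl
  have r0 := tρ_eq i (x := x) ⟨hx.2.1.le, hx.2.2.le⟩ t
  rw [divv_sl] at h
  simp only [dot, grad, pu, pρ, e0, e1, e2, r1, r2, r0, sl, tu, Prod.fst_add, Prod.snd_add] at h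
  simp only [U0, U1, U2] at h ⊢
  linarith

theorem mom1C (i : P.I) {t : ℝ} (ht : t ∈ Set.Icc 0 i.T) {x : ℝ × ℝ} (hx : x ∈ Ω) :
    ((RT i).1 (t, x) + (U0 i).1 (t, x)) * (pd w0 (U1 i).1 (t, x) +
      ((x.2 + (U1 i).1 (t, x)) * pd w1 (U1 i).1 (t, x) + (U2 i).1 (t, x) * pd w2 (U1 i).1 (t, x)) + (U2 i).1 (t, x))
      + (i.ε ^ 2)⁻¹ * pd w1 (PQ i).1 (t, x)
      - P.Re⁻¹ * (pd w1 (pd w1 (U1 i).1) (t, x) + pd w2 (pd w2 (U1 i).1) (t, x))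
      - (P.Re⁻¹ + P.r * P.Re⁻¹) * (pd w1 (pd w1 (U1 i).1) (t, x) + pd w1 (pd w2 (U2 i).1) (t, x)) = 0 := by
  have h := i.S.mom_eq1 t ht x hx
  have e0 : (dt i.S.ψ t x).1 = pd w0 (U1 i).1 (t, x) := by rw [dt_vec i.sm.2.1]; rfl
  have e1 : d1 (fun y => (i.S.ψ t y).1) = sl (pd w1 (U1 i).1) t := d1_sl (U1 i).2.1 t
  have e2 : d2 (fun y => (i.S.ψ t y).1) = sl (pd w2 (U1 i).1) t := d2_sl (U1 i).2.1 t
  have r0 := tρ_eq i (x := x) ⟨hx.2.1.le, hx.2.2.le⟩ t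
  have p := press i hx t (1, 0)
  rw [divv_sl, d1_sl ((pd_cd (U1 i).2.1 _).add (pd_cd (U2 i).2.1 _)), pd_add (pd_cd (U1 i).2.1 _) (pd_cd (U2 i).2.1 _), d1, p] at h
  simp only [dot, grad, lap, e0, e1, e2, tu1, tu2, d1_sl (pd_cd (U1 i).2.1 _), d2_sl (pd_cd (U1 i).2.1 _)] at h
  simp only [pu, pρ, r0, sl, tu, Prod.fst_add, Prod.snd_add] at h
  simp only [U0, U1, U2] at h ⊢
  rw [show w1 = ((0 : ℝ), ((1 : ℝ), (0 : ℝ))) from rfl] at h ⊢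
  linarith

theorem mom2C (i : P.I) {t : ℝ} (ht : t ∈ Set.Icc 0 i.T) {x : ℝ × ℝ} (hx : x ∈ Ω) :
    ((RT i).1 (t, x) + (U0 i).1 (t, x)) * (pd w0 (U2 i).1 (t, x) +
      ((x.2 + (U1 i).1 (t, x)) * pd w1 (U2 i).1 (t, x) + (U2 i).1 (t, x) * pd w2 (U2 i).1 (t, x)))
      + (i.ε ^ 2)⁻¹ * pd w2 (PQ i).1 (t, x)
      - P.Re⁻¹ * (pd w1 (pd w1 (U2 i).1) (t, x) + pd w2 (pd w2 (U2 i).1) (t, x))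
      - (P.Re⁻¹ + P.r * P.Re⁻¹) * (pd w2 (pd w1 (U1 i).1) (t, x) + pd w2 (pd w2 (U2 i).1) (t, x)) = 0 := by
  have h := i.S.mom_eq2 t ht x hx
  have e0 : (dt i.S.ψ t x).2 = pd w0 (U2 i).1 (t, x) := by rw [dt_vec i.sm.2.1]; rfl
  have e1 : d1 (fun y => (i.S.ψ t y).2) = sl (pd w1 (U2 i).1) t := d1_sl (U2 i).2.1 t
  have e2 : d2 (fun y => (i.S.ψ t y).2) = sl (pd w2 (U2 i).1) t := d2_sl (U2 i).2.1 t
  have r0 := tρ_eq i (x := x) ⟨hx.2.1.le, hx.2.2.le⟩ t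
  have p := press i hx t (0, 1)
  rw [divv_sl, d2_sl ((pd_cd (U1 i).2.1 _).add (pd_cd (U2 i).2.1 _)), pd_add (pd_cd (U1 i).2.1 _) (pd_cd (U2 i).2.1 _), d2, p] at h
  simp only [dot, grad, lap, e0, e1, e2, tu3, tu4, d1_sl (pd_cd (U2 i).2.1 _), d2_sl (pd_cd (U2 i).2.1 _)] at h
  simp only [pu, pρ, r0, sl, tu, Prod.fst_add, Prod.snd_add] at h
  simp only [U0, U1, U2] at h ⊢
  rw [show w2 = ((0 : ℝ), ((0 : ℝ), (1 : ℝ))) from rfl] at h ⊢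
  linarith

theorem enC (i : P.I) {t : ℝ} (ht : t ∈ Set.Icc 0 i.T) {x : ℝ × ℝ} (hx : x ∈ Ω) :
    ((RT i).1 (t, x) + (U0 i).1 (t, x)) / (P.γ - 1) * (pd w0 (U3 i).1 (t, x) +
      ((x.2 + (U1 i).1 (t, x)) * pd w1 (U3 i).1 (t, x) + (U2 i).1 (t, x) * pd w2 (U3 i).1 (t, x))
        + (U2 i).1 (t, x) * pd w2 (TT i).1 (t, x))
      + ((RT i).1 (t, x) + (U0 i).1 (t, x)) * ((TT i).1 (t, x) + (U3 i).1 (t, x)) *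
        (pd w1 (U1 i).1 (t, x) + pd w2 (U2 i).1 (t, x))
      - P.γ / (P.γ - 1) / (P.Re * P.Pr) * (pd w1 (pd w1 (U3 i).1) (t, x) + pd w2 (pd w2 (U3 i).1) (t, x))
      = i.ε ^ 2 * (2 * P.Re⁻¹ * (pd w1 (U1 i).1 (t, x) ^ 2 + pd w2 (U2 i).1 (t, x) ^ 2)
        + P.Re⁻¹ * (pd w1 (U2 i).1 (t, x) + pd w2 (U1 i).1 (t, x)) ^ 2
        + 2 * P.Re⁻¹ * (pd w1 (U2 i).1 (t, x) + pd w2 (U1 i).1 (t, x))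
        + P.r * P.Re⁻¹ * (pd w1 (U1 i).1 (t, x) + pd w2 (U2 i).1 (t, x)) ^ 2) := by
  have h := i.S.energy_eq t ht x hx
  have e0 : dt i.S.θ t x = pd w0 (U3 i).1 (t, x) := congrFun (dt_sl (U3 i).2.1 t) x
  have e1 : d1 (i.S.θ t) = sl (pd w1 (U3 i).1) t := d1_sl (U3 i).2.1 t
  have e2 : d2 (i.S.θ t) = sl (pd w2 (U3 i).1) t := d2_sl (U3 i).2.1 t
  have a1 : d1 (fun y => (i.S.ψ t y).1) = sl (pd w1 (U1 i).1) t := d1_sl (U1 i).2.1 t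
  have a2 : d2 (fun y => (i.S.ψ t y).1) = sl (pd w2 (U1 i).1) t := d2_sl (U1 i).2.1 t
  have b1 : d1 (fun y => (i.S.ψ t y).2) = sl (pd w1 (U2 i).1) t := d1_sl (U2 i).2.1 t
  have b2 : d2 (fun y => (i.S.ψ t y).2) = sl (pd w2 (U2 i).1) t := d2_sl (U2 i).2.1 t
  have r1 : d1 (tT P.γ P.Pr i.ε i.χ) x = 0 := by
    have : d1 (tT P.γ P.Pr i.ε i.χ) = sl (pd w1 (TT i).1) t := d1_sl (TT i).2.1 t
    rw [this]
    exact pd1_indep (TT i).2.1 (fun _ _ _ _ => rfl) _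
  have r2 : d2 (tT P.γ P.Pr i.ε i.χ) = sl (pd w2 (TT i).1) t := d2_sl (TT i).2.1 t
  have r0 := tρ_eq i (x := x) ⟨hx.2.1.le, hx.2.2.le⟩ t
  rw [divv_sl] at h
  simp only [dot, grad, lap, defContract, e0, e1, e2, a1, a2, b1, b2, r1, r2, tu1, tu2, tu3, tu4,
    d1_sl (pd_cd (U3 i).2.1 _), d2_sl (pd_cd (U3 i).2.1 _)] at h
  simp only [pu, pρ, pT, r0, sl, tu, Prod.fst_add, Prod.snd_add] at h
  simp only [U0, U1, U2, U3, TT] at h ⊢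
  linear_combination h
end Con
end Couette
end

noncomputable section
open MeasureTheory Real Filter Topology
set_option linter.unusedSectionVars false
set_option linter.unusedVariables false
set_option linter.ambiguousOpen false
set_option linter.deprecated false
namespace Couette
namespace Con
open Couette.Core CB
variable {F : Fam}
set_option linter.unusedSimpArgs false

variable {P : Par}
theorem fam_e (i : (fam P).ι) : (fam P).e i = i.ε := rfl

def sc (c : (fam P).ι → ℝ) (U : (fam P).ι → SP) : AA (fam P) := fun i => c i • U i
theorem sc_ap (c : (fam P).ι → ℝ) (U : (fam P).ι → SP) (i : (fam P).ι) (p : V3) : (sc c U i).1 p = c i * (U i).1 p := rfl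
theorem sc_fun (c : (fam P).ι → ℝ) (U : (fam P).ι → SP) (i : (fam P).ι) : (sc c U i).1 = fun p => c i * (U i).1 p := rfl
theorem dA_sc (d : (fam P).ι → ℝ) (v : V3) (c : (fam P).ι → ℝ) (U : (fam P).ι → SP) :
    dA (fam P) d v (sc c U) = sc (fun i => d i * c i) (fun i => ⟨pd v (U i).1, pd_mem (U i).2 v⟩) := by
  funext i; apply Subtype.ext; funext p
  rw [dA_fun, sc_fun]
  simp only
  rw [pd_smul (U i).2.1, sc_ap]; ring

theorem pi0 {f : AA F} (h : ∀ i t, t ∈ Set.Icc 0 (F.T i) → ∀ x ∈ Ω, (f i).1 (t, x) = 0) : π' F f = 0 := by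
  rw [← map_zero (π' F), π'_eq]
  intro i t x y ht hy
  exact ext0 (f i).2 t (h i t ht) x y hy

def aPh : AA (fam P) := sc (fun i => (i.ε ^ 2)⁻¹) U0
def aP1 : AA (fam P) := sc (fun i => i.ε⁻¹) U1
def aP2 : AA (fam P) := sc (fun i => i.ε⁻¹) U2
def aTh : AA (fam P) := sc (fun i => (i.ε ^ 2)⁻¹) U3
def aTT : AA (fam P) := sc (fun i => 1) TT
def aRT : AA (fam P) := sc (fun i => 1) RT
def aX : AA (fam P) := sc (fun i => 1) XX
def aK : AA (fam P) := cA (fam P) fun i => (1 - i.χ) / i.ε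
def aPQ : AA (fam P) := sc (fun i => (i.ε ^ 2)⁻¹) PQ

def c0P (P : Par) : ℝ := P.Pr / (2 * (P.γ / (P.γ - 1)))

theorem cst_π (c : ℝ) : (cst c : RR F) = π' F (cA F fun _ => c) := by
  rw [cst, ← AlgHom.commutes (π' F)]; rfl

theorem add_ap (f g : AA F) (i : F.ι) (p : V3) : ((f + g) i).1 p = (f i).1 p + (g i).1 p := rfl
theorem sub_ap (f g : AA F) (i : F.ι) (p : V3) : ((f - g) i).1 p = (f i).1 p - (g i).1 p := rfl
theorem mul_ap (f g : AA F) (i : F.ι) (p : V3) : ((f * g) i).1 p = (f i).1 p * (g i).1 p := rfl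
theorem one_ap (i : F.ι) (p : V3) : ((1 : AA F) i).1 p = 1 := rfl

theorem Teq : (1 + eps * (π' (fam P) aK * (π' _ aX - 1) + cst (c0P P) * (eps * (π' _ aX - π' _ aX * π' _ aX))) : RR (fam P))
    = π' _ aTT := by
  rw [cst_π, eps_π, ← map_one (π' (fam P))]
  simp only [← map_mul, ← map_add, ← map_sub]
  rw [π'_eq]
  intro i t x y ht hy
  have he := (i.hε : 0 < i.ε).ne'
  simp only [aX, aTT, aK, add_ap, sub_ap, mul_ap, one_ap, cA_apply, sc_ap, fam_e, TT, XX, tT, c0P]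
  field_simp
  ring

theorem PQeq : (π' (fam P) aTT * π' _ aPh + π' _ aRT * π' _ aTh + eps * eps * (π' _ aPh * π' _ aTh) : RR (fam P))
    = π' _ aPQ := by
  rw [eps_π]
  simp only [← map_mul, ← map_add, ← map_sub]
  rw [π'_eq]
  intro i t x y ht hy
  have he := (i.hε : 0 < i.ε).ne'
  have e : (PQ i).1 (t, (x, y)) = (TT i).1 (t, (x, y)) * (U0 i).1 (t, (x, y)) + (RT i).1 (t, (x, y)) * (U3 i).1 (t, (x, y))
    + (U0 i).1 (t, (x, y)) * (U3 i).1 (t, (x, y)) := rfl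
  simp only [aPh, aTh, aTT, aRT, aPQ, add_ap, sub_ap, mul_ap, one_ap, cA_apply, sc_ap, fam_e, e]
  field_simp

theorem eqM' : (D0 (π' (fam P) aPh) + eps * π' _ aX * D1 (π' _ aPh) + eps * eps * (π' _ aP1 * D1 (π' _ aPh) + π' _ aP2 * D2 (π' _ aPh))
    + (π' _ aRT + eps * eps * π' _ aPh) * (D1 (π' _ aP1) + D2 (π' _ aP2)) + π' _ aP2 * D2 (π' _ aRT) : RR (fam P)) = 0 := by
  simp only [eps_π, D0_π, D1_π, D2_π, aPh, aP1, aP2, aRT, aX, dA_sc]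
  simp only [← map_mul, ← map_add, ← map_sub]
  refine pi0 fun i t ht x hx => ?_
  refine Eq.trans ?_ (massC i ht hx)
  have he := (i.hε : 0 < i.ε).ne'
  simp only [add_ap, sub_ap, mul_ap, one_ap, cA_apply, sc_ap, fam_e, XX]
  field_simp
  ring

theorem eqP1' : ((π' (fam P) aRT + eps * eps * π' _ aPh) * (D0 (π' _ aP1) + eps * π' _ aX * D1 (π' _ aP1)
      + eps * eps * (π' _ aP1 * D1 (π' _ aP1) + π' _ aP2 * D2 (π' _ aP1)) + eps * eps * π' _ aP2)
    + D1 (π' _ aPQ)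
    - cst (P.Re⁻¹) * (D1 (D1 (π' _ aP1)) + D2 (D2 (π' _ aP1)))
    - cst (P.Re⁻¹ + P.r * P.Re⁻¹) * D1 (D1 (π' _ aP1) + D2 (π' _ aP2)) : RR (fam P)) = 0 := by
  simp only [cst_π, eps_π, D0_π, D1_π, D2_π, aPh, aP1, aP2, aRT, aX, aPQ, dA_sc, map_add D1, map_add D2]
  simp only [← map_mul, ← map_add, ← map_sub]
  refine pi0 fun i t ht x hx => ?_
  refine Eq.trans ?_ ((congrArg (fun z => i.ε * z) (mom1C i ht hx)).trans (mul_zero _))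
  have he := (i.hε : 0 < i.ε).ne'
  have hR := P.hRe.ne'
  simp only [add_ap, sub_ap, mul_ap, one_ap, cA_apply, sc_ap, fam_e, XX]
  field_simp
  ring

theorem eqP2' : ((π' (fam P) aRT + eps * eps * π' _ aPh) * (D0 (π' _ aP2) + eps * π' _ aX * D1 (π' _ aP2)
      + eps * eps * (π' _ aP1 * D1 (π' _ aP2) + π' _ aP2 * D2 (π' _ aP2)))
    + D2 (π' _ aPQ)
    - cst (P.Re⁻¹) * (D1 (D1 (π' _ aP2)) + D2 (D2 (π' _ aP2)))
    - cst (P.Re⁻¹ + P.r * P.Re⁻¹) * D2 (D1 (π' _ aP1) + D2 (π' _ aP2)) : RR (fam P)) = 0 := by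
  simp only [cst_π, eps_π, D0_π, D1_π, D2_π, aPh, aP1, aP2, aRT, aX, aPQ, dA_sc, map_add D1, map_add D2]
  simp only [← map_mul, ← map_add, ← map_sub]
  refine pi0 fun i t ht x hx => ?_
  refine Eq.trans ?_ ((congrArg (fun z => i.ε * z) (mom2C i ht hx)).trans (mul_zero _))
  have he := (i.hε : 0 < i.ε).ne'
  have hR := P.hRe.ne'
  simp only [add_ap, sub_ap, mul_ap, one_ap, cA_apply, sc_ap, fam_e, XX]
  field_simp
  ring

theorem eqT' : (cst (P.γ - 1)⁻¹ * (π' (fam P) aRT + eps * eps * π' _ aPh) * (D0 (π' _ aTh) + eps * π' _ aX * D1 (π' _ aTh)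
      + eps * eps * (π' _ aP1 * D1 (π' _ aTh) + π' _ aP2 * D2 (π' _ aTh)) + π' _ aP2 * D2 (π' _ aTT))
    + (π' _ aRT + eps * eps * π' _ aPh) * (π' _ aTT + eps * eps * π' _ aTh) * (D1 (π' _ aP1) + D2 (π' _ aP2))
    - cst (P.γ / (P.γ - 1) / (P.Re * P.Pr)) * (D1 (D1 (π' _ aTh)) + D2 (D2 (π' _ aTh))) : RR (fam P))
    = eps * eps * (cst (2 * P.Re⁻¹) * (D1 (π' _ aP1) * D1 (π' _ aP1) + D2 (π' _ aP2) * D2 (π' _ aP2))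
      + cst P.Re⁻¹ * ((D1 (π' _ aP2) + D2 (π' _ aP1)) * (D1 (π' _ aP2) + D2 (π' _ aP1)))
      + cst (2 * P.Re⁻¹) * (D1 (π' _ aP2) + D2 (π' _ aP1))
      + cst (P.r * P.Re⁻¹) * ((D1 (π' _ aP1) + D2 (π' _ aP2)) * (D1 (π' _ aP1) + D2 (π' _ aP2)))) := by
  rw [← sub_eq_zero]
  simp only [cst_π, eps_π, D0_π, D1_π, D2_π, aPh, aP1, aP2, aTh, aTT, aRT, aX, dA_sc]
  simp only [← map_mul, ← map_add, ← map_sub]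
  refine pi0 fun i t ht x hx => ?_
  refine Eq.trans ?_ (sub_eq_zero.2 (enC i ht hx))
  have he := (i.hε : 0 < i.ε).ne'
  have hR := P.hRe.ne'
  have hP := P.hPr.ne'
  have hg : P.γ - 1 ≠ 0 := by linarith [P.hγ]
  simp only [add_ap, sub_ap, mul_ap, one_ap, cA_apply, sc_ap, fam_e, XX]
  field_simp
  ring
end Con
end Couette
end

noncomputable section
open MeasureTheory Real Filter Topology
set_option linter.unusedSectionVars false
set_option linter.unusedVariables false
set_option linter.ambiguousOpen false
set_option linter.deprecated false
namespace Couette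
namespace Con
open Couette.Core CB
variable {F : Fam}

variable {P : Par}

theorem nm_mul_le (a : AA F) {C : ℝ} (hC : 0 ≤ C)
    (h : ∀ i t, t ∈ Set.Icc 0 (F.T i) → ∀ x ∈ Ω, |(a i).1 (t, x)| ≤ C) (f : RR F) (j : JJ F) :
    nm (π' F a * f) j ≤ C * nm f j := by
  obtain ⟨f, rfl⟩ := π'_surj F f
  refine le_of_sq_le (mul_nonneg hC (nm_nonneg _ _)) ?_
  rw [mul_pow, ← map_mul, nm_π, nm_π, q2, q2, ← integral_const_mul]
  have hfc := slice_cont (f j.1.1).2.1 j.1.2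
  have hac := slice_cont (a j.1.1).2.1 j.1.2
  refine setIntegral_mono_on (Ω_int ?_) (Ω_int (continuous_const.mul (hfc.mul hfc))) Ω_meas fun x hx => ?_
  · rw [mul_fun]; exact (hac.mul hfc).mul (hac.mul hfc)
  · rw [mul_fun]
    have := h j.1.1 j.1.2 j.2 x hx
    have h2 : (a j.1.1).1 (j.1.2, x) ^ 2 ≤ C ^ 2 := by rw [← sq_abs]; exact pow_le_pow_left₀ (abs_nonneg _) this 2
    nlinarith [mul_le_mul_of_nonneg_right h2 (sq_nonneg ((f j.1.1).1 (j.1.2, x)))]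

theorem mass0 (i : P.I) {t : ℝ} (ht : t ∈ Set.Icc 0 i.T) : ∫ x in Ω, (U0 i).1 (t, x) = 0 := by
  have hder : ∀ s ∈ Set.Icc 0 i.T, ∫ x in Ω, pd w0 (U0 i).1 (s, x) = 0 := by
    intro s hs
    have e1 : ∫ x in Ω, pd w0 (U0 i).1 (s, x)
        = ∫ x in Ω, (-(pd w1 ((RT i + U0 i) * U1 i + XX i * U0 i : SP).1 (s, x)) - pd w2 ((RT i + U0 i) * U2 i : SP).1 (s, x)) := by
      refine setIntegral_congr_fun Ω_meas fun x hx => ?_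
      have hm := massC i hs hx
      have r1 : pd w1 (RT i).1 (s, x) = 0 := pd1_indep (RT i).2.1 (fun _ _ _ _ => rfl) _
      have r2 : pd w1 (XX i).1 (s, x) = 0 := pd1_indep (XX i).2.1 (fun _ _ _ _ => rfl) _
      have d : ∀ f g : SP, ∀ v p, pd v (f * g : SP).1 p = f.1 p * pd v g.1 p + g.1 p * pd v f.1 p := by
        intro f g v p
        have := fderiv_mul (SP_diff f.2.1 p) (SP_diff g.2.1 p)
        show fderiv ℝ (f.1 * g.1) p v = _
        rw [this]; rfl
      have a : ∀ f g : SP, ∀ v p, pd v (f + g : SP).1 p = pd v f.1 p + pd v g.1 p := by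
        intro f g v p; exact congrFun (pd_add f.2.1 g.2.1 v) p
      have sa : ∀ f g : SP, ∀ p, (f + g : SP).1 p = f.1 p + g.1 p := fun _ _ _ => rfl
      have x2 : (XX i).1 (s, x) = x.2 := rfl
      simp only [d, a, sa, r1, r2, x2]
      linarith
    rw [e1, integral_sub, integral_neg, int_x0 (Subtype.property _), int_y0 (Subtype.property _)]
    · simp
    · intro x
      have := i.S.bc_ψ s hs (x, 0) (Or.inl rfl)
      show _ * (i.S.ψ s (x, 0)).2 = 0
      rw [this]; simp
    · intro x
      have := i.S.bc_ψ s hs (x, 1) (Or.inr rfl)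
      show _ * (i.S.ψ s (x, 1)).2 = 0
      rw [this]; simp
    · exact (Ω_int (slice_cont (pd_cd (Subtype.property ((RT i + U0 i) * U1 i + XX i * U0 i : SP)).1 w1) s)).neg
    · exact Ω_int (slice_cont (pd_cd (Subtype.property ((RT i + U0 i) * U2 i : SP)).1 w2) s)
  have hd := fun s => int_t (U0 i).2.1 s
  have := constant_of_has_deriv_right_zero (a := 0) (b := i.T) (f := fun t => ∫ x in Ω, (U0 i).1 (t, x))
    (fun s _ => (hd s).continuousAt.continuousWithinAt)
    (fun s hs => by have := (hd s).hasDerivWithinAt (s := Set.Ici s); rwa [hder s ⟨hs.1, hs.2.le⟩] at this) t ht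
  rw [this]; exact i.std.2.2.2.1

theorem pm' : Bo (nm (eps * π' (fam P) aPh)) (nm (D1 (π' (fam P) aPh)) + nm (D2 (π' (fam P) aPh))) := by
  refine ⟨9, by norm_num, fun j => ?_⟩
  have h0 : ∫ x in Ω, ((aPh : AA (fam P)) j.1.1).1 (j.1.2, x) = 0 := by
    simp only [aPh, sc_ap]
    rw [integral_const_mul, mass0 j.1.1 j.2, mul_zero]
  have h1 := poin0 ((aPh : AA (fam P)) j.1.1).2.1 j.1.2 h0
  have n1 := nm_π (dA (fam P) (fun i => (fam P).e i) w1 aPh) j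
  have n2 := nm_π (dA (fam P) (fun i => (fam P).e i) w2 aPh) j
  have n0 := nm_π (aPh : AA (fam P)) j
  have hq : ∀ (e : ℝ) (V : V3 → ℝ) t, q2 (fun p => e * V p) t = e ^ 2 * q2 V t := by
    intro e V t; unfold q2; rw [← integral_const_mul]; congr 1; funext x; ring
  rw [dA_fun, hq, ← D1_π] at n1
  rw [dA_fun, hq, ← D2_π] at n2
  rw [nm_eps, ep_π]
  have hp : π ^ 2 ≤ 10 := by nlinarith [pi_lt_d2, pi_pos]
  have p1 := nm_nonneg (D1 (π' (fam P) aPh)) j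
  have p2 := nm_nonneg (D2 (π' (fam P) aPh)) j
  refine le_of_sq_le (mul_nonneg (by norm_num) (add_nonneg p1 p2)) ?_
  rw [mul_pow, n0]
  have q1 := q2_nonneg (pd w1 ((aPh : AA (fam P)) j.1.1).1) j.1.2
  have h3 := mul_le_mul_of_nonneg_left h1 (sq_nonneg ((fam P).e j.1.1))
  have h4 := mul_le_mul_of_nonneg_right hp (sq_nonneg (nm (D1 (π' (fam P) aPh)) j))
  show _ ≤ (9 * (nm (D1 (π' (fam P) aPh)) j + nm (D2 (π' (fam P) aPh)) j)) ^ 2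
  have h5 : (fam P).e j.1.1 ^ 2 * q2 ((aPh : AA (fam P)) j.1.1).1 j.1.2 ≤ 8 * π ^ 2 * nm (D1 (π' (fam P) aPh)) j ^ 2
      + 2 * nm (D2 (π' (fam P) aPh)) j ^ 2 := by rw [n1, n2]; linarith
  nlinarith [mul_nonneg p1 p2, sq_nonneg (nm (D2 (π' (fam P) aPh)) j)]

/-- pieces of the sup functional -/
def Mp (ε c : ℝ) {G : Type*} [NormedAddCommGroup G] [NormedSpace ℝ G] (n : ℕ) (f : ℝ × ℝ → G) : ℝ :=
  ∑ l ∈ Finset.range n, ε ^ (2 * l) * (c ^ 2 * dSq l f)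

theorem Mp_nonneg {ε : ℝ} (c : ℝ) (hε : 0 < ε) {G : Type*} [NormedAddCommGroup G] [NormedSpace ℝ G] (n : ℕ) (f : ℝ × ℝ → G) :
    0 ≤ Mp ε c n f := Finset.sum_nonneg fun l _ => by have := dSq_nonneg f l; positivity

theorem Msup_eq {ε : ℝ} (hε : 0 < ε) (φ : ℝ → ℝ × ℝ → ℝ) (ψ : ℝ → ℝ × ℝ → ℝ × ℝ) (θ : ℝ → ℝ × ℝ → ℝ) (s : ℝ) :
    Msup ε φ ψ θ s = Mp ε (ε ^ 2)⁻¹ 4 (φ s) + Mp ε ε⁻¹ 4 (ψ s) + Mp ε (ε ^ 2)⁻¹ 4 (θ s)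
      + Mp ε (ε ^ 2 * ε⁻¹) 2 (dt ψ s) + Mp ε (ε ^ 2 * (ε ^ 2)⁻¹) 2 (dt θ s) + dSq 0 (dt φ s) := by
  simp only [Msup, Mp, Finset.sum_range_succ, Finset.sum_range_zero, L2Sq]
  field_simp
  ring

theorem hs_sc (k : ℕ) (c : (fam P).ι → ℝ) (U : (fam P).ι → SP) (j : JJ (fam P)) :
    hs k (π' (fam P) (sc c U)) j ^ 2 ≤ hsC k * Mp j.1.1.ε (c j.1.1) (k + 1) (sl (U j.1.1).1 j.1.2) := by
  refine (hs_le_dSq k _ j).trans (le_of_eq ?_)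
  rw [Mp]; congr 1
  refine Finset.sum_congr rfl fun l _ => ?_
  rw [sc_fun, dSq_smul (U j.1.1).2.1]

theorem Mp_mono {ε : ℝ} (c : ℝ) (hε : 0 < ε) {G H : Type*} [NormedAddCommGroup G] [NormedSpace ℝ G]
    [NormedAddCommGroup H] [NormedSpace ℝ H] (n : ℕ) {f : ℝ × ℝ → G} {g : ℝ × ℝ → H}
    (h : ∀ l, dSq l f ≤ dSq l g) : Mp ε c n f ≤ Mp ε c n g :=
  Finset.sum_le_sum fun l _ => by
    have := h l
    gcongr

theorem ψ_cd (i : P.I) (t : ℝ) : ContDiff ℝ (⊤ : ℕ∞) (i.S.ψ t) := i.sm.2.1.comp (contDiff_const.prodMk contDiff_id)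

theorem dtψ_cd (i : P.I) (t : ℝ) : ContDiff ℝ (⊤ : ℕ∞) (dt i.S.ψ t) := by
  rw [dt_vec i.sm.2.1]
  exact (sl_cd (pd_cd (U1 i).2.1 w0) t).prodMk (sl_cd (pd_cd (U2 i).2.1 w0) t)

theorem eF_le (j : JJ (fam P)) :
    eF (π' (fam P) aPh) (π' _ aP1) (π' _ aP2) (π' _ aTh) j ^ 2
      ≤ 16905 * Msup j.1.1.ε j.1.1.S.φ j.1.1.S.ψ j.1.1.S.θ j.1.2 := by
  have hε : 0 < j.1.1.ε := j.1.1.hε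
  set i : P.I := j.1.1 with hi
  set t := j.1.2 with ht
  set M := Msup i.ε i.S.φ i.S.ψ i.S.θ t with hM
  have hMe : M = _ := Msup_eq hε i.S.φ i.S.ψ i.S.θ t
  have n1 := Mp_nonneg (i.ε ^ 2)⁻¹ hε 4 (i.S.φ t)
  have n2 := Mp_nonneg i.ε⁻¹ hε 4 (i.S.ψ t)
  have n3 := Mp_nonneg (i.ε ^ 2)⁻¹ hε 4 (i.S.θ t)
  have n4 := Mp_nonneg (i.ε ^ 2 * i.ε⁻¹) hε 2 (dt i.S.ψ t)
  have n5 := Mp_nonneg (i.ε ^ 2 * (i.ε ^ 2)⁻¹) hε 2 (dt i.S.θ t)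
  have n6 := dSq_nonneg (dt i.S.φ t) 0
  have hM0 : 0 ≤ M := by rw [hMe]; positivity
  have c3 : hsC 3 = 345 := by norm_num [hsC]
  have c1 : hsC 1 = 9 := by norm_num [hsC]
  have key : ∀ a : ℝ, a ^ 2 ≤ 345 * M → a ≤ √(345 * M) := fun a h => Real.le_sqrt_of_sq_le h
  have k1 : hs 3 (π' (fam P) aPh) j ≤ √(345 * M) := by
    refine key _ ((hs_sc 3 _ _ j).trans ?_)
    rw [c3]
    have : Mp i.ε (i.ε ^ 2)⁻¹ 4 (sl (U0 i).1 t) = Mp i.ε (i.ε ^ 2)⁻¹ 4 (i.S.φ t) := rfl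
    rw [← hi, ← ht, this, hMe]; linarith
  have k4 : hs 3 (π' (fam P) aTh) j ≤ √(345 * M) := by
    refine key _ ((hs_sc 3 _ _ j).trans ?_)
    rw [c3]
    have : Mp i.ε (i.ε ^ 2)⁻¹ 4 (sl (U3 i).1 t) = Mp i.ε (i.ε ^ 2)⁻¹ 4 (i.S.θ t) := rfl
    rw [← hi, ← ht, this, hMe]; linarith
  have k2 : hs 3 (π' (fam P) aP1) j ≤ √(345 * M) := by
    refine key _ ((hs_sc 3 _ _ j).trans ?_)
    rw [c3]
    have : Mp i.ε i.ε⁻¹ 4 (sl (U1 i).1 t) ≤ Mp i.ε i.ε⁻¹ 4 (i.S.ψ t) :=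
      Mp_mono _ hε _ fun l => (vec_le (ψ_cd i t) l).1
    rw [← hi, ← ht, hMe]; linarith
  have k3 : hs 3 (π' (fam P) aP2) j ≤ √(345 * M) := by
    refine key _ ((hs_sc 3 _ _ j).trans ?_)
    rw [c3]
    have : Mp i.ε i.ε⁻¹ 4 (sl (U2 i).1 t) ≤ Mp i.ε i.ε⁻¹ 4 (i.S.ψ t) :=
      Mp_mono _ hε _ fun l => (vec_le (ψ_cd i t) l).2.1
    rw [← hi, ← ht, hMe]; linarith
  have k5 : hs 1 (D0 (π' (fam P) aP1)) j ≤ √(345 * M) := by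
    rw [D0_π, aP1, dA_sc]
    refine key _ ((hs_sc 1 _ _ j).trans ?_)
    rw [c1]
    have h : Mp i.ε (i.ε ^ 2 * i.ε⁻¹) 2 (sl (pd w0 (U1 i).1) t) ≤ Mp i.ε (i.ε ^ 2 * i.ε⁻¹) 2 (dt i.S.ψ t) :=
      Mp_mono _ hε _ fun l => by
        have := (vec_le (dtψ_cd i t) l).1
        rw [dt_vec i.sm.2.1] at this ⊢; exact this
    have h' := Mp_nonneg (i.ε ^ 2 * i.ε⁻¹) hε 2 (sl (pd w0 (U1 i).1) t)
    refine le_trans (b := 345 * Mp i.ε (i.ε ^ 2 * i.ε⁻¹) 2 (sl (pd w0 (U1 i).1) t)) ?_ (by rw [hMe]; linarith)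
    exact mul_le_mul_of_nonneg_right (by norm_num) h'
  have k6 : hs 1 (D0 (π' (fam P) aP2)) j ≤ √(345 * M) := by
    rw [D0_π, aP2, dA_sc]
    refine key _ ((hs_sc 1 _ _ j).trans ?_)
    rw [c1]
    have h : Mp i.ε (i.ε ^ 2 * i.ε⁻¹) 2 (sl (pd w0 (U2 i).1) t) ≤ Mp i.ε (i.ε ^ 2 * i.ε⁻¹) 2 (dt i.S.ψ t) :=
      Mp_mono _ hε _ fun l => by
        have := (vec_le (dtψ_cd i t) l).2.1
        rw [dt_vec i.sm.2.1] at this ⊢; exact this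
    have h' := Mp_nonneg (i.ε ^ 2 * i.ε⁻¹) hε 2 (sl (pd w0 (U2 i).1) t)
    refine le_trans (b := 345 * Mp i.ε (i.ε ^ 2 * i.ε⁻¹) 2 (sl (pd w0 (U2 i).1) t)) ?_ (by rw [hMe]; linarith)
    exact mul_le_mul_of_nonneg_right (by norm_num) h'
  have k7 : hs 1 (D0 (π' (fam P) aTh)) j ≤ √(345 * M) := by
    rw [D0_π, aTh, dA_sc]
    refine key _ ((hs_sc 1 _ _ j).trans ?_)
    rw [c1]
    have h : sl (pd w0 (U3 i).1) t = dt i.S.θ t := (dt_sl (U3 i).2.1 t).symm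
    refine le_trans (b := 345 * Mp i.ε (i.ε ^ 2 * (i.ε ^ 2)⁻¹) 2 (sl (pd w0 (U3 i).1) t)) ?_ (by rw [hMe, h]; linarith)
    exact mul_le_mul_of_nonneg_right (by norm_num) (by rw [h]; exact n5)
  have hs0 : ∀ k f, 0 ≤ hs k f j := fun k (f : RR (fam P)) => hs_nonneg k f j
  have e : eF (π' (fam P) aPh) (π' _ aP1) (π' _ aP2) (π' _ aTh) j ≤ 7 * √(345 * M) := by
    show hs 3 _ j + (hs 3 _ j + hs 3 _ j + hs 3 _ j) + (hs 1 _ j + hs 1 _ j + hs 1 _ j) ≤ _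
    linarith
  have e0 : 0 ≤ eF (π' (fam P) aPh) (π' _ aP1) (π' _ aP2) (π' _ aTh) j := by
    show 0 ≤ hs 3 _ j + (hs 3 _ j + hs 3 _ j + hs 3 _ j) + (hs 1 _ j + hs 1 _ j + hs 1 _ j)
    have := hs0 3 (π' (fam P) aPh); have := hs0 3 (π' (fam P) aP1); have := hs0 3 (π' (fam P) aP2)
    have := hs0 3 (π' (fam P) aTh); have := hs0 1 (D0 (π' (fam P) aP1)); have := hs0 1 (D0 (π' (fam P) aP2))
    have := hs0 1 (D0 (π' (fam P) aTh)); linarith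
  refine (pow_le_pow_left₀ e0 e 2).trans (le_of_eq ?_)
  rw [mul_pow, Real.sq_sqrt (by positivity)]; ring

@[reducible] def cfI (P : Par) (h1 : 1 + (1 + (P.γ - 1)⁻¹) * (P.Kχ + 3 * c0P P) ≤ P.Re⁻¹)
    (h2 : 1 + (1 + (P.γ - 1)⁻¹) * (P.Kχ + 3 * c0P P) ≤ P.γ / (P.γ - 1) / (P.Re * P.Pr)) :
    CF (RR (fam P)) (JJ (fam P)) where
  mu := P.Re⁻¹
  nu := P.Re⁻¹ + P.r * P.Re⁻¹
  kap := P.γ / (P.γ - 1) / (P.Re * P.Pr)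
  cc := (P.γ - 1)⁻¹
  lam := P.r * P.Re⁻¹
  KK := P.Kχ
  c0 := c0P P
  nu_pos := by
    have := mul_pos P.hr (inv_pos.2 P.hRe); linarith
  cc_pos := inv_pos.2 (by linarith [P.hγ])
  KK_nonneg := P.hK.le
  c0_nonneg := by
    have := P.hPr; have : 0 < P.γ - 1 := by linarith [P.hγ]
    have : 0 < P.γ := by linarith [P.hγ]
    unfold c0P; positivity
  mu_big := h1
  kap_big := h2
  sob0 := ⟨2, by norm_num, sob0R⟩
  sob1 := ⟨2, by norm_num, sob1R⟩
  infsup := infsupR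
  X := π' _ aX
  kk := π' _ aK
  rt := π' _ aRT
  X0 := by
    rw [D0_π, aX, dA_sc]
    refine pi0 fun i t ht x hx => ?_
    rw [sc_ap]
    have : HasDerivAt (fun s : ℝ => (XX i).1 (s, x)) 0 t := hasDerivAt_const t x.2
    show _ * pd w0 (XX i).1 (t, x) = 0
    rw [show pd w0 (XX i).1 (t, x) = 0 from (pd_t (XX i).2.1 t x.1 x.2).unique this, mul_zero]
  X1 := by
    rw [D1_π, aX, dA_sc]
    refine pi0 fun i t ht x hx => ?_
    show _ * pd w1 (XX i).1 (t, x) = 0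
    rw [show pd w1 (XX i).1 (t, x) = 0 from pd1_indep (XX i).2.1 (fun _ _ _ _ => rfl) _, mul_zero]
  X2 := by
    rw [D2_π, aX, dA_sc, eps_π, ← sub_eq_zero, ← map_sub]
    refine pi0 fun i t ht x hx => ?_
    rw [sub_ap, sc_ap, cA_apply]
    have : HasDerivAt (fun s : ℝ => (XX i).1 (t, (x.1, s))) 1 x.2 := hasDerivAt_id _
    show (fam P).e i * 1 * pd w2 (XX i).1 (t, x) - (fam P).e i = 0
    rw [show pd w2 (XX i).1 (t, x) = 1 from (pd_y (XX i).2.1 t x.1 x.2).unique this]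
    ring
  k0 := by rw [D0_π, aK, dA_cA, map_zero]
  k1 := by rw [D1_π, aK, dA_cA, map_zero]
  k2 := by rw [D2_π, aK, dA_cA, map_zero]
  Xb := fun f j => by
    have := nm_mul_le (aX : AA (fam P)) (C := 1) (by norm_num) (fun i t ht x hx => by
      rw [aX, sc_ap, one_mul, show (XX i).1 (t, x) = x.2 from rfl, abs_of_pos hx.2.1]; exact hx.2.2.le) f j
    linarith
  kb := fun f j => nm_mul_le (aK : AA (fam P)) P.hK.le (fun i t ht x hx => by
      have he : 0 < i.ε := i.hε
      rw [aK, cA_apply, abs_div, abs_of_pos he, div_le_iff₀ he]; exact i.hχ) f j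
  rb := fun f j => nm_mul_le (aRT : AA (fam P)) (by norm_num) (fun i t ht x hx => by
      have h := tT_ge i (x := x) ⟨hx.2.1.le, hx.2.2.le⟩
      rw [aRT, sc_ap, one_mul, ← tρ_eq i (x := x) ⟨hx.2.1.le, hx.2.2.le⟩ t, tρ, abs_of_pos (inv_pos.2 (by linarith))]
      rw [inv_le_comm₀ (by linarith) (by norm_num)]; linarith) f j
  rt_eq := by
    rw [Teq, ← map_mul, ← map_one (π' (fam P)), ← sub_eq_zero, ← map_sub]
    refine pi0 fun i t ht x hx => ?_
    have h := tT_ge i (x := x) ⟨hx.2.1.le, hx.2.2.le⟩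
    rw [sub_ap, mul_ap, one_ap, aRT, aTT, sc_ap, sc_ap, ← tρ_eq i (x := x) ⟨hx.2.1.le, hx.2.2.le⟩ t, tρ]
    show 1 * (tT P.γ P.Pr i.ε i.χ x)⁻¹ * (1 * tT P.γ P.Pr i.ε i.χ x) - 1 = 0
    rw [one_mul, one_mul, inv_mul_cancel₀ (by linarith), sub_self]
  ph := π' _ aPh
  p1 := π' _ aP1
  p2 := π' _ aP2
  th := π' _ aTh
  p1Z := Z_π _ fun i t x y ht hy => by
    rw [aP1, sc_ap, show (U1 i).1 (t, (x, y)) = (i.S.ψ t (x, y)).1 from rfl, i.S.bc_ψ t ht (x, y) hy]; simp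
  p2Z := Z_π _ fun i t x y ht hy => by
    rw [aP2, sc_ap, show (U2 i).1 (t, (x, y)) = (i.S.ψ t (x, y)).2 from rfl, i.S.bc_ψ t ht (x, y) hy]; simp
  thZ := Z_π _ fun i t x y ht hy => by
    rw [aTh, sc_ap, show (U3 i).1 (t, (x, y)) = i.S.θ t (x, y) from rfl, i.S.bc_θ t ht (x, y) hy]; simp
  pm := pm'
  eqM := eqM'
  eqP1 := by rw [Teq, PQeq]; exact eqP1'
  eqP2 := by rw [Teq, PQeq]; exact eqP2'
  eqT := by rw [Teq]; exact eqT'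
  s_le := fun j => by
    have h := eF_le j
    have hs := j.1.1.small j.1.2 j.2
    have he : ep (RR (fam P)) j ≤ 1 / 2 := j.1.1.hε2
    have : eF (π' (fam P) aPh) (π' _ aP1) (π' _ aP2) (π' _ aTh) j ≤ 1 / 2 := by
      refine le_of_sq_le (by norm_num) (h.trans ?_)
      linarith
    linarith
end Con
end Couette
end

noncomputable section
open MeasureTheory Real Filter Topology
set_option linter.unusedSectionVars false
set_option linter.unusedVariables false
set_option linter.ambiguousOpen false
set_option linter.deprecated false
namespace Couette
namespace Con
open Couette.Core CB
variable {F : Fam}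

variable {P : Par}

theorem lyapC (P : Par) (h1 : 1 + (1 + (P.γ - 1)⁻¹) * (P.Kχ + 3 * c0P P) ≤ P.Re⁻¹)
    (h2 : 1 + (1 + (P.γ - 1)⁻¹) * (P.Kχ + 3 * c0P P) ≤ P.γ / (P.γ - 1) / (P.Re * P.Pr)) :
    ∃ (Q : AA (fam P)) (C : ℝ), 0 ≤ C ∧ ∀ (j : JJ (fam P)) (E Y : ℝ),
      E = eF (π' (fam P) aPh) (π' _ aP1) (π' _ aP2) (π' _ aTh) j →
      Y = yF (π' (fam P) aPh) (π' _ aP1) (π' _ aP2) (π' _ aTh) j →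
      E * E ≤ I (π' _ Q) j + C * ((j.1.1.ε + E) * (E * E)) ∧ |I (π' _ Q) j| ≤ C * (E * E) ∧
      I (D0 (π' _ Q)) j + Y * Y ≤ C * ((j.1.1.ε + E) * (Y * Y)) ∧
      hs 2 (D0 (π' (fam P) aPh)) j ≤ C * E ∧ hs 2 (D0 (π' (fam P) aPh)) j ≤ C * Y := by
  letI := cfI P h1 h2
  obtain ⟨q, C, hC, h⟩ := lyap (R := RR (fam P))
  obtain ⟨C1, hC1, e1⟩ := mem_Hb.1 (pht_e (R := RR (fam P)))
  obtain ⟨C2, hC2, e2⟩ := mem_Hb.1 (pht_y (R := RR (fam P)))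
  obtain ⟨Q, rfl⟩ := π'_surj _ q
  refine ⟨Q, C + C1 + C2, by positivity, ?_⟩
  rintro j E0 Y0 rfl rfl
  obtain ⟨a, b, c⟩ := h j
  have a1 := e1 j
  have a2 := e2 j
  have hE : E (RR (fam P)) j = eF (π' (fam P) aPh) (π' _ aP1) (π' _ aP2) (π' _ aTh) j := rfl
  have hY : Y (RR (fam P)) j = yF (π' (fam P) aPh) (π' _ aP1) (π' _ aP2) (π' _ aTh) j := rfl
  have hS : S (RR (fam P)) j = j.1.1.ε + eF (π' (fam P) aPh) (π' _ aP1) (π' _ aP2) (π' _ aTh) j := rfl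
  have hp : (CF.ph : RR (fam P)) = π' _ aPh := rfl
  have nE := Enn (R := RR (fam P)) j
  have nY := Ynn (R := RR (fam P)) j
  rw [hE] at a b a1 nE
  rw [hY] at c a2 nY
  rw [hS] at a c
  rw [hp] at a1 a2
  set e := eF (π' (fam P) aPh) (π' _ aP1) (π' _ aP2) (π' _ aTh) j
  set y := yF (π' (fam P) aPh) (π' _ aP1) (π' _ aP2) (π' _ aTh) j
  have he : 0 < j.1.1.ε := j.1.1.hε
  have m : ∀ z : ℝ, 0 ≤ z → C * z ≤ (C + C1 + C2) * z := fun z hz => mul_le_mul_of_nonneg_right (by linarith) hz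
  have nE' : 0 ≤ e := nE
  have nY' : 0 ≤ y := nY
  refine ⟨a.trans (by linarith [m ((j.1.1.ε + e) * (e * e)) (by positivity)]), b.trans (m _ (by positivity)),
    c.trans (m _ (by positivity)), a1.trans (mul_le_mul_of_nonneg_right (by linarith) nE'),
    a2.trans (mul_le_mul_of_nonneg_right (by linarith) nY')⟩

theorem hs_step (k : ℕ) (f : RR F) (j : JJ F) : hs k f j ≤ hs (k + 1) f j := by
  induction k generalizing f with
  | zero =>
    show nm f j ≤ nm f j + nm (D1 f) j + nm (D2 f) j
    linarith [nm_nonneg (D1 f) j, nm_nonneg (D2 f) j]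
  | succ k ih =>
    show nm f j + hs k (D1 f) j + hs k (D2 f) j ≤ nm f j + hs (k + 1) (D1 f) j + hs (k + 1) (D2 f) j
    linarith [ih (D1 f), ih (D2 f)]

theorem hs_mono' {k l : ℕ} (h : k ≤ l) (f : RR F) (j : JJ F) : hs k f j ≤ hs l f j := by
  induction h with
  | refl => exact le_rfl
  | step _ ih => exact ih.trans (hs_step _ f j)

theorem Mp_le (k : ℕ) (c : (fam P).ι → ℝ) (U : (fam P).ι → SP) (j : JJ (fam P)) :
    Mp j.1.1.ε (c j.1.1) (k + 1) (sl (U j.1.1).1 j.1.2) ≤ (k + 1) * 2 ^ k * hs k (π' (fam P) (sc c U)) j ^ 2 := by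
  have : ∀ l ∈ Finset.range (k + 1), j.1.1.ε ^ (2 * l) * (c j.1.1 ^ 2 * dSq l (sl (U j.1.1).1 j.1.2))
      ≤ 2 ^ k * hs k (π' (fam P) (sc c U)) j ^ 2 := by
    intro l hl
    have h := dSq_le_hs l (sc c U) j
    rw [sc_fun, dSq_smul (U j.1.1).2.1] at h
    refine h.trans ?_
    have hlk : l ≤ k := by simpa [Nat.lt_succ_iff] using hl
    exact mul_le_mul (pow_le_pow_right₀ (by norm_num) hlk) (pow_le_pow_left₀ (hs_nonneg _ _ _) (hs_mono' hlk _ _) 2)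
      (by positivity) (by positivity)
  have := Finset.sum_le_card_nsmul _ _ _ this
  rw [Finset.card_range, nsmul_eq_mul] at this
  rw [Mp]; push_cast at this; linarith

theorem Mp_vec {ε : ℝ} (c : ℝ) (hε : 0 < ε) (n : ℕ) {f : ℝ × ℝ → ℝ × ℝ} (hf : ContDiff ℝ (⊤ : ℕ∞) f) :
    Mp ε c n f ≤ 2 * (Mp ε c n (fun y => (f y).1) + Mp ε c n (fun y => (f y).2)) := by
  rw [Mp, Mp, Mp, ← Finset.sum_add_distrib, Finset.mul_sum]
  refine Finset.sum_le_sum fun l _ => ?_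
  have := mul_le_mul_of_nonneg_left (vec_le hf l).2.2 (show 0 ≤ ε ^ (2 * l) * c ^ 2 by positivity)
  linarith

theorem dtψ_fst (i : P.I) (t : ℝ) : (fun y => (dt i.S.ψ t y).1) = sl (pd w0 (U1 i).1) t := by rw [dt_vec i.sm.2.1]; rfl
theorem dtψ_snd (i : P.I) (t : ℝ) : (fun y => (dt i.S.ψ t y).2) = sl (pd w0 (U2 i).1) t := by rw [dt_vec i.sm.2.1]; rfl

theorem sqle {a b : ℝ} (ha : 0 ≤ a) (h : a ≤ b) : a ^ 2 ≤ b ^ 2 := pow_le_pow_left₀ ha h 2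

theorem Msup_le (j : JJ (fam P)) {C E : ℝ} (hE : E = eF (π' (fam P) aPh) (π' _ aP1) (π' _ aP2) (π' _ aTh) j)
    (h : hs 2 (D0 (π' (fam P) aPh)) j ≤ C * E) :
    Msup j.1.1.ε j.1.1.S.φ j.1.1.S.ψ j.1.1.S.θ j.1.2 ≤ (212 + C ^ 2) * E ^ 2 := by
  have hε : 0 < j.1.1.ε := j.1.1.hε
  have hs0 : ∀ k f, 0 ≤ hs k f j := fun k (f : RR (fam P)) => hs_nonneg k f j
  have E' : E = hs 3 (π' (fam P) aPh) j + (hs 3 (π' (fam P) aP1) j + hs 3 (π' (fam P) aP2) j + hs 3 (π' (fam P) aTh) j)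
    + (hs 1 (D0 (π' (fam P) aP1)) j + hs 1 (D0 (π' (fam P) aP2)) j + hs 1 (D0 (π' (fam P) aTh)) j) := hE
  have z1 := hs0 3 (π' (fam P) aPh); have z2 := hs0 3 (π' (fam P) aP1); have z3 := hs0 3 (π' (fam P) aP2)
  have z4 := hs0 3 (π' (fam P) aTh); have z5 := hs0 1 (D0 (π' (fam P) aP1)); have z6 := hs0 1 (D0 (π' (fam P) aP2))
  have z7 := hs0 1 (D0 (π' (fam P) aTh))
  have b1 := sqle z1 (show _ ≤ E by linarith)
  have b2 := sqle z2 (show _ ≤ E by linarith)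
  have b3 := sqle z3 (show _ ≤ E by linarith)
  have b4 := sqle z4 (show _ ≤ E by linarith)
  have b5 := sqle z5 (show _ ≤ E by linarith)
  have b6 := sqle z6 (show _ ≤ E by linarith)
  have b7 := sqle z7 (show _ ≤ E by linarith)
  have b8 := sqle (hs0 0 _) ((hs_mono' (show 0 ≤ 2 by norm_num) (D0 (π' (fam P) aPh)) j).trans h)
  have m1 := Mp_le 3 (fun i => (i.ε ^ 2)⁻¹) U0 j
  have m2 := Mp_le 3 (fun i => i.ε⁻¹) U1 j
  have m3 := Mp_le 3 (fun i => i.ε⁻¹) U2 j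
  have m4 := Mp_le 3 (fun i => (i.ε ^ 2)⁻¹) U3 j
  rw [D0_π, aP1, dA_sc] at b5
  rw [D0_π, aP2, dA_sc] at b6
  rw [D0_π, aTh, dA_sc] at b7
  rw [D0_π, aPh, dA_sc] at b8
  have m5 := (Mp_le 1 _ _ j).trans (mul_le_mul_of_nonneg_left b5 (by norm_num))
  have m6 := (Mp_le 1 _ _ j).trans (mul_le_mul_of_nonneg_left b6 (by norm_num))
  have m7 := (Mp_le 1 _ _ j).trans (mul_le_mul_of_nonneg_left b7 (by norm_num))
  have m8 := (Mp_le 0 _ _ j).trans (mul_le_mul_of_nonneg_left b8 (by norm_num))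
  rw [← aPh] at m1; rw [← aP1] at m2; rw [← aP2] at m3; rw [← aTh] at m4
  simp only at m1 m2 m3 m4 m5 m6 m7 m8
  revert b1 b2 b3 b4 m1 m2 m3 m4 m5 m6 m7 m8
  generalize hh1 : hs 3 (π' (fam P) aPh) j = H1
  generalize hh2 : hs 3 (π' (fam P) aP1) j = H2
  generalize hh3 : hs 3 (π' (fam P) aP2) j = H3
  generalize hh4 : hs 3 (π' (fam P) aTh) j = H4
  intro b1 b2 b3 b4 m1 m2 m3 m4 m5 m6 m7 m8
  have e0 := Msup_eq hε j.1.1.S.φ j.1.1.S.ψ j.1.1.S.θ j.1.2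
  have v1 := Mp_vec j.1.1.ε⁻¹ hε 4 (ψ_cd j.1.1 j.1.2)
  have v2 := Mp_vec (j.1.1.ε ^ 2 * j.1.1.ε⁻¹) hε 2 (dtψ_cd j.1.1 j.1.2)
  rw [dtψ_fst, dtψ_snd] at v2
  rw [← dt_sl (U3 _).2.1] at m7
  rw [← dt_sl (U0 _).2.1] at m8
  have m8' : dSq 0 (dt j.1.1.S.φ j.1.2) ≤ (C * E) ^ 2 := by
    refine le_trans (le_of_eq ?_) (m8.trans (le_of_eq (by norm_num)))
    rw [Mp, Finset.sum_range_succ, Finset.sum_range_zero, zero_add, mul_zero, pow_zero, one_mul,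
      mul_inv_cancel₀ (by positivity), one_pow, one_mul]
    rfl
  rw [e0]
  have m1' : Mp j.1.1.ε (j.1.1.ε ^ 2)⁻¹ 4 (j.1.1.S.φ j.1.2) ≤ 32 * H1 ^ 2 := m1.trans (le_of_eq (by norm_num))
  have m2' : Mp j.1.1.ε j.1.1.ε⁻¹ 4 (fun y => (j.1.1.S.ψ j.1.2 y).1) ≤ 32 * H2 ^ 2 := m2.trans (le_of_eq (by norm_num))
  have m3' : Mp j.1.1.ε j.1.1.ε⁻¹ 4 (fun y => (j.1.1.S.ψ j.1.2 y).2) ≤ 32 * H3 ^ 2 := m3.trans (le_of_eq (by norm_num))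
  have m4' : Mp j.1.1.ε (j.1.1.ε ^ 2)⁻¹ 4 (j.1.1.S.θ j.1.2) ≤ 32 * H4 ^ 2 := m4.trans (le_of_eq (by norm_num))
  have m5' : Mp j.1.1.ε (j.1.1.ε ^ 2 * j.1.1.ε⁻¹) 2 (sl (pd w0 (U1 j.1.1).1) j.1.2) ≤ 4 * E ^ 2 := m5.trans (le_of_eq (by norm_num))
  have m6' : Mp j.1.1.ε (j.1.1.ε ^ 2 * j.1.1.ε⁻¹) 2 (sl (pd w0 (U2 j.1.1).1) j.1.2) ≤ 4 * E ^ 2 := m6.trans (le_of_eq (by norm_num))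
  have m7' : Mp j.1.1.ε (j.1.1.ε ^ 2 * (j.1.1.ε ^ 2)⁻¹) 2 (dt j.1.1.S.θ j.1.2) ≤ 4 * E ^ 2 := m7.trans (le_of_eq (by norm_num))
  rw [mul_pow] at m8'
  linarith
end Con
end Couette
end

noncomputable section
open MeasureTheory Real Filter Topology
set_option linter.unusedSectionVars false
set_option linter.unusedVariables false
set_option linter.ambiguousOpen false
set_option linter.deprecated false
namespace Couette
namespace Con
open Couette.Core CB
variable {F : Fam}


variable {P : Par}

theorem KL (l : ℕ) (c : (fam P).ι → ℝ) (U : (fam P).ι → SP) (j : JJ (fam P)) :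
    j.1.1.ε ^ (2 * (l + 1)) * (c j.1.1 ^ 2 * dSq (l + 1) (sl (U j.1.1).1 j.1.2))
      ≤ 2 ^ (l + 1) * (hs l (D1 (π' (fam P) (sc c U))) j ^ 2 + hs l (D2 (π' (fam P) (sc c U))) j ^ 2) := by
  have h0 := dSq_sl_succ (U j.1.1).2.1 j.1.2 l
  have h1 := dSq_le_hs l (dA (fam P) (fun i => (fam P).e i) w1 (sc c U)) j
  have h2 := dSq_le_hs l (dA (fam P) (fun i => (fam P).e i) w2 (sc c U)) j
  rw [← D1_π] at h1
  rw [← D2_π] at h2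
  rw [dA_sc, sc_fun] at h1 h2
  rw [dSq_smul (pd_cd (U j.1.1).2.1 w1)] at h1
  rw [dSq_smul (pd_cd (U j.1.1).2.1 w2)] at h2
  simp only at h1 h2
  have h3 := mul_le_mul_of_nonneg_left h0 (show 0 ≤ j.1.1.ε ^ (2 * (l + 1)) * c j.1.1 ^ 2 from mul_nonneg (pow_nonneg j.1.1.hε.le _) (sq_nonneg _))
  have e1 : ∀ z : ℝ, j.1.1.ε ^ (2 * l) * ((j.1.1.ε * c j.1.1) ^ 2 * z) = j.1.1.ε ^ (2 * (l + 1)) * c j.1.1 ^ 2 * z := by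
    intro z; ring
  rw [e1] at h1 h2
  rw [pow_succ 2 l]
  linarith

def KV (ε c : ℝ) {G : Type*} [NormedAddCommGroup G] [NormedSpace ℝ G] (f ft ftt : ℝ × ℝ → G) : ℝ :=
  ε ^ 2 * (c ^ 2 * dSq 0 f) + ε ^ 2 * (c ^ 2 * dSq 1 f) + ε ^ 4 * (c ^ 2 * dSq 2 f) + ε ^ 6 * (c ^ 2 * dSq 3 f)
    + Mp ε (ε ^ 2 * c) 2 ft + (ε ^ 2 * (ε ^ 2 * c)) ^ 2 * dSq 0 ftt

theorem nm_eps_sq (c : (fam P).ι → ℝ) (U : (fam P).ι → SP) (j : JJ (fam P)) :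
    nm (eps * π' (fam P) (sc c U)) j ^ 2 = j.1.1.ε ^ 2 * (c j.1.1 ^ 2 * dSq 0 (sl (U j.1.1).1 j.1.2)) := by
  rw [nm_eps, ep_π, mul_pow, nm_dSq, sc_fun, dSq_smul (U j.1.1).2.1]

theorem KV_le (c : (fam P).ι → ℝ) (U : (fam P).ι → SP) (j : JJ (fam P)) :
    KV j.1.1.ε (c j.1.1) (sl (U j.1.1).1 j.1.2) (sl (pd w0 (U j.1.1).1) j.1.2) (sl (pd w0 (pd w0 (U j.1.1).1)) j.1.2)
      ≤ 34 * yV (π' (fam P) (sc c U)) j ^ 2 := by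
  have hs0 : ∀ k f, 0 ≤ hs k f j := fun k (f : RR (fam P)) => hs_nonneg k f j
  have k0 := nm_eps_sq c U j
  have k1 := KL 0 c U j
  have k2 := KL 1 c U j
  have k3 := KL 2 c U j
  have k4 := Mp_le 1 (fun i => i.ε ^ 2 * c i) (fun i => (⟨pd w0 (U i).1, pd_mem (U i).2 w0⟩ : SP)) j
  rw [← dA_sc (P := P) (fun i => i.ε ^ 2) w0 c U, ← D0_π] at k4
  have k5 := nm_dSq (dA (fam P) (fun i => (fam P).e i ^ 2) w0 (dA (fam P) (fun i => (fam P).e i ^ 2) w0 (sc c U))) j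
  rw [← D0_π, ← D0_π, dA_sc, dA_sc, sc_fun, dSq_smul (pd_cd (pd_cd (U j.1.1).2.1 w0) w0)] at k5
  have hm : ∀ (l : ℕ) (f : RR (fam P)), l ≤ 3 → hs l f j ^ 2 ≤ hs 3 f j ^ 2 := fun l f h => sqle (hs0 l f) (hs_mono' h f j)
  set v := π' (fam P) (sc c U) with hv
  have a1 := hm 0 (D1 v) (by norm_num)
  have a2 := hm 1 (D1 v) (by norm_num)
  have a3 := hm 2 (D1 v) (by norm_num)
  have b1 := hm 0 (D2 v) (by norm_num)
  have b2 := hm 1 (D2 v) (by norm_num)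
  have b3 := hm 2 (D2 v) (by norm_num)
  have c1 := sqle (hs0 1 (D0 v)) (hs_mono' (show 1 ≤ 2 by norm_num) (D0 v) j)
  have hy : yV v j = nm (eps * v) j + (hs 3 (D1 v) j + hs 3 (D2 v) j) + hs 2 (D0 v) j + nm (D0 (D0 v)) j := rfl
  have n1 := nm_nonneg (eps * v) j
  have n2 := nm_nonneg (D0 (D0 v)) j
  have n3 := hs0 3 (D1 v)
  have n4 := hs0 3 (D2 v)
  have n5 := hs0 2 (D0 v)
  have q : nm (eps * v) j ^ 2 + hs 3 (D1 v) j ^ 2 + hs 3 (D2 v) j ^ 2 + hs 2 (D0 v) j ^ 2 + nm (D0 (D0 v)) j ^ 2 ≤ yV v j ^ 2 := by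
    rw [hy]
    generalize nm (eps * v) j = a at *
    generalize hs 3 (D1 v) j = b at *
    generalize hs 3 (D2 v) j = d at *
    generalize hs 2 (D0 v) j = e at *
    generalize nm (D0 (D0 v)) j = f at *
    have := mul_nonneg n1 n3; have := mul_nonneg n1 n4; have := mul_nonneg n1 n5; have := mul_nonneg n1 n2
    have := mul_nonneg n3 n4; have := mul_nonneg n3 n5; have := mul_nonneg n3 n2
    have := mul_nonneg n4 n5; have := mul_nonneg n4 n2; have := mul_nonneg n5 n2
    linarith
  unfold KV
  norm_num at k1 k2 k3 k4 k5
  have s1 := sq_nonneg (nm (eps * v) j)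
  have s2 := sq_nonneg (nm (D0 (D0 v)) j)
  have s3 := sq_nonneg (hs 3 (D1 v) j)
  have s4 := sq_nonneg (hs 3 (D2 v) j)
  have s5 := sq_nonneg (hs 2 (D0 v) j)
  linarith

/-- the integrands, weighted as in the total functional -/
def Kfun (ε : ℝ) (φ : ℝ → ℝ × ℝ → ℝ) (ψ : ℝ → ℝ × ℝ → ℝ × ℝ) (θ : ℝ → ℝ × ℝ → ℝ) (s : ℝ) : ℝ :=
  (ε ^ 2)⁻¹ * (HSq 1 (ψ s) + (ε ^ 2)⁻¹ * HSq 1 (θ s))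
    + (L2Sq (dt ψ s) + (ε ^ 2)⁻¹ * L2Sq (dt θ s))
    + ((ε ^ 4)⁻¹ * HSq 1 (φ s) + (ε ^ 2)⁻¹ * L2Sq (dt φ s))
    + (HSq 2 (ψ s) + (ε ^ 2)⁻¹ * HSq 2 (θ s))
    + ε ^ 2 * (dSq 1 (dt ψ s) + (ε ^ 2)⁻¹ * dSq 1 (dt θ s))
    + ε ^ 2 * ((ε ^ 4)⁻¹ * HSq 2 (φ s) + HSq 3 (ψ s) + (ε ^ 2)⁻¹ * HSq 3 (θ s))
    + ε ^ 4 * (L2Sq (dt (dt ψ) s) + (ε ^ 2)⁻¹ * L2Sq (dt (dt θ) s))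

theorem Kfun_le {ε : ℝ} (hε : 0 < ε) (h1 : ε ≤ 1) (φ : ℝ → ℝ × ℝ → ℝ) (ψ : ℝ → ℝ × ℝ → ℝ × ℝ) (θ : ℝ → ℝ × ℝ → ℝ) (s : ℝ) :
    ε ^ 2 * Kfun ε φ ψ θ s ≤ 3 * (KV ε ε⁻¹ (ψ s) (dt ψ s) (dt (dt ψ) s) + KV ε (ε ^ 2)⁻¹ (θ s) (dt θ s) (dt (dt θ) s)
      + (ε ^ 2 * (((ε ^ 2)⁻¹) ^ 2 * dSq 0 (φ s)) + ε ^ 2 * (((ε ^ 2)⁻¹) ^ 2 * dSq 1 (φ s)) + ε ^ 4 * (((ε ^ 2)⁻¹) ^ 2 * dSq 2 (φ s))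
        + dSq 0 (dt φ s))) := by
  simp only [Kfun, KV, Mp, HSq, L2Sq, Finset.sum_range_succ, Finset.sum_range_zero]
  have g0 := fun l => dSq_nonneg (φ s) l
  have g1 := fun l => dSq_nonneg (ψ s) l
  have g2 := fun l => dSq_nonneg (θ s) l
  have g3 := fun l => dSq_nonneg (dt ψ s) l
  have g4 := fun l => dSq_nonneg (dt θ s) l
  have g5 := dSq_nonneg (dt (dt ψ) s) 0
  have g6 := dSq_nonneg (dt (dt θ) s) 0
  have g7 := dSq_nonneg (dt φ s) 0
  generalize dSq 0 (dt φ s) = z0 at *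
  generalize dSq 0 (dt (dt θ) s) = z1 at *
  generalize dSq 0 (dt (dt ψ) s) = z2 at *
  have p0 := g0 0; have p1 := g0 1; have p2 := g0 2
  have q0 := g1 0; have q1 := g1 1; have q2 := g1 2; have q3 := g1 3
  have r0 := g2 0; have r1 := g2 1; have r2 := g2 2; have r3 := g2 3
  have s0 := g3 0; have s1 := g3 1; have t0 := g4 0; have t1 := g4 1
  clear g0 g1 g2 g3 g4
  generalize dSq 0 (φ s) = a0 at *
  generalize dSq 1 (φ s) = a1 at *
  generalize dSq 2 (φ s) = a2 at *
  generalize dSq 0 (ψ s) = b0 at *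
  generalize dSq 1 (ψ s) = b1 at *
  generalize dSq 2 (ψ s) = b2 at *
  generalize dSq 3 (ψ s) = b3 at *
  generalize dSq 0 (θ s) = c0 at *
  generalize dSq 1 (θ s) = c1 at *
  generalize dSq 2 (θ s) = c2 at *
  generalize dSq 3 (θ s) = c3 at *
  generalize dSq 0 (dt ψ s) = d0 at *
  generalize dSq 1 (dt ψ s) = d1 at *
  generalize dSq 0 (dt θ s) = e0 at *
  generalize dSq 1 (dt θ s) = e1 at *
  have w : (0:ℝ) ≤ 1 - ε ^ 2 := by nlinarith
  have w2 : (0:ℝ) ≤ 1 - ε ^ 4 := by nlinarith [sq_nonneg ε]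
  rw [← sub_nonneg]
  have : 0 ≤ ((1 - ε ^ 2) + (1 - ε ^ 4)) * (b0 + b1 + (ε ^ 2)⁻¹ * (c0 + c1)) + ε ^ 2 * ((1 + (1 - ε ^ 2)) * (b2 + (ε ^ 2)⁻¹ * c2))
     + 2 * ε ^ 4 * (b3 + (ε ^ 2)⁻¹ * c3) + 2 * ε ^ 2 * (d0 + (ε ^ 2)⁻¹ * e0) + 2 * ε ^ 4 * (d1 + (ε ^ 2)⁻¹ * e1)
     + 2 * ε ^ 6 * (z2 + (ε ^ 2)⁻¹ * z1) + (ε ^ 2)⁻¹ * (1 + (1 - ε ^ 2)) * (a0 + a1) + 2 * a2 + 2 * z0 := by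
    have := add_nonneg zero_le_one w
    positivity
  refine this.trans (le_of_eq ?_)
  field_simp
  ring

theorem KV_vec {ε : ℝ} (c : ℝ) (hε : 0 < ε) {f g h : ℝ × ℝ → ℝ × ℝ} (hf : ContDiff ℝ (⊤ : ℕ∞) f)
    (hg : ContDiff ℝ (⊤ : ℕ∞) g) (hh : ContDiff ℝ (⊤ : ℕ∞) h) :
    KV ε c f g h ≤ 2 * (KV ε c (fun y => (f y).1) (fun y => (g y).1) (fun y => (h y).1)
      + KV ε c (fun y => (f y).2) (fun y => (g y).2) (fun y => (h y).2)) := by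
  unfold KV
  have h1 := Mp_vec (ε ^ 2 * c) hε 2 hg
  have h2 := mul_le_mul_of_nonneg_left (vec_le hh 0).2.2 (sq_nonneg (ε ^ 2 * (ε ^ 2 * c)))
  have h3 := mul_le_mul_of_nonneg_left (vec_le hf 0).2.2 (show 0 ≤ ε ^ 2 * c ^ 2 by positivity)
  have h4 := mul_le_mul_of_nonneg_left (vec_le hf 1).2.2 (show 0 ≤ ε ^ 2 * c ^ 2 by positivity)
  have h5 := mul_le_mul_of_nonneg_left (vec_le hf 2).2.2 (show 0 ≤ ε ^ 4 * c ^ 2 by positivity)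
  have h6 := mul_le_mul_of_nonneg_left (vec_le hf 3).2.2 (show 0 ≤ ε ^ 6 * c ^ 2 by positivity)
  linarith

theorem dtdtψ (i : P.I) (t : ℝ) :
    dt (dt i.S.ψ) t = fun x => (sl (pd w0 (pd w0 (U1 i).1)) t x, sl (pd w0 (pd w0 (U2 i).1)) t x) := by
  have e : dt i.S.ψ = fun s x => (sl (pd w0 (U1 i).1) s x, sl (pd w0 (U2 i).1) s x) := by
    funext s; rw [dt_vec i.sm.2.1]; rfl
  rw [e]
  exact dt_vec (ψ := fun s x => (sl (pd w0 (U1 i).1) s x, sl (pd w0 (U2 i).1) s x))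
    ((pd_cd (U1 i).2.1 w0).prodMk (pd_cd (U2 i).2.1 w0)) t

theorem dtdtθ (i : P.I) (t : ℝ) : dt (dt i.S.θ) t = sl (pd w0 (pd w0 (U3 i).1)) t := by
  have e : dt i.S.θ = sl (pd w0 (U3 i).1) := by
    funext s; exact dt_sl (U3 i).2.1 s
  rw [e, dt_sl (pd_cd (U3 i).2.1 w0)]

theorem K_le (j : JJ (fam P)) {C Y : ℝ} (hY : Y = yF (π' (fam P) aPh) (π' _ aP1) (π' _ aP2) (π' _ aTh) j)
    (h : hs 2 (D0 (π' (fam P) aPh)) j ≤ C * Y) :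
    j.1.1.ε ^ 2 * Kfun j.1.1.ε j.1.1.S.φ j.1.1.S.ψ j.1.1.S.θ j.1.2 ≤ (600 + 3 * C ^ 2) * Y ^ 2 := by
  have hε : 0 < j.1.1.ε := j.1.1.hε
  have hε1 : j.1.1.ε ≤ 1 := j.1.1.hε2.trans (by norm_num)
  have hs0 : ∀ k f, 0 ≤ hs k f j := fun k (f : RR (fam P)) => hs_nonneg k f j
  have Y' : Y = nm (eps * π' (fam P) aPh) j + (hs 2 (D1 (π' (fam P) aPh)) j + hs 2 (D2 (π' (fam P) aPh)) j)
    + (yV (π' (fam P) aP1) j + yV (π' (fam P) aP2) j + yV (π' (fam P) aTh) j) := hY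
  have yn : ∀ v : RR (fam P), 0 ≤ yV v j := by
    intro v
    have hy : yV v j = nm (eps * v) j + (hs 3 (D1 v) j + hs 3 (D2 v) j) + hs 2 (D0 v) j + nm (D0 (D0 v)) j := rfl
    have := nm_nonneg (eps * v) j
    have := nm_nonneg (D0 (D0 v)) j
    linarith [hs0 3 (D1 v), hs0 3 (D2 v), hs0 2 (D0 v)]
  have z0 := nm_nonneg (eps * π' (fam P) aPh) j
  have z1 := hs0 2 (D1 (π' (fam P) aPh)); have z2 := hs0 2 (D2 (π' (fam P) aPh))
  have z3 := yn (π' (fam P) aP1); have z4 := yn (π' (fam P) aP2); have z5 := yn (π' (fam P) aTh)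
  have hm : ∀ (l : ℕ) (f : RR (fam P)), l ≤ 2 → hs l f j ^ 2 ≤ hs 2 f j ^ 2 := fun l f h => sqle (hs0 l f) (hs_mono' h f j)
  have a1 := hm 0 (D1 (π' (fam P) aPh)) (by norm_num)
  have a2 := hm 1 (D1 (π' (fam P) aPh)) (by norm_num)
  have b1 := hm 0 (D2 (π' (fam P) aPh)) (by norm_num)
  have b2 := hm 1 (D2 (π' (fam P) aPh)) (by norm_num)
  have k0 := nm_eps_sq (fun i => (i.ε ^ 2)⁻¹) U0 j
  have k1 := KL 0 (fun i => (i.ε ^ 2)⁻¹) U0 j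
  have k2 := KL 1 (fun i => (i.ε ^ 2)⁻¹) U0 j
  have v1 := KV_le (fun i => i.ε⁻¹) U1 j
  have v2 := KV_le (fun i => i.ε⁻¹) U2 j
  have v3 := KV_le (fun i => (i.ε ^ 2)⁻¹) U3 j
  have c1 := sqle (hs0 0 _) ((hs_mono' (show 0 ≤ 2 by norm_num) (D0 (π' (fam P) aPh)) j).trans h)
  rw [← aPh] at k0 k1 k2
  rw [← aP1] at v1; rw [← aP2] at v2; rw [← aTh] at v3
  rw [D0_π, aPh, dA_sc] at c1
  have m8 := (Mp_le 0 _ _ j).trans (mul_le_mul_of_nonneg_left c1 (by norm_num))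
  simp only at m8
  rw [← dt_sl (U0 _).2.1] at m8
  have m8' : dSq 0 (dt j.1.1.S.φ j.1.2) ≤ (C * Y) ^ 2 := by
    refine le_trans (le_of_eq ?_) (m8.trans (le_of_eq (by norm_num)))
    rw [Mp, Finset.sum_range_succ, Finset.sum_range_zero, zero_add, mul_zero, pow_zero, one_mul,
      mul_inv_cancel₀ (by positivity), one_pow, one_mul]
    rfl
  have hc := KV_vec (j.1.1.ε⁻¹) hε (ψ_cd j.1.1 j.1.2) (dtψ_cd j.1.1 j.1.2) (h := dt (dt j.1.1.S.ψ) j.1.2) (by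
    rw [dtdtψ]
    exact (sl_cd (pd_cd (pd_cd (U1 j.1.1).2.1 w0) w0) _).prodMk (sl_cd (pd_cd (pd_cd (U2 j.1.1).2.1 w0) w0) _))
  rw [dtψ_fst, dtψ_snd] at hc
  simp only [dtdtψ] at hc
  have hK := Kfun_le hε hε1 j.1.1.S.φ j.1.1.S.ψ j.1.1.S.θ j.1.2
  rw [dtdtθ, dtdtψ] at hK
  have e3 : dt j.1.1.S.θ j.1.2 = sl (pd w0 (U3 j.1.1).1) j.1.2 := dt_sl (U3 j.1.1).2.1 j.1.2
  rw [e3] at hK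
  have v1' : KV j.1.1.ε j.1.1.ε⁻¹ (fun y => (j.1.1.S.ψ j.1.2 y).1) (sl (pd w0 (U1 j.1.1).1) j.1.2)
    (sl (pd w0 (pd w0 (U1 j.1.1).1)) j.1.2) ≤ 34 * yV (π' (fam P) aP1) j ^ 2 := v1
  have v2' : KV j.1.1.ε j.1.1.ε⁻¹ (fun y => (j.1.1.S.ψ j.1.2 y).2) (sl (pd w0 (U2 j.1.1).1) j.1.2)
    (sl (pd w0 (pd w0 (U2 j.1.1).1)) j.1.2) ≤ 34 * yV (π' (fam P) aP2) j ^ 2 := v2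
  have v3' : KV j.1.1.ε (j.1.1.ε ^ 2)⁻¹ (j.1.1.S.θ j.1.2) (sl (pd w0 (U3 j.1.1).1) j.1.2)
    (sl (pd w0 (pd w0 (U3 j.1.1).1)) j.1.2) ≤ 34 * yV (π' (fam P) aTh) j ^ 2 := v3
  have k0' : nm (eps * π' (fam P) aPh) j ^ 2 = j.1.1.ε ^ 2 * (((j.1.1.ε ^ 2)⁻¹) ^ 2 * dSq 0 (j.1.1.S.φ j.1.2)) := k0
  have k1' : j.1.1.ε ^ 2 * (((j.1.1.ε ^ 2)⁻¹) ^ 2 * dSq 1 (j.1.1.S.φ j.1.2)) ≤ 2 * (hs 0 (D1 (π' (fam P) aPh)) j ^ 2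
    + hs 0 (D2 (π' (fam P) aPh)) j ^ 2) := k1.trans (le_of_eq (by norm_num))
  have k2' : j.1.1.ε ^ 4 * (((j.1.1.ε ^ 2)⁻¹) ^ 2 * dSq 2 (j.1.1.S.φ j.1.2)) ≤ 4 * (hs 1 (D1 (π' (fam P) aPh)) j ^ 2
    + hs 1 (D2 (π' (fam P) aPh)) j ^ 2) := k2.trans (le_of_eq (by norm_num))
  have q : nm (eps * π' (fam P) aPh) j ^ 2 + hs 2 (D1 (π' (fam P) aPh)) j ^ 2 + hs 2 (D2 (π' (fam P) aPh)) j ^ 2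
      + yV (π' (fam P) aP1) j ^ 2 + yV (π' (fam P) aP2) j ^ 2 + yV (π' (fam P) aTh) j ^ 2 ≤ Y ^ 2 := by
    rw [Y']
    generalize nm (eps * π' (fam P) aPh) j = a at *
    generalize hs 2 (D1 (π' (fam P) aPh)) j = b at *
    generalize hs 2 (D2 (π' (fam P) aPh)) j = c at *
    generalize yV (π' (fam P) aP1) j = d at *
    generalize yV (π' (fam P) aP2) j = e at *
    generalize yV (π' (fam P) aTh) j = f at *
    have n1 : 0 ≤ a * (b + c + d + e + f) := by positivity
    have n2 : 0 ≤ b * (c + d + e + f) := by positivity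
    have n3 : 0 ≤ c * (d + e + f) := by positivity
    have n4 : 0 ≤ d * (e + f) := by positivity
    have n5 : 0 ≤ e * f := by positivity
    linarith
  rw [mul_pow] at m8'
  have s1 := sq_nonneg (nm (eps * π' (fam P) aPh) j)
  have s2 := sq_nonneg (hs 2 (D1 (π' (fam P) aPh)) j)
  have s3 := sq_nonneg (hs 2 (D2 (π' (fam P) aPh)) j)
  have s4 := sq_nonneg (yV (π' (fam P) aP1) j)
  have s5 := sq_nonneg (yV (π' (fam P) aP2) j)
  have s6 := sq_nonneg (yV (π' (fam P) aTh) j)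
  linarith
end Con
end Couette
end

noncomputable section
open MeasureTheory Real Filter Topology
set_option linter.unusedSectionVars false
set_option linter.unusedVariables false
set_option linter.ambiguousOpen false
set_option linter.deprecated false
namespace Couette
namespace Con
open Couette.Core CB
variable {F : Fam}


/-- boundedness on a time interval -/
def Bd (T : ℝ) (f : ℝ → ℝ) : Prop := ∃ B, ∀ s ∈ Set.Icc 0 T, f s ≤ B

theorem Bd.add {T : ℝ} {f g : ℝ → ℝ} (hf : Bd T f) (hg : Bd T g) : Bd T fun s => f s + g s := by
  obtain ⟨B, hB⟩ := hf; obtain ⟨C, hC⟩ := hg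
  exact ⟨B + C, fun s hs => add_le_add (hB s hs) (hC s hs)⟩

theorem Bd.mul {T : ℝ} {f : ℝ → ℝ} {c : ℝ} (hc : 0 ≤ c) (hf : Bd T f) : Bd T fun s => c * f s := by
  obtain ⟨B, hB⟩ := hf
  exact ⟨c * B, fun s hs => mul_le_mul_of_nonneg_left (hB s hs) hc⟩

theorem Bd.vec {T : ℝ} {V W : V3 → ℝ} (hV : ContDiff ℝ (⊤ : ℕ∞) V) (hW : ContDiff ℝ (⊤ : ℕ∞) W) (j : ℕ) :
    Bd T fun s => dSq j (fun x => (sl V s x, sl W s x)) := by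
  obtain ⟨B, hB⟩ := dSq_bdd hV j T
  obtain ⟨C, hC⟩ := dSq_bdd hW j T
  exact ⟨2 * (B + C), fun s hs => ((vec_le ((sl_cd hV s).prodMk (sl_cd hW s)) j).2.2).trans
    (mul_le_mul_of_nonneg_left (add_le_add (hB s hs) (hC s hs)) (by norm_num))⟩

theorem lsup {T : ℝ} {f : ℝ → ℝ} (hf : Bd T f) {s : ℝ} (hs : s ∈ Set.Icc 0 T) :
    f s ≤ ⨆ s ∈ Set.Icc (0 : ℝ) T, f s := by
  obtain ⟨B, hB⟩ := hf
  refine le_ciSup_of_le (f := fun s => ⨆ (_ : s ∈ Set.Icc (0 : ℝ) T), f s) ⟨max B 0, ?_⟩ s ?_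
  · rintro _ ⟨u, rfl⟩
    by_cases hu : u ∈ Set.Icc (0 : ℝ) T
    · simp only [ciSup_pos hu]; exact (hB u hu).trans (le_max_left _ _)
    · have : IsEmpty (u ∈ Set.Icc (0 : ℝ) T) := isEmpty_Prop.2 hu
      simp only [Real.iSup_of_isEmpty]; exact le_max_right _ _
  · rw [ciSup_pos hs]

theorem usup {T : ℝ} {f : ℝ → ℝ} {w B : ℝ} (hw : 0 < w) (hB : 0 ≤ B) (h : ∀ s ∈ Set.Icc 0 T, w * f s ≤ B) :
    w * (⨆ s ∈ Set.Icc (0 : ℝ) T, f s) ≤ B := by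
  rw [← le_div_iff₀' hw]
  refine Real.iSup_le (fun s => Real.iSup_le (fun hs => ?_) (by positivity)) (by positivity)
  rw [le_div_iff₀' hw]; exact h s hs

theorem uint {T : ℝ} (hT : 0 ≤ T) {f G : ℝ → ℝ} {w : ℝ} (hw : 0 ≤ w) (hf : ∀ s, 0 ≤ f s) (hG : IntervalIntegrable G volume 0 T)
    (h : ∀ s ∈ Set.Icc 0 T, w * f s ≤ G s) : w * (∫ s in (0 : ℝ)..T, f s) ≤ ∫ s in (0 : ℝ)..T, G s := by
  rw [← intervalIntegral.integral_const_mul, intervalIntegral.integral_of_le hT, intervalIntegral.integral_of_le hT]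
  rw [intervalIntegrable_iff_integrableOn_Ioc_of_le hT] at hG
  refine integral_mono_of_nonneg (Eventually.of_forall fun s => mul_nonneg hw (hf s)) hG ?_
  exact (ae_restrict_iff' measurableSet_Ioc).2 (Eventually.of_forall fun s hs => h s ⟨hs.1.le, hs.2⟩)

theorem HSq_nonneg {G : Type*} [NormedAddCommGroup G] [NormedSpace ℝ G] (f : ℝ × ℝ → G) (k : ℕ) : 0 ≤ HSq k f :=
  Finset.sum_nonneg fun _ _ => dSq_nonneg _ _
theorem L2Sq_nonneg {G : Type*} [NormedAddCommGroup G] [NormedSpace ℝ G] (f : ℝ × ℝ → G) : 0 ≤ L2Sq f := dSq_nonneg _ _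

theorem Msup_le_N {ε T : ℝ} (hε : 0 < ε) {φ : ℝ → ℝ × ℝ → ℝ} {ψ : ℝ → ℝ × ℝ → ℝ × ℝ} {θ : ℝ → ℝ × ℝ → ℝ}
    (h1 : ContDiff ℝ (⊤ : ℕ∞) (Function.uncurry φ)) (h2 : ContDiff ℝ (⊤ : ℕ∞) (Function.uncurry ψ))
    (h3 : ContDiff ℝ (⊤ : ℕ∞) (Function.uncurry θ)) {s : ℝ} (hs : s ∈ Set.Icc 0 T) :
    Msup ε φ ψ θ s ≤ Nfun ε φ ψ θ T := by
  have hT : 0 ≤ T := hs.1.trans hs.2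
  have bφ : ∀ j, Bd T fun s => dSq j (φ s) := fun j => dSq_bdd h1 j T
  have bθ : ∀ j, Bd T fun s => dSq j (θ s) := fun j => dSq_bdd h3 j T
  have p1 : ContDiff ℝ (⊤ : ℕ∞) (fun p : V3 => (ψ p.1 p.2).1) := contDiff_fst.comp h2
  have p2 : ContDiff ℝ (⊤ : ℕ∞) (fun p : V3 => (ψ p.1 p.2).2) := contDiff_snd.comp h2
  have bψ : ∀ j, Bd T fun s => dSq j (ψ s) := fun j => Bd.vec p1 p2 j
  have bφt : ∀ j, Bd T fun s => dSq j (dt φ s) := by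
    intro j
    have e : dt φ = sl (pd w0 (Function.uncurry φ)) := funext fun s => dt_sl h1 s
    rw [e]; exact dSq_bdd (pd_cd h1 w0) j T
  have bθt : ∀ j, Bd T fun s => dSq j (dt θ s) := by
    intro j
    have e : dt θ = sl (pd w0 (Function.uncurry θ)) := funext fun s => dt_sl h3 s
    rw [e]; exact dSq_bdd (pd_cd h3 w0) j T
  have bψt : ∀ j, Bd T fun s => dSq j (dt ψ s) := by
    intro j
    simp only [dt_vec h2]
    exact Bd.vec (pd_cd p1 w0) (pd_cd p2 w0) j
  have hi : 0 ≤ (ε ^ 2)⁻¹ := by positivity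
  have l0 := lsup (((bψ 0).add ((bφ 0).mul hi)).add ((bθ 0).mul hi)) hs
  have l1 := lsup ((bψ 1).add ((bθ 1).mul hi)) hs
  have l2 := lsup (bφ 1) hs
  have l3 := lsup ((((bφt 0).mul hi).add (bψt 0)).add ((bθt 0).mul hi)) hs
  have l4 := lsup ((((bφ 2).mul hi).add (bψ 2)).add ((bθ 2).mul hi)) hs
  have l5 := lsup ((((bφ 3).mul hi).add ((bψ 3).add (bψt 1))).add (((bθ 3).add (bθt 1)).mul hi)) hs
  have hi4 : 0 ≤ (ε ^ 4)⁻¹ := by positivity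
  have i0 : 0 ≤ ∫ s in (0 : ℝ)..T, (HSq 1 (ψ s) + (ε ^ 2)⁻¹ * HSq 1 (θ s)) :=
    intervalIntegral.integral_nonneg hT fun s _ => add_nonneg (HSq_nonneg _ _) (mul_nonneg hi (HSq_nonneg _ _))
  have i1 : 0 ≤ ∫ s in (0 : ℝ)..T, (L2Sq (dt ψ s) + (ε ^ 2)⁻¹ * L2Sq (dt θ s)) :=
    intervalIntegral.integral_nonneg hT fun s _ => add_nonneg (L2Sq_nonneg _) (mul_nonneg hi (L2Sq_nonneg _))
  have i2 : 0 ≤ ∫ s in (0 : ℝ)..T, ((ε ^ 4)⁻¹ * HSq 1 (φ s) + (ε ^ 2)⁻¹ * L2Sq (dt φ s)) :=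
    intervalIntegral.integral_nonneg hT fun s _ => add_nonneg (mul_nonneg hi4 (HSq_nonneg _ _)) (mul_nonneg hi (L2Sq_nonneg _))
  have i3 : 0 ≤ ∫ s in (0 : ℝ)..T, (HSq 2 (ψ s) + (ε ^ 2)⁻¹ * HSq 2 (θ s)) :=
    intervalIntegral.integral_nonneg hT fun s _ => add_nonneg (HSq_nonneg _ _) (mul_nonneg hi (HSq_nonneg _ _))
  have i4 : 0 ≤ ∫ s in (0 : ℝ)..T, (dSq 1 (dt ψ s) + (ε ^ 2)⁻¹ * dSq 1 (dt θ s)) :=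
    intervalIntegral.integral_nonneg hT fun s _ => add_nonneg (dSq_nonneg _ _) (mul_nonneg hi (dSq_nonneg _ _))
  have i5 : 0 ≤ ∫ s in (0 : ℝ)..T, ((ε ^ 4)⁻¹ * HSq 2 (φ s) + HSq 3 (ψ s) + (ε ^ 2)⁻¹ * HSq 3 (θ s)) :=
    intervalIntegral.integral_nonneg hT fun s _ => add_nonneg (add_nonneg (mul_nonneg hi4 (HSq_nonneg _ _)) (HSq_nonneg _ _))
      (mul_nonneg hi (HSq_nonneg _ _))
  have i6 : 0 ≤ ∫ s in (0 : ℝ)..T, (L2Sq (dt (dt ψ) s) + (ε ^ 2)⁻¹ * L2Sq (dt (dt θ) s)) :=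
    intervalIntegral.integral_nonneg hT fun s _ => add_nonneg (L2Sq_nonneg _) (mul_nonneg hi (L2Sq_nonneg _))
  unfold Msup Nfun A0 A1 A2 A3 A4 A5
  have e2 : 0 ≤ ε ^ 2 := by positivity
  have e4 : 0 ≤ ε ^ 4 := by positivity
  refine add_le_add (add_le_add (add_le_add (add_le_add (add_le_add ?_ ?_) ?_) ?_) ?_) ?_
  · exact mul_le_mul_of_nonneg_left (le_add_of_le_of_nonneg l0 i0) hi
  · exact le_add_of_le_of_nonneg l1 i1
  · exact le_add_of_le_of_nonneg (le_add_of_le_of_nonneg (mul_le_mul_of_nonneg_left l2 hi) i2) i3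
  · exact mul_le_mul_of_nonneg_left (le_add_of_le_of_nonneg l3 i4) e2
  · exact mul_le_mul_of_nonneg_left (le_add_of_le_of_nonneg l4 i5) e2
  · exact mul_le_mul_of_nonneg_left (le_add_of_le_of_nonneg l5 i6) e4

theorem N_le {ε T B : ℝ} (hε : 0 < ε) (hT : 0 ≤ T) {φ : ℝ → ℝ × ℝ → ℝ} {ψ : ℝ → ℝ × ℝ → ℝ × ℝ} {θ : ℝ → ℝ × ℝ → ℝ}
    {G : ℝ → ℝ} (hG : IntervalIntegrable G volume 0 T) (hB : 0 ≤ B) (hM : ∀ s ∈ Set.Icc 0 T, Msup ε φ ψ θ s ≤ B)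
    (hK : ∀ s ∈ Set.Icc 0 T, Kfun ε φ ψ θ s ≤ G s) :
    Nfun ε φ ψ θ T ≤ 6 * B + 7 * ∫ s in (0 : ℝ)..T, G s := by
  have hi : 0 < (ε ^ 2)⁻¹ := by positivity
  have hi4 : 0 < (ε ^ 4)⁻¹ := by positivity
  have e2 : 0 < ε ^ 2 := by positivity
  have e4 : 0 < ε ^ 4 := by positivity
  have n1 : ∀ s, 0 ≤ L2Sq (ψ s) + (ε ^ 2)⁻¹ * L2Sq (φ s) + (ε ^ 2)⁻¹ * L2Sq (θ s) := fun s =>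
    add_nonneg (add_nonneg (L2Sq_nonneg _) (mul_nonneg hi.le (L2Sq_nonneg _))) (mul_nonneg hi.le (L2Sq_nonneg _))
  have n2 : ∀ s, 0 ≤ dSq 1 (ψ s) + (ε ^ 2)⁻¹ * dSq 1 (θ s) := fun s => add_nonneg (dSq_nonneg _ _) (mul_nonneg hi.le (dSq_nonneg _ _))
  have n3 : ∀ s, 0 ≤ dSq 1 (φ s) := fun s => dSq_nonneg _ _
  have n4 : ∀ s, 0 ≤ (ε ^ 2)⁻¹ * L2Sq (dt φ s) + L2Sq (dt ψ s) + (ε ^ 2)⁻¹ * L2Sq (dt θ s) := fun s =>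
    add_nonneg (add_nonneg (mul_nonneg hi.le (L2Sq_nonneg _)) (L2Sq_nonneg _)) (mul_nonneg hi.le (L2Sq_nonneg _))
  have n5 : ∀ s, 0 ≤ (ε ^ 2)⁻¹ * dSq 2 (φ s) + dSq 2 (ψ s) + (ε ^ 2)⁻¹ * dSq 2 (θ s) := fun s =>
    add_nonneg (add_nonneg (mul_nonneg hi.le (dSq_nonneg _ _)) (dSq_nonneg _ _)) (mul_nonneg hi.le (dSq_nonneg _ _))
  have n6 : ∀ s, 0 ≤ (ε ^ 2)⁻¹ * dSq 3 (φ s) + (dSq 3 (ψ s) + dSq 1 (dt ψ s)) + (ε ^ 2)⁻¹ * (dSq 3 (θ s) + dSq 1 (dt θ s)) := fun s =>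
    add_nonneg (add_nonneg (mul_nonneg hi.le (dSq_nonneg _ _)) (add_nonneg (dSq_nonneg _ _) (dSq_nonneg _ _)))
      (mul_nonneg hi.le (add_nonneg (dSq_nonneg _ _) (dSq_nonneg _ _)))
  have m : ∀ s ∈ Set.Icc 0 T, _ := fun s hs => hM s hs
  unfold Msup at m
  have mm := fun s => mul_nonneg hi.le (n1 s)
  have m3 := fun s => mul_nonneg hi.le (n3 s)
  have m4 := fun s => mul_nonneg e2.le (n4 s)
  have m5 := fun s => mul_nonneg e2.le (n5 s)
  have m6 := fun s => mul_nonneg e4.le (n6 s)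
  have u1 := usup hi hB (fun s hs => show _ * (L2Sq (ψ s) + (ε ^ 2)⁻¹ * L2Sq (φ s) + (ε ^ 2)⁻¹ * L2Sq (θ s)) ≤ B by
    linarith [m s hs, mm s, n2 s, m3 s, m4 s, m5 s, m6 s])
  have u2 := usup one_pos hB (fun s hs => show _ * (dSq 1 (ψ s) + (ε ^ 2)⁻¹ * dSq 1 (θ s)) ≤ B by
    linarith [m s hs, mm s, n2 s, m3 s, m4 s, m5 s, m6 s])
  have u3 := usup hi hB (fun s hs => show _ * (dSq 1 (φ s)) ≤ B by
    linarith [m s hs, mm s, n2 s, m3 s, m4 s, m5 s, m6 s])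
  have u4 := usup e2 hB (fun s hs => show _ * ((ε ^ 2)⁻¹ * L2Sq (dt φ s) + L2Sq (dt ψ s) + (ε ^ 2)⁻¹ * L2Sq (dt θ s)) ≤ B by
    linarith [m s hs, mm s, n2 s, m3 s, m4 s, m5 s, m6 s])
  have u5 := usup e2 hB (fun s hs => show _ * ((ε ^ 2)⁻¹ * dSq 2 (φ s) + dSq 2 (ψ s) + (ε ^ 2)⁻¹ * dSq 2 (θ s)) ≤ B by
    linarith [m s hs, mm s, n2 s, m3 s, m4 s, m5 s, m6 s])
  have u6 := usup e4 hB (fun s hs => show _ * ((ε ^ 2)⁻¹ * dSq 3 (φ s) + (dSq 3 (ψ s) + dSq 1 (dt ψ s))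
      + (ε ^ 2)⁻¹ * (dSq 3 (θ s) + dSq 1 (dt θ s))) ≤ B by
    linarith [m s hs, mm s, n2 s, m3 s, m4 s, m5 s, m6 s])
  have k0 : ∀ s, 0 ≤ HSq 1 (ψ s) + (ε ^ 2)⁻¹ * HSq 1 (θ s) := fun s => add_nonneg (HSq_nonneg _ _) (mul_nonneg hi.le (HSq_nonneg _ _))
  have k1 : ∀ s, 0 ≤ L2Sq (dt ψ s) + (ε ^ 2)⁻¹ * L2Sq (dt θ s) := fun s => add_nonneg (L2Sq_nonneg _) (mul_nonneg hi.le (L2Sq_nonneg _))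
  have k2 : ∀ s, 0 ≤ (ε ^ 4)⁻¹ * HSq 1 (φ s) + (ε ^ 2)⁻¹ * L2Sq (dt φ s) := fun s =>
    add_nonneg (mul_nonneg hi4.le (HSq_nonneg _ _)) (mul_nonneg hi.le (L2Sq_nonneg _))
  have k3 : ∀ s, 0 ≤ HSq 2 (ψ s) + (ε ^ 2)⁻¹ * HSq 2 (θ s) := fun s => add_nonneg (HSq_nonneg _ _) (mul_nonneg hi.le (HSq_nonneg _ _))
  have k4 : ∀ s, 0 ≤ dSq 1 (dt ψ s) + (ε ^ 2)⁻¹ * dSq 1 (dt θ s) := fun s => add_nonneg (dSq_nonneg _ _) (mul_nonneg hi.le (dSq_nonneg _ _))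
  have k5 : ∀ s, 0 ≤ (ε ^ 4)⁻¹ * HSq 2 (φ s) + HSq 3 (ψ s) + (ε ^ 2)⁻¹ * HSq 3 (θ s) := fun s =>
    add_nonneg (add_nonneg (mul_nonneg hi4.le (HSq_nonneg _ _)) (HSq_nonneg _ _)) (mul_nonneg hi.le (HSq_nonneg _ _))
  have k6 : ∀ s, 0 ≤ L2Sq (dt (dt ψ) s) + (ε ^ 2)⁻¹ * L2Sq (dt (dt θ) s) := fun s =>
    add_nonneg (L2Sq_nonneg _) (mul_nonneg hi.le (L2Sq_nonneg _))
  have K : ∀ s ∈ Set.Icc 0 T, _ := fun s hs => hK s hs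
  unfold Kfun at K
  have j0 := fun s => mul_nonneg hi.le (k0 s)
  have j4 := fun s => mul_nonneg e2.le (k4 s)
  have j5 := fun s => mul_nonneg e2.le (k5 s)
  have j6 := fun s => mul_nonneg e4.le (k6 s)
  have w0 := uint hT hi.le k0 hG (fun s hs => by linarith [K s hs, j0 s, k1 s, k2 s, k3 s, j4 s, j5 s, j6 s])
  have w1 := uint hT zero_le_one k1 hG (fun s hs => by linarith [K s hs, j0 s, k1 s, k2 s, k3 s, j4 s, j5 s, j6 s])
  have w2 := uint hT zero_le_one k2 hG (fun s hs => by linarith [K s hs, j0 s, k1 s, k2 s, k3 s, j4 s, j5 s, j6 s])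
  have w3 := uint hT zero_le_one k3 hG (fun s hs => by linarith [K s hs, j0 s, k1 s, k2 s, k3 s, j4 s, j5 s, j6 s])
  have w4 := uint hT e2.le k4 hG (fun s hs => by linarith [K s hs, j0 s, k1 s, k2 s, k3 s, j4 s, j5 s, j6 s])
  have w5 := uint hT e2.le k5 hG (fun s hs => by linarith [K s hs, j0 s, k1 s, k2 s, k3 s, j4 s, j5 s, j6 s])
  have w6 := uint hT e4.le k6 hG (fun s hs => by linarith [K s hs, j0 s, k1 s, k2 s, k3 s, j4 s, j5 s, j6 s])
  unfold Nfun A0 A1 A2 A3 A4 A5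
  rw [one_mul] at u2 w1 w2 w3
  simp only [mul_add (ε ^ 2)⁻¹ (iSup _), mul_add (ε ^ 2) (iSup _), mul_add (ε ^ 4) (iSup _)]
  linarith
end Con
end Couette
end

noncomputable section
open MeasureTheory Real Filter Topology
set_option linter.unusedSectionVars false
set_option linter.unusedVariables false
set_option linter.ambiguousOpen false
set_option linter.deprecated false
namespace Couette
namespace Con
open Couette.Core CB
variable {F : Fam}


variable {P : Par}

theorem final_est (P : Par) (Q : AA (fam P)) {C : ℝ} (hC : 0 ≤ C)
    (H : ∀ (j : JJ (fam P)) (E Y : ℝ),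
      E = eF (π' (fam P) aPh) (π' _ aP1) (π' _ aP2) (π' _ aTh) j →
      Y = yF (π' (fam P) aPh) (π' _ aP1) (π' _ aP2) (π' _ aTh) j →
      E * E ≤ I (π' _ Q) j + C * ((j.1.1.ε + E) * (E * E)) ∧ |I (π' _ Q) j| ≤ C * (E * E) ∧
      I (D0 (π' _ Q)) j + Y * Y ≤ C * ((j.1.1.ε + E) * (Y * Y)) ∧
      hs 2 (D0 (π' (fam P) aPh)) j ≤ C * E ∧ hs 2 (D0 (π' (fam P) aPh)) j ≤ C * Y)
    (i : P.I) (he : i.ε < 1 / (4 * (C + 1))) (hN : Nfun i.ε i.S.φ i.S.ψ i.S.θ i.T < (1 / (4 * (C + 1))) ^ 2 / 16905) :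
    Nfun i.ε i.S.φ i.S.ψ i.S.θ i.T
      ≤ (12 * (212 + C ^ 2) + 14 * (600 + 3 * C ^ 2)) * (C * 16905) * Nfun i.ε i.S.φ i.S.ψ i.S.θ 0 := by
  have hε := i.hε
  have hT := i.hT
  set g : ℝ → ℝ := fun s => ∫ x in Ω, (Q i).1 (s, x) with hg
  set g' : ℝ → ℝ := fun s => ∫ x in Ω, pd w0 (Q i).1 (s, x) with hg'
  have dg : ∀ s, HasDerivAt g (g' s) s := fun s => int_t (Q i).2.1 s
  have cg' : Continuous g' := continuous_iff_continuousAt.2 fun s => (int_t (pd_cd (Q i).2.1 w0) s).continuousAt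
  have D : 0 < 1 / (4 * (C + 1)) := by positivity
  have key : ∀ s ∈ Set.Icc 0 i.T,
      Msup i.ε i.S.φ i.S.ψ i.S.θ s ≤ 2 * (212 + C ^ 2) * g s ∧ g s ≤ C * 16905 * Msup i.ε i.S.φ i.S.ψ i.S.θ s ∧
      g' s ≤ 0 ∧ 0 ≤ g s ∧ Kfun i.ε i.S.φ i.S.ψ i.S.θ s ≤ - (2 * (600 + 3 * C ^ 2)) * g' s := by
    intro s ht
    let j : JJ (fam P) := ⟨(i, s), ht⟩
    obtain ⟨E, hE⟩ : ∃ E, E = eF (π' (fam P) aPh) (π' _ aP1) (π' _ aP2) (π' _ aTh) j := ⟨_, rfl⟩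
    obtain ⟨Y, hY⟩ : ∃ Y, Y = yF (π' (fam P) aPh) (π' _ aP1) (π' _ aP2) (π' _ aTh) j := ⟨_, rfl⟩
    obtain ⟨a, b, c, d1, d2⟩ := H j E Y hE hY
    have m1 := Msup_le j hE d1
    have m2 := K_le j hY d2
    have m3 := eF_le j
    rw [← hE] at m3
    have hs0 : ∀ k f, 0 ≤ hs k f j := fun k (f : RR (fam P)) => hs_nonneg k f j
    have hE0 : 0 ≤ E := by
      have E' : E = hs 3 (π' (fam P) aPh) j + (hs 3 (π' (fam P) aP1) j + hs 3 (π' (fam P) aP2) j + hs 3 (π' (fam P) aTh) j)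
        + (hs 1 (D0 (π' (fam P) aP1)) j + hs 1 (D0 (π' (fam P) aP2)) j + hs 1 (D0 (π' (fam P) aTh)) j) := hE
      rw [E']
      linarith [hs0 3 (π' (fam P) aPh), hs0 3 (π' (fam P) aP1), hs0 3 (π' (fam P) aP2), hs0 3 (π' (fam P) aTh),
        hs0 1 (D0 (π' (fam P) aP1)), hs0 1 (D0 (π' (fam P) aP2)), hs0 1 (D0 (π' (fam P) aTh))]
    have e1 : I (π' _ Q) j = g s := I_π Q j
    have e2 : I (D0 (π' _ Q)) j = i.ε ^ 2 * g' s := by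
      rw [D0_π, I_π]
      exact integral_const_mul _ _
    rw [e1] at a b
    rw [e2] at c
    have m1' : Msup i.ε i.S.φ i.S.ψ i.S.θ s ≤ (212 + C ^ 2) * E ^ 2 := m1
    have m2' : i.ε ^ 2 * Kfun i.ε i.S.φ i.S.ψ i.S.θ s ≤ (600 + 3 * C ^ 2) * Y ^ 2 := m2
    have m3' : E ^ 2 ≤ 16905 * Msup i.ε i.S.φ i.S.ψ i.S.θ s := m3
    have a' : E * E ≤ g s + C * ((i.ε + E) * (E * E)) := a
    have c' : i.ε ^ 2 * g' s + Y * Y ≤ C * ((i.ε + E) * (Y * Y)) := c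
    have MN := Msup_le_N hε i.sm.1 i.sm.2.1 i.sm.2.2 ht
    have hE2 : E ≤ 1 / (4 * (C + 1)) := by
      refine le_of_sq_le D.le ?_
      have := (lt_div_iff₀ (by norm_num : (0:ℝ) < 16905)).1 hN
      linarith
    have hsm : C * (i.ε + E) ≤ 1 / 2 := by
      have h1 : i.ε + E ≤ 2 * (1 / (4 * (C + 1))) := by linarith
      have h2 : C * (i.ε + E) ≤ C * (2 * (1 / (4 * (C + 1)))) := mul_le_mul_of_nonneg_left h1 hC
      refine h2.trans ?_
      rw [show C * (2 * (1 / (4 * (C + 1)))) = (C / (C + 1)) * (1 / 2) by field_simp; norm_num]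
      have : C / (C + 1) ≤ 1 := by rw [div_le_one (by positivity)]; linarith
      linarith
    have hEE : E ^ 2 ≤ 2 * g s := by
      have := mul_le_mul_of_nonneg_right hsm (mul_self_nonneg E)
      nlinarith
    have hYY : Y ^ 2 ≤ - (2 * (i.ε ^ 2 * g' s)) := by
      have := mul_le_mul_of_nonneg_right hsm (mul_self_nonneg Y)
      nlinarith
    have hε2 : 0 < i.ε ^ 2 := by positivity
    have g0 : 0 ≤ g s := by linarith [sq_nonneg E]
    refine ⟨?_, ?_, ?_, g0, ?_⟩
    · have := mul_le_mul_of_nonneg_left hEE (show 0 ≤ 212 + C ^ 2 by positivity)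
      linarith
    · have h1 := (le_abs_self _).trans b
      have h2 := mul_le_mul_of_nonneg_left m3' hC
      nlinarith
    · by_contra hh
      push Not at hh
      have := mul_pos hε2 hh
      linarith [sq_nonneg Y]
    · have := mul_le_mul_of_nonneg_left hYY (show 0 ≤ 600 + 3 * C ^ 2 by positivity)
      refine le_of_mul_le_mul_left ?_ hε2
      linarith
  have z0 : (0 : ℝ) ∈ Set.Icc 0 i.T := ⟨le_rfl, hT.le⟩
  have zT : i.T ∈ Set.Icc 0 i.T := ⟨hT.le, le_rfl⟩
  have mono : ∀ s ∈ Set.Icc 0 i.T, g s ≤ g 0 := by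
    have : AntitoneOn g (Set.Icc 0 i.T) := by
      refine antitoneOn_of_deriv_nonpos (convex_Icc _ _) (fun s _ => (dg s).continuousAt.continuousWithinAt)
        (fun s _ => (dg s).differentiableAt.differentiableWithinAt) fun s hs => ?_
      rw [(dg s).deriv]; exact (key s (interior_subset hs)).2.2.1
    exact fun s hs => this z0 hs hs.1
  have g00 := (key 0 z0).2.2.2.1
  have gN : g 0 ≤ C * 16905 * Nfun i.ε i.S.φ i.S.ψ i.S.θ 0 :=
    (key 0 z0).2.1.trans (mul_le_mul_of_nonneg_left
      (Msup_le_N hε i.sm.1 i.sm.2.1 i.sm.2.2 ⟨le_rfl, le_rfl⟩) (by positivity))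
  have fin := N_le hε hT.le (B := 2 * (212 + C ^ 2) * g 0) (G := fun s => - (2 * (600 + 3 * C ^ 2)) * g' s)
    ((continuous_const.mul cg').intervalIntegrable _ _) (by positivity)
    (fun s hs => (key s hs).1.trans (mul_le_mul_of_nonneg_left (mono s hs) (by positivity)))
    (fun s hs => (key s hs).2.2.2.2)
  rw [intervalIntegral.integral_const_mul,
    intervalIntegral.integral_eq_sub_of_hasDerivAt (fun s _ => dg s) (cg'.intervalIntegrable _ _)] at fin
  have gT := (key i.T zT).2.2.2.1
  have r1 := mul_nonneg (show 0 ≤ 14 * (600 + 3 * C ^ 2) by positivity) gT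
  have r2 := mul_le_mul_of_nonneg_left gN (show 0 ≤ 12 * (212 + C ^ 2) + 14 * (600 + 3 * C ^ 2) by positivity)
  linarith

end Con

/-- uniform a priori estimate: if `Re`, `ε` and `N̂ = N(T)` are small,
then `N̂ ≤ Chat N(0)`. -/
theorem uniform_apriori_estimate (γ Pr r Kχ : ℝ)
    (hγ : 1 < γ) (hPr : 0 < Pr) (hr : 0 < 1 + r) (hK : 0 < Kχ) :
    ∃ Re' : ℝ, 0 < Re' ∧ ∀ Re : ℝ, 0 < Re → Re < Re' →
      ∃ ε' N' Chat : ℝ, 0 < ε' ∧ 0 < N' ∧ 0 < Chat ∧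
        ∀ (ε χ T : ℝ) (S : PerturbSol γ Pr r Re ε χ T),
          0 < ε → ε ≤ 1 → ε < ε' → 0 < χ → |1 - χ| ≤ Kχ * ε → |1 - χ| ≤ 1 / 2 →
          0 ≤ T → SmoothSol S → StdHyp S →
          Nfun ε S.φ S.ψ S.θ T ≤ 1 → Nfun ε S.φ S.ψ S.θ T < N' →
          Nfun ε S.φ S.ψ S.θ T ≤ Chat * Nfun ε S.φ S.ψ S.θ 0 := by
  have hγ1 : 0 < γ - 1 := by linarith
  have hγ0 : 0 < γ := by linarith
  obtain ⟨A, hA⟩ : ∃ A, A = 1 + (1 + (γ - 1)⁻¹) * (Kχ + 3 * (Pr / (2 * (γ / (γ - 1))))) := ⟨_, rfl⟩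
  have hA0 : 0 < A := by rw [hA]; positivity
  have hg : 0 < γ / (γ - 1) := by positivity
  refine ⟨min A⁻¹ (γ / (γ - 1) / (Pr * A)), by positivity, fun Re hRe hRe' => ?_⟩
  have hR1 : Re < A⁻¹ := hRe'.trans_le (min_le_left _ _)
  have hR2 : Re < γ / (γ - 1) / (Pr * A) := hRe'.trans_le (min_le_right _ _)
  let P : Con.Par := ⟨γ, Pr, r, Re, Kχ, hγ, hPr, hr, hK, hRe⟩
  have h1 : A ≤ Re⁻¹ := (le_inv_comm₀ hRe hA0).1 hR1.le
  have h2 : A ≤ γ / (γ - 1) / (Re * Pr) := by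
    rw [le_div_iff₀ (by positivity)]
    rw [lt_div_iff₀ (by positivity)] at hR2
    linarith
  rw [hA] at h1 h2
  obtain ⟨Q, C, hC, H⟩ := Con.lyapC P h1 h2
  have D : 0 < 1 / (4 * (C + 1)) := by positivity
  refine ⟨min (1 / 2) (1 / (4 * (C + 1))), min (1 / 67620) ((1 / (4 * (C + 1))) ^ 2 / 16905),
    (12 * (212 + C ^ 2) + 14 * (600 + 3 * C ^ 2)) * (C * 16905) + 1, by positivity, by positivity, by positivity, ?_⟩
  intro ε χ T S hε _ hε' _ hχ hχ2 hT sm std _ hN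
  have N0 : 0 ≤ Nfun ε S.φ S.ψ S.θ 0 := by
    refine le_trans ?_ (Con.Msup_le_N hε sm.1 sm.2.1 sm.2.2 (s := 0) (T := 0) ⟨le_rfl, le_rfl⟩)
    rw [Con.Msup_eq hε]
    exact add_nonneg (add_nonneg (add_nonneg (add_nonneg (add_nonneg (Con.Mp_nonneg _ hε _ _) (Con.Mp_nonneg _ hε _ _))
      (Con.Mp_nonneg _ hε _ _)) (Con.Mp_nonneg _ hε _ _)) (Con.Mp_nonneg _ hε _ _)) (Con.dSq_nonneg _ _)
  have K0 : 0 ≤ (12 * (212 + C ^ 2) + 14 * (600 + 3 * C ^ 2)) * (C * 16905) := by positivity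
  rcases hT.eq_or_lt with h0 | hT0
  · subst h0
    nlinarith [mul_nonneg K0 N0]
  · have sm' : ∀ s ∈ Set.Icc 0 T, Con.Msup ε S.φ S.ψ S.θ s ≤ 1 / 67620 := fun s hs =>
      (Con.Msup_le_N hε sm.1 sm.2.1 sm.2.2 hs).trans (hN.le.trans (min_le_left _ _))
    let i : P.I := ⟨ε, χ, T, S, hε, (hε'.trans_le (min_le_left _ _)).le, hχ, hχ2, hT0, sm, std, sm'⟩
    have := Con.final_est P Q hC H i (hε'.trans_le (min_le_right _ _)) (hN.trans_le (min_le_right _ _))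
    refine this.trans ?_
    show _ * Nfun ε S.φ S.ψ S.θ 0 ≤ _
    linarith
end Couette
end
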